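/- Let p be a prime with p > 379 or p ∈ 𝒮 = {101,103,107,167,173,179,191,193,199,223,227,239,251,263,269,271,293,311,337,347,359,367}. Then a_p·h(−5p) = 4·ε₂₀ + Σ_{d∈𝔗} 4·ε_d·deg(H_{−d}) + 4·N_p, where N_p is the number of pairs (a,b) ∈ 𝔽_p × 𝔽_p such that X² + aX + b is irreducible over 𝔽_p, divides J_p(X) in 𝔽_p[X], does not divide the reduction mod p of H_{−d}(X) for any d ∈ 𝔗 ∪ {20} having ε_d = 1, and Q₅(a,b) = 0 in 𝔽_p. -/

import Mathlib

open Polynomial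

/-- The set `𝔗 = {4, 11, 16, 19, 24, 36, 51, 64, 84, 91, 96, 99}`. -/
def Tfrak : Finset ℕ := {4, 11, 16, 19, 24, 36, 51, 64, 84, 91, 96, 99}

/-- The set `𝒮` of 22 exceptional primes below 379. -/
def Sset : Finset ℕ :=
  {101, 103, 107, 167, 173, 179, 191, 193, 199, 223, 227,
   239, 251, 263, 269, 271, 293, 311, 337, 347, 359, 367}

/-- The class polynomial `H_{−d}(X) ∈ ℤ[X]` for the relevant discriminants `−d`. -/
noncomputable def classPoly : ℕ → Polynomial ℤ
  | 4 => X - 1728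
  | 11 => X + 32768
  | 16 => X - 287496
  | 19 => X + 884736
  | 20 => X ^ 2 - 1264000 * X - 681472000
  | 24 => X ^ 2 - 4834944 * X + 14670139392
  | 36 => X ^ 2 - 153542016 * X - 1790957481984
  | 51 => X ^ 2 + 5541101568 * X + 6262062317568
  | 64 => X ^ 2 - 82226316240 * X - 7367066619912
  | 91 => X ^ 2 + 10359073013760 * X - 3845689020776448
  | 99 => X ^ 2 + 37616060956672 * X - 56171326053810176
  | 84 => X ^ 4 - 3196800946944 * X ^ 3 - 5663679223085309952 * X ^ 2
            + 88821246589810089394176 * X - 5133201653210986057826304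
  | 96 => X ^ 4 - 23340144296736 * X ^ 3 + 670421055192156288 * X ^ 2
            + 447805364111967209472 * X - 984163224549635621646336
  | _ => 0

/-- The discriminant `Δ_d = disc(H_{−d})` for `d ∈ {24, 36, 51, 64, 91, 99}`. -/
def discH : ℕ → ℤ
  | 24 => 2 ^ 19 * 3 ^ 6 * 13 ^ 2 * 19 ^ 2
  | 36 => 2 ^ 20 * 3 ^ 3 * 7 ^ 4 * 19 ^ 2 * 31 ^ 2
  | 51 => 2 ^ 30 * 3 ^ 6 * 7 ^ 4 * 17 * 31 ^ 2
  | 64 => 2 ^ 5 * 3 ^ 14 * 7 ^ 4 * 11 ^ 4 * 19 ^ 2 * 59 ^ 2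
  | 91 => 2 ^ 32 * 3 ^ 12 * 7 ^ 2 * 11 ^ 4 * 13 * 71 ^ 2
  | 99 => 2 ^ 30 * 3 * 7 ^ 4 * 11 ^ 3 * 13 ^ 2 * 19 ^ 4 * 79 ^ 2
  | _ => 0

/-- The exponent `ε_d` from Theorem 2.1, expressed in terms of Jacobi (Legendre) symbols. -/
noncomputable def epsd (p d : ℕ) : ℚ :=
  if d = 20 then (1 - (jacobiSym (-20) p : ℚ)) * (1 + (jacobiSym 5 p : ℚ)) / 4
  else if d = 4 ∨ d = 11 ∨ d = 16 ∨ d = 19 then (1 - (jacobiSym (-(d : ℤ)) p : ℚ)) / 2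
  else if d = 84 then
    (1 - (jacobiSym (-84) p : ℚ)) * (1 - (jacobiSym 3 p : ℚ)) * (1 - (jacobiSym 7 p : ℚ)) / 8
  else if d = 96 then
    (1 - (jacobiSym (-96) p : ℚ)) * (1 - (jacobiSym 2 p : ℚ)) * (1 - (jacobiSym 3 p : ℚ)) / 8
  else (1 - (jacobiSym (-(d : ℤ)) p : ℚ)) * (1 - (jacobiSym (discH d) p : ℚ)) / 4

/-- `a_p = 1 + ½(1−(−1/p))(2+(2/p))`, so `a_p = 1, 2, 4` according as `p ≡ 1 (mod 4)`,
`p ≡ 3 (mod 8)`, `p ≡ 7 (mod 8)`. -/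
noncomputable def ap (p : ℕ) : ℚ :=
  1 + (1 - (jacobiSym (-1) p : ℚ)) * (2 + (jacobiSym 2 p : ℚ)) / 2

/-- The polynomial `J_p(X) ∈ 𝔽_p[X]`. -/
noncomputable def Jpoly (p : ℕ) : Polynomial (ZMod p) :=
  let n := p / 12
  let s := if p % 4 = 3 then 1 else 0
  ∑ k ∈ Finset.range (n + 1),
    (Nat.choose (2 * n + s) (2 * k + s) : Polynomial (ZMod p)) *
      (Nat.choose (2 * n - 2 * k) (n - k) : Polynomial (ZMod p)) *
      (-432 : Polynomial (ZMod p)) ^ (n - k) * (X - 1728) ^ k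

/-- The de-symmetrized modular polynomial `Q₅(u,v)` of level 5. -/
def Q5 {R : Type*} [CommRing R] (u v : R) : R :=
  u ^ 6 - 1963211489280 * u ^ 5
    + (-246683410956 * v + 1284733132841424456253440) * u ^ 4
    + (-2028551200 * v ^ 2 - 128541798897012758937600 * v
        - 280244777828439527804321565297868800) * u ^ 3
    + (-4550940 * v ^ 3 + 383083610766544859184 * v ^ 2
        - 192457939757860831020806056181760 * v
        + 6692500042627997708487149415015068467200) * u ^ 2
    + (-3720 * v ^ 4 - 107878922099683200 * v ^ 3
        - 26898103232984020907026022400 * v ^ 2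
        - 35714002250464310712293507636763033600 * v
        - 53274330803424425450420160273356509151232000) * u
    - v ^ 5 + 1666008466480 * v ^ 4 - 441973132732967824498752 * v ^ 3
    + 5495857649359740948103830574202880 * v ^ 2
    - 277458457161876591676690089078008919883776 * v
    + 2 ^ 90 * 3 ^ 18 * 5 ^ 3 * 11 ^ 9

noncomputable section
set_option linter.unusedSectionVars false
open UpperHalfPlane Filter Topology
open Finset (mem_filter range mul_sum sum_congr mem_univ univ mem_singleton mem_insert mem_range sum_range_succ sum_insert sum_const prod_congr prod_eq_zero)
open Int (castRingHom)
open PowerSeries (coeff_zero_eq_constantCoeff_apply)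
open scoped MatrixGroups ModularForm CongruenceSubgroup Modular ArithmeticFunction.sigma nonZeroDivisors PowerSeries

section
lemma poly_map {R S : Type*} [CommRing R] [CommRing S] (f : R →+* S) : (∀ P Q : R[X], (P * Q).map f = P.map f * Q.map f) ∧
    (∀ P Q : R[X], (P - Q).map f = P.map f - Q.map f) ∧ (∀ (P : R[X]) (n : ℕ), (P ^ n).map f = P.map f ^ n) ∧
    (X : R[X]).map f = X ∧ ∀ a, (C a).map f = C (f a) := by
  simp
/-- the local parameter `exp(2πiτ/m)` -/
def xq (m : ℕ) (τ : ℍ) : ℂ := Function.Periodic.qParam m τ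
lemma xq_ne (m : ℕ) (τ : ℍ) : xq m τ ≠ 0 := Function.Periodic.qParam_ne_zero _
lemma xq_lt {m : ℕ} (hm : 0 < m) (τ : ℍ) : ‖xq m τ‖ < 1 :=
  Function.Periodic.norm_qParam_lt_one (mod_cast hm) τ.im_pos
lemma xq_surj {m : ℕ} (hm : 0 < m) {z : ℂ} (hz : z ≠ 0) (hz1 : ‖z‖ < 1) : ∃ τ : ℍ, xq m τ = z := by
  have hm' : (0 : ℝ) < m := mod_cast hm
  exact ⟨⟨_, Function.Periodic.im_invQParam_pos_of_norm_lt_one hm' hz1 hz⟩,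
    Function.Periodic.qParam_right_inv hm'.ne' hz⟩
lemma xq_tendsto {m : ℕ} (hm : 0 < m) : Tendsto (xq m) atImInfty (𝓝 0) := by
  have hm' : (0 : ℝ) < m := mod_cast hm
  exact (qParam_tendsto_atImInfty hm')
/-- `x^n g` has the convergent expansion `F` in `x = q^{1/m}`. -/
def HasQ (m n : ℕ) (F : ℂ⟦X⟧) (g : ℍ → ℂ) : Prop :=
  ∀ τ, HasSum (fun k => F.coeff k * xq m τ ^ k) (xq m τ ^ n * g τ)
namespace HasQ
variable {m n n' : ℕ} {F G : ℂ⟦X⟧} {f g : ℍ → ℂ}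
lemma add (hf : HasQ m n F f) (hg : HasQ m n G g) : HasQ m n (F + G) (f + g) := fun τ => by
  simpa [add_mul, mul_add] using (hf τ).add (hg τ)
lemma sub (hf : HasQ m n F f) (hg : HasQ m n G g) : HasQ m n (F - G) (f - g) := fun τ => by
  simpa [sub_mul, mul_sub] using (hf τ).sub (hg τ)
lemma mul (hf : HasQ m n F f) (hg : HasQ m n' G g) : HasQ m (n + n') (F * G) (f * g) := fun τ => by
  have h1 := (hf τ).summable.norm
  have h2 := (hg τ).summable.norm
  have h3 := (summable_norm_sum_mul_antidiagonal_of_summable_norm h1 h2).of_norm.hasSum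
  rw [← tsum_mul_tsum_eq_tsum_sum_antidiagonal_of_summable_norm h1 h2, (hf τ).tsum_eq,
    (hg τ).tsum_eq] at h3
  have e1 : (fun k => (F * G).coeff k * xq m τ ^ k) = fun k =>
      ∑ kl ∈ Finset.HasAntidiagonal.antidiagonal k, F.coeff kl.1 * xq m τ ^ kl.1 * (G.coeff kl.2 * xq m τ ^ kl.2) := by
    funext k
    rw [PowerSeries.coeff_mul, Finset.sum_mul]
    refine sum_congr rfl fun x hx => ?_
    rw [← Finset.HasAntidiagonal.mem_antidiagonal.mp hx, pow_add]; ring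
  have e2 : xq m τ ^ (n + n') * (f * g) τ = xq m τ ^ n * f τ * (xq m τ ^ n' * g τ) := by
    simp only [Pi.mul_apply]; ring
  rw [e1, e2]; exact h3
lemma const (m : ℕ) (c : ℂ) : HasQ m 0 (PowerSeries.C c) (fun _ => c) := fun τ => by
  have := hasSum_single (f := fun k => (PowerSeries.C c).coeff k * xq m τ ^ k) 0
    (by intro k hk; simp [PowerSeries.coeff_C, hk])
  simpa using this
lemma xpow (m k : ℕ) : HasQ m 0 (PowerSeries.X ^ k) (fun τ => xq m τ ^ k) := fun τ => by
  have := hasSum_single (f := fun j => (PowerSeries.X ^ k : ℂ⟦X⟧).coeff j * xq m τ ^ j) k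
    (by intro j hj; simp [PowerSeries.coeff_X_pow, hj])
  simpa [PowerSeries.coeff_X_pow] using this
lemma shift (hf : HasQ m n F f) (k : ℕ) : HasQ m (n + k) (F * PowerSeries.X ^ k) f := fun τ => by
  have := (hf.mul (xpow m k)) τ
  convert this using 1
  simp; ring
lemma pow (hf : HasQ m n F f) (k : ℕ) : HasQ m (k * n) (F ^ k) (f ^ k) := by
  induction k with
  | zero => simpa using! const m 1
  | succ k ih => rw [pow_succ, pow_succ, Nat.succ_mul]; exact ih.mul hf
lemma hasSum_ball (hm : 0 < m) (hf : HasQ m n F f) {z : ℂ} (hz1 : ‖z‖ < 1) :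
    Summable (fun k => F.coeff k * z ^ k) := by
  by_cases hz : z = 0
  · subst hz
    exact summable_of_ne_finset_zero (s := {0}) (by intro k hk; simp at hk; simp [hk])
  · obtain ⟨τ, rfl⟩ := xq_surj hm hz hz1
    exact (hf τ).summable
/-- the sum function on the disc -/
def S (F : ℂ⟦X⟧) (z : ℂ) : ℂ := ∑' k, F.coeff k * z ^ k
lemma S_zero : S F 0 = F.coeff 0 := by
  rw [S, tsum_eq_single 0]
  · simp
  · intro k hk; simp [hk]
lemma eq_S (hf : HasQ m n F f) (τ : ℍ) : xq m τ ^ n * f τ = S F (xq m τ) := (hf τ).tsum_eq.symm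
lemma hasFP (hm : 0 < m) (hf : HasQ m n F f) :
    HasFPowerSeriesOnBall (S F) (.ofScalars ℂ fun k => F.coeff k) 0 1 := by
  constructor
  · refine le_of_forall_lt_imp_le_of_dense fun r hr ↦ ?_
    lift r to NNReal using hr.ne_top
    apply FormalMultilinearSeries.le_radius_of_summable
    have : ‖((r : ℝ) : ℂ)‖ < 1 := by simpa using hr
    simpa [norm_mul, mul_comm] using (hf.hasSum_ball hm this).norm
  · simp
  · intro y hy
    rw [← ENNReal.coe_one, Metric.eball_coe, NNReal.coe_one, mem_ball_zero_iff] at hy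
    simpa [S, mul_comm] using (hf.hasSum_ball hm hy).hasSum
lemma differentiableOn_S (hm : 0 < m) (hf : HasQ m n F f) :
    DifferentiableOn ℂ (S F) (Metric.ball 0 1) := by
  have := (hf.hasFP hm).differentiableOn
  rwa [← ENNReal.coe_one, Metric.eball_coe, NNReal.coe_one] at this
lemma tendsto (hm : 0 < m) (hf : HasQ m n F f) :
    Tendsto (fun τ => xq m τ ^ n * f τ) atImInfty (𝓝 (F.coeff 0)) := by
  simp_rw [hf.eq_S]
  rw [← S_zero]
  exact (hf.hasFP hm).hasFPowerSeriesAt.continuousAt.tendsto.comp (xq_tendsto hm)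
/-- uniqueness of the expansion -/
lemma unique (hm : 0 < m) (hf : HasQ m n F f) (hg : HasQ m n G f) : F = G := by
  have h1 := (hf.hasFP hm).hasFPowerSeriesAt
  have h2 := (hg.hasFP hm).hasFPowerSeriesAt
  have : S F =ᶠ[𝓝 0] S G := by
    have hc1 := h1.continuousAt
    have hc2 := h2.continuousAt
    refine (hc1.eventuallyEq_nhds_iff_eventuallyEq_nhdsNE hc2).mp ?_
    have : ∀ᶠ z : ℂ in 𝓝[≠] 0, ‖z‖ < 1 := by
      refine Filter.Eventually.filter_mono nhdsWithin_le_nhds ?_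
      filter_upwards [Metric.ball_mem_nhds (0 : ℂ) one_pos] with z hz
      simpa using hz
    filter_upwards [this, self_mem_nhdsWithin] with z hz hz0
    obtain ⟨τ, rfl⟩ := xq_surj hm hz0 hz
    rw [← hf.eq_S, ← hg.eq_S]
  have := HasFPowerSeriesAt.eq_formalMultilinearSeries_of_eventually h1 h2 this
  ext k
  have h := congrArg (fun p => FormalMultilinearSeries.coeff p k) this
  simpa using h
lemma mdiff (hm : 0 < m) (hf : HasQ m n F f) : DifferentiableOn ℂ (f ∘ ofComplex) {z | 0 < z.im} := by
  have h : Set.EqOn (f ∘ ofComplex) (fun z => S F (Function.Periodic.qParam m z) /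
      (Function.Periodic.qParam m z) ^ n) {z | 0 < z.im} := by
    intro z hz
    have := hf.eq_S ⟨z, hz⟩
    simp only [xq] at this
    rw [Function.comp, ofComplex_apply_of_im_pos hz]
    beta_reduce
    rw [← this, mul_div_cancel_left₀ _ (pow_ne_zero _ (Function.Periodic.qParam_ne_zero _))]
  refine DifferentiableOn.congr ?_ h
  have hd := Function.Periodic.differentiable_qParam (h := m)
  refine DifferentiableOn.div ?_ (hd.pow n).differentiableOn
    (fun z _ => pow_ne_zero _ (Function.Periodic.qParam_ne_zero _))
  refine (hf.differentiableOn_S hm).comp hd.differentiableOn ?_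
  intro z hz
  have := xq_lt hm ⟨z, hz⟩
  simpa [xq] using this
end HasQ
/-- A holomorphic `SL₂(ℤ)`-invariant function bounded at infinity is constant. -/
lemma const_of_inv {m : ℕ} (hm : 0 < m) {F : ℂ⟦X⟧} {f : ℍ → ℂ} (hf : HasQ m 0 F f)
    (hinv : ∀ (γ : Matrix.SpecialLinearGroup (Fin 2) ℤ) τ, f (γ • τ) = f τ) :
    ∀ τ, f τ = F.coeff 0 := by
  have hslash : ∀ γ : SL(2, ℤ), f ∣[(0:ℤ)] γ = f := by
    intro γ
    ext τ
    rw [ModularForm.SL_slash_apply]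
    simpa using hinv γ τ
  have ht := hf.tendsto hm
  simp only [pow_zero, one_mul] at ht
  let M : ModularForm 𝒮ℒ 0 :=
    { toFun := f
      slash_action_eq' := by
        rintro A ⟨γ, rfl⟩
        exact hslash γ
      holo' := by
        rw [UpperHalfPlane.mdifferentiable_iff]
        exact hf.mdiff hm
      bdd_at_cusps' hc := by
        rw [Subgroup.IsArithmetic.isCusp_iff_isCusp_SL2Z] at hc
        rw [OnePoint.isBoundedAt_iff_forall_SL2Z hc]
        intro γ _
        rw [hslash γ]
        exact ht.isBigO_one ℝ }
  obtain ⟨c, hc⟩ := ModularFormClass.levelOne_weight_zero_const M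
  have hc' : f = Function.const ℍ c := hc
  have : c = F.coeff 0 := by
    rw [hc'] at ht
    exact tendsto_nhds_unique tendsto_const_nhds ht
  intro τ; rw [hc', ← this]; rfl
end

section
namespace HasQ
variable {m n n' : ℕ} {F G : ℂ⟦X⟧} {f g : ℍ → ℂ}
lemma of_diff (hm : 0 < m) {Φ : ℂ → ℂ} (hΦ : DifferentiableOn ℂ Φ (Metric.ball 0 1))
    (h : ∀ τ, f τ = Φ (xq m τ)) : ∃ F, HasQ m 0 F f := by
  refine ⟨PowerSeries.mk fun k => (k.factorial : ℂ)⁻¹ * iteratedDeriv k Φ 0, fun τ => ?_⟩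
  have := Complex.hasSum_taylorSeries_on_ball hΦ (z := xq m τ) (by simpa using xq_lt hm τ)
  simp only [PowerSeries.coeff_mk, pow_zero, one_mul, h]
  convert! this using 2 with k
  simp; ring
lemma inv (hm : 0 < m) (hf : HasQ m n F f) (h0 : F.coeff 0 ≠ 0) (hne : ∀ τ, f τ ≠ 0) :
    HasQ m 0 F⁻¹ (fun τ => (xq m τ ^ n * f τ)⁻¹) := by
  have hd : DifferentiableOn ℂ (fun z => (S F z)⁻¹) (Metric.ball 0 1) := by
    refine (hf.differentiableOn_S hm).inv fun z hz => ?_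
    by_cases hz0 : z = 0
    · rw [hz0, S_zero]; exact h0
    · obtain ⟨τ, rfl⟩ := xq_surj hm hz0 (by simpa using hz)
      rw [← hf.eq_S]
      exact mul_ne_zero (pow_ne_zero _ (xq_ne _ _)) (hne τ)
  obtain ⟨G, hG⟩ := of_diff (f := fun τ => (xq m τ ^ n * f τ)⁻¹) hm hd (fun τ => by rw [hf.eq_S])
  have h1 : HasQ m 0 (F * G) 1 := by
    intro τ
    have := (hf.mul hG) τ
    convert this using 1
    have := mul_ne_zero (pow_ne_zero n (xq_ne m τ)) (hne τ)
    simp only [pow_zero, Pi.one_apply, add_zero, Pi.mul_apply]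
    rw [← mul_assoc, mul_inv_cancel₀ this, one_mul]
  have h2 : F * G = 1 := by
    refine h1.unique hm ?_
    simpa using! const m 1
  have : F⁻¹ = G := by
    rw [PowerSeries.inv_eq_iff_mul_eq_one]
    · rw [mul_comm]; exact h2
    · simpa using h0
  rwa [this]
end HasQ
/-- integral power series viewed over `ℂ` -/
def toC : ℤ⟦X⟧ →+* ℂ⟦X⟧ := PowerSeries.map (castRingHom ℂ)
@[simp] lemma toC_coeff (F : ℤ⟦X⟧) (k : ℕ) : (toC F).coeff k = (F.coeff k : ℂ) := by
  simp [toC]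
lemma coeffZ_mul (F G : ℤ⟦X⟧) : (F * G).coeff 0 = F.coeff 0 * G.coeff 0 := by simp
def sA : ℤ⟦X⟧ := PowerSeries.mk fun n => (σ 3 n : ℤ)
def sB : ℤ⟦X⟧ := PowerSeries.mk fun n => (σ 5 n : ℤ)
def sC : ℤ⟦X⟧ := PowerSeries.mk fun n => (5 * (σ 3 n : ℤ) + 7 * (σ 5 n : ℤ)) / 12
def F4 : ℤ⟦X⟧ := 1 + 240 * sA
def F6 : ℤ⟦X⟧ := 1 - 504 * sB
def FD : ℤ⟦X⟧ := sC + 100 * sA ^ 2 + 8000 * sA ^ 3 - 147 * sB ^ 2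
lemma sC_mul : 12 * sC = 5 * sA + 7 * sB := by
  ext n
  have h : (12 : ℤ) ∣ 5 * (σ 3 n : ℤ) + 7 * (σ 5 n : ℤ) := by
    rw [ArithmeticFunction.sigma_apply, ArithmeticFunction.sigma_apply]
    push_cast
    rw [mul_sum, mul_sum, ← Finset.sum_add_distrib]
    refine Finset.dvd_sum fun d _ => ?_
    refine (ZMod.intCast_zmod_eq_zero_iff_dvd _ 12).mp ?_
    push_cast
    generalize (d : ZMod 12) = x
    revert x; decide
  have e : ∀ (c : ℤ) (P : ℤ⟦X⟧), (PowerSeries.C c * P).coeff n = c * P.coeff n :=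
    fun c P => PowerSeries.coeff_C_mul _ _ _
  have e12 : (12 : ℤ⟦X⟧) = PowerSeries.C 12 := by simp
  have e5 : (5 : ℤ⟦X⟧) = PowerSeries.C 5 := by simp
  have e7 : (7 : ℤ⟦X⟧) = PowerSeries.C 7 := by simp
  rw [e12, e5, e7, map_add, e, e, e]
  simp only [sA, sB, sC, PowerSeries.coeff_mk]
  exact Int.mul_ediv_cancel' h
lemma FD_mul : 1728 * FD = F4 ^ 3 - F6 ^ 2 := by
  have := sC_mul
  rw [FD, F4, F6]
  linear_combination 144 * this
lemma sA0 : sA.coeff 0 = 0 := by simp [sA]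
lemma sB0 : sB.coeff 0 = 0 := by simp [sB]
lemma X_dvd_sA : PowerSeries.X ∣ sA := by
  rw [PowerSeries.X_dvd_iff]; simpa using sA0
lemma X_dvd_sB : PowerSeries.X ∣ sB := by
  rw [PowerSeries.X_dvd_iff]; simpa using sB0
lemma FD0 : FD.coeff 0 = 0 := by
  rw [coeff_zero_eq_constantCoeff_apply, FD]
  have h1 := sA0; have h2 := sB0
  rw [coeff_zero_eq_constantCoeff_apply] at h1 h2
  simp [h1, h2, sC]
lemma FD1 : FD.coeff 1 = 1 := by
  obtain ⟨a, ha⟩ := X_dvd_sA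
  obtain ⟨b, hb⟩ := X_dvd_sB
  have : FD = sC + PowerSeries.X * (PowerSeries.X * (100 * a ^ 2 + PowerSeries.X * (8000 * a ^ 3) - 147 * b ^ 2)) := by
    rw [FD, ha, hb]; ring
  rw [this, map_add, PowerSeries.coeff_succ_X_mul]
  simp [sC]
/-- `Δ/q` -/
def FD' : ℤ⟦X⟧ := PowerSeries.mk fun n => FD.coeff (n + 1)
lemma FD_eq : FD = PowerSeries.X * FD' := by
  ext n
  cases n with
  | zero => simpa using FD0
  | succ n => rw [PowerSeries.coeff_succ_X_mul]; simp [FD']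
lemma FD'0 : FD'.coeff 0 = 1 := by simp [FD', FD1]
def FDi : ℤ⟦X⟧ := PowerSeries.invOfUnit FD' 1
lemma FDi_mul : FD' * FDi = 1 := PowerSeries.mul_invOfUnit _ _ (by simpa using FD'0)
lemma FDi0 : FDi.coeff 0 = 1 := by
  have := congrArg (PowerSeries.coeff 0) FDi_mul
  rw [coeffZ_mul, FD'0] at this
  simpa using this
def Fj : ℤ⟦X⟧ := F4 ^ 3 * FDi
lemma Fj0 : Fj.coeff 0 = 1 := by
  rw [Fj, coeffZ_mul, FDi0, coeff_zero_eq_constantCoeff_apply, F4]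
  have h1 := sA0
  rw [coeff_zero_eq_constantCoeff_apply] at h1
  simp [h1]
open EisensteinSeries ModularForm
def f4 : ℍ → ℂ := fun τ => E₄ τ
def f6 : ℍ → ℂ := fun τ => E₆ τ
def fD : ℍ → ℂ := fun τ => ModularForm.discriminant τ
def jf : ℍ → ℂ := fun τ => f4 τ ^ 3 / fD τ
lemma fD_eq (τ : ℍ) : 1728 * fD τ = f4 τ ^ 3 - f6 τ ^ 2 := by
  have := ModularForm.discriminant_eq_E₄_cube_sub_E₆_sq τ
  rw [fD, f4, f6, this]; ring
lemma fD_ne (τ : ℍ) : fD τ ≠ 0 := ModularForm.discriminant_ne_zero τ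
lemma hasQ_E {k : ℕ} (hk : 3 ≤ k) (hk2 : Even k) (c : ℤ) (hc : -(2 * k / _root_.bernoulli k : ℂ) = c) :
    HasQ 1 0 (toC (1 + PowerSeries.C c * PowerSeries.mk fun n => (σ (k - 1) n : ℤ))) (fun τ => E hk τ) := by
  intro τ
  have := ModularForm.hasSum_qExpansion (h := 1) (E hk) one_pos one_mem_strictPeriods_SL τ
  simp only [pow_zero, one_mul]
  convert! this using 2 with n
  rw [EisensteinSeries.E_qExpansion_coeff hk hk2, hc, toC_coeff]
  congr 1
  · rw [map_add, PowerSeries.coeff_C_mul, PowerSeries.coeff_mk, PowerSeries.coeff_one]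
    split_ifs with h
    · simp [h]
    · push_cast; ring
  · simp [xq]
lemma hasQ_f4 : HasQ 1 0 (toC F4) f4 := by
  have := hasQ_E (k := 4) (by norm_num) (by decide) 240 (by
    rw [bernoulli_eq_bernoulli'_of_ne_one (by norm_num), bernoulli'_four]; norm_num)
  exact this
lemma hasQ_f6 : HasQ 1 0 (toC F6) f6 := by
  have := hasQ_E (k := 6) (by norm_num) (by decide) (-504) (by
    rw [show _root_.bernoulli 6 = 1 / 42 by decide +kernel]; norm_num)
  convert! this using 2
  rw [F6, sB]; simp; ring
lemma hasQ_fD : HasQ 1 0 (toC FD) fD := by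
  have h := ((hasQ_f4.pow 3).sub (by simpa using hasQ_f6.pow 2)).mul (HasQ.const 1 (1728 : ℂ)⁻¹)
  simp only [mul_zero, add_zero] at h
  convert h using 1
  · rw [← map_pow, ← map_pow, ← map_sub, ← FD_mul, map_mul, mul_comm, ← mul_assoc]
    have : (PowerSeries.C (1728 : ℂ)⁻¹ * toC 1728) = 1 := by
      rw [map_ofNat, show (1728 : ℂ⟦X⟧) = PowerSeries.C (1728 : ℂ) from (map_ofNat _ _).symm,
        ← map_mul]
      norm_num
    rw [this, one_mul]
  · funext τ
    have := fD_eq τ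
    simp only [Pi.mul_apply, Pi.sub_apply, Pi.pow_apply, ← this]
    field_simp
lemma HasQ.pole {m n k : ℕ} {F : ℂ⟦X⟧} {f g : ℍ → ℂ} (hf : HasQ m n F f)
    (h : ∀ τ, xq m τ ^ n * f τ = xq m τ ^ k * g τ) : HasQ m k F g := fun τ => by
  rw [← h]; exact hf τ
lemma hasQ_fD' : HasQ 1 0 (toC FD') (fun τ => fD τ / xq 1 τ) := by
  intro τ
  have h := hasQ_fD τ
  rw [← hasSum_nat_add_iff' 1] at h
  simp only [Finset.range_one, Finset.sum_singleton, pow_zero, one_mul, toC_coeff, FD0] at h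
  simp only [Int.cast_zero, mul_one, sub_zero] at h
  have := h.div_const (xq 1 τ)
  have hx := xq_ne 1 τ
  convert! this using 1
  · funext k
    rw [toC_coeff, FD', PowerSeries.coeff_mk, pow_succ]; field_simp
  · simp
lemma toC_FDi : (toC FD')⁻¹ = toC FDi := by
  rw [PowerSeries.inv_eq_iff_mul_eq_one]
  · rw [mul_comm, ← map_mul, FDi_mul, map_one]
  · have := FD'0
    rw [← coeff_zero_eq_constantCoeff_apply, toC_coeff, this]; simp
lemma hasQ_fDi : HasQ 1 1 (toC FDi) (fun τ => (fD τ)⁻¹) := by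
  have := hasQ_fD'.inv one_pos (by rw [toC_coeff, FD'0]; simp)
    (fun τ => div_ne_zero (fD_ne τ) (xq_ne 1 τ))
  rw [toC_FDi] at this
  refine this.pole fun τ => ?_
  have hx := xq_ne 1 τ
  have := fD_ne τ
  simp [div_eq_mul_inv]
lemma hasQ_j : HasQ 1 1 (toC Fj) jf := by
  have := (hasQ_f4.pow 3).mul hasQ_fDi
  rw [Fj, map_mul, map_pow]
  simpa using! this
end

section
abbrev M2 := Matrix (Fin 2) (Fin 2) ℤ
/-- integral matrices with positive determinant -/
def Mp : Submonoid M2 where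
  carrier := {X | 0 < X.det}
  one_mem' := by simp
  mul_mem' {a b} ha hb := by
    simp only [Set.mem_ofPred_eq, Matrix.det_mul] at *; positivity
instance : CoeFun Mp fun _ => Fin 2 → Fin 2 → ℤ := ⟨fun X => X.1⟩
lemma Mp.pos (X : Mp) : 0 < (X : M2).det := X.2
def Mp.toGL : Mp →* GL (Fin 2) ℝ where
  toFun X := Matrix.GeneralLinearGroup.mkOfDetNeZero ((X : M2).map (castRingHom ℝ)) (by
    have := (Mp.pos X)
    rw [← RingHom.mapMatrix_apply, ← RingHom.map_det]
    simpa using this.ne')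
  map_one' := Units.ext (Matrix.map_one (castRingHom ℝ) (map_zero _) (map_one _))
  map_mul' X Y := by
    apply Units.ext
    exact Matrix.map_mul
instance : MulAction Mp ℍ := MulAction.compHom ℍ Mp.toGL
lemma Mp.toGL_apply (X : Mp) (i j) : (Mp.toGL X) i j = (X i j : ℝ) := rfl
/-- automorphy factor -/
def jd (X : Mp) (τ : ℍ) : ℂ := X 1 0 * τ + X 1 1
lemma jd_eq (X : Mp) (τ : ℍ) : jd X τ = denom (Mp.toGL X) τ := by
  simp [jd, denom, Mp.toGL_apply]
lemma jd_ne (X : Mp) (τ : ℍ) : jd X τ ≠ 0 := by rw [jd_eq]; exact denom_ne_zero _ _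
lemma Mp.det_pos (X : Mp) : 0 < (Mp.toGL X).det.val := by
  have := (Mp.pos X)
  have h : (Mp.toGL X).det.val = ((X : M2).det : ℝ) := by
    rw [Matrix.GeneralLinearGroup.val_det_apply, Matrix.det_fin_two, Matrix.det_fin_two]
    push_cast
    rfl
  rw [h]; exact_mod_cast this
lemma Mp.coe_smul (X : Mp) (τ : ℍ) :
    ((X • τ : ℍ) : ℂ) = (X 0 0 * τ + X 0 1) / jd X τ := by
  have := UpperHalfPlane.coe_smul_of_det_pos (Mp.det_pos X) τ
  rw [jd_eq]
  simpa [num, Mp.toGL_apply] using! this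
lemma jd_mul (X Y : Mp) (τ : ℍ) : jd (X * Y) τ = jd X (Y • τ) * jd Y τ := by
  have h := jd_ne Y τ
  have e : jd X (Y • τ) = X 1 0 * ((Y • τ : ℍ) : ℂ) + X 1 1 := rfl
  rw [e, Mp.coe_smul]
  field_simp
  simp only [jd, Submonoid.coe_mul, Matrix.mul_apply, Fin.sum_univ_two]
  push_cast; ring
def ofSL : SL(2, ℤ) →* Mp where
  toFun γ := ⟨γ.1, by show 0 < γ.1.det; rw [γ.2]; exact one_pos⟩
  map_one' := rfl
  map_mul' _ _ := rfl
@[simp] lemma ofSL_coe (γ : SL(2, ℤ)) : ((ofSL γ : Mp) : M2) = γ.1 := rfl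
lemma ofSL_smul (γ : SL(2, ℤ)) (τ : ℍ) : ofSL γ • τ = γ • τ := by
  have : Mp.toGL (ofSL γ) = (γ : GL (Fin 2) ℝ) := by
    ext i j; rfl
  show Mp.toGL (ofSL γ) • τ = _
  rw [this]; rfl
lemma jd_ofSL (γ : SL(2, ℤ)) (τ : ℍ) : jd (ofSL γ) τ = denom γ τ := by
  rw [jd_eq]; rfl
lemma modular_smul {k : ℤ} (f : ModularForm 𝒮ℒ k) (γ : SL(2, ℤ)) (τ : ℍ) :
    f (ofSL γ • τ) = jd (ofSL γ) τ ^ k * f τ := by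
  rw [ofSL_smul, jd_ofSL]
  have : (⇑f) ∣[k] γ = f := f.slash_action_eq' _ ⟨γ, rfl⟩
  have h := congrFun this τ
  rw [ModularForm.SL_slash_apply] at h
  rw [← h]
  have := denom_ne_zero (γ : GL (Fin 2) ℝ) τ
  rw [zpow_neg, mul_comm, mul_assoc]
  field_simp
lemma f4_smul (γ : SL(2, ℤ)) (τ : ℍ) : f4 (ofSL γ • τ) = jd (ofSL γ) τ ^ 4 * f4 τ := by
  have := modular_smul (k := 4) ModularForm.E₄ γ τ
  exact_mod_cast this
lemma f6_smul (γ : SL(2, ℤ)) (τ : ℍ) : f6 (ofSL γ • τ) = jd (ofSL γ) τ ^ 6 * f6 τ := by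
  have := modular_smul (k := 6) ModularForm.E₆ γ τ
  exact_mod_cast this
lemma fD_smul (γ : SL(2, ℤ)) (τ : ℍ) : fD (ofSL γ • τ) = jd (ofSL γ) τ ^ 12 * fD τ := by
  have h1 := fD_eq (ofSL γ • τ)
  have h2 := fD_eq τ
  rw [f4_smul, f6_smul] at h1
  have : 1728 * fD (ofSL γ • τ) = 1728 * (jd (ofSL γ) τ ^ 12 * fD τ) := by
    rw [h1]; linear_combination -jd (ofSL γ) τ ^ 12 * h2
  exact mul_left_cancel₀ (by norm_num) this
lemma jf_smul (γ : SL(2, ℤ)) (τ : ℍ) : jf (ofSL γ • τ) = jf τ := by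
  rw [jf, jf, fD_smul, f4_smul]
  have := jd_ne (ofSL γ) τ
  have := fD_ne τ
  field_simp
def MInv (g : ℍ → ℂ) : Prop := ∀ (γ : SL(2, ℤ)) τ, g (ofSL γ • τ) = g τ
/-! ### substitution in q-expansions -/
lemma HasQ.subst {m n a : ℕ} (ha : a ≠ 0) {F : ℂ⟦X⟧} {g : ℍ → ℂ} (hg : HasQ 1 n F g)
    (s : ℍ → ℍ) {ζ : ℂ} (hζ : ζ ≠ 0) (hs : ∀ τ, xq 1 (s τ) = ζ * xq m τ ^ a) :
    HasQ m (a * n) (PowerSeries.C (ζ⁻¹ ^ n) * PowerSeries.expand a ha (PowerSeries.rescale ζ F))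
      (fun τ => g (s τ)) := by
  intro τ
  have h := (hg (s τ)).mul_left (ζ⁻¹ ^ n)
  have hinj : Function.Injective (fun k : ℕ => a * k) := fun x y h => Nat.eq_of_mul_eq_mul_left (Nat.pos_of_ne_zero ha) h
  rw [← hinj.hasSum_iff]
  · convert! h using 1
    · funext k
      simp only [Function.comp, PowerSeries.coeff_C_mul, PowerSeries.coeff_expand_mul,
        PowerSeries.coeff_rescale, hs]
      rw [mul_pow, pow_mul]; ring
    · rw [hs, mul_pow, pow_mul, inv_pow]
      field_simp
  · intro k hk
    rw [PowerSeries.coeff_C_mul, PowerSeries.coeff_expand_of_not_dvd, mul_zero, zero_mul]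
    rintro ⟨c, rfl⟩
    exact hk ⟨c, rfl⟩
lemma xq_one_eq {m : ℕ} (hm : m ≠ 0) (τ : ℍ) : xq 1 τ = xq m τ ^ m := by
  simp only [xq, Function.Periodic.qParam, ← Complex.exp_nat_mul]
  congr 1
  have : (m : ℂ) ≠ 0 := mod_cast hm
  push_cast; field_simp
/-! ### q-expansion principle -/
def QA (R : Subring ℂ) (m n : ℕ) (g : ℍ → ℂ) : Prop :=
  ∃ F : ℂ⟦X⟧, (∀ k, F.coeff k ∈ R) ∧ HasQ m n F g
variable {R : Subring ℂ} {m n n' : ℕ} {f g : ℍ → ℂ}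
namespace QA
lemma add (hf : QA R m n f) (hg : QA R m n g) : QA R m n (f + g) := by
  obtain ⟨F, hF, h⟩ := hf; obtain ⟨G, hG, h'⟩ := hg
  exact ⟨F + G, fun k => by rw [map_add]; exact R.add_mem (hF k) (hG k), h.add h'⟩
lemma sub (hf : QA R m n f) (hg : QA R m n g) : QA R m n (f - g) := by
  obtain ⟨F, hF, h⟩ := hf; obtain ⟨G, hG, h'⟩ := hg
  exact ⟨F - G, fun k => by rw [map_sub]; exact R.sub_mem (hF k) (hG k), h.sub h'⟩
lemma mul (hf : QA R m n f) (hg : QA R m n' g) : QA R m (n + n') (f * g) := by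
  obtain ⟨F, hF, h⟩ := hf; obtain ⟨G, hG, h'⟩ := hg
  exact ⟨F * G, fun k => by
    rw [PowerSeries.coeff_mul]; exact R.sum_mem fun x _ => R.mul_mem (hF _) (hG _), h.mul h'⟩
lemma const {c : ℂ} (hc : c ∈ R) : QA R m 0 (fun _ => c) :=
  ⟨PowerSeries.C c, fun k => by
    rw [PowerSeries.coeff_C]; split_ifs; exacts [hc, R.zero_mem], HasQ.const m c⟩
lemma pow (hf : QA R m n f) (k : ℕ) : QA R m (k * n) (f ^ k) := by
  induction k with
  | zero => simpa using! const (m := m) R.one_mem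
  | succ k ih => rw [pow_succ, Nat.succ_mul]; exact ih.mul hf
lemma mono (hf : QA R m n f) (h : n ≤ n') : QA R m n' f := by
  obtain ⟨F, hF, h1⟩ := hf
  obtain ⟨k, rfl⟩ := Nat.exists_eq_add_of_le h
  refine ⟨F * PowerSeries.X ^ k, fun i => ?_, h1.shift k⟩
  rw [PowerSeries.coeff_mul_X_pow']
  split_ifs; exacts [hF _, R.zero_mem]
lemma of_int {F : ℤ⟦X⟧} (h : HasQ m n (toC F) f) : QA R m n f :=
  ⟨_, fun k => by rw [toC_coeff]; exact intCast_mem R _, h⟩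
lemma subst {a : ℕ} (ha : a ≠ 0) (hg : QA R 1 n g)
    (s : ℍ → ℍ) {ζ : ℂ} (hζ : ζ ∈ R) (hζ' : ζ⁻¹ ∈ R) (h0 : ζ ≠ 0)
    (hs : ∀ τ, xq 1 (s τ) = ζ * xq m τ ^ a) : QA R m (a * n) (fun τ => g (s τ)) := by
  obtain ⟨F, hF, h⟩ := hg
  refine ⟨_, fun k => ?_, h.subst ha s h0 hs⟩
  rw [PowerSeries.coeff_C_mul]
  refine R.mul_mem (R.pow_mem hζ' _) ?_
  rw [PowerSeries.coeff_expand]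
  split_ifs
  · rw [PowerSeries.coeff_rescale]; exact R.mul_mem (R.pow_mem hζ _) (hF _)
  · exact R.zero_mem
lemma widen (hm : m ≠ 0) (hg : QA R 1 n g) : QA R m (m * n) g :=
  hg.subst hm id R.one_mem (by simp) one_ne_zero (fun τ => by simp [xq_one_eq hm τ])
end QA
lemma qa_j : QA R 1 1 jf := .of_int hasQ_j
lemma HasQ.shift_down {F : ℂ⟦X⟧} (h : HasQ m (n + 1) F g) (h0 : F.coeff 0 = 0) :
    HasQ m n (PowerSeries.mk fun k => F.coeff (k + 1)) g := by
  intro τ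
  have h := h τ
  rw [← hasSum_nat_add_iff' 1] at h
  simp only [Finset.range_one, Finset.sum_singleton, pow_zero, h0] at h
  simp only [mul_one, sub_zero] at h
  have := h.div_const (xq m τ)
  have hx := xq_ne m τ
  convert! this using 1
  · funext k
    rw [PowerSeries.coeff_mk, pow_succ]; field_simp
  · rw [pow_succ]; field_simp
lemma MInv.T (hg : MInv g) (τ : ℍ) : g ((1 : ℝ) +ᵥ τ) = g τ := by
  have := hg ModularGroup.T τ
  rwa [ofSL_smul, UpperHalfPlane.modular_T_smul] at this
lemma xq_vadd (hm : 0 < m) (τ : ℍ) :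
    xq m ((1 : ℝ) +ᵥ τ) = Complex.exp (2 * Real.pi * Complex.I / m) * xq m τ := by
  simp only [xq, Function.Periodic.qParam, ← Complex.exp_add]
  congr 1
  have : (m : ℂ) ≠ 0 := mod_cast hm.ne'
  simp only [coe_vadd]
  push_cast; field_simp
lemma coeff_zero_of_inv (hm : 0 < m) {F : ℂ⟦X⟧} (h : HasQ m n F g) (hg : MInv g)
    (hn : ¬ m ∣ n) : F.coeff 0 = 0 := by
  have h1 := h.tendsto hm
  have ht : Tendsto (fun τ : ℍ => (1 : ℝ) +ᵥ τ) atImInfty atImInfty := by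
    rw [atImInfty, tendsto_comap_iff]
    have : (UpperHalfPlane.im ∘ fun τ : ℍ => (1 : ℝ) +ᵥ τ) = UpperHalfPlane.im := by
      funext τ; simp
    rw [this]; exact tendsto_comap
  have h2 := h1.comp ht
  have h3 := h1.const_mul (Complex.exp (2 * Real.pi * Complex.I / m) ^ n)
  have e : (fun τ => Complex.exp (2 * Real.pi * Complex.I / m) ^ n * (xq m τ ^ n * g τ)) =
      (fun τ => xq m τ ^ n * g τ) ∘ fun τ : ℍ => (1 : ℝ) +ᵥ τ := by
    funext τ
    simp only [Function.comp, hg.T, xq_vadd hm]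
    ring
  rw [e] at h3
  have := tendsto_nhds_unique h2 h3
  by_contra hne
  have h1 : Complex.exp (2 * Real.pi * Complex.I / m) ^ n = 1 :=
    mul_right_cancel₀ hne (by rw [← this, one_mul])
  exact hn ((Complex.isPrimitiveRoot_exp m hm.ne').dvd_of_pow_eq_one n h1)
lemma MInv.sub (hf : MInv f) (hg : MInv g) : MInv (f - g) := fun γ τ => by
  simp [hf γ τ, hg γ τ]
lemma MInv.mul (hf : MInv f) (hg : MInv g) : MInv (f * g) := fun γ τ => by
  simp [hf γ τ, hg γ τ]
lemma MInv.add (hf : MInv f) (hg : MInv g) : MInv (f + g) := fun γ τ => by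
  simp [hf γ τ, hg γ τ]
lemma MInv.pow (hf : MInv f) (k : ℕ) : MInv (f ^ k) := fun γ τ => by
  simp [hf γ τ]
lemma MInv.const (c : ℂ) : MInv (fun _ => c) := fun _ _ => rfl
lemma inv_j : MInv jf := jf_smul
theorem q_principle' (R : AddSubgroup ℂ) (hm : 0 < m) : ∀ {n : ℕ} {g : ℍ → ℂ} {F : ℂ⟦X⟧},
    HasQ m n F g → (∀ k ≤ n, F.coeff k ∈ R) → MInv g →
    ∃ P : ℂ[X], (∀ k, P.coeff k ∈ R) ∧ P.natDegree * m ≤ n ∧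
      (∀ k, n = m * k → P.coeff k = F.coeff 0) ∧ ∀ τ, g τ = P.eval (jf τ) := by
  intro n
  induction n with
  | zero =>
    rintro g F h hF hg
    refine ⟨C (F.coeff 0), fun k => ?_, by simp, fun k hk => ?_, fun τ => ?_⟩
    · rw [coeff_C]; split_ifs; exacts [hF _ le_rfl, R.zero_mem]
    · obtain rfl : k = 0 := by
        rcases Nat.mul_eq_zero.1 hk.symm with h | h
        · omega
        · exact h
      rw [coeff_C_zero]
    · rw [eval_C]; exact const_of_inv hm h (fun γ τ => by rw [← ofSL_smul]; exact hg γ τ) τ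
  | succ n ih =>
    rintro g F h hF hg
    by_cases hn : m ∣ n + 1
    · obtain ⟨k, hk⟩ := hn
      have hj : HasQ m m (PowerSeries.expand m hm.ne' (toC Fj)) jf := by
        have := hasQ_j.subst (m := m) (a := m) hm.ne' id one_ne_zero (fun τ => by simp [xq_one_eq hm.ne' τ])
        simpa using! this
      have hjR : ∀ i, (PowerSeries.expand m hm.ne' (toC Fj)).coeff i ∈ (castRingHom ℂ).range := fun i => by
        rw [PowerSeries.coeff_expand]
        split_ifs
        · rw [toC_coeff]; exact intCast_mem _ _
        · exact Subring.zero_mem _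
      have hjk := (HasQ.const m (F.coeff 0)).mul (hj.pow k)
      rw [zero_add, mul_comm k m, ← hk] at hjk
      have hR : ∀ i, (PowerSeries.C (F.coeff 0) * (PowerSeries.expand m hm.ne' (toC Fj)) ^ k).coeff i ∈ R := by
        intro i
        rw [PowerSeries.coeff_C_mul]
        have : ∀ k i, ((PowerSeries.expand m hm.ne' (toC Fj)) ^ k).coeff i ∈ (castRingHom ℂ).range := by
          intro k
          induction k with
          | zero => intro i; rw [pow_zero, PowerSeries.coeff_one]; split_ifs; exacts [Subring.one_mem _, Subring.zero_mem _]
          | succ k ih => intro i; rw [pow_succ, PowerSeries.coeff_mul]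
                         exact Subring.sum_mem _ fun x _ => Subring.mul_mem _ (ih _) (hjR _)
        obtain ⟨z, hz⟩ := this k i
        rw [← hz, mul_comm, eq_intCast, ← zsmul_eq_mul]
        exact R.zsmul_mem (hF 0 (Nat.zero_le _)) z
      have hs := h.sub hjk
      have h0 : (F - PowerSeries.C (F.coeff 0) * (PowerSeries.expand m hm.ne' (toC Fj)) ^ k).coeff 0 = 0 := by
        have := Fj0
        have h' : PowerSeries.constantCoeff (toC Fj) = 1 := by
          rw [← coeff_zero_eq_constantCoeff_apply, toC_coeff, this]; simp
        rw [coeff_zero_eq_constantCoeff_apply]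
        simp [h']
      obtain ⟨P, hP, hd, -, hev⟩ := ih (hs.shift_down h0) (fun i hi => by
        rw [PowerSeries.coeff_mk, map_sub]; exact R.sub_mem (hF _ (by omega)) (hR _))
        (hg.sub ((MInv.const _).mul (inv_j.pow k)))
      refine ⟨P + C (F.coeff 0) * X ^ k, fun i => ?_, ?_, fun i hi => ?_, fun τ => ?_⟩
      · rw [coeff_add, coeff_C_mul, coeff_X_pow]
        refine R.add_mem (hP _) ?_
        split_ifs
        · simpa using hF 0 (Nat.zero_le _)
        · simp [R.zero_mem]
      · have h1 : (P + C (F.coeff 0) * X ^ k).natDegree ≤ max P.natDegree k :=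
          (natDegree_add_le _ _).trans (max_le_max le_rfl (natDegree_C_mul_X_pow_le _ _))
        refine (Nat.mul_le_mul_right m h1).trans ?_
        rcases max_cases P.natDegree k with h | h
        · rw [h.1]; omega
        · rw [h.1, hk, mul_comm]
      · obtain rfl : i = k := Nat.eq_of_mul_eq_mul_left hm (hi.symm.trans hk)
        rw [coeff_add, coeff_C_mul, coeff_X_pow_self, mul_one, coeff_eq_zero_of_natDegree_lt, zero_add]
        by_contra hc
        have := Nat.mul_le_mul_right m (not_lt.1 hc)
        rw [mul_comm i m] at this; omega
      · have := hev τ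
        simp only [Pi.sub_apply, Pi.mul_apply, Pi.pow_apply] at this
        simp only [eval_add, eval_mul, eval_C, eval_pow, eval_X, ← this]; ring
    · have h0 := coeff_zero_of_inv hm h hg hn
      obtain ⟨P, hP, hd, -, hev⟩ := ih (h.shift_down h0) (fun k hk => by
        rw [PowerSeries.coeff_mk]; exact hF _ (by omega)) hg
      exact ⟨P, hP, by omega, fun k hk => absurd ⟨k, hk⟩ hn, hev⟩
theorem q_principle (hm : 0 < m) (h : QA R m n g) (hg : MInv g) :
    ∃ P : ℂ[X], (∀ k, P.coeff k ∈ R) ∧ ∀ τ, g τ = P.eval (jf τ) := by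
  obtain ⟨F, hF, h⟩ := h
  obtain ⟨P, h1, -, -, h2⟩ := q_principle' R.toAddSubgroup hm h (fun k _ => hF k) hg
  exact ⟨P, h1, h2⟩
end

def Dd (g : ℍ → ℂ) : ℍ → ℂ := Derivative.normalizedDerivOfComplex g
def thetaC (F : ℂ⟦X⟧) : ℂ⟦X⟧ := PowerSeries.mk fun k => k * F.coeff k
def thetaZ (F : ℤ⟦X⟧) : ℤ⟦X⟧ := PowerSeries.mk fun k => k * F.coeff k
lemma toC_thetaZ (F : ℤ⟦X⟧) : toC (thetaZ F) = thetaC (toC F) := by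
  ext k; simp [thetaC, thetaZ, toC]
lemma HasQ.hasDeriv {F : ℂ⟦X⟧} {g : ℍ → ℂ} (h : HasQ 1 0 F g) (τ : ℍ) :
    HasDerivAt (g ∘ ofComplex) (deriv (HasQ.S F) (xq 1 τ) * (2 * Real.pi * Complex.I * xq 1 τ)) τ := by
  have h1 : HasDerivAt (fun z : ℂ => Function.Periodic.qParam (1 : ℕ) z)
      (2 * Real.pi * Complex.I * xq 1 τ) τ := by
    have : HasDerivAt (fun z : ℂ => Complex.exp (2 * Real.pi * Complex.I * z / ((1:ℕ):ℝ)))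
      (Complex.exp (2 * Real.pi * Complex.I * τ / ((1:ℕ):ℝ)) * (2 * Real.pi * Complex.I)) τ := by
      apply HasDerivAt.cexp
      simpa using ((hasDerivAt_id (τ : ℂ)).const_mul (2 * Real.pi * Complex.I))
    rw [mul_comm (Complex.exp _)] at this
    exact this
  have hd : DifferentiableAt ℂ (HasQ.S F) (xq 1 τ) :=
    (h.differentiableOn_S one_pos).differentiableAt (Metric.isOpen_ball.mem_nhds (by
      simpa using xq_lt one_pos τ))
  have h3 := HasDerivAt.comp (τ : ℂ) (h₂ := HasQ.S F) hd.hasDerivAt h1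
  refine h3.congr_of_eventuallyEq ?_
  have : {z : ℂ | 0 < z.im} ∈ 𝓝 (τ : ℂ) := (isOpen_lt continuous_const Complex.continuous_im).mem_nhds τ.2
  filter_upwards [this] with z hz
  have := h.eq_S ⟨z, hz⟩
  simp only [xq, pow_zero, one_mul] at this
  rw [Function.comp, ofComplex_apply_of_im_pos hz]
  exact this
lemma HasQ.Dd {F : ℂ⟦X⟧} {g : ℍ → ℂ} (h : HasQ 1 0 F g) : HasQ 1 0 (thetaC F) (Dd g) := by
  intro τ
  have e : _root_.Dd g τ = xq 1 τ * deriv (HasQ.S F) (xq 1 τ) := by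
    simp only [_root_.Dd, Derivative.normalizedDerivOfComplex, (h.hasDeriv τ).deriv]
    have := Complex.two_pi_I_ne_zero
    field_simp
  rw [e, pow_zero, one_mul]
  have h1 := (h.hasFP one_pos).fderiv
  have hx : xq 1 τ ∈ Metric.eball (0 : ℂ) 1 := by
    rw [← ENNReal.coe_one, Metric.eball_coe, NNReal.coe_one, mem_ball_zero_iff]
    exact xq_lt one_pos τ
  have h2 := h1.hasSum hx
  have h3 := h2.mapL (ContinuousLinearMap.apply ℂ ℂ (xq 1 τ))
  simp only [ContinuousLinearMap.apply_apply, FormalMultilinearSeries.derivSeries_apply_diag, zero_add] at h3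
  have h4 : HasSum (fun k => (thetaC F).coeff (k + 1) * xq 1 τ ^ (k + 1)) (xq 1 τ * deriv (HasQ.S F) (xq 1 τ)) := by
    rw [fderiv_eq_smul_deriv, smul_eq_mul] at h3
    refine h3.congr_fun ?_
    intro k
    simp [thetaC]
    ring
  rw [hasSum_nat_add_iff (f := fun k => (thetaC F).coeff k * xq 1 τ ^ k) 1] at h4
  simpa [thetaC] using h4
open scoped Manifold in
lemma HasQ.mdiff' {F : ℂ⟦X⟧} {g : ℍ → ℂ} (h : HasQ 1 0 F g) : MDiff g := by
  rw [UpperHalfPlane.mdifferentiable_iff]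
  exact h.mdiff one_pos
def f2 : ℍ → ℂ := fun τ => EisensteinSeries.E2 τ
def F2 : ℤ⟦X⟧ := 1 - 24 * PowerSeries.mk fun n => (σ 1 n : ℤ)
lemma F20 : F2.coeff 0 = 1 := by
  rw [F2, map_sub, coeffZ_mul]; simp
lemma F40 : F4.coeff 0 = 1 := by
  rw [F4, map_add, coeffZ_mul, sA0]; simp
lemma F60 : F6.coeff 0 = 1 := by
  rw [F6, map_sub, coeffZ_mul, sB0]; simp
lemma coeffC_mul (F G : ℂ⟦X⟧) : (F * G).coeff 0 = F.coeff 0 * G.coeff 0 := by simp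
lemma thetaC0 (F : ℂ⟦X⟧) : (thetaC F).coeff 0 = 0 := by simp [thetaC]
lemma hasQ_f2 : HasQ 1 0 (toC F2) f2 := by
  intro τ
  have := EisensteinSeries.hasSum_qExpansion_E2 τ
  simp only [pow_zero, one_mul]
  convert this using 2 with k
  · rcases k with _ | k
    · simp [toC_coeff, F20]
    · have : (24 : ℤ⟦X⟧) = PowerSeries.C 24 := rfl
      rw [toC_coeff, F2, this, map_sub, PowerSeries.coeff_C_mul]
      simp [xq, PowerSeries.coeff_one, Function.Periodic.qParam]
  · rfl
lemma wt_zero {k : ℕ} (hk12 : k < 12) {f : ℍ → ℂ} {F : ℂ⟦X⟧}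
    (hf : ∀ γ τ, f (ofSL γ • τ) = jd (ofSL γ) τ ^ k * f τ) (hF : HasQ 1 0 F f) (h0 : F.coeff 0 = 0) :
    f = 0 := by
  have h1 := (hF.pow 12).mul (hasQ_fDi.pow k)
  have hX : PowerSeries.X ∣ F := by rw [PowerSeries.X_dvd_iff]; simpa using h0
  obtain ⟨G, rfl⟩ := hX
  obtain ⟨P, hP, -, -, hv⟩ := q_principle' ⊥ one_pos h1 (by
    intro i hi
    rw [AddSubgroup.mem_bot, mul_pow, mul_assoc, PowerSeries.coeff_X_pow_mul', if_neg (by omega)])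
    (by
      intro γ τ
      simp only [Pi.mul_apply, Pi.pow_apply, hf, fD_smul, mul_inv, mul_pow, inv_pow]
      have := jd_ne (ofSL γ) τ
      have := fD_ne τ
      field_simp
      ring)
  have : P = 0 := by ext i; simpa using hP i
  ext τ
  have := hv τ
  simp [‹P = 0›, fD_ne] at this
  simpa using this
lemma wt_of_slash {k : ℕ} {f : ℍ → ℂ} (h : ∀ γ : SL(2, ℤ), f ∣[(k : ℤ)] γ = f) (γ : SL(2, ℤ)) (τ : ℍ) :
    f (ofSL γ • τ) = jd (ofSL γ) τ ^ k * f τ := by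
  have := congrFun (h γ) τ
  rw [ModularForm.SL_slash_apply] at this
  rw [ofSL_smul, jd_ofSL, ← this, zpow_neg, zpow_natCast]
  have := denom_ne_zero γ τ
  field_simp
lemma slash_of_wt {k : ℕ} {f : ℍ → ℂ} (h : ∀ (γ : SL(2, ℤ)) τ, f (ofSL γ • τ) = jd (ofSL γ) τ ^ k * f τ)
    (γ : SL(2, ℤ)) : f ∣[(k : ℤ)] γ = f := by
  ext τ
  have := h γ τ
  rw [ModularForm.SL_slash_apply]
  rw [ofSL_smul, jd_ofSL] at this
  rw [this, zpow_neg, zpow_natCast]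
  have := denom_ne_zero γ τ
  field_simp
lemma serre_wt {k : ℕ} {f : ℍ → ℂ} {F : ℂ⟦X⟧} (hF : HasQ 1 0 F f)
    (h : ∀ (γ : SL(2, ℤ)) τ, f (ofSL γ • τ) = jd (ofSL γ) τ ^ k * f τ) (γ : SL(2, ℤ)) (τ : ℍ) :
    12 * Dd f (ofSL γ • τ) - k * f2 (ofSL γ • τ) * f (ofSL γ • τ) =
      jd (ofSL γ) τ ^ (k + 2) * (12 * Dd f τ - k * f2 τ * f τ) := by
  have := wt_of_slash (k := k + 2) (f := Derivative.serreDerivative (k : ℂ) f) (fun γ => by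
    have := Derivative.serreDerivative_slash_invariant hF.mdiff' (slash_of_wt h γ)
    exact_mod_cast this) γ τ
  simp only [Derivative.serreDerivative_apply] at this
  simp only [Dd, f2]
  linear_combination 12 * this
lemma ram4 : 3 * Dd f4 = f2 * f4 - f6 := by
  have hq := (((HasQ.const 1 12).mul hasQ_f4.Dd).sub ((HasQ.const 1 4).mul (hasQ_f2.mul hasQ_f4))).add ((HasQ.const 1 4).mul hasQ_f6)
  have h := wt_zero (k := 6) (by norm_num) (f := _) (F := _) (fun γ τ => by
    have := serre_wt hasQ_f4 f4_smul γ τ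
    have h6 := f6_smul γ τ
    simp only [Pi.add_apply, Pi.sub_apply, Pi.mul_apply]
    push_cast at this
    linear_combination this + 4 * h6) hq (by
    simp only [map_add, map_sub, coeffC_mul, thetaC0, toC_coeff, F20, F40, F60]; simp)
  ext τ
  have := congrFun h τ
  simp only [Pi.add_apply, Pi.sub_apply, Pi.mul_apply, Pi.zero_apply] at this ⊢
  simp only [Pi.ofNat_apply]
  linear_combination this / 4
lemma ram6 : 2 * Dd f6 = f2 * f6 - f4 ^ 2 := by
  have hq := (((HasQ.const 1 12).mul hasQ_f6.Dd).sub ((HasQ.const 1 6).mul (hasQ_f2.mul hasQ_f6))).add ((HasQ.const 1 6).mul (hasQ_f4.mul hasQ_f4))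
  have h := wt_zero (k := 8) (by norm_num) (f := _) (F := _) (fun γ τ => by
    have := serre_wt hasQ_f6 f6_smul γ τ
    have h6 := f4_smul γ τ
    simp only [Pi.add_apply, Pi.sub_apply, Pi.mul_apply]
    push_cast at this
    rw [h6]
    linear_combination this) hq (by
    simp only [map_add, map_sub, coeffC_mul, thetaC0, toC_coeff, F20, F40, F60]; simp)
  ext τ
  have := congrFun h τ
  simp only [Pi.add_apply, Pi.sub_apply, Pi.mul_apply, Pi.zero_apply] at this ⊢
  simp only [Pi.ofNat_apply, Pi.pow_apply]
  linear_combination this / 6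

lemma Dd_u (a b : ℂ) (τ : ℍ) (h : a * τ + b ≠ 0) :
    HasDerivAt ((fun z : ℍ => a / (a * z + b)) ∘ ofComplex) (- (a / (a * τ + b)) ^ 2) (τ : ℂ) := by
  have h1 : HasDerivAt (fun z : ℂ => a / (a * z + b)) (- (a / (a * τ + b)) ^ 2) (τ : ℂ) := by
    have h2 : HasDerivAt (fun z : ℂ => a * z + b) a (τ : ℂ) := by
      simpa using ((hasDerivAt_id (τ : ℂ)).const_mul a).add_const b
    have := (hasDerivAt_const (τ : ℂ) a).div h2 h
    convert! this using 1
    field_simp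
    ring
  refine h1.congr_of_eventuallyEq ?_
  have : {z : ℂ | 0 < z.im} ∈ 𝓝 (τ : ℂ) := (isOpen_lt continuous_const Complex.continuous_im).mem_nhds τ.2
  filter_upwards [this] with z hz
  rw [Function.comp, ofComplex_apply_of_im_pos hz]
lemma f2_wt (γ : SL(2, ℤ)) (τ : ℍ) :
    12 * Dd f2 (ofSL γ • τ) - f2 (ofSL γ • τ) ^ 2 = jd (ofSL γ) τ ^ 4 * (12 * Dd f2 τ - f2 τ ^ 2) := by
  set u : ℍ → ℂ := fun z => (γ 1 0 : ℂ) / ((γ 1 0 : ℂ) * z + γ 1 1) with hu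
  have hj : ∀ z : ℍ, denom γ z = (γ 1 0 : ℂ) * z + γ 1 1 := fun z => by
    rw [← jd_ofSL]; simp [jd, ofSL]
  have hpi : (Real.pi : ℂ) ≠ 0 := mod_cast Real.pi_ne_zero
  have e1 : f2 ∣[(2 : ℤ)] γ = fun z => f2 z - 6 * Complex.I / Real.pi * u z := by
    ext z
    have := congrFun (EisensteinSeries.E2_slash_action γ) z
    rw [show f2 = EisensteinSeries.E2 from rfl, this]
    simp only [Pi.sub_apply, Pi.smul_apply, EisensteinSeries.D2, riemannZeta_two, hj, hu, smul_eq_mul]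
    have : (γ 1 0 : ℂ) * z + γ 1 1 ≠ 0 := by rw [← hj]; exact denom_ne_zero _ _
    field_simp
  have e2 := congrFun (Derivative.normalizedDerivOfComplex_SL_slash (k := 2) hasQ_f2.mdiff' (γ := γ)) τ
  have hne : (γ 1 0 : ℂ) * τ + γ 1 1 ≠ 0 := by rw [← hj]; exact denom_ne_zero _ _
  have e3 : Derivative.normalizedDerivOfComplex (f2 ∣[(2 : ℤ)] γ) τ =
      Dd f2 τ + 3 / Real.pi ^ 2 * u τ ^ 2 := by
    have h1 := hasQ_f2.hasDeriv τ
    have h2 := (Dd_u (γ 1 0) (γ 1 1) τ hne).const_mul (6 * Complex.I / Real.pi)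
    have h3 := h1.sub h2
    rw [e1]
    simp only [Dd, Derivative.normalizedDerivOfComplex]
    rw [h1.deriv]
    have : deriv ((fun z => f2 z - 6 * Complex.I / Real.pi * u z) ∘ ofComplex) τ = _ := h3.deriv
    rw [this]
    have := Complex.I_ne_zero
    simp only [hu]
    field_simp
    ring
  rw [e3] at e2
  simp only [Pi.sub_apply, ModularForm.SL_slash_apply] at e2
  have e4 := congrFun e1 τ
  simp only [ModularForm.SL_slash_apply] at e4
  rw [e4] at e2
  rw [← ofSL_smul] at e2 e4
  rw [← jd_ofSL] at e2 e4
  have hn := jd_ne (ofSL γ) τ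
  have e5 : (γ 1 0 : ℂ) / jd (ofSL γ) τ = u τ := by
    simp only [hu]; rw [jd_ofSL, hj]
  rw [e5] at e2
  rw [zpow_neg] at e4
  rw [show -(2 + 2 : ℤ) = -4 by norm_num, zpow_neg] at e2
  set J := jd (ofSL γ) τ
  have a4 : f2 (ofSL γ • τ) = J ^ 2 * (f2 τ - 6 * Complex.I / Real.pi * u τ) := by
    rw [← e4]; field_simp
  have a2 : Dd f2 (ofSL γ • τ) = J ^ 4 * (Dd f2 τ + 3 / Real.pi ^ 2 * u τ ^ 2 +
      2 * (2 * Real.pi * Complex.I)⁻¹ * u τ * (f2 τ - 6 * Complex.I / Real.pi * u τ)) := by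
    have : Dd f2 (ofSL γ • τ) * (J ^ (4 : ℤ))⁻¹ = Dd f2 τ + 3 / Real.pi ^ 2 * u τ ^ 2 +
      2 * (2 * Real.pi * Complex.I)⁻¹ * u τ * (f2 τ - 6 * Complex.I / Real.pi * u τ) := by
      rw [e2]; simp only [Dd]; push_cast; ring
    rw [← this]; field_simp
  rw [a2, a4]
  have hI := Complex.I_ne_zero
  have hI2 := Complex.I_sq
  field_simp
  ring_nf
  rw [show Complex.I ^ 3 = -Complex.I by rw [pow_succ, hI2]; ring]
  simp only [hI2]
  ring
lemma ram2 : 12 * Dd f2 = f2 ^ 2 - f4 := by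
  have hq := (((HasQ.const 1 12).mul hasQ_f2.Dd).sub (hasQ_f2.mul hasQ_f2)).add hasQ_f4
  have h := wt_zero (k := 4) (by norm_num) (f := _) (F := _) (fun γ τ => by
    have := f2_wt γ τ
    have h6 := f4_smul γ τ
    simp only [Pi.add_apply, Pi.sub_apply, Pi.mul_apply]
    linear_combination this + h6) hq (by
    simp only [map_add, map_sub, coeffC_mul, thetaC0, toC_coeff, F20, F40, F60]; simp)
  ext τ
  have := congrFun h τ
  simp only [Pi.add_apply, Pi.sub_apply, Pi.mul_apply, Pi.zero_apply] at this ⊢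
  simp only [Pi.ofNat_apply, Pi.pow_apply]
  linear_combination this
lemma theta_eq {R : Type*} [CommRing R] (F : PowerSeries R) :
    (PowerSeries.mk fun k => k * F.coeff k) = PowerSeries.X * PowerSeries.derivative R F := by
  ext k
  rcases k with _ | k
  · simp
  · rw [PowerSeries.coeff_succ_X_mul]; simp [PowerSeries.coeff_derivative, mul_comm]
lemma thetaZ_add (F G : ℤ⟦X⟧) : thetaZ (F + G) = thetaZ F + thetaZ G := by
  unfold thetaZ; rw [theta_eq, theta_eq, theta_eq, map_add, mul_add]
lemma thetaZ_sub (F G : ℤ⟦X⟧) : thetaZ (F - G) = thetaZ F - thetaZ G := by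
  unfold thetaZ; rw [theta_eq, theta_eq, theta_eq, map_sub, mul_sub]
lemma thetaZ_mul (F G : ℤ⟦X⟧) : thetaZ (F * G) = F * thetaZ G + thetaZ F * G := by
  simp only [thetaZ, theta_eq]
  rw [Derivation.leibniz]; simp only [smul_eq_mul]; ring
lemma thetaZ_pow (F : ℤ⟦X⟧) (n : ℕ) : thetaZ (F ^ n) = n * F ^ (n - 1) * thetaZ F := by
  simp only [thetaZ, theta_eq]
  rw [Derivation.leibniz_pow]; simp only [smul_eq_mul, nsmul_eq_mul]; ring
lemma toC_inj {F G : ℤ⟦X⟧} (h : toC F = toC G) : F = G := by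
  ext k; have := congrArg (fun F => F.coeff k) h; simpa using this
lemma thetaF2 : 12 * thetaZ F2 = F2 ^ 2 - F4 := by
  apply toC_inj
  have h1 := (HasQ.const 1 12).mul hasQ_f2.Dd
  have h2 := (hasQ_f2.pow 2).sub hasQ_f4
  rw [show (fun _ => 12 : ℍ → ℂ) = 12 from rfl, ram2] at h1
  rw [map_mul, toC_thetaZ, map_sub, map_pow, ← h1.unique one_pos h2]
  congr 1; rw [map_ofNat]; rfl
lemma thetaF4 : 3 * thetaZ F4 = F2 * F4 - F6 := by
  apply toC_inj
  have h1 := (HasQ.const 1 3).mul hasQ_f4.Dd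
  have h2 := (hasQ_f2.mul hasQ_f4).sub hasQ_f6
  rw [show (fun _ => 3 : ℍ → ℂ) = 3 from rfl, ram4] at h1
  rw [map_mul, toC_thetaZ, map_sub, map_mul, ← h1.unique one_pos h2]
  congr 1; rw [map_ofNat]; rfl
lemma thetaF6 : 2 * thetaZ F6 = F2 * F6 - F4 ^ 2 := by
  apply toC_inj
  have h1 := (HasQ.const 1 2).mul hasQ_f6.Dd
  have h2 := (hasQ_f2.mul hasQ_f6).sub (hasQ_f4.pow 2)
  rw [show (fun _ => 2 : ℍ → ℂ) = 2 from rfl, ram6] at h1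
  rw [map_mul, toC_thetaZ, map_sub, map_mul, map_pow, ← h1.unique one_pos h2]
  congr 1; rw [map_ofNat]; rfl
/-- derivative of `j` on the half plane -/
lemma j_deriv (τ : ℍ) : HasDerivAt (jf ∘ ofComplex)
    (-(2 * Real.pi * Complex.I) * (f4 τ ^ 2 * f6 τ / fD τ)) (τ : ℂ) := by
  have h4 := hasQ_f4.hasDeriv τ
  have h6 := hasQ_f6.hasDeriv τ
  have hp := Complex.two_pi_I_ne_zero
  have d4 : deriv (f4 ∘ ofComplex) τ = (2 * Real.pi * Complex.I) * ((f2 τ * f4 τ - f6 τ) / 3) := by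
    have := congrFun ram4 τ
    simp only [Pi.mul_apply, Pi.sub_apply, Pi.ofNat_apply, Dd, Derivative.normalizedDerivOfComplex] at this
    rw [← this]; field_simp
  have d6 : deriv (f6 ∘ ofComplex) τ = (2 * Real.pi * Complex.I) * ((f2 τ * f6 τ - f4 τ ^ 2) / 2) := by
    have := congrFun ram6 τ
    simp only [Pi.mul_apply, Pi.sub_apply, Pi.pow_apply, Pi.ofNat_apply, Dd, Derivative.normalizedDerivOfComplex] at this
    rw [← this]; field_simp
  have h4' := h4.differentiableAt.hasDerivAt
  have h6' := h6.differentiableAt.hasDerivAt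
  rw [d4] at h4'
  rw [d6] at h6'
  have hD : fD τ = (f4 τ ^ 3 - f6 τ ^ 2) / 1728 := by rw [← fD_eq]; ring
  have hDn := fD_ne τ
  have key : jf ∘ ofComplex = fun z => 1728 * (f4 ∘ ofComplex) z ^ 3 / ((f4 ∘ ofComplex) z ^ 3 - (f6 ∘ ofComplex) z ^ 2) := by
    ext z
    simp only [Function.comp, jf]
    have := fD_ne (ofComplex z)
    rw [← fD_eq]
    field_simp
  rw [key]
  have hn : (f4 ∘ ofComplex) τ ^ 3 - (f6 ∘ ofComplex) τ ^ 2 ≠ 0 := by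
    simp only [Function.comp, ofComplex_apply]
    rw [← fD_eq]; exact mul_ne_zero (by norm_num) hDn
  have := ((h4'.pow 3).const_mul 1728).div ((h4'.pow 3).sub (h6'.pow 2)) hn
  convert! this using 1
  simp only [Function.comp, ofComplex_apply, Pi.pow_apply, Pi.sub_apply] at hn ⊢
  rw [hD]
  field_simp
  push_cast
  ring

/-! ### Hecke representatives -/
def mkM (a b c d : ℤ) (h : 0 < a * d - b * c) : Mp := ⟨!![a, b; c, d], by
  show 0 < Matrix.det (!![a, b; c, d] : M2); rw [Matrix.det_fin_two_of]; linarith⟩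
@[simp] lemma mkM_coe (a b c d : ℤ) (h) : ((mkM a b c d h : Mp) : M2) = !![a, b; c, d] := rfl
abbrev Mdet (X : Mp) : ℤ := (X : M2).det
lemma Mdet_eq (X : Mp) : Mdet X = X 0 0 * X 1 1 - X 0 1 * X 1 0 :=
  Matrix.det_fin_two _
lemma Mdet_mul (X Y : Mp) : Mdet (X * Y) = Mdet X * Mdet Y := Matrix.det_mul _ _
lemma Mp.ext' {X Y : Mp} (h00 : X 0 0 = Y 0 0) (h01 : X 0 1 = Y 0 1)
    (h10 : X 1 0 = Y 1 0) (h11 : X 1 1 = Y 1 1) : X = Y := by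
  apply Subtype.ext
  ext i j
  fin_cases i <;> fin_cases j <;> assumption
lemma Mp.mul_entries (X Y : Mp) : (X * Y : Mp) 0 0 = X 0 0 * Y 0 0 + X 0 1 * Y 1 0 ∧ (X * Y : Mp) 0 1 = X 0 0 * Y 0 1 + X 0 1 * Y 1 1 ∧
    (X * Y : Mp) 1 0 = X 1 0 * Y 0 0 + X 1 1 * Y 1 0 ∧ (X * Y : Mp) 1 1 = X 1 0 * Y 0 1 + X 1 1 * Y 1 1 := by
  simp [Matrix.mul_apply, Fin.sum_univ_two]
/-- adjugate -/
def Mp.adj (X : Mp) : Mp := mkM (X 1 1) (-X 0 1) (-X 1 0) (X 0 0) (by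
  have := Mp.pos X; rw [Matrix.det_fin_two] at this; linarith)
/-- scalar matrix -/
def Mp.sc (n : ℤ) (h : n ≠ 0) : Mp := mkM n 0 0 n (by simpa using (mul_self_pos.2 h))
lemma Mp.adj_mul (X : Mp) : Mp.adj X * X = Mp.sc (Mdet X) (Mp.pos X).ne' := by
  apply Mp.ext' <;> simp only [Mp.mul_entries, Mp.adj, Mp.sc, mkM_coe, Mdet_eq] <;> simp <;> ring
lemma Mp.mul_adj (X : Mp) : X * Mp.adj X = Mp.sc (Mdet X) (Mp.pos X).ne' := by
  apply Mp.ext' <;> simp only [Mp.mul_entries, Mp.adj, Mp.sc, mkM_coe, Mdet_eq] <;> simp <;> ring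
lemma Mp.cancel_left {X Y Z : Mp} (h : X * Y = X * Z) : Y = Z := by
  have h1 : (X : M2) * (Y : M2) = (X : M2) * (Z : M2) := congrArg Subtype.val h
  have h2 := congrArg (fun W => Matrix.adjugate (X : M2) * W) h1
  simp only [← Matrix.mul_assoc, Matrix.adjugate_mul, Matrix.smul_mul, Matrix.one_mul] at h2
  exact Subtype.ext (smul_right_injective _ (Mp.pos X).ne' h2)
lemma Mp.cancel_right {X Y Z : Mp} (h : Y * X = Z * X) : Y = Z := by
  have h1 : (Y : M2) * (X : M2) = (Z : M2) * (X : M2) := congrArg Subtype.val h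
  have h2 := congrArg (fun W => W * Matrix.adjugate (X : M2)) h1
  simp only [Matrix.mul_assoc, Matrix.mul_adjugate, Matrix.mul_smul, Matrix.mul_one] at h2
  exact Subtype.ext (smul_right_injective _ (Mp.pos X).ne' h2)
lemma Mp.sc_smul (n : ℤ) (h : n ≠ 0) (τ : ℍ) : Mp.sc n h • τ = τ := by
  apply UpperHalfPlane.ext
  rw [Mp.coe_smul]
  simp [Mp.sc, jd]
  field_simp
lemma Mp.sc_comm (n : ℤ) (h : n ≠ 0) (X : Mp) : X * Mp.sc n h = Mp.sc n h * X := by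
  apply Mp.ext' <;> simp only [Mp.mul_entries, Mp.sc, mkM_coe] <;> simp <;> ring
def rep (l : ℕ) [hl : NeZero l] : Option (Fin l) → Mp
  | none => mkM l 0 0 1 (by have := Nat.pos_of_ne_zero hl.out; simpa using this)
  | some b => mkM 1 b 0 l (by have := Nat.pos_of_ne_zero hl.out; simpa using this)
section
variable {l : ℕ} [NeZero l]
lemma rep_det (i) : Mdet (rep l i) = l := by
  rw [Mdet_eq]; cases i <;> simp [rep]
lemma exists_ofSL {X : Mp} (h : Mdet X = 1) : ∃ γ, X = ofSL γ := ⟨⟨X.1, h⟩, rfl⟩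
lemma rep_factor (hl : l.Prime) (X : Mp) (h : (l : ℤ) ∣ Mdet X) : ∃ Y i, X = Y * rep l i := by
  have hp : Prime (l : ℤ) := Nat.prime_iff_prime_int.1 hl
  have hl0 : (0 : ℤ) < l := mod_cast hl.pos
  have hdet := Mdet_eq X
  set a := X 0 0 with ha
  set b := X 0 1 with hb
  set c := X 1 0 with hc
  set d := X 1 1 with hd
  have hpos : 0 < a * d - b * c := by rw [← hdet]; exact Mp.pos X
  by_cases h1 : (l : ℤ) ∣ a ∧ (l : ℤ) ∣ c
  · obtain ⟨⟨u, hu⟩, ⟨v, hv⟩⟩ := h1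
    refine ⟨mkM u b v d ?_, none, ?_⟩
    · rw [hu, hv] at hpos
      have : 0 < (l : ℤ) * (u * d - b * v) := by linarith
      exact pos_of_mul_pos_right this hl0.le
    · apply Mp.ext' <;> simp only [Mp.mul_entries, rep, mkM_coe] <;> simp [← ha, ← hb, ← hc, ← hd, hu, hv, mul_comm]
  · have key : ∃ t : ℤ, (l : ℤ) ∣ b - t * a ∧ (l : ℤ) ∣ d - t * c := by
      rw [hdet] at h
      have gen : ∀ a c b d : ℤ, ¬ (l : ℤ) ∣ a → (l : ℤ) ∣ a * d - b * c → ∃ t : ℤ, (l : ℤ) ∣ b - t * a ∧ (l : ℤ) ∣ d - t * c := by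
        intro a c b d hna h
        have hco : IsCoprime a (l : ℤ) := (hp.coprime_iff_not_dvd.2 hna).symm
        obtain ⟨u, v, huv⟩ := hco
        refine ⟨b * u, ⟨b * v, by linear_combination -b * huv⟩, ?_⟩
        obtain ⟨w, hw⟩ := h
        exact ⟨u * w + d * v, by linear_combination u * hw - d * huv⟩
      by_cases h2 : (l : ℤ) ∣ a
      · have h3 : ¬ (l : ℤ) ∣ c := fun h3 => h1 ⟨h2, h3⟩
        obtain ⟨t, ht1, ht2⟩ := gen c a d b h3 (by
          rw [show c * b - d * a = -(a * d - b * c) by ring]; exact dvd_neg.2 h)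
        exact ⟨t, ht2, ht1⟩
      · exact gen a c b d h2 h
    obtain ⟨t, ht1, ht2⟩ := key
    have hm0 := Int.emod_nonneg t hl0.ne'
    have hm1 := Int.emod_lt_of_pos t hl0
    obtain ⟨s, hs⟩ : ∃ s : Fin l, ((s : ℕ) : ℤ) = t % l :=
      ⟨⟨(t % l).toNat, by omega⟩, by simp; omega⟩
    have hdv : (l : ℤ) ∣ t - t % l := Int.dvd_self_sub_emod
    obtain ⟨u, hu⟩ : (l : ℤ) ∣ b - (s : ℕ) * a := by
      rw [hs, show b - t % l * a = (b - t * a) + (t - t % l) * a by ring]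
      exact dvd_add ht1 (hdv.mul_right _)
    obtain ⟨v, hv⟩ : (l : ℤ) ∣ d - (s : ℕ) * c := by
      rw [hs, show d - t % l * c = (d - t * c) + (t - t % l) * c by ring]
      exact dvd_add ht2 (hdv.mul_right _)
    refine ⟨mkM a u c v ?_, some s, ?_⟩
    · have : 0 < (l : ℤ) * (a * v - u * c) := by
        have : (l : ℤ) * (a * v - u * c) = a * d - b * c := by linear_combination c * hu - a * hv
        rwa [this]
      exact pos_of_mul_pos_right this hl0.le
    · apply Mp.ext' <;> simp only [Mp.mul_entries, rep, mkM_coe] <;> simp [← ha, ← hb, ← hc, ← hd]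
      · linear_combination hu
      · linear_combination hv
/-- matrix divisible by `l` -/
def Mp.Div (l : ℤ) (X : Mp) : Prop := ∀ i j, l ∣ X i j
lemma rep_unique (hl : l.Prime) {Y Y' : Mp} {i i'} (h : Y * rep l i = Y' * rep l i')
    (hn : ¬ Mp.Div l (Y * rep l i)) : i = i' := by
  have h00 := congrArg (fun Z : Mp => Z 0 0) h
  have h01 := congrArg (fun Z : Mp => Z 0 1) h
  have h10 := congrArg (fun Z : Mp => Z 1 0) h
  have h11 := congrArg (fun Z : Mp => Z 1 1) h
  simp only [Mp.mul_entries] at h00 h01 h10 h11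
  have hD : Mp.Div l (Y * rep l i) ↔ ((l : ℤ) ∣ (Y * rep l i : Mp) 0 0 ∧ (l : ℤ) ∣ (Y * rep l i : Mp) 0 1 ∧
      (l : ℤ) ∣ (Y * rep l i : Mp) 1 0 ∧ (l : ℤ) ∣ (Y * rep l i : Mp) 1 1) :=
    ⟨fun h => ⟨h 0 0, h 0 1, h 1 0, h 1 1⟩, fun ⟨a, b, c, d⟩ i j => by fin_cases i <;> fin_cases j <;> assumption⟩
  rw [hD] at hn
  simp only [Mp.mul_entries] at hn
  cases i with
  | none =>
    cases i' with
    | none => rfl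
    | some b =>
      exfalso; apply hn
      simp [rep] at h00 h01 h10 h11 ⊢
      rw [h01, h11, ← h00, ← h10]
      exact ⟨⟨Y 0 0 * ((b : ℕ) : ℤ) + Y' 0 1, by ring⟩,
        ⟨Y 1 0 * ((b : ℕ) : ℤ) + Y' 1 1, by ring⟩⟩
  | some b =>
    cases i' with
    | none =>
      exfalso; apply hn
      simp [rep] at h00 h01 h10 h11 ⊢
      rw [h00, h10]
      exact ⟨Dvd.intro_left _ rfl, ⟨Y' 0 0 * ((b : ℕ) : ℤ), by ring⟩, Dvd.intro_left _ rfl,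
        ⟨Y' 1 0 * ((b : ℕ) : ℤ), by ring⟩⟩
    | some c =>
      by_contra hbc
      apply hn
      simp [rep] at h00 h01 h10 h11 hbc ⊢
      have hp : Prime (l : ℤ) := Nat.prime_iff_prime_int.1 hl
      have hnd : ¬ (l : ℤ) ∣ ((b : ℕ) : ℤ) - ((c : ℕ) : ℤ) := by
        intro hd
        have hb := b.2
        have hc := c.2
        have := Int.eq_zero_of_abs_lt_dvd hd (by rw [abs_lt]; constructor <;> omega)
        exact hbc (Fin.ext (by omega))
      have hx : (l : ℤ) ∣ Y 0 0 := by
        refine (hp.dvd_or_dvd (?_ : (l : ℤ) ∣ Y 0 0 * (((b : ℕ) : ℤ) - ((c : ℕ) : ℤ)))).resolve_right hnd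
        exact ⟨Y' 0 1 - Y 0 1, by linear_combination h01 - ((c : ℕ) : ℤ) * h00⟩
      have hz : (l : ℤ) ∣ Y 1 0 := by
        refine (hp.dvd_or_dvd (?_ : (l : ℤ) ∣ Y 1 0 * (((b : ℕ) : ℤ) - ((c : ℕ) : ℤ)))).resolve_right hnd
        exact ⟨Y' 1 1 - Y 1 1, by linear_combination h11 - ((c : ℕ) : ℤ) * h10⟩
      exact ⟨hx, hx.mul_right _, hz, hz.mul_right _⟩
lemma Div_det (X : Mp) (h : Mp.Div l X) : (l : ℤ) ^ 2 ∣ Mdet X := by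
  rw [Mdet_eq, sq]
  exact dvd_sub (mul_dvd_mul (h 0 0) (h 1 1)) (mul_dvd_mul (h 0 1) (h 1 0))
/-- right multiplication by a matrix of determinant prime to `l` -/
lemma rep_mul (hl : l.Prime) (X : Mp) (i) : ∃ Y k, rep l i * X = Y * rep l k ∧ Mdet Y = Mdet X := by
  obtain ⟨Y, k, h⟩ := rep_factor hl (rep l i * X) (by rw [Mdet_mul, rep_det]; exact Dvd.intro _ rfl)
  refine ⟨Y, k, h, ?_⟩
  have := congrArg Mdet h
  rw [Mdet_mul, Mdet_mul, rep_det, rep_det, mul_comm] at this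
  have hl0 : (l : ℤ) ≠ 0 := mod_cast hl.ne_zero
  exact (mul_right_cancel₀ hl0 this).symm
def sig (hl : l.Prime) (X : Mp) (i : Option (Fin l)) : Option (Fin l) := (rep_mul hl X i).choose_spec.choose
def sigY (hl : l.Prime) (X : Mp) (i : Option (Fin l)) : Mp := (rep_mul hl X i).choose
lemma sig_spec (hl : l.Prime) (X : Mp) (i : Option (Fin l)) :
    rep l i * X = sigY hl X i * rep l (sig hl X i) := (rep_mul hl X i).choose_spec.choose_spec.1
lemma sigY_det (hl : l.Prime) (X : Mp) (i : Option (Fin l)) : Mdet (sigY hl X i) = Mdet X :=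
  (rep_mul hl X i).choose_spec.choose_spec.2
lemma not_sq_dvd (hl : l.Prime) {a : ℤ} (h : ¬ (l : ℤ) ∣ a) : ¬ (l : ℤ) ^ 2 ∣ a * l := by
  intro h2
  have hl0 : (l : ℤ) ≠ 0 := mod_cast hl.ne_zero
  rw [sq] at h2
  exact h (Int.dvd_of_mul_dvd_mul_right hl0 h2)
lemma sig_inj (hl : l.Prime) (X : Mp) (hX : ¬ (l : ℤ) ∣ Mdet X) : Function.Injective (sig hl X) := by
  intro i i' h
  have h1 := sig_spec hl X i
  have h2 := sig_spec hl X i'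
  rw [h] at h1
  have e : ∀ i, sig hl X i = sig hl X i' → (Mp.adj (sigY hl X i) * rep l i) * X =
      Mp.sc (Mdet X) (Mp.pos X).ne' * rep l (sig hl X i') := by
    intro i hi
    rw [mul_assoc, sig_spec hl X i, ← mul_assoc, Mp.adj_mul, hi]
    congr 2
    simp only [sigY_det]
  have := Mp.cancel_right ((e i h).trans (e i' rfl).symm)
  refine rep_unique hl this ?_
  intro hD
  have h3 := Div_det _ hD
  rw [Mdet_mul, rep_det] at h3
  refine not_sq_dvd hl ?_ h3
  rw [show Mdet (Mp.adj (sigY hl X i)) = Mdet (sigY hl X i) by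
    rw [Mdet_eq, Mdet_eq]; simp [Mp.adj]; ring, sigY_det]
  exact hX
lemma sig_bij (hl : l.Prime) (X : Mp) (hX : ¬ (l : ℤ) ∣ Mdet X) : Function.Bijective (sig hl X) :=
  Finite.injective_iff_bijective.1 (sig_inj hl X hX)
/-! ### families -/
structure Fam (u : Mp → ℍ → ℂ) : Prop where
  left : ∀ γ X, u (ofSL γ * X) = u X
  right : ∀ γ X τ, u X (ofSL γ • τ) = u (X * ofSL γ) τ
lemma ofSL_det (γ : SL(2, ℤ)) : Mdet (ofSL γ) = 1 := γ.2
lemma Fam.perm {u : Mp → ℍ → ℂ} (hu : Fam u) (hl : l.Prime) (γ : SL(2, ℤ)) (τ : ℍ) (i) :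
    u (rep l i) (ofSL γ • τ) = u (rep l (sig hl (ofSL γ) i)) τ := by
  rw [hu.right, sig_spec hl]
  obtain ⟨δ, hδ⟩ := exists_ofSL ((sigY_det hl (ofSL γ) i).trans (ofSL_det γ))
  rw [hδ, hu.left]
lemma Fam.sig_bij (hl : l.Prime) (γ : SL(2, ℤ)) : Function.Bijective (sig hl (ofSL γ)) :=
  _root_.sig_bij hl _ (by rw [ofSL_det]; intro h; exact hl.one_lt.ne' (mod_cast Int.eq_one_of_dvd_one (by positivity) h))
lemma Fam.sum_inv {u : Mp → ℍ → ℂ} (hu : Fam u) (hl : l.Prime) : MInv (fun τ => ∑ i, u (rep l i) τ) := by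
  intro γ τ
  simp only [hu.perm hl γ τ]
  exact Function.Bijective.sum_comp (Fam.sig_bij hl γ) (fun i => u (rep l i) τ)
/-- characteristic polynomial of a family -/
def cp (l : ℕ) [NeZero l] (u : Mp → ℍ → ℂ) (τ : ℍ) : ℂ[X] := ∏ i, (X - C (u (rep l i) τ))
lemma Fam.cp_inv {u : Mp → ℍ → ℂ} (hu : Fam u) (hl : l.Prime) (γ : SL(2, ℤ)) (τ : ℍ) :
    cp l u (ofSL γ • τ) = cp l u τ := by
  simp only [cp, hu.perm hl γ τ]
  exact Function.Bijective.prod_comp (Fam.sig_bij hl γ) (fun i => (X - C (u (rep l i) τ)))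
end
def jX (X : Mp) (τ : ℍ) : ℂ := jf (X • τ)
def phi (X : Mp) (τ : ℍ) : ℂ := (Mdet X : ℂ) ^ 12 * fD (X • τ) / (jd X τ ^ 12 * fD τ)
def psi (X : Mp) (τ : ℍ) : ℂ := jd X τ ^ 12 * fD τ / fD (X • τ)
lemma phi_psi (X : Mp) (τ : ℍ) : phi X τ * psi X τ = (Mdet X : ℂ) ^ 12 := by
  have := fD_ne τ; have := fD_ne (X • τ); have := jd_ne X τ
  unfold phi psi; field_simp
lemma phi_mul (X Y : Mp) (τ : ℍ) : phi (X * Y) τ = phi X (Y • τ) * phi Y τ := by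
  have := fD_ne τ; have := fD_ne (Y • τ); have := jd_ne X (Y • τ); have := jd_ne Y τ
  unfold phi; rw [Mdet_mul, jd_mul, mul_smul]; push_cast; field_simp
lemma psi_mul (X Y : Mp) (τ : ℍ) : psi (X * Y) τ = psi X (Y • τ) * psi Y τ := by
  have := fD_ne τ; have := fD_ne (Y • τ); have := fD_ne (X • Y • τ)
  unfold psi; rw [jd_mul, mul_smul]; field_simp
lemma phi_SL (γ : SL(2, ℤ)) (τ : ℍ) : phi (ofSL γ) τ = 1 := by
  have := fD_ne τ; have := jd_ne (ofSL γ) τ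
  unfold phi; rw [fD_smul, ofSL_det]; field_simp; simp
lemma psi_SL (γ : SL(2, ℤ)) (τ : ℍ) : psi (ofSL γ) τ = 1 := by
  have := fD_ne τ; have := jd_ne (ofSL γ) τ
  unfold psi; rw [fD_smul]; field_simp
lemma fam_j : Fam jX := ⟨fun γ X => by ext τ; simp only [jX, mul_smul, jf_smul],
  fun γ X τ => by simp only [jX, mul_smul]⟩
lemma fam_phi : Fam phi := ⟨fun γ X => by ext τ; rw [phi_mul, phi_SL, one_mul],
  fun γ X τ => by rw [phi_mul, phi_SL, mul_one]⟩
lemma fam_psi : Fam psi := ⟨fun γ X => by ext τ; rw [psi_mul, psi_SL, one_mul],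
  fun γ X τ => by rw [psi_mul, psi_SL, mul_one]⟩

lemma xq_upper (X : Mp) (h : X 1 0 = 0) {a d : ℕ} (ha : X 0 0 = a) (hd : X 1 1 = d)
    (ha0 : a ≠ 0) (hd0 : d ≠ 0) (τ : ℍ) :
    xq 1 (X • τ) = Complex.exp (2 * Real.pi * Complex.I * (X 0 1 / d : ℂ)) * xq (a * d) τ ^ (a ^ 2) := by
  simp only [xq, Function.Periodic.qParam]
  rw [← Complex.exp_nat_mul, ← Complex.exp_add, Mp.coe_smul, jd, h, ha, hd]
  congr 1
  have : (a : ℂ) ≠ 0 := mod_cast ha0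
  have : (d : ℂ) ≠ 0 := mod_cast hd0
  simp only [Int.cast_zero, zero_mul, zero_add, Int.cast_natCast]
  push_cast
  field_simp
  ring
/-- subring containing all roots of unity -/
def RU (R : Subring ℂ) : Prop := ∀ (z : ℂ) (n : ℕ), n ≠ 0 → z ^ n = 1 → z ∈ R
lemma zeta_pow (b : ℤ) {d : ℕ} (hd : d ≠ 0) : Complex.exp (2 * Real.pi * Complex.I * (b / d : ℂ)) ^ d = 1 := by
  rw [← Complex.exp_nat_mul, Complex.exp_eq_one_iff]
  have : (d : ℂ) ≠ 0 := mod_cast hd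
  exact ⟨b, by field_simp⟩
section
variable {R : Subring ℂ} {m n : ℕ} {g : ℍ → ℂ}
lemma QA.upper (hR : RU R) (hg : QA R 1 n g) (X : Mp) (h : X 1 0 = 0) {a d : ℕ} (ha : X 0 0 = a) (hd : X 1 1 = d)
    (ha0 : a ≠ 0) (hd0 : d ≠ 0) (hm : m = a * d) : QA R m (a ^ 2 * n) (fun τ => g (X • τ)) := by
  subst hm
  have hz := zeta_pow (X 0 1) hd0
  exact hg.subst (pow_ne_zero 2 ha0) (fun τ => X • τ) (hR _ d hd0 hz) (hR _ d hd0 (by rw [inv_pow, hz, inv_one]))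
    (Complex.exp_ne_zero _) (xq_upper X h ha hd ha0 hd0)
def QR (R : Subring ℂ) (m : ℕ) : Subring (ℍ → ℂ) where
  carrier := {g | ∃ n, QA R m n g}
  mul_mem' := by rintro a b ⟨n, h⟩ ⟨n', h'⟩; exact ⟨_, h.mul h'⟩
  one_mem' := ⟨0, QA.const R.one_mem⟩
  add_mem' := by
    rintro a b ⟨n, h⟩ ⟨n', h'⟩; exact ⟨_, (h.mono (le_max_left n n')).add (h'.mono (le_max_right n n'))⟩
  zero_mem' := ⟨0, QA.const R.zero_mem⟩
  neg_mem' := by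
    rintro a ⟨n, h⟩
    refine ⟨0 + n, ?_⟩
    have := (QA.const (m := m) (R.neg_mem R.one_mem)).mul h
    convert! this using 1
    ext τ; simp
lemma QA.mem (h : QA R m n g) : g ∈ QR R m := ⟨n, h⟩
lemma QR.const {c : ℂ} (hc : c ∈ R) : (fun _ => c) ∈ QR R m := ⟨0, QA.const hc⟩
lemma QR_principle (hm : 0 < m) (h : g ∈ QR R m) (hg : MInv g) :
    ∃ P : ℂ[X], (∀ k, P.coeff k ∈ R) ∧ ∀ τ, g τ = P.eval (jf τ) := by
  obtain ⟨n, h⟩ := h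
  exact q_principle hm h hg
lemma eval_mem {P : ℂ[X]} (hP : ∀ k, P.coeff k ∈ R) {z : ℂ} (hz : z ∈ R) : P.eval z ∈ R := by
  rw [eval_eq_sum_range]
  exact R.sum_mem fun i _ => R.mul_mem (hP i) (R.pow_mem hz i)
lemma QR.value (hm : 0 < m) (h : g ∈ QR R m) (hg : MInv g) {τ : ℍ} (hτ : jf τ ∈ R) : g τ ∈ R := by
  obtain ⟨P, hP, hv⟩ := QR_principle hm h hg
  rw [hv]; exact eval_mem hP hτ
variable {l : ℕ} [NeZero l]
lemma rep_upper (hR : RU R) (hg : QA R 1 n g) (i) : (fun τ => g (rep l i • τ)) ∈ QR R l := by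
  have hl := NeZero.ne l
  cases i with
  | none => exact (hg.upper hR (rep l none) (a := l) (d := 1) (by simp [rep]) (by simp [rep]) (by simp [rep]) hl one_ne_zero (by simp)).mem
  | some b => exact (hg.upper hR (rep l (some b)) (a := 1) (d := l) (by simp [rep]) (by simp [rep]) (by simp [rep]) one_ne_zero hl (by simp)).mem
lemma QA_fD : QA R 1 0 fD := .of_int hasQ_fD
lemma QA_fDi : QA R 1 1 (fun τ => (fD τ)⁻¹) := .of_int hasQ_fDi
lemma QR_j (i) (hR : RU R) : jX (rep l i) ∈ QR R l := rep_upper hR qa_j i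
lemma QR_j1 : jf ∈ QR R l := (qa_j.widen (NeZero.ne l)).mem
lemma phi_none (τ : ℍ) : phi (rep l none) τ = (l : ℂ) ^ 12 * (fD (rep l none • τ) * (fD τ)⁻¹) := by
  unfold phi; rw [rep_det]; simp [jd, rep]; ring
lemma phi_some (b) (τ : ℍ) : phi (rep l (some b)) τ = fD (rep l (some b) • τ) * (fD τ)⁻¹ := by
  have : (l : ℂ) ≠ 0 := mod_cast NeZero.ne l
  unfold phi; rw [rep_det]; simp [jd, rep]; field_simp
lemma psi_none (τ : ℍ) : psi (rep l none) τ = fD τ * (fD (rep l none • τ))⁻¹ := by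
  unfold psi; simp [jd, rep]; ring
lemma psi_some (b) (τ : ℍ) : psi (rep l (some b)) τ = (l : ℂ) ^ 12 * (fD τ * (fD (rep l (some b) • τ))⁻¹) := by
  unfold psi; simp [jd, rep]; ring
lemma QR_phi (i) (hR : RU R) : phi (rep l i) ∈ QR R l := by
  have h1 := rep_upper (l := l) hR (QA_fD) i
  have h2 := ((QA_fDi (R := R)).widen (NeZero.ne l)).mem
  have hl : (fun _ => (l : ℂ) ^ 12) ∈ QR R l := QR.const (R.pow_mem (natCast_mem R l) 12)
  cases i with
  | none => convert! Subring.mul_mem _ hl (Subring.mul_mem _ h1 h2) using 1; ext τ; exact phi_none τ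
  | some b => convert! (Subring.mul_mem _ h1 h2) using 1; ext τ; exact phi_some b τ
lemma QR_psi (i) (hR : RU R) : psi (rep l i) ∈ QR R l := by
  have h1 := rep_upper (l := l) hR (QA_fDi) i
  have h2 := ((QA_fD (R := R)).widen (NeZero.ne l)).mem
  have hl : (fun _ => (l : ℂ) ^ 12) ∈ QR R l := QR.const (R.pow_mem (natCast_mem R l) 12)
  cases i with
  | none => convert! (Subring.mul_mem _ h2 h1) using 1; ext τ; exact psi_none τ
  | some b => convert! Subring.mul_mem _ hl (Subring.mul_mem _ h2 h1) using 1; ext τ; exact psi_some b τ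
/-- evaluation at a point -/
def evH (τ : ℍ) : (ℍ → ℂ) →+* ℂ := Pi.evalRingHom _ τ
def cpQ (R : Subring ℂ) (l : ℕ) [NeZero l] (u : Mp → ℍ → ℂ) (hu : ∀ i, u (rep l i) ∈ QR R l) : (QR R l)[X] :=
  ∏ i, (X - C (⟨u (rep l i), hu i⟩ : QR R l))
lemma cpQ_map (u : Mp → ℍ → ℂ) (hu : ∀ i, u (rep l i) ∈ QR R l) (τ : ℍ) :
    (cpQ R l u hu).map ((evH τ).comp (QR R l).subtype) = cp l u τ := by
  simp only [cpQ, cp, Polynomial.map_prod, Polynomial.map_sub, map_X, map_C]; rfl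
lemma cp_coeff (u : Mp → ℍ → ℂ) (hu : ∀ i, u (rep l i) ∈ QR R l) (k : ℕ) :
    (fun τ => (cp l u τ).coeff k) ∈ QR R l := by
  have : (fun τ => (cp l u τ).coeff k) = ((cpQ R l u hu).coeff k : QR R l) := by
    ext τ
    rw [← cpQ_map u hu, coeff_map]; rfl
  rw [this]; exact Subtype.property _
lemma cp_coeff_mem (hl : l.Prime) {u : Mp → ℍ → ℂ} (hf : Fam u) (hu : ∀ i, u (rep l i) ∈ QR R l) {τ : ℍ}
    (hτ : jf τ ∈ R) (k : ℕ) : (cp l u τ).coeff k ∈ R :=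
  QR.value (m := l) hl.pos (cp_coeff u hu k) (fun γ τ => by simp only [hf.cp_inv hl]) hτ
end
lemma cp_monic {l : ℕ} [NeZero l] (u : Mp → ℍ → ℂ) (τ : ℍ) : (cp l u τ).Monic :=
  monic_prod_of_monic _ _ fun _ _ => monic_X_sub_C _
lemma cp_root {l : ℕ} [NeZero l] (u : Mp → ℍ → ℂ) (τ : ℍ) (i) : (cp l u τ).eval (u (rep l i) τ) = 0 := by
  rw [cp, eval_prod]
  exact prod_eq_zero (mem_univ i) (by simp)
section
variable (V : ValuationSubring ℂ)
lemma RU_V : RU V.toSubring := by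
  intro z n hn h
  rw [ValuationSubring.mem_toSubring, ← V.valuation_le_one_iff]
  have := congrArg V.valuation h
  rw [map_pow, map_one] at this
  exact (pow_le_one_iff hn).1 this.le
lemma mem_of_root {P : ℂ[X]} (hm : P.Monic) (hP : ∀ k, P.coeff k ∈ V) {z : ℂ} (hz : P.eval z = 0) : z ∈ V := by
  have hl : P ∈ Polynomial.lifts (algebraMap V ℂ) := by
    rw [Polynomial.lifts_iff_coeff_lifts]
    intro k; exact ⟨⟨_, hP k⟩, rfl⟩
  obtain ⟨Q, hQ, -, hQm⟩ := Polynomial.lifts_and_degree_eq_and_monic hl hm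
  have : IsIntegral V z := ⟨Q, hQm, by rw [← eval_map, hQ, hz]⟩
  obtain ⟨y, hy⟩ := IsIntegrallyClosed.isIntegral_iff.1 this
  rw [← hy]; exact y.2
lemma fam_mem {l : ℕ} [NeZero l] (hl : l.Prime) {u : Mp → ℍ → ℂ} (hf : Fam u)
    (hu : ∀ i, u (rep l i) ∈ QR V.toSubring l) {τ : ℍ} (hτ : jf τ ∈ V) (i) : u (rep l i) τ ∈ V :=
  mem_of_root V (cp_monic u τ) (cp_coeff_mem hl hf hu hτ) (cp_root u τ i)
lemma all_mem (X : Mp) : ∀ {τ : ℍ}, jf τ ∈ V → jX X τ ∈ V ∧ phi X τ ∈ V ∧ psi X τ ∈ V := by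
  induction h : (Mdet X).toNat using Nat.strong_induction_on generalizing X with
  | _ n ih =>
    intro τ hτ
    have hpos : 0 < Mdet X := Mp.pos X
    by_cases h1 : Mdet X = 1
    · obtain ⟨γ, rfl⟩ := exists_ofSL h1
      rw [jX, jf_smul, phi_SL, psi_SL]
      exact ⟨hτ, V.one_mem, V.one_mem⟩
    · obtain ⟨l, hl, hd⟩ := Nat.exists_prime_and_dvd (n := (Mdet X).toNat) (by omega)
      have : NeZero l := ⟨hl.ne_zero⟩
      have hd' : (l : ℤ) ∣ Mdet X := by
        have : ((Mdet X).toNat : ℤ) = Mdet X := Int.toNat_of_nonneg hpos.le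
        rw [← this]; exact_mod_cast hd
      obtain ⟨Y, i, rfl⟩ := rep_factor hl X hd'
      have hY : (Mdet Y).toNat < n := by
        rw [← h, Mdet_mul, rep_det]
        have h3 : 0 < Mdet Y := Mp.pos Y
        have h2 := hl.two_le
        have : Mdet Y < Mdet Y * l := by
          have : (2 : ℤ) ≤ l := mod_cast h2
          nlinarith
        have h3 : 0 < Mdet Y := Mp.pos Y
        omega
      have hj : jf (rep l i • τ) ∈ V := fam_mem V hl fam_j (fun i => QR_j i (RU_V V)) hτ i
      obtain ⟨a, b, c⟩ := ih _ hY Y rfl hj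
      refine ⟨?_, ?_, ?_⟩
      · rw [jX, mul_smul]; exact a
      · rw [phi_mul]; exact V.mul_mem _ _ b (fam_mem V hl fam_phi (fun i => QR_phi i (RU_V V)) hτ i)
      · rw [psi_mul]; exact V.mul_mem _ _ c (fam_mem V hl fam_psi (fun i => QR_psi i (RU_V V)) hτ i)
end

theorem jf_surj (c : ℂ) : ∃ τ, jf τ = c := by
  by_contra hne
  push Not at hne
  have h1 : HasQ 1 1 (toC Fj - PowerSeries.C c * PowerSeries.X ^ 1) (jf - fun _ => c) :=
    hasQ_j.sub ((HasQ.const 1 c).shift 1)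
  have h2 := h1.inv one_pos (by rw [map_sub, toC_coeff, Fj0, PowerSeries.coeff_C_mul, PowerSeries.coeff_X_pow]; simp) (fun τ => sub_ne_zero.2 (hne τ))
  have h3 := (HasQ.xpow 1 1).mul h2
  have h4 := const_of_inv one_pos h3 (fun γ τ => ?_)
  · have h5 := h4 I
    rw [coeff_zero_eq_constantCoeff_apply] at h5
    have := xq_ne 1 I
    have := sub_ne_zero.2 (hne I)
    simp_all
  · have key : ∀ τ, ((fun τ => xq 1 τ ^ 1) * fun τ => (xq 1 τ ^ 1 * (jf - fun _ => c : ℍ → ℂ) τ)⁻¹) τ = (jf τ - c)⁻¹ := by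
      intro τ
      have := xq_ne 1 τ
      have := sub_ne_zero.2 (hne τ)
      simp only [Pi.mul_apply, Pi.sub_apply]
      field_simp
    rw [key, key, ← ofSL_smul, jf_smul]

/-- a place of ℂ above the odd prime p, with a primitive p-th root of unity -/
structure PV (p : ℕ) [Fact p.Prime] where
  V : ValuationSubring ℂ
  z : ℂ
  hz : IsPrimitiveRoot z p
  hpV : V.valuation p < 1
  h2 : p ≠ 2
namespace PV
variable {p : ℕ} [hp : Fact p.Prime] (v : PV p)
abbrev R : Subring ℂ := v.V.toSubring
abbrev pi : ℂ := 1 - v.z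
instance instNZ : NeZero p := ⟨hp.out.ne_zero⟩
lemma ru : RU v.R := RU_V v.V
lemma z_mem : v.z ∈ v.R := v.ru _ p hp.out.ne_zero v.hz.pow_eq_one
lemma pi_mem : v.pi ∈ v.R := v.R.sub_mem v.R.one_mem v.z_mem
lemma pi_ne : v.pi ≠ 0 := by
  intro h
  exact v.hz.ne_one hp.out.one_lt (sub_eq_zero.1 h).symm
lemma p_eq : ∃ c ∈ v.R, (p : ℂ) = v.pi * c := by
  have h1 := eval_one_cyclotomic_prime (R := ℂ) (p := p)
  rw [cyclotomic_eq_prod_X_sub_primitiveRoots v.hz, eval_prod] at h1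
  have hm : v.z ∈ primitiveRoots p ℂ := (mem_primitiveRoots hp.out.pos).2 v.hz
  rw [← Finset.mul_prod_erase _ _ hm] at h1
  refine ⟨∏ x ∈ (primitiveRoots p ℂ).erase v.z, eval 1 (X - C x), ?_, by rw [← h1]; simp [pi]⟩
  refine v.R.prod_mem fun i hi => ?_
  have hi' := (mem_primitiveRoots hp.out.pos).1 (Finset.mem_of_mem_erase hi)
  simp only [eval_sub, eval_X, eval_C]
  exact v.R.sub_mem v.R.one_mem (v.ru _ p hp.out.ne_zero hi'.pow_eq_one)
lemma pi_pow : ∃ c ∈ v.R, v.pi ^ p = p * c := by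
  obtain ⟨r, hr⟩ := exists_add_pow_prime_eq hp.out (1 : v.R) (-⟨v.z, v.z_mem⟩)
  have ho : Odd p := hp.out.odd_of_ne_two v.h2
  have h := congrArg (fun x : v.R => (x : ℂ)) hr
  refine ⟨((1 : v.R) * (-⟨v.z, v.z_mem⟩ * r) : v.R), Subtype.property _, ?_⟩
  simp only [Subring.coe_add, Subring.coe_pow, Subring.coe_neg, Subring.coe_one, Subring.coe_mul, ho.neg_pow, v.hz.pow_eq_one, one_pow] at h ⊢
  rw [pi, sub_eq_add_neg, h]
  simp [mul_assoc]
lemma val_pi : v.V.valuation v.pi < 1 := by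
  obtain ⟨c, hc, h⟩ := v.pi_pow
  have h1 : v.V.valuation (v.pi ^ p) < 1 := by
    rw [h, map_mul]
    exact mul_lt_one_of_lt_of_le v.hpV ((v.V.valuation_le_one_iff c).2 hc)
  rw [map_pow] at h1
  exact (pow_lt_one_iff hp.out.ne_zero).1 h1
/-! ### the quotient ring -/
abbrev QQ : Subring (ℍ → ℂ) := QR v.R p
def piQ : v.QQ := ⟨fun _ => v.pi, QR.const v.pi_mem⟩
abbrev Qb := v.QQ ⧸ Ideal.span {v.piQ}
abbrev mq : v.QQ →+* v.Qb := Ideal.Quotient.mk _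
lemma mk_eq_iff {f g : v.QQ} : v.mq f = v.mq g ↔ ∃ h : v.QQ, ∀ τ, (f : ℍ → ℂ) τ - (g : ℍ → ℂ) τ = v.pi * (h : ℍ → ℂ) τ := by
  rw [Ideal.Quotient.eq, Ideal.mem_span_singleton]
  constructor
  · rintro ⟨h, hh⟩
    exact ⟨h, fun τ => congrArg (fun x : v.QQ => (x : ℍ → ℂ) τ) hh⟩
  · rintro ⟨h, hh⟩
    exact ⟨h, Subtype.ext (funext hh)⟩
lemma mk_eq_of {n : ℕ} {F G : ℂ⟦X⟧} {f g : v.QQ} (hf : HasQ p n F f) (hg : HasQ p n G g)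
    (h : ∀ k, ∃ c ∈ v.R, F.coeff k - G.coeff k = v.pi * c) : v.mq f = v.mq g := by
  rw [mk_eq_iff]
  have h1 := (HasQ.const p (v.pi⁻¹)).mul (hf.sub hg)
  refine ⟨⟨_, 0 + n, _, ?_, h1⟩, fun τ => ?_⟩
  · intro k
    obtain ⟨c, hc, hk⟩ := h k
    rw [PowerSeries.coeff_C_mul, map_sub, hk, ← mul_assoc, inv_mul_cancel₀ v.pi_ne, one_mul]
    exact hc
  · have := v.pi_ne
    simp only [Pi.mul_apply, Pi.sub_apply]
    field_simp
lemma p_zero : (p : v.Qb) = 0 := by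
  have : v.mq (p : v.QQ) = v.mq 0 := by
    rw [mk_eq_iff]
    obtain ⟨c, hc, h⟩ := v.p_eq
    refine ⟨⟨fun _ => c, QR.const hc⟩, fun τ => ?_⟩
    simpa using h
  simpa using this
/-! ### integral expansions -/
variable {n : ℕ} {F : ℤ⟦X⟧} {g : ℍ → ℂ}
/-- g composed with rep i as an element of QQ -/
def at' (hg : HasQ 1 n (toC F) g) (i : Option (Fin p)) : v.QQ := ⟨fun τ => g (rep p i • τ), rep_upper v.ru (.of_int hg) i⟩
def at1 (hg : HasQ 1 n (toC F) g) : v.QQ := ⟨g, ((QA.of_int hg).widen hp.out.ne_zero).mem⟩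
lemma hasQ_some (hg : HasQ 1 n (toC F) g) (b : Fin p) : ∃ ζ : ℂ, ζ ^ p = 1 ∧ ζ ∈ v.R ∧ (∃ c ∈ v.R, ζ - 1 = v.pi * c) ∧
    HasQ p n (PowerSeries.C (ζ⁻¹ ^ n) * PowerSeries.rescale ζ (toC F)) (fun τ => g (rep p (some b) • τ)) := by
  have h1 := zeta_pow (b : ℤ) hp.out.ne_zero
  set ζ := Complex.exp (2 * Real.pi * Complex.I * ((b : ℤ) / p : ℂ)) with hζ
  have hs := xq_upper (rep p (some b)) (a := 1) (d := p) (by simp [rep]) (by simp [rep]) (by simp [rep]) one_ne_zero hp.out.ne_zero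
  refine ⟨ζ, h1, v.ru _ _ hp.out.ne_zero h1, ?_, ?_⟩
  · obtain ⟨i, -, hi⟩ := v.hz.eq_pow_of_pow_eq_one h1
    rw [← hi]
    refine ⟨-∑ k ∈ range i, v.z ^ k, v.R.neg_mem (v.R.sum_mem fun k _ => v.R.pow_mem v.z_mem k), ?_⟩
    have := mul_geom_sum v.z i
    simp only [pi]
    linear_combination -this
  · have := hg.subst (m := p) one_ne_zero (fun τ => rep p (some b) • τ) (ζ := ζ) (Complex.exp_ne_zero _) (fun τ => by
      rw [hs]; simp [rep, hζ])
    simpa [PowerSeries.expand_one] using this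
lemma hasQ_1 (hg : HasQ 1 n (toC F) g) : HasQ p (p * n) (toC (PowerSeries.expand p hp.out.ne_zero F)) g := by
  have := hg.subst (m := p) hp.out.ne_zero (fun τ => τ) (ζ := 1) one_ne_zero (fun τ => by
    rw [xq_one_eq hp.out.ne_zero]; simp)
  convert! this using 1
  ext k
  simp only [inv_one, one_pow, map_one, one_mul, PowerSeries.rescale_one, RingHom.id_apply]
  rw [toC_coeff, PowerSeries.coeff_expand, PowerSeries.coeff_expand]
  split_ifs <;> simp [toC_coeff]
lemma hasQ_none (hg : HasQ 1 n (toC F) g) :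
    HasQ p (p * (p * n)) (toC (PowerSeries.expand p hp.out.ne_zero (PowerSeries.expand p hp.out.ne_zero F))) (fun τ => g (rep p none • τ)) := by
  have hs := xq_upper (rep p none) (a := p) (d := 1) (by simp [rep]) (by simp [rep]) (by simp [rep]) hp.out.ne_zero one_ne_zero
  have := hg.subst (m := p) (pow_ne_zero 2 hp.out.ne_zero) (fun τ => rep p none • τ) (ζ := 1) one_ne_zero (fun τ => by
    rw [hs]; simp [rep])
  convert! this using 1
  · ring
  ext k
  simp only [inv_one, one_pow, map_one, one_mul, PowerSeries.rescale_one, RingHom.id_apply]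
  rw [toC_coeff, PowerSeries.coeff_expand, PowerSeries.coeff_expand, PowerSeries.coeff_expand]
  have hpp := hp.out.pos
  by_cases h1 : p ∣ k
  · obtain ⟨a, rfl⟩ := h1
    rw [if_pos (Dvd.intro _ rfl), Nat.mul_div_cancel_left _ hpp]
    by_cases h2 : p ∣ a
    · obtain ⟨c, rfl⟩ := h2
      rw [if_pos (Dvd.intro _ rfl), Nat.mul_div_cancel_left _ hpp, if_pos ⟨c, by ring⟩, toC_coeff,
        show p * (p * c) = p ^ 2 * c by ring, Nat.mul_div_cancel_left _ (pow_pos hpp 2)]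
    · rw [if_neg h2, if_neg]
      · simp
      · rintro ⟨c, hc⟩
        exact h2 ⟨c, by apply Nat.eq_of_mul_eq_mul_left hpp; rw [hc]; ring⟩
  · rw [if_neg h1, if_neg]
    · simp
    · intro h; exact h1 ((Dvd.intro_left p (by ring)).trans h)
lemma at_some (hg : HasQ 1 n (toC F) g) (b b' : Fin p) : v.mq (v.at' hg (some b)) = v.mq (v.at' hg (some b')) := by
  have key : ∀ b, ∃ G : ℂ⟦X⟧, HasQ p n G (fun τ => g (rep p (some b) • τ)) ∧
      ∀ k, ∃ c ∈ v.R, G.coeff k - (toC F).coeff k = v.pi * c := by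
    intro b
    obtain ⟨ζ, h1, hζ, ⟨c, hc, hcc⟩, h⟩ := v.hasQ_some hg b
    refine ⟨_, h, fun k => ?_⟩
    have hi : ζ⁻¹ = ζ ^ (p - 1) := by
      have h0 : ζ ≠ 0 := by rintro rfl; simp [hp.out.ne_zero] at h1
      field_simp
      rw [← pow_succ', Nat.sub_add_cancel hp.out.one_lt.le, h1]
    rw [PowerSeries.coeff_C_mul, PowerSeries.coeff_rescale, hi, toC_coeff]
    set m := (p - 1) * n + k
    refine ⟨c * (∑ i ∈ range m, ζ ^ i) * (F.coeff k : ℂ), v.R.mul_mem (v.R.mul_mem hc (v.R.sum_mem fun i _ => v.R.pow_mem hζ i)) (intCast_mem _ _), ?_⟩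
    have h3 := mul_geom_sum ζ m
    have h4 : (ζ ^ (p - 1)) ^ n * (ζ ^ k * (F.coeff k : ℂ)) = ζ ^ m * F.coeff k := by
      simp only [m, pow_add, pow_mul]; ring
    rw [h4]
    linear_combination (-(F.coeff k : ℂ)) * h3 + (∑ i ∈ range m, ζ ^ i) * (F.coeff k : ℂ) * hcc
  obtain ⟨G, hG, h⟩ := key b
  obtain ⟨G', hG', h'⟩ := key b'
  refine v.mk_eq_of hG hG' fun k => ?_
  obtain ⟨c, hc, h⟩ := h k
  obtain ⟨c', hc', h'⟩ := h' k
  exact ⟨c - c', v.R.sub_mem hc hc', by linear_combination h - h'⟩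
lemma frob_series (F : ℤ⟦X⟧) (k : ℕ) : ∃ c : ℤ, (F ^ p).coeff k - (PowerSeries.expand p hp.out.ne_zero F).coeff k = p * c := by
  have hm := MvPowerSeries.map_frobenius_expand p hp.out.ne_zero (R := ZMod p)
    (f := PowerSeries.map (castRingHom (ZMod p)) F)
  have hm : PowerSeries.map (castRingHom (ZMod p)) (F ^ p) =
      PowerSeries.map (castRingHom (ZMod p)) (PowerSeries.expand p hp.out.ne_zero F) := by
    rw [map_pow, PowerSeries.map_expand]
    refine hm.symm.trans ?_
    ext k
    exact ZMod.pow_card _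
  have h1 := congrArg (PowerSeries.coeff k) hm
  rw [PowerSeries.coeff_map, PowerSeries.coeff_map] at h1
  have h2 := (ZMod.intCast_eq_intCast_iff_dvd_sub _ _ _).1 h1.symm
  exact h2
lemma frob {m : ℕ} {f h : v.QQ} (hf : HasQ p m (toC F) f) (hh : HasQ p (p * m) (toC (PowerSeries.expand p hp.out.ne_zero F)) h) :
    v.mq h = v.mq f ^ p := by
  rw [← map_pow]
  symm
  have h1 : HasQ p (p * m) (toC F ^ p) ((f ^ p : v.QQ) : ℍ → ℂ) := hf.pow p
  refine v.mk_eq_of h1 hh fun k => ?_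
  obtain ⟨c, hc⟩ := frob_series (p := p) F k
  obtain ⟨d, hd, hpd⟩ := v.p_eq
  refine ⟨d * c, v.R.mul_mem hd (intCast_mem _ _), ?_⟩
  have : toC F ^ p = toC (F ^ p) := (map_pow (PowerSeries.map (castRingHom ℂ)) F p).symm
  rw [this, toC_coeff, toC_coeff, ← Int.cast_sub, hc]
  push_cast; rw [hpd]; ring
lemma at_1 (hg : HasQ 1 n (toC F) g) (b : Fin p) : v.mq (v.at1 hg) = v.mq (v.at' hg (some b)) ^ p := by
  have hq : HasQ p n (toC F) (fun τ => g (rep p (some 0) • τ)) := by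
    have hs := xq_upper (rep p (some 0)) (a := 1) (d := p) (by simp [rep]) (by simp [rep]) (by simp [rep]) one_ne_zero hp.out.ne_zero
    have := hg.subst (m := p) one_ne_zero (fun τ => rep p (some 0) • τ) (ζ := 1) one_ne_zero (fun τ => by
      rw [hs]; simp [rep])
    simpa [PowerSeries.expand_one] using this
  rw [v.at_some hg b 0]
  exact v.frob (f := v.at' hg (some 0)) (h := v.at1 hg) hq (hasQ_1 hg)
lemma at_none (hg : HasQ 1 n (toC F) g) : v.mq (v.at' hg none) = v.mq (v.at1 hg) ^ p :=
  v.frob (f := v.at1 hg) (h := v.at' hg none) (hasQ_1 hg) (hasQ_none hg)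
end PV

namespace PV
variable {p : ℕ} [hp : Fact p.Prime] (v : PV p)
/-! ### residue field -/
abbrev kk := IsLocalRing.ResidueField v.V
open Classical in
def rd (x : ℂ) : v.kk := if h : x ∈ v.V then IsLocalRing.residue v.V ⟨x, h⟩ else 0
lemma rd_eq {x : ℂ} (h : x ∈ v.V) : v.rd x = IsLocalRing.residue v.V ⟨x, h⟩ := dif_pos h
lemma rd_coe (x : v.V) : v.rd x = IsLocalRing.residue v.V x := v.rd_eq x.2
lemma rd_add {x y : ℂ} (hx : x ∈ v.V) (hy : y ∈ v.V) : v.rd (x + y) = v.rd x + v.rd y := by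
  rw [v.rd_eq hx, v.rd_eq hy, v.rd_eq (add_mem hx hy), ← map_add]; rfl
lemma rd_sub {x y : ℂ} (hx : x ∈ v.V) (hy : y ∈ v.V) : v.rd (x - y) = v.rd x - v.rd y := by
  rw [v.rd_eq hx, v.rd_eq hy, v.rd_eq (sub_mem hx hy), ← map_sub]; rfl
lemma rd_mul {x y : ℂ} (hx : x ∈ v.V) (hy : y ∈ v.V) : v.rd (x * y) = v.rd x * v.rd y := by
  rw [v.rd_eq hx, v.rd_eq hy, v.rd_eq (mul_mem hx hy), ← map_mul]; rfl
lemma rd_pow {x : ℂ} (hx : x ∈ v.V) (n : ℕ) : v.rd (x ^ n) = v.rd x ^ n := by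
  rw [v.rd_eq hx, v.rd_eq (pow_mem hx n), ← map_pow]; rfl
lemma rd_one : v.rd 1 = 1 := by rw [v.rd_eq (one_mem _)]; exact map_one _
lemma rd_zero : v.rd 0 = 0 := by rw [v.rd_eq (zero_mem _)]; exact map_zero _
lemma rd_int (n : ℤ) : v.rd n = n := by
  rw [v.rd_eq (intCast_mem _ n)]; exact map_intCast (IsLocalRing.residue v.V) n
lemma rd_surj (a : v.kk) : ∃ x ∈ v.V, v.rd x = a := by
  obtain ⟨x, rfl⟩ := IsLocalRing.residue_surjective a
  exact ⟨x, x.2, v.rd_coe x⟩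
lemma rd_eq_zero {x : ℂ} (hx : x ∈ v.V) : v.rd x = 0 ↔ v.V.valuation x < 1 := by
  rw [v.rd_eq hx, IsLocalRing.residue_eq_zero_iff, v.V.valuation_lt_one_iff]
lemma rd_pi_mul {x : ℂ} (hx : x ∈ v.V) : v.rd (v.pi * x) = 0 := by
  rw [v.rd_mul v.pi_mem hx, (v.rd_eq_zero v.pi_mem).2 v.val_pi, zero_mul]
instance instCharP : CharP v.kk p := by
  have h0 : ((p : ℤ) : v.kk) = 0 := by
    rw [← v.rd_int, v.rd_eq_zero (intCast_mem _ _)]; simpa using v.hpV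
  have h1 : (p : v.kk) = 0 := by simpa using h0
  have h2 := ringChar.dvd h1
  rcases (Nat.dvd_prime hp.out).1 h2 with h | h
  · exact absurd h CharP.ringChar_ne_one
  · exact ringChar.of_eq h
/-- reduction of values of lifted polynomials -/
lemma rd_eval (P : v.V[X]) {x : ℂ} (hx : x ∈ v.V) :
    v.rd ((P.map (algebraMap v.V ℂ)).eval x) = (P.map (IsLocalRing.residue v.V)).eval (v.rd x) := by
  have : (P.map (algebraMap v.V ℂ)).eval x = (P.eval ⟨x, hx⟩ : v.V) := by
    rw [eval_map]; exact eval₂_at_apply (algebraMap v.V ℂ) (⟨x, hx⟩ : v.V)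
  rw [this, v.rd_coe, eval_map, v.rd_eq hx, eval₂_at_apply]
/-- lifting of polynomials with coefficients in V -/
lemma lift_poly {P : ℂ[X]} (hP : ∀ k, P.coeff k ∈ v.R) : ∃ Q : v.V[X], Q.map (algebraMap v.V ℂ) = P := by
  have hl : P ∈ Polynomial.lifts (algebraMap v.V ℂ) := by
    rw [Polynomial.lifts_iff_coeff_lifts]
    intro k; exact ⟨⟨_, hP k⟩, rfl⟩
  exact hl
lemma cong {f g : v.QQ} (h : v.mq f = v.mq g) (hf : MInv f) (hg : MInv g) :
    ∃ P : v.V[X], ∀ τ, (f : ℍ → ℂ) τ - (g : ℍ → ℂ) τ = v.pi * (P.map (algebraMap v.V ℂ)).eval (jf τ) := by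
  obtain ⟨e, he⟩ := v.mk_eq_iff.1 h
  obtain ⟨P, hP, hv⟩ := QR_principle hp.out.pos e.2 (fun γ τ => by
    have h1 := he τ
    have h2 := he (ofSL γ • τ)
    rw [hf, hg, h1] at h2
    exact (mul_left_cancel₀ v.pi_ne h2).symm)
  obtain ⟨Q, rfl⟩ := v.lift_poly hP
  exact ⟨Q, fun τ => by rw [he, hv]⟩
lemma cong_rd {f g : v.QQ} (h : v.mq f = v.mq g) (hf : MInv f) (hg : MInv g) {τ : ℍ} (hτ : jf τ ∈ v.V) :
    ∃ c ∈ v.V, (f : ℍ → ℂ) τ - (g : ℍ → ℂ) τ = v.pi * c := by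
  obtain ⟨P, hP⟩ := v.cong h hf hg
  refine ⟨_, ?_, hP τ⟩
  exact eval_mem (R := v.R) (fun k => by rw [coeff_map]; exact Subtype.property _) hτ
/-! ### congruences for j, phi, psi -/
def jQ : v.QQ := v.at1 hasQ_j
def jiQ (i : Option (Fin p)) : v.QQ := v.at' hasQ_j i
def phQ (i : Option (Fin p)) : v.QQ := ⟨phi (rep p i), QR_phi i v.ru⟩
def psQ (i : Option (Fin p)) : v.QQ := ⟨psi (rep p i), QR_psi i v.ru⟩
/-- the mod p Hasse function -/
def AQ : v.QQ := v.psQ none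
lemma ji_some (b) : v.mq (v.jiQ (some b)) ^ p = v.mq v.jQ := (v.at_1 hasQ_j b).symm
lemma ji_none : v.mq (v.jiQ none) = v.mq v.jQ ^ p := v.at_none hasQ_j
lemma ph_none : v.mq (v.phQ none) = 0 := by
  have : v.phQ none = (p : v.QQ) ^ 12 * (v.at' hasQ_fD none * v.at1 hasQ_fDi) := by
    apply Subtype.ext; ext τ
    refine (phi_none τ).trans ?_
    simp [at', at1]
  rw [this, map_mul, map_pow, map_natCast, v.p_zero]; simp
lemma ps_some (b) : v.mq (v.psQ (some b)) = 0 := by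
  have : v.psQ (some b) = (p : v.QQ) ^ 12 * (v.at1 hasQ_fD * v.at' hasQ_fDi (some b)) := by
    apply Subtype.ext; ext τ
    refine (psi_some b τ).trans ?_
    simp [at', at1]
  rw [this, map_mul, map_pow, map_natCast, v.p_zero]; simp
lemma ph_some (b) : v.mq (v.phQ (some b)) ^ p = v.mq v.AQ := by
  have h1 : v.phQ (some b) = (v.at' hasQ_fD (some b) * v.at1 hasQ_fDi) := by
    apply Subtype.ext; ext τ
    exact (phi_some b τ)
  have h2 : v.AQ = (v.at1 hasQ_fD * v.at' hasQ_fDi none) := by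
    apply Subtype.ext; ext τ
    exact (psi_none τ)
  rw [h1, h2, map_mul, map_mul, v.at_1 hasQ_fD b, v.at_none hasQ_fDi]; ring
lemma frob_sub {R : Type*} [CommRing R] (h : (p : R) = 0) (h2 : p ≠ 2) (a b : R) : (a - b) ^ p = a ^ p - b ^ p := by
  obtain ⟨r, hr⟩ := exists_add_pow_prime_eq hp.out a (-b)
  rw [sub_eq_add_neg, hr, h, (hp.out.odd_of_ne_two h2).neg_pow]; ring
lemma prod_const {R : Type*} [CommRing R] (h : (p : R) = 0) (h2 : p ≠ 2) (y : Fin p → R) (hy : ∀ b b', y b = y b') :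
    ∏ b, (X - C (y b)) = X ^ p - C (y 0 ^ p) := by
  have h1 : (p : R[X]) = 0 := by rw [← C_eq_natCast, h, C_0]
  rw [prod_congr rfl (fun b _ => by rw [hy b 0]), Finset.prod_const, Finset.card_univ, Fintype.card_fin, frob_sub h1 h2, C_pow]
def ev (τ : ℍ) : v.QQ →+* ℂ := (evH τ).comp (QR v.R p).subtype
/-- polynomial with roots `u i τ` over V -/
def cpV (u : Option (Fin p) → v.V) : v.V[X] := ∏ i, (X - C (u i))
lemma poly_cong {u : Mp → ℍ → ℂ} (hf : Fam u) (hu : ∀ i, u (rep p i) ∈ QR v.R p) {G : v.QQ[X]}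
    (hG : ∀ γ τ, G.map (v.ev (ofSL γ • τ)) = G.map (v.ev τ)) (h : (cpQ v.R p u hu).map v.mq = G.map v.mq)
    {τ : ℍ} (hτ : jf τ ∈ v.V) (k : ℕ) : ∃ c ∈ v.V, (cp p u τ).coeff k - (G.map (v.ev τ)).coeff k = v.pi * c := by
  have h1 := congrArg (fun P => P.coeff k) h
  simp only [coeff_map] at h1
  have h2 : ∀ τ, (cp p u τ).coeff k = (((cpQ v.R p u hu).coeff k : v.QQ) : ℍ → ℂ) τ := by
    intro τ
    rw [← cpQ_map u hu, coeff_map]; rfl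
  have h3 : ∀ τ, (G.map (v.ev τ)).coeff k = ((G.coeff k : v.QQ) : ℍ → ℂ) τ := fun τ => by rw [coeff_map]; rfl
  obtain ⟨c, hc, hcc⟩ := v.cong_rd h1 (fun γ τ => by rw [← h2, ← h2, hf.cp_inv hp.out])
    (fun γ τ => by rw [← h3, ← h3, hG]) hτ
  exact ⟨c, hc, by rw [h2, h3, hcc]⟩
lemma poly_cong_rd {u : Mp → ℍ → ℂ} (hf : Fam u) (hu : ∀ i, u (rep p i) ∈ QR v.R p) {G : v.QQ[X]}
    (hG : ∀ γ τ, G.map (v.ev (ofSL γ • τ)) = G.map (v.ev τ)) (h : (cpQ v.R p u hu).map v.mq = G.map v.mq)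
    {τ : ℍ} (hτ : jf τ ∈ v.V) {H : v.V[X]} (hH : H.map (algebraMap v.V ℂ) = G.map (v.ev τ)) :
    ∏ i, (X - C (v.rd (u (rep p i) τ))) = H.map (IsLocalRing.residue v.V) := by
  have hm : ∀ i, u (rep p i) τ ∈ v.V := fun i => fam_mem v.V hp.out hf hu hτ i
  have h1 : (v.cpV fun i => ⟨_, hm i⟩).map (algebraMap v.V ℂ) = cp p u τ := by
    simp only [cpV, cp, Polynomial.map_prod, Polynomial.map_sub, map_X, map_C]; rfl
  have h2 : (v.cpV fun i => ⟨_, hm i⟩).map (IsLocalRing.residue v.V) = ∏ i, (X - C (v.rd (u (rep p i) τ))) := by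
    simp only [cpV, Polynomial.map_prod, Polynomial.map_sub, map_X, map_C, v.rd_eq (hm _)]
  rw [← h2]
  ext k
  obtain ⟨c, hc, hcc⟩ := v.poly_cong hf hu hG h hτ k
  rw [← h1, ← hH, coeff_map, coeff_map] at hcc
  rw [coeff_map, coeff_map, ← sub_eq_zero, ← map_sub, ← v.rd_coe]
  have : (((v.cpV fun i => ⟨_, hm i⟩).coeff k - H.coeff k : v.V) : ℂ) = v.pi * c := hcc
  rw [this, v.rd_pi_mul hc]
/-! #### j -/
def Gj : v.QQ[X] := (X ^ p - C v.jQ) * (X - C (v.jQ ^ p))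
lemma Gj_ev (τ : ℍ) : v.Gj.map (v.ev τ) = (X ^ p - C (jf τ)) * (X - C (jf τ ^ p)) := by
  simp only [Gj, poly_map]; rfl
lemma Gj_inv (γ τ) : v.Gj.map (v.ev (ofSL γ • τ)) = v.Gj.map (v.ev τ) := by
  rw [Gj_ev, Gj_ev, jf_smul]
lemma Gj_mq : (cpQ v.R p jX (fun i => QR_j i v.ru)).map v.mq = v.Gj.map v.mq := by
  have h : ∀ i, (⟨jX (rep p i), QR_j i v.ru⟩ : v.QQ) = v.jiQ i := fun i => rfl
  simp only [cpQ, Gj, Polynomial.map_prod, poly_map, h]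
  rw [Fintype.prod_option, prod_const v.p_zero v.h2 (fun b => v.mq (v.jiQ (some b))) (fun b b' => v.at_some hasQ_j b b'), v.ji_some, v.ji_none, mul_comm, map_pow v.mq]
lemma j_cong {τ : ℍ} (hτ : jf τ ∈ v.V) (i) : ∃ c ∈ v.V, (jX (rep p i) τ ^ p - jf τ) * (jX (rep p i) τ - jf τ ^ p) = v.pi * c := by
  have hm : jX (rep p i) τ ∈ v.R := fam_mem v.V hp.out fam_j (fun i => QR_j i v.ru) hτ i
  have h1 := v.poly_cong fam_j (fun i => QR_j i v.ru) v.Gj_inv v.Gj_mq hτ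
  choose c hc hcc using h1
  have h2 := cp_root (l := p) jX τ i
  have h3 : (v.Gj.map (v.ev τ)).eval (jX (rep p i) τ) = (jX (rep p i) τ ^ p - jf τ) * (jX (rep p i) τ - jf τ ^ p) := by
    rw [Gj_ev]; simp
  rw [← h3, show (v.Gj.map (v.ev τ)) = cp p jX τ - (cp p jX τ - (v.Gj.map (v.ev τ))) by ring, eval_sub, h2, zero_sub,
    eval_eq_sum_range]
  simp only [coeff_sub, hcc]
  refine ⟨-∑ x ∈ range ((cp p jX τ - v.Gj.map (v.ev τ)).natDegree + 1), c x * jX (rep p i) τ ^ x, ?_, ?_⟩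
  · exact v.R.neg_mem (v.R.sum_mem fun k _ => v.R.mul_mem (hc k) (v.R.pow_mem hm k))
  · rw [mul_neg, mul_sum]; simp only [mul_assoc]
lemma j_prod {τ : ℍ} (hτ : jf τ ∈ v.V) : ∏ i, (X - C (v.rd (jX (rep p i) τ))) =
    (X ^ p - C (v.rd (jf τ))) * (X - C (v.rd (jf τ) ^ p)) := by
  rw [v.poly_cong_rd fam_j (fun i => QR_j i v.ru) v.Gj_inv v.Gj_mq hτ (H := (X ^ p - C ⟨jf τ, hτ⟩) * (X - C ⟨jf τ, hτ⟩ ^ p))]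
  · simp [poly_map, v.rd_eq hτ]
  · rw [Gj_ev]; simp [poly_map]
/-! #### psi, phi and the Hasse polynomial -/
def aQ : v.QQ := ∑ i, v.psQ i
lemma aQ_ev (τ : ℍ) : (v.aQ : ℍ → ℂ) τ = ∑ i, psi (rep p i) τ := by
  have : (v.aQ : ℍ → ℂ) = ∑ i, psi (rep p i) := by
    rw [aQ, ← Subring.coe_subtype, map_sum]; rfl
  rw [this, Finset.sum_apply]
lemma aQ_inv : MInv v.aQ := fun γ τ => by
  rw [aQ_ev, aQ_ev]; exact fam_psi.sum_inv hp.out γ τ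
lemma aQ_mq : v.mq v.aQ = v.mq v.AQ := by
  rw [aQ, map_sum, Fintype.sum_option]; simp [v.ps_some, AQ]
lemma exists_A0 : ∃ P : v.V[X], ∀ τ, (v.aQ : ℍ → ℂ) τ = (P.map (algebraMap v.V ℂ)).eval (jf τ) := by
  obtain ⟨P, hP, hv⟩ := QR_principle hp.out.pos v.aQ.2 v.aQ_inv
  obtain ⟨Q, rfl⟩ := v.lift_poly hP
  exact ⟨Q, hv⟩
def A0 : v.V[X] := v.exists_A0.choose
lemma A0_spec (τ : ℍ) : (v.aQ : ℍ → ℂ) τ = (v.A0.map (algebraMap v.V ℂ)).eval (jf τ) := v.exists_A0.choose_spec τ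
/-- the 12th power of the Hasse polynomial -/
def A : v.kk[X] := v.A0.map (IsLocalRing.residue v.V)
lemma aQ_mem {τ : ℍ} (hτ : jf τ ∈ v.V) : (v.aQ : ℍ → ℂ) τ ∈ v.V := by
  rw [A0_spec]; exact eval_mem (R := v.R) (fun k => by rw [coeff_map]; exact Subtype.property _) hτ
lemma rd_aQ {τ : ℍ} (hτ : jf τ ∈ v.V) : v.rd ((v.aQ : ℍ → ℂ) τ) = v.A.eval (v.rd (jf τ)) := by
  rw [A0_spec, v.rd_eval _ hτ]; rfl
lemma psi_prod {τ : ℍ} (hτ : jf τ ∈ v.V) : ∏ i, (X - C (v.rd (psi (rep p i) τ))) =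
    X ^ p * (X - C (v.A.eval (v.rd (jf τ)))) := by
  have he : ∀ τ, ((X ^ p * (X - C v.aQ) : v.QQ[X])).map (v.ev τ) = X ^ p * (X - C ((v.aQ : ℍ → ℂ) τ)) := by
    intro τ; simp only [poly_map]; rfl
  rw [v.poly_cong_rd fam_psi (fun i => QR_psi i v.ru) (G := X ^ p * (X - C v.aQ)) (fun γ τ => by rw [he, he, aQ_inv]) ?_ hτ
    (H := X ^ p * (X - C ⟨_, v.aQ_mem hτ⟩))]
  · rw [← v.rd_aQ hτ]
    simp [poly_map, v.rd_eq (v.aQ_mem hτ)]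
  · rw [he]; simp [poly_map]
  · have h : ∀ i, (⟨psi (rep p i), QR_psi i v.ru⟩ : v.QQ) = v.psQ i := fun i => rfl
    simp only [cpQ, Polynomial.map_prod, poly_map, h]
    rw [Fintype.prod_option]
    simp only [v.ps_some, aQ_mq]
    simp [mul_comm, AQ]
lemma phi_prod {τ : ℍ} (hτ : jf τ ∈ v.V) : ∏ i, (X - C (v.rd (phi (rep p i) τ))) =
    X * (X ^ p - C (v.A.eval (v.rd (jf τ)))) := by
  have he : ∀ τ, ((X * (X ^ p - C v.aQ) : v.QQ[X])).map (v.ev τ) = X * (X ^ p - C ((v.aQ : ℍ → ℂ) τ)) := by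
    intro τ; simp only [poly_map]; rfl
  rw [v.poly_cong_rd fam_phi (fun i => QR_phi i v.ru) (G := X * (X ^ p - C v.aQ)) (fun γ τ => by rw [he, he, aQ_inv]) ?_ hτ
    (H := X * (X ^ p - C ⟨_, v.aQ_mem hτ⟩))]
  · rw [← v.rd_aQ hτ]
    simp [poly_map, v.rd_eq (v.aQ_mem hτ)]
  · rw [he]; simp [poly_map]
  · have h : ∀ i, (⟨phi (rep p i), QR_phi i v.ru⟩ : v.QQ) = v.phQ i := fun i => rfl
    simp only [cpQ, Polynomial.map_prod, poly_map, h]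
    have hb : ∀ b b', v.mq (v.phQ (some b)) = v.mq (v.phQ (some b')) := by
      intro b b'
      have h1 : ∀ b, v.phQ (some b) = (v.at' hasQ_fD (some b) * v.at1 hasQ_fDi) := by
        intro b
        apply Subtype.ext; ext τ
        exact (phi_some b τ)
      rw [h1, h1, map_mul, map_mul, v.at_some hasQ_fD b b']
    rw [Fintype.prod_option, prod_const v.p_zero v.h2 _ hb, v.ph_some, v.ph_none, aQ_mq]
    simp
end PV

lemma fix_eq {X : Mp} {τ : ℍ} (h : X • τ = τ) :
    (X 0 0 : ℂ) * τ + X 0 1 = τ * jd X τ := by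
  have h1 := congrArg UpperHalfPlane.coe h
  rw [Mp.coe_smul, div_eq_iff (jd_ne X τ)] at h1
  exact h1
lemma fix_of_eq {X : Mp} {τ : ℍ} (h : (X 0 0 : ℂ) * τ + X 0 1 = τ * jd X τ) : X • τ = τ := by
  apply UpperHalfPlane.ext
  rw [Mp.coe_smul, div_eq_iff (jd_ne X τ)]
  exact h
def Mtr (X : Mp) : ℤ := X 0 0 + X 1 1
lemma fix_char {X : Mp} {τ : ℍ} (h : X • τ = τ) : jd X τ ^ 2 - Mtr X * jd X τ + Mdet X = 0 := by
  have h1 := fix_eq h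
  have h2 : jd X τ = X 1 0 * τ + X 1 1 := rfl
  rw [Mdet_eq, Mtr]
  push_cast
  rw [h2] at h1 ⊢
  linear_combination (-(X 1 0 : ℂ)) * h1
lemma fix_phi {X : Mp} {τ : ℍ} (h : X • τ = τ) : phi X τ = (Mtr X - jd X τ) ^ 12 := by
  have h1 := fix_char h
  have h2 := jd_ne X τ
  have : (Mdet X : ℂ) = jd X τ * (Mtr X - jd X τ) := by linear_combination h1
  have h3 := fD_ne τ
  unfold phi; rw [h, this]; field_simp
lemma fix_psi {X : Mp} {τ : ℍ} (h : X • τ = τ) : psi X τ = jd X τ ^ 12 := by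
  have h3 := fD_ne τ
  unfold psi; rw [h]; field_simp
namespace PV
variable {p : ℕ} [hp : Fact p.Prime] (v : PV p) {τ : ℍ}
/-- the supersingular condition at τ -/
def SS (τ : ℍ) : Prop := v.A.eval (v.rd (jf τ)) = 0
lemma phi_mem (X : Mp) (hτ : jf τ ∈ v.V) : phi X τ ∈ v.V := (all_mem v.V X hτ).2.1
lemma psi_mem (X : Mp) (hτ : jf τ ∈ v.V) : psi X τ ∈ v.V := (all_mem v.V X hτ).2.2
lemma jX_mem (X : Mp) (hτ : jf τ ∈ v.V) : jX X τ ∈ v.V := (all_mem v.V X hτ).1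
lemma int_zero (n : ℤ) : v.rd n = 0 ↔ (p : ℤ) ∣ n := by
  rw [v.rd_int, CharP.intCast_eq_zero_iff v.kk p]
lemma ss_psi (hτ : jf τ ∈ v.V) (h : v.SS τ) (i) : v.rd (psi (rep p i) τ) = 0 := by
  have h1 := congrArg (fun P => P.eval (v.rd (psi (rep p i) τ))) (v.psi_prod hτ)
  simp only [eval_prod, eval_sub, eval_X, eval_C, eval_mul, eval_pow] at h1
  rw [SS] at h
  rw [prod_eq_zero (mem_univ i) (sub_self _), h, sub_zero, ← pow_succ] at h1
  exact pow_eq_zero_iff (by omega) |>.1 h1.symm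
lemma ss_phi (hτ : jf τ ∈ v.V) (h : v.SS τ) (i) : v.rd (phi (rep p i) τ) = 0 := by
  have h1 := congrArg (fun P => P.eval (v.rd (phi (rep p i) τ))) (v.phi_prod hτ)
  simp only [eval_prod, eval_sub, eval_X, eval_C, eval_mul, eval_pow] at h1
  rw [SS] at h
  rw [prod_eq_zero (mem_univ i) (sub_self _), h, sub_zero, ← pow_succ'] at h1
  exact pow_eq_zero_iff (by omega) |>.1 h1.symm
lemma phi_unique (hτ : jf τ ∈ v.V) (h : ¬ v.SS τ) {i i'} (hi : v.rd (phi (rep p i) τ) = 0) (hi' : v.rd (phi (rep p i') τ) = 0) : i = i' := by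
  by_contra hne
  have h1 := v.phi_prod hτ
  rw [← Finset.mul_prod_erase _ _ (mem_univ i), hi, C_0, sub_zero] at h1
  have h2 := mul_left_cancel₀ X_ne_zero h1
  have h3 := congrArg (fun P => P.eval 0) h2
  simp only [eval_prod, eval_sub, eval_X, eval_C, eval_pow] at h3
  rw [prod_eq_zero (i := i') (by simp [Ne.symm hne]) (by rw [hi', sub_self]), zero_pow hp.out.ne_zero, zero_sub] at h3
  exact h (neg_eq_zero.1 h3.symm)
lemma phi_exists (hτ : jf τ ∈ v.V) : ∃ i, v.rd (phi (rep p i) τ) = 0 := by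
  have h1 := congrArg (fun P => P.eval 0) (v.phi_prod hτ)
  simp only [eval_prod, eval_sub, eval_X, eval_C, eval_mul, zero_mul] at h1
  obtain ⟨i, -, hi⟩ := Finset.prod_eq_zero_iff.1 h1
  exact ⟨i, by simpa using hi⟩
lemma psi_exists (hτ : jf τ ∈ v.V) (h : ¬ v.SS τ) : ∃ i, v.rd (psi (rep p i) τ) ≠ 0 := by
  by_contra hne
  push Not at hne
  have h1 := congrArg (fun P => P.eval (v.A.eval (v.rd (jf τ)))) (v.psi_prod hτ)
  simp only [eval_sub, eval_X, eval_C, eval_mul, hne, sub_self, mul_zero, Finset.prod_const] at h1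
  rw [eval_pow, eval_sub, eval_X, eval_C, sub_zero] at h1
  exact h (pow_eq_zero_iff (Finset.card_ne_zero.2 Finset.univ_nonempty) |>.1 h1)
lemma phi_psi_rd (hτ : jf τ ∈ v.V) (X : Mp) : v.rd (phi X τ) * v.rd (psi X τ) = (Mdet X : v.kk) ^ 12 := by
  rw [← v.rd_mul (v.phi_mem X hτ) (v.psi_mem X hτ), phi_psi, v.rd_pow (intCast_mem _ _), v.rd_int]
lemma not_both (hτ : jf τ ∈ v.V) (h : ¬ v.SS τ) {i} (hi : v.rd (phi (rep p i) τ) = 0) : v.rd (psi (rep p i) τ) ≠ 0 := by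
  obtain ⟨c, hc⟩ := v.psi_exists hτ h
  have h1 := v.phi_psi_rd hτ (rep p c)
  rw [rep_det, Int.cast_natCast, CharP.cast_eq_zero, zero_pow (by norm_num)] at h1
  have h2 := (mul_eq_zero.1 h1).resolve_right hc
  rw [v.phi_unique hτ h hi h2]; exact hc
lemma phi_unit (hτ : jf τ ∈ v.V) {X : Mp} (hX : ¬ (p : ℤ) ∣ Mdet X) : v.rd (phi X τ) ≠ 0 := by
  intro h
  have h1 := v.phi_psi_rd hτ X
  rw [h, zero_mul] at h1
  exact hX ((CharP.intCast_eq_zero_iff v.kk p _).1 (pow_eq_zero_iff (by norm_num) |>.1 h1.symm))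
lemma mem_of_pow {x : ℂ} {n : ℕ} (hn : n ≠ 0) (h : x ^ n ∈ v.V) : x ∈ v.V := by
  rw [← v.V.valuation_le_one_iff] at h ⊢
  rw [map_pow] at h
  exact (pow_le_one_iff hn).1 h
lemma crit1 (hτ : jf τ ∈ v.V) (h : v.SS τ) {X : Mp} (hX : X • τ = τ) (hd : (p : ℤ) ∣ Mdet X) : (p : ℤ) ∣ Mtr X := by
  have h1 : v.rd (phi X τ) = 0 ∧ v.rd (psi X τ) = 0 := by
    obtain ⟨Y, i, rfl⟩ := rep_factor hp.out X hd
    rw [phi_mul, psi_mul]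
    have hj := v.jX_mem (rep p i) hτ
    rw [v.rd_mul (v.phi_mem Y hj) (v.phi_mem _ hτ), v.rd_mul (v.psi_mem Y hj) (v.psi_mem _ hτ), v.ss_phi hτ h, v.ss_psi hτ h]
    simp
  have m1 := v.phi_mem X hτ
  have m2 := v.psi_mem X hτ
  rw [fix_phi hX] at h1 m1
  rw [fix_psi hX] at h1 m2
  have m1' := v.mem_of_pow (by norm_num) m1
  have m2' := v.mem_of_pow (by norm_num) m2
  rw [v.rd_pow m1', v.rd_pow m2', pow_eq_zero_iff (by norm_num), pow_eq_zero_iff (by norm_num)] at h1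
  rw [← v.int_zero, show ((Mtr X : ℤ) : ℂ) = (Mtr X - jd X τ) + jd X τ by ring, v.rd_add m1' m2', h1.1, h1.2, add_zero]
lemma crit2 (hτ : jf τ ∈ v.V) {X : Mp} (hX : X • τ = τ) (hd : (p : ℤ) ∣ Mdet X) (hd2 : ¬ (p : ℤ) ^ 2 ∣ Mdet X) (ht : Mtr X = 0) : v.SS τ := by
  by_contra h
  have h1 : v.rd (phi X τ) = v.rd (psi X τ) := by
    rw [fix_phi hX, fix_psi hX, ht]; congr 1; simp; ring
  have h2 := v.phi_psi_rd hτ X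
  rw [(CharP.intCast_eq_zero_iff v.kk p _).2 hd, zero_pow (by norm_num), h1, mul_self_eq_zero] at h2
  rw [h2] at h1
  obtain ⟨Y, i, rfl⟩ := rep_factor hp.out X hd
  have hY : ¬ (p : ℤ) ∣ Mdet Y := by
    intro hY
    apply hd2
    rw [Mdet_mul, rep_det, sq]; exact mul_dvd_mul_right hY _
  have hj : jf (rep p i • τ) ∈ v.V := v.jX_mem (rep p i) hτ
  rw [phi_mul, v.rd_mul (v.phi_mem Y hj) (v.phi_mem _ hτ)] at h1
  have h3 := (mul_eq_zero.1 h1).resolve_left (v.phi_unit hj hY)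
  have h4 := v.not_both hτ h h3
  rw [psi_mul, v.rd_mul (v.psi_mem Y hj) (v.psi_mem _ hτ)] at h2
  have h5 := v.phi_psi_rd hj Y
  rw [(mul_eq_zero.1 h2).resolve_right h4, mul_zero] at h5
  exact hY ((CharP.intCast_eq_zero_iff v.kk p _).1 (pow_eq_zero_iff (by norm_num) |>.1 h5.symm))
lemma crit3 (hτ : jf τ ∈ v.V) (h : ¬ v.SS τ) {X : Mp} (hX : X • τ = τ) (hd : ¬ (p : ℤ) ∣ Mdet X) :
    ∃ y : ℤ, (p : ℤ) ∣ Mtr X ^ 2 - 4 * Mdet X - y ^ 2 := by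
  obtain ⟨c, hc⟩ := v.phi_exists hτ
  have hs := sig_spec hp.out X c
  have h1 : v.rd (phi (rep p (sig hp.out X c)) τ) = 0 := by
    have h2 : phi (rep p c * X) τ = phi (sigY hp.out X c * rep p (sig hp.out X c)) τ := by rw [hs]
    have hj : jf (rep p (sig hp.out X c) • τ) ∈ v.V := v.jX_mem (rep p _) hτ
    rw [phi_mul, phi_mul, hX] at h2
    have h3 := congrArg v.rd h2
    rw [v.rd_mul (v.phi_mem _ hτ) (v.phi_mem _ hτ), v.rd_mul (v.phi_mem _ hj) (v.phi_mem _ hτ), hc, zero_mul] at h3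
    exact (mul_eq_zero.1 h3.symm).resolve_left (v.phi_unit hj (by rw [sigY_det]; exact hd))
  have h2 := v.phi_unique hτ h hc h1
  rw [← h2] at hs
  set Y := sigY hp.out X c
  have h00 := congrArg (fun Z : Mp => Z 0 0) hs
  have h01 := congrArg (fun Z : Mp => Z 0 1) hs
  have h10 := congrArg (fun Z : Mp => Z 1 0) hs
  have h11 := congrArg (fun Z : Mp => Z 1 1) hs
  simp only [Mp.mul_entries] at h00 h01 h10 h11
  rw [Mdet_eq, Mtr]
  cases c with
  | none =>
    simp [rep] at h00 h01 h10 h11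
    refine ⟨X 0 0 - X 1 1, 4 * X 0 1 * Y 1 0, ?_⟩
    rw [h10]; ring
  | some b =>
    simp [rep] at h00 h01 h10 h11
    refine ⟨2 * X 1 0 * b + X 0 0 - X 1 1, 4 * X 1 0 * Y 0 1, ?_⟩
    rw [← h00] at h01
    linear_combination (4 * X 1 0) * h01
/-- supersingularity of CM points -/
lemma ss_iff (hτ : jf τ ∈ v.V) {X : Mp} (hX : X • τ = τ) (hd : ¬ (p : ℤ) ∣ Mdet X) (hD : Mtr X ^ 2 - 4 * Mdet X < 0)
    (hpD : ¬ (p : ℤ) ∣ Mtr X ^ 2 - 4 * Mdet X) : v.SS τ ↔ ¬ ∃ y : ℤ, (p : ℤ) ∣ Mtr X ^ 2 - 4 * Mdet X - y ^ 2 := by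
  constructor
  · rintro h ⟨y, hy⟩
    obtain ⟨l, hl⟩ : ∃ l : ℤ, (p : ℤ) ∣ Mtr X - y - 2 * l := by
      have ho := hp.out.odd_of_ne_two v.h2
      obtain ⟨m, hm⟩ := ho
      refine ⟨-(m * (Mtr X - y)), Mtr X - y, ?_⟩
      rw [hm]; push_cast; ring
    have hdet : 0 < (X 0 0 - l) * (X 1 1 - l) - X 0 1 * X 1 0 := by
      rw [Mdet_eq, Mtr] at hD
      nlinarith [sq_nonneg (X 0 0 + X 1 1 - 2 * l)]
    set Z := mkM (X 0 0 - l) (X 0 1) (X 1 0) (X 1 1 - l) hdet with hZ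
    have hZτ : Z • τ = τ := by
      apply fix_of_eq
      have h1 := fix_eq hX
      rw [jd] at h1 ⊢
      simp [hZ]
      linear_combination h1
    have hp' : Prime (p : ℤ) := Nat.prime_iff_prime_int.1 hp.out
    have e1 : Mtr Z = Mtr X - 2 * l := by simp [Mtr, hZ]; ring
    have e2 : 4 * Mdet Z = Mtr Z ^ 2 - (Mtr X ^ 2 - 4 * Mdet X) := by
      rw [e1, Mdet_eq, Mdet_eq, Mtr]; simp [hZ]; ring
    have e3 : (p : ℤ) ∣ 4 * Mdet Z := by
      obtain ⟨a, ha⟩ := hl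
      obtain ⟨b, hb⟩ := hy
      refine ⟨a * (p * a + 2 * y) - b, ?_⟩
      rw [e2, e1, show Mtr X - 2 * l = p * a + y by linarith]
      linear_combination -hb
    have e4 : (p : ℤ) ∣ Mdet Z := by
      refine (hp'.dvd_mul.1 e3).resolve_left fun h4 => ?_
      have h5 : p ∣ 2 ^ 2 := mod_cast h4
      exact v.h2 ((Nat.prime_dvd_prime_iff_eq hp.out Nat.prime_two).1 (hp.out.dvd_of_dvd_pow h5))
    have e5 := v.crit1 hτ h hZτ e4
    apply hpD
    rw [show Mtr X ^ 2 - 4 * Mdet X = Mtr Z ^ 2 - 4 * Mdet Z by linarith]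
    exact dvd_sub (dvd_pow e5 (by norm_num)) (e4.mul_left 4)
  · intro h
    by_contra hn
    exact h (v.crit3 hτ hn hX hd)
/-! ### reduction of roots -/
open Classical in
lemma roots_red {f : v.V[X]} (h0 : f.map (IsLocalRing.residue v.V) ≠ 0) :
    (f.map (IsLocalRing.residue v.V)).roots = ((f.map (algebraMap v.V ℂ)).roots.filter (· ∈ v.V)).map v.rd := by
  have key : ∀ s : Multiset ℂ, ∃ G : v.V[X], ∃ c : ℂ, c ≠ 0 ∧ (s.map fun a => X - C a).prod = C c * G.map (algebraMap v.V ℂ) ∧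
      ∃ e : v.kk, e ≠ 0 ∧ G.map (IsLocalRing.residue v.V) = C e * (((s.filter (· ∈ v.V)).map v.rd).map fun a => X - C a).prod := by
    intro s
    induction s using Multiset.induction_on with
    | empty => exact ⟨1, 1, one_ne_zero, by simp, 1, one_ne_zero, by simp⟩
    | cons a s ih =>
      obtain ⟨G, c, hc, h1, e, he, h2⟩ := ih
      by_cases ha : a ∈ v.V
      · refine ⟨(X - C ⟨a, ha⟩) * G, c, hc, ?_, e, he, ?_⟩
        · rw [Multiset.map_cons, Multiset.prod_cons, h1]
          simp only [poly_map]
          rw [show (algebraMap v.V ℂ) ⟨a, ha⟩ = a from rfl]; ring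
        · rw [Multiset.filter_cons_of_pos _ ha, Multiset.map_cons, Multiset.map_cons, Multiset.prod_cons, v.rd_eq ha]
          simp only [poly_map, h2]; ring
      · have ha0 : a ≠ 0 := by rintro rfl; exact ha (zero_mem _)
        have hi : a⁻¹ ∈ v.V := (v.V.mem_or_inv_mem a).resolve_left ha
        have hv : v.rd a⁻¹ = 0 := by
          rw [v.rd_eq_zero hi, map_inv₀]
          rw [← v.V.valuation_le_one_iff, not_le] at ha
          exact inv_lt_one_of_one_lt₀ ha
        refine ⟨(C ⟨a⁻¹, hi⟩ * X - 1) * G, a * c, mul_ne_zero ha0 hc, ?_, -e, neg_ne_zero.2 he, ?_⟩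
        · rw [Multiset.map_cons, Multiset.prod_cons, h1]
          simp only [poly_map, Polynomial.map_one]
          rw [show (algebraMap v.V ℂ) ⟨a⁻¹, hi⟩ = a⁻¹ from rfl, C_mul]
          have : C a * C a⁻¹ = 1 := by rw [← C_mul, mul_inv_cancel₀ ha0, C_1]
          linear_combination (-X * C c * map (algebraMap v.V ℂ) G) * this
        · rw [Multiset.filter_cons_of_neg _ ha]
          rw [v.rd_eq hi] at hv
          simp only [poly_map, Polynomial.map_one, h2, hv]
          simp
  obtain ⟨G, c, hc, h1, e, he, h2⟩ := key (f.map (algebraMap v.V ℂ)).roots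
  have h3 : f.map (algebraMap v.V ℂ) = C ((f.map (algebraMap v.V ℂ)).leadingCoeff * c) * G.map (algebraMap v.V ℂ) := by
    rw [C_mul, mul_assoc, ← h1, C_leadingCoeff_mul_prod_multiset_X_sub_C]
    exact splits_iff_card_roots.1 (IsAlgClosed.splits _)
  set d := (f.map (algebraMap v.V ℂ)).leadingCoeff * c
  set Z := (((((f.map (algebraMap v.V ℂ)).roots).filter (· ∈ v.V)).map v.rd).map fun a => X - C a).prod with hZ
  have hZ0 : Z ≠ 0 := (monic_multisetProd_X_sub_C _).ne_zero
  have hG0 : G.map (IsLocalRing.residue v.V) ≠ 0 := by rw [h2]; exact mul_ne_zero (C_ne_zero.2 he) hZ0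
  obtain ⟨k, hk⟩ : ∃ k, (G.map (IsLocalRing.residue v.V)).coeff k ≠ 0 := by
    by_contra hn; push Not at hn; exact hG0 (ext hn)
  rw [coeff_map] at hk
  have hu : IsUnit (G.coeff k) := by
    by_contra hn; exact hk ((IsLocalRing.residue_eq_zero_iff _).2 hn)
  obtain ⟨u, hu⟩ := hu
  have hd : d = ((f.coeff k * (↑u⁻¹ : v.V) : v.V) : ℂ) := by
    have h4 := congrArg (fun P => P.coeff k) h3
    simp only [coeff_map, coeff_C_mul, ← hu] at h4
    have h5 : ((u : v.V) : ℂ) * ((↑u⁻¹ : v.V) : ℂ) = 1 := by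
      exact congrArg (fun x : v.V => (x : ℂ)) u.mul_inv
    change (f.coeff k : ℂ) = d * ((u : v.V) : ℂ) at h4
    change d = (f.coeff k : ℂ) * ((↑u⁻¹ : v.V) : ℂ)
    rw [h4, mul_assoc, h5, mul_one]
  have h4 : f = C (f.coeff k * (↑u⁻¹ : v.V)) * G := by
    apply Polynomial.map_injective (algebraMap v.V ℂ) Subtype.val_injective
    rw [h3, hd, Polynomial.map_mul, map_C]; rfl
  rw [h4, Polynomial.map_mul, map_C, h2, ← mul_assoc, ← C_mul]
  rw [h4, Polynomial.map_mul, map_C] at h0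
  have h5 : IsLocalRing.residue v.V (f.coeff k * (↑u⁻¹ : v.V)) ≠ 0 := by
    intro h; rw [h, C_0, zero_mul] at h0; exact h0 rfl
  rw [roots_C_mul _ (mul_ne_zero h5 he), hZ, roots_multiset_prod_X_sub_C, ← h4]
lemma root_lift {f : v.V[X]} (h0 : f.map (IsLocalRing.residue v.V) ≠ 0) {α : v.kk}
    (hα : (f.map (IsLocalRing.residue v.V)).eval α = 0) : ∃ r ∈ v.V, v.rd r = α ∧ (f.map (algebraMap v.V ℂ)).eval r = 0 := by
  classical
  have h1 : α ∈ (f.map (IsLocalRing.residue v.V)).roots := (mem_roots h0).2 hα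
  rw [v.roots_red h0, Multiset.mem_map] at h1
  obtain ⟨r, hr, h⟩ := h1
  rw [Multiset.mem_filter] at hr
  exact ⟨r, hr.2, h, isRoot_of_mem_roots hr.1⟩
/-! ### supersingular values lie in the field with p² elements -/
def sQ (N : ℕ) : v.QQ := ∑ i, v.psQ i * (v.jiQ i ^ p - v.jQ) ^ N
lemma sQ_ev (N : ℕ) (τ : ℍ) : (v.sQ N : ℍ → ℂ) τ = ∑ i, psi (rep p i) τ * (jX (rep p i) τ ^ p - jf τ) ^ N := by
  have : (v.sQ N : ℍ → ℂ) = ∑ i, psi (rep p i) * (jX (rep p i) ^ p - jf) ^ N := by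
    rw [sQ, ← Subring.coe_subtype, map_sum]; rfl
  rw [this, Finset.sum_apply]; rfl
lemma sQ_inv (N : ℕ) : MInv (v.sQ N) := by
  have hf : Fam (fun X τ => psi X τ * (jX X τ ^ p - jf τ) ^ N) :=
    ⟨fun γ X => by ext τ; simp only [fam_psi.left, fam_j.left], fun γ X τ => by simp only [fam_psi.right, fam_j.right, jf_smul]⟩
  intro γ τ
  rw [sQ_ev, sQ_ev]; exact hf.sum_inv hp.out γ τ
lemma sQ_mq {N : ℕ} : v.mq (v.sQ N) = v.mq (v.aQ * (v.jQ ^ (p ^ 2) - v.jQ) ^ N) := by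
  rw [sQ, map_sum, Fintype.sum_option]
  simp only [map_mul, map_pow, map_sub, v.ps_some, v.ji_none, v.aQ_mq, zero_mul, Finset.sum_const_zero, add_zero, AQ]
  rw [← pow_mul, sq]
theorem ss_sq (hA : v.A ≠ 0) {α : v.kk} (hα : v.A.eval α = 0) : α ^ (p ^ 2) = α := by
  by_contra hne
  set N := 12 * p + 1 with hN
  obtain ⟨P, hP⟩ := v.cong (v.sQ_mq (N := N)) (v.sQ_inv N) (fun γ τ => by
    change (v.aQ : ℍ → ℂ) (ofSL γ • τ) * (jf (ofSL γ • τ) ^ p ^ 2 - jf (ofSL γ • τ)) ^ N = (v.aQ : ℍ → ℂ) τ * (jf τ ^ p ^ 2 - jf τ) ^ N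
    rw [aQ_inv, jf_smul])
  set S : v.V[X] := v.A0 * (X ^ p ^ 2 - X) ^ N + C ⟨v.pi, v.pi_mem⟩ * P with hS
  have hSv : ∀ τ, (v.sQ N : ℍ → ℂ) τ = (S.map (algebraMap v.V ℂ)).eval (jf τ) := by
    intro τ
    have h1 := hP τ
    change (v.sQ N : ℍ → ℂ) τ - (v.aQ : ℍ → ℂ) τ * (jf τ ^ p ^ 2 - jf τ) ^ N = _ at h1
    rw [A0_spec] at h1
    simp only [hS, Polynomial.map_add, poly_map, eval_add, eval_mul, eval_pow, eval_sub, eval_X, eval_C]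
    rw [show (algebraMap v.V ℂ) ⟨v.pi, v.pi_mem⟩ = v.pi from rfl]
    linear_combination h1
  have hSr : S.map (IsLocalRing.residue v.V) = v.A * (X ^ p ^ 2 - X) ^ N := by
    have : IsLocalRing.residue v.V ⟨v.pi, v.pi_mem⟩ = 0 := by
      rw [← v.rd_coe]; exact (v.rd_eq_zero v.pi_mem).2 v.val_pi
    simp only [hS, Polynomial.map_add, poly_map, this, C_0, zero_mul, add_zero, A]
  have hX : (X ^ p ^ 2 - X : v.kk[X]) ≠ 0 := FiniteField.X_pow_card_sub_X_ne_zero _ (by nlinarith [hp.out.two_le] : 1 < p ^ 2)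
  obtain ⟨r, hr, hrα, hr0⟩ := v.root_lift (by rw [hSr]; exact mul_ne_zero hA (pow_ne_zero _ hX)) (α := α) (by
    rw [hSr, eval_mul, hα, zero_mul])
  obtain ⟨τ, rfl⟩ := jf_surj r
  rw [← hSv, sQ_ev] at hr0
  obtain ⟨c, hc⟩ : ∃ c, v.rd (jX (rep p c) τ) = α ^ p := by
    have h1 := congrArg (fun P => P.eval (α ^ p)) (v.j_prod hr)
    simp only [eval_prod, eval_sub, eval_X, eval_C, eval_mul, hrα, sub_self, mul_zero] at h1
    obtain ⟨i, -, hi⟩ := Finset.prod_eq_zero_iff.1 h1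
    exact ⟨i, (sub_eq_zero.1 hi).symm⟩
  have huniq : ∀ i, i ≠ c → v.rd (jX (rep p i) τ) ≠ α ^ p := by
    intro i hi hi2
    have h1 := v.j_prod hr
    rw [← Finset.mul_prod_erase _ _ (mem_univ c), hc, hrα, mul_comm] at h1
    have h2 := mul_right_cancel₀ (X_sub_C_ne_zero _) h1
    have h3 := congrArg (fun P => P.eval (α ^ p)) h2
    simp only [eval_prod, eval_sub, eval_X, eval_C, eval_pow] at h3
    rw [prod_eq_zero (i := i) (by simp [hi]) (by rw [hi2, sub_self]), ← pow_mul, ← sq] at h3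
    exact hne (sub_eq_zero.1 h3.symm)
  have hj := fun i => v.jX_mem (rep p i) hr
  have hps := fun i => v.psi_mem (rep p i) hr
  set w := v.V.valuation with hw
  have hval : ∀ i, i ≠ c → w (jX (rep p i) τ ^ p - jf τ) ≤ w v.pi := by
    intro i hi
    obtain ⟨e, he, hh⟩ := v.j_cong hr i
    have h1 : w (jX (rep p i) τ - jf τ ^ p) = 1 := by
      have hm : jX (rep p i) τ - jf τ ^ p ∈ v.V := sub_mem (hj i) (pow_mem hr p)
      apply le_antisymm ((v.V.valuation_le_one_iff _).2 hm)
      by_contra hlt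
      rw [not_le, ← v.rd_eq_zero hm, v.rd_sub (hj i) (pow_mem hr p), v.rd_pow hr, hrα, sub_eq_zero] at hlt
      exact huniq i hi hlt
    have h2 := congrArg w hh
    rw [map_mul, map_mul, h1, mul_one] at h2
    rw [h2]; exact mul_le_of_le_one_right' ((v.V.valuation_le_one_iff _).2 he)
  have hcu : w (jX (rep p c) τ ^ p - jf τ) = 1 := by
    have hm : jX (rep p c) τ ^ p - jf τ ∈ v.V := sub_mem (pow_mem (hj c) p) hr
    apply le_antisymm ((v.V.valuation_le_one_iff _).2 hm)
    by_contra hlt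
    rw [not_le, ← v.rd_eq_zero hm, v.rd_sub (pow_mem (hj c) p) hr, v.rd_pow (hj c), hc, hrα, sub_eq_zero, ← pow_mul, ← sq] at hlt
    exact hne hlt
  have h1 : w (psi (rep p c) τ) ≤ w v.pi ^ N := by
    rw [← Finset.add_sum_erase _ _ (mem_univ c)] at hr0
    have h2 : w (psi (rep p c) τ) = w (∑ i ∈ Finset.univ.erase c, psi (rep p i) τ * (jX (rep p i) τ ^ p - jf τ) ^ N) := by
      have h3 := eq_neg_of_add_eq_zero_left hr0
      have h4 := congrArg w h3
      rw [Valuation.map_neg, map_mul, map_pow, hcu, one_pow, mul_one] at h4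
      exact h4
    rw [h2]
    refine Valuation.map_sum_le _ fun i hi => ?_
    rw [map_mul, map_pow]
    exact (mul_le_mul' ((v.V.valuation_le_one_iff _).2 (hps i)) (pow_le_pow_left' (hval i (Finset.ne_of_mem_erase hi)) N)).trans (one_mul _).le
  have h2 : w p ^ 12 ≤ w (psi (rep p c) τ) := by
    have h3 := congrArg w (phi_psi (rep p c) τ)
    rw [map_mul, map_pow, rep_det] at h3
    simp only [Int.cast_natCast] at h3
    rw [← h3]; exact mul_le_of_le_one_left' ((v.V.valuation_le_one_iff _).2 (v.phi_mem _ hr))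
  have h3 : w v.pi ^ (12 * p) ≤ w p ^ 12 := by
    obtain ⟨e, he, hh⟩ := v.pi_pow
    have h4 := congrArg w hh
    rw [map_pow, map_mul] at h4
    rw [mul_comm, pow_mul, h4]
    exact pow_le_pow_left' (mul_le_of_le_one_right' ((v.V.valuation_le_one_iff _).2 he)) 12
  have h4 := (h3.trans h2).trans h1
  have h5 : w v.pi ≠ 0 := (Valuation.ne_zero_iff _).2 v.pi_ne
  rw [hN, pow_succ] at h4
  have h6 : 0 < w v.pi ^ (12 * p) := zero_lt_iff.2 (pow_ne_zero _ h5)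
  have h7 : w v.pi ^ (12 * p) * w v.pi < w v.pi ^ (12 * p) := mul_lt_of_lt_one_right h6 v.val_pi
  exact absurd h4 (not_le.2 h7)
end PV

section
/-! ### the Hasse invariant as a power series -/
def FE : ℤ⟦X⟧ := -432 * FD
lemma FE_eq : 4 * FE = F6 ^ 2 - F4 ^ 3 := by
  rw [FE]; linear_combination - FD_mul
lemma thetaFE : thetaZ FE = F2 * FE := by
  have h := congrArg thetaZ FE_eq
  rw [thetaZ_sub, thetaZ_pow, thetaZ_pow, thetaZ_mul] at h
  have h4 : thetaZ (4 : ℤ⟦X⟧) = 0 := by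
    have : (4 : ℤ⟦X⟧) = PowerSeries.C (4 : ℤ) := by simp
    rw [this]; ext k
    simp only [thetaZ, PowerSeries.coeff_mk, PowerSeries.coeff_C, map_zero]
    split_ifs with h <;> simp [h]
  rw [h4] at h
  have h5 : (4 : ℤ⟦X⟧) * thetaZ FE = 4 * (F2 * FE) := by
    push_cast at h
    have e : (4 : ℤ⟦X⟧) * (F2 * FE) = F2 * (F6 ^ 2 - F4 ^ 3) := by rw [← FE_eq]; ring
    rw [e]
    linear_combination h + F6 * thetaF6 - F4 ^ 2 * thetaF4
  have h40 : (4 : ℤ⟦X⟧) ≠ 0 := fun h => by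
    have := congrArg (PowerSeries.constantCoeff (R := ℤ)) h
    rw [map_ofNat, map_zero] at this; norm_num at this
  exact mul_left_cancel₀ h40 h5
lemma thetaFE_pow (i : ℕ) : thetaZ (FE ^ i) = i * F2 * FE ^ i := by
  rw [thetaZ_pow, thetaFE]
  cases i with
  | zero => simp
  | succ i => simp [pow_succ]; ring
def hT (a m i : ℕ) : ℤ⟦X⟧ := F4 ^ a * F6 ^ m * FE ^ i
def hG (a m i : ℕ) : ℤ⟦X⟧ := (2 * a * F4 ^ (a - 1) * F6 ^ (m + 1) + 3 * m * F4 ^ (a + 2) * F6 ^ (m - 1)) * FE ^ i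
def hK (a m i : ℕ) : ℤ⟦X⟧ := ((6 * a * (m + 1) + 6 * m * (a + 2)) * F4 ^ (a + 1) * F6 ^ m
  + 9 * (m * (m - 1)) * F4 ^ (a + 4) * F6 ^ (m - 2)) * FE ^ i
lemma thetaZ_nat (k : ℕ) (F : ℤ⟦X⟧) : thetaZ (k * F) = k * thetaZ F := by
  have e2 : ((k : ℕ) : ℤ⟦X⟧) = PowerSeries.C (k : ℤ) := by simp
  ext j
  rw [e2]
  simp only [thetaZ, PowerSeries.coeff_mk, PowerSeries.coeff_C_mul]; ring
lemma theta_hT (a m i : ℕ) (ha : a ≤ 1) :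
    12 * thetaZ (hT a m i) = (4 * a + 6 * m + 12 * i) * F2 * hT a m i - 2 * hG a m i := by
  rw [hT, hG, thetaZ_mul, thetaZ_mul, thetaFE_pow, thetaZ_pow, thetaZ_pow]
  rcases m with _ | m <;> interval_cases a
  · simp; ring
  · simp; linear_combination 4 * FE ^ i * thetaF4
  · simp; linear_combination 6 * (m + 1) * F6 ^ m * FE ^ i * thetaF6
  · simp; linear_combination 6 * (m + 1) * F6 ^ m * FE ^ i * F4 * thetaF6 + 4 * F6 ^ (m + 1) * FE ^ i * thetaF4
lemma theta_hG (a m i : ℕ) (ha : a ≤ 1) :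
    12 * thetaZ (hG a m i) = (4 * a + 6 * m + 12 * i + 2) * F2 * hG a m i - 2 * hK a m i := by
  have e : hG a m i = (2 * a : ℕ) * (F4 ^ (a - 1) * (F6 ^ (m + 1) * FE ^ i)) + (3 * m : ℕ) * (F4 ^ (a + 2) * (F6 ^ (m - 1) * FE ^ i)) := by
    rw [hG]; push_cast; ring
  rw [e, hK, thetaZ_add, thetaZ_nat, thetaZ_nat]
  simp only [thetaZ_mul, thetaFE_pow]
  simp only [thetaZ_pow]
  rcases m with _ | m
  · interval_cases a
    · simp
    · simp; linear_combination 12 * FE ^ i * thetaF6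
  rcases m with _ | m <;> interval_cases a
  · simp; linear_combination 24 * F4 * FE ^ i * thetaF4
  · simp; linear_combination 24 * F6 * FE ^ i * thetaF6 + 36 * F4 ^ 2 * FE ^ i * thetaF4
  · simp; linear_combination 24 * (m+2) * F4 * F6 ^ (m + 1) * FE ^ i * thetaF4 + 18 * (m + 2) * (m + 1) * F4 ^ 2 * F6 ^ m * FE ^ i * thetaF6
  · simp; linear_combination 36 * (m+2) * F4 ^ 2 * F6 ^ (m + 1) * FE ^ i * thetaF4 + 18 * (m + 2) * (m + 1) * F4 ^ 3 * F6 ^ m * FE ^ i * thetaF6 + 12 * (m + 3) * F6 ^ (m + 2) * FE ^ i * thetaF6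
lemma hK_eq (a m i : ℕ) (ha : a ≤ 1) : 4 * hK a m i + F4 * hT a m i =
    (6 * m + 1 + 4 * a) ^ 2 * (F4 ^ (a + 1) * F6 ^ m * FE ^ i) - 144 * (m * (m - 1)) * (F4 ^ (a + 1) * F6 ^ (m - 2) * FE ^ (i + 1)) := by
  rw [hK, hT]
  have h := FE_eq
  rcases m with _ | m
  · interval_cases a <;> simp <;> ring
  rcases m with _ | m
  · interval_cases a <;> (simp; ring)
  interval_cases a
  · simp; linear_combination 36 * (m + 2) * (m + 1) * F4 * F6 ^ m * FE ^ i * h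
  · simp; linear_combination 36 * (m + 2) * (m + 1) * F4 ^ 2 * F6 ^ m * FE ^ i * h
lemma he_rec (N i : ℕ) : (i + 1) ^ 2 * (N.choose (2 * (i + 1)) * (2 * (i + 1)).choose (i + 1)) =
    (N - 2 * i) * (N - 2 * i - 1) * (N.choose (2 * i) * (2 * i).choose i) := by
  have h1 := Nat.choose_succ_right_eq N (2 * i)
  have h2 := Nat.choose_succ_right_eq N (2 * i + 1)
  have h3 := Nat.succ_mul_centralBinom_succ i
  rw [Nat.centralBinom, Nat.centralBinom] at h3
  have e : N - (2 * i + 1) = N - 2 * i - 1 := by omega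
  rw [e] at h2
  rw [show 2 * (i + 1) = 2 * i + 1 + 1 by ring] at *
  apply Nat.eq_of_mul_eq_mul_left (show 0 < 2 * (2 * i + 1) by positivity)
  generalize N - 2 * i - 1 = y at *
  generalize N - 2 * i = x at *
  zify at *
  generalize (N.choose (2*i+1+1) : ℤ) = A at *
  generalize (N.choose (2*i+1) : ℤ) = B at *
  generalize (N.choose (2*i) : ℤ) = D at *
  generalize ((2*i+1+1).choose (i+1) : ℤ) = U at *
  generalize ((2*i).choose i : ℤ) = W at *
  linear_combination (2 * (2 * i + 1) * (i + 1) * A) * h3 + 2 * (2*i+1)^2 * W * h2 + 2 * (2*i+1) * W * y * h1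
variable {p : ℕ}
def hN (n s : ℕ) : ℕ := 2 * n + s
def he (n s i : ℕ) : ℕ := (2 * n + s).choose (2 * i) * (2 * i).choose i
def hF (n s a : ℕ) : ℤ⟦X⟧ := ∑ i ∈ range (n + 1), (he n s i : ℤ⟦X⟧) * hT a (2 * n + s - 2 * i) i
lemma thetaZ_sum {ι : Type*} (t : Finset ι) (f : ι → ℤ⟦X⟧) : thetaZ (∑ i ∈ t, f i) = ∑ i ∈ t, thetaZ (f i) := by
  classical
  induction t using Finset.induction_on with
  | empty => ext; simp [thetaZ]
  | insert a s ha ih => rw [sum_insert ha, sum_insert ha, thetaZ_add, ih]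
lemma tele (n s a : ℕ) (hs : s ≤ 1) : ∑ i ∈ range (n + 1), (he n s i : ℤ⟦X⟧) * (i ^ 2 * (F4 ^ (a + 1) * F6 ^ (2 * n + s - 2 * i) * FE ^ i) -
    ((2 * n + s - 2 * i : ℕ) * ((2 * n + s - 2 * i : ℕ) - 1)) * (F4 ^ (a + 1) * F6 ^ (2 * n + s - 2 * i - 2) * FE ^ (i + 1))) = 0 := by
  have key : ∀ M ≤ n, ∑ i ∈ range (M + 1), (he n s i : ℤ⟦X⟧) * (i ^ 2 * (F4 ^ (a + 1) * F6 ^ (2 * n + s - 2 * i) * FE ^ i) -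
    ((2 * n + s - 2 * i : ℕ) * ((2 * n + s - 2 * i : ℕ) - 1)) * (F4 ^ (a + 1) * F6 ^ (2 * n + s - 2 * i - 2) * FE ^ (i + 1))) =
      - (he n s M * ((2 * n + s - 2 * M : ℕ) * ((2 * n + s - 2 * M : ℕ) - 1)) * (F4 ^ (a + 1) * F6 ^ (2 * n + s - 2 * M - 2) * FE ^ (M + 1))) := by
    intro M
    induction M with
    | zero => intro _; simp; ring
    | succ M ih =>
      intro hM
      rw [sum_range_succ, ih (by omega)]
      have h := he_rec (2 * n + s) M
      have h1 := congrArg (Nat.cast (R := ℤ⟦X⟧)) h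
      have e : 2 * n + s - 2 * (M + 1) = 2 * n + s - 2 * M - 2 := by omega
      have e2 : ((2 * n + s - 2 * M - 1 : ℕ) : ℤ⟦X⟧) = (2 * n + s - 2 * M : ℕ) - 1 := by
        rw [Nat.cast_sub (by omega), Nat.cast_one]
      rw [Nat.cast_mul, Nat.cast_mul ((2 * n + s - 2 * M) * (2 * n + s - 2 * M - 1)), Nat.cast_mul (2 * n + s - 2 * M), e2] at h1
      rw [e]
      change ((((M + 1) ^ 2 : ℕ) : ℤ⟦X⟧) * ((he n s (M + 1) : ℕ) : ℤ⟦X⟧) = _ * ((he n s M : ℕ) : ℤ⟦X⟧)) at h1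
      push_cast [Nat.cast_sub] at h1 ⊢
      linear_combination (F4 ^ (a + 1) * F6 ^ (2 * n + s - 2 * M - 2) * FE ^ (M + 1)) * h1
  rw [key n le_rfl]
  have : 2 * n + s - 2 * n = s := by omega
  rw [this]
  interval_cases s <;> simp
lemma theta2_hF {n s a : ℕ} (hs : s ≤ 1) (ha : a ≤ 1) (hp : p = 12 * n + 4 * a + 6 * s + 1) :
    ∃ H : ℤ⟦X⟧, 144 * thetaZ (thetaZ (hF n s a)) = p * H := by
  set G : ℤ⟦X⟧ := ∑ i ∈ range (n + 1), (he n s i : ℤ⟦X⟧) * hG a (2 * n + s - 2 * i) i with hGd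
  set K : ℤ⟦X⟧ := ∑ i ∈ range (n + 1), (he n s i : ℤ⟦X⟧) * hK a (2 * n + s - 2 * i) i with hKd
  have hm : ∀ i ∈ range (n + 1), (4 * a + 6 * (2 * n + s - 2 * i : ℕ) + 12 * i : ℤ⟦X⟧) = p - 1 := by
    intro i hi
    rw [mem_range] at hi
    rw [Nat.cast_sub (by omega), hp]; push_cast; ring
  have h1 : 12 * thetaZ (hF n s a) = (p - 1) * F2 * hF n s a - 2 * G := by
    rw [hF, thetaZ_sum, hGd, mul_sum, mul_sum, mul_sum, ← Finset.sum_sub_distrib]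
    refine sum_congr rfl fun i hi => ?_
    rw [thetaZ_nat, ← hm i hi]
    linear_combination (he n s i : ℤ⟦X⟧) * theta_hT a (2 * n + s - 2 * i) i ha
  have h2 : 12 * thetaZ G = (p + 1) * F2 * G - 2 * K := by
    rw [hGd, thetaZ_sum, hKd, mul_sum, mul_sum, mul_sum, ← Finset.sum_sub_distrib]
    refine sum_congr rfl fun i hi => ?_
    rw [thetaZ_nat]
    linear_combination (he n s i : ℤ⟦X⟧) * theta_hG a (2 * n + s - 2 * i) i ha + (he n s i : ℤ⟦X⟧) * F2 * hG a (2 * n + s - 2 * i) i * hm i hi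
  have h3 : ∃ L : ℤ⟦X⟧, 4 * K + F4 * hF n s a = p * L := by
    refine ⟨∑ i ∈ range (n + 1), (he n s i : ℤ⟦X⟧) * ((p - 24 * i) * (F4 ^ (a + 1) * F6 ^ (2 * n + s - 2 * i) * FE ^ i)), ?_⟩
    have ht := tele n s a hs
    rw [← sub_eq_zero, ← mul_zero (144 : ℤ⟦X⟧), ← ht]
    rw [hKd, hF, mul_sum, mul_sum, mul_sum, mul_sum, ← Finset.sum_add_distrib, ← Finset.sum_sub_distrib]
    refine sum_congr rfl fun i hi => ?_
    have hm' : (6 * (2 * n + s - 2 * i : ℕ) + 1 + 4 * a : ℤ⟦X⟧) = p - 12 * i := by linear_combination hm i hi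
    have := hK_eq a (2 * n + s - 2 * i) i ha
    rw [hm'] at this
    linear_combination (he n s i : ℤ⟦X⟧) * this
  obtain ⟨L, hL⟩ := h3
  have h4 := congrArg thetaZ h1
  have h5 : thetaZ (12 * thetaZ (hF n s a)) = 12 * thetaZ (thetaZ (hF n s a)) := mod_cast thetaZ_nat 12 _
  have h6 : thetaZ ((p - 1) * F2 * hF n s a - 2 * G) = (p - 1) * thetaZ (F2 * hF n s a) - 2 * thetaZ G := by
    rw [thetaZ_sub]
    have e1 : thetaZ (2 * G) = 2 * thetaZ G := mod_cast thetaZ_nat 2 _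
    have e2 : ((p : ℤ⟦X⟧) - 1) * F2 * hF n s a = (p : ℕ) * (F2 * hF n s a) - F2 * hF n s a := by ring
    rw [e1, e2, thetaZ_sub, thetaZ_nat]; ring
  rw [h5, h6, thetaZ_mul] at h4
  refine ⟨L - F4 * hF n s a + (p - 1) * F2 ^ 2 * hF n s a - 4 * F2 * G, ?_⟩
  linear_combination 12 * h4 + (p - 1) * F2 * h1 + (p - 1) * hF n s a * thetaF2 - 2 * h2 + hL
lemma FE0 : PowerSeries.constantCoeff FE = 0 := by
  have := FD0
  rw [coeff_zero_eq_constantCoeff_apply] at this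
  rw [FE, map_mul, this, mul_zero]
lemma hF0 (n s a : ℕ) : (hF n s a).coeff 0 = 1 := by
  have h4 := F40; have h6 := F60
  rw [coeff_zero_eq_constantCoeff_apply] at *
  rw [hF, map_sum, Finset.sum_eq_single 0]
  · simp [he, hT, h4, h6]
  · intro i _ hi; simp [hT, FE0, hi]
  · simp
lemma hF_coeff {n s a : ℕ} (hpp : p.Prime) (h5 : 5 ≤ p) (hs : s ≤ 1) (ha : a ≤ 1) (hp : p = 12 * n + 4 * a + 6 * s + 1) {k : ℕ} (h0 : 0 < k) (hk : k < p) :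
    (p : ℤ) ∣ (hF n s a).coeff k := by
  obtain ⟨H, hH⟩ := theta2_hF hs ha hp
  have h1 := congrArg (PowerSeries.coeff k) hH
  have e1 : (144 : ℤ⟦X⟧) = PowerSeries.C (144 : ℤ) := by simp
  have e2 : ((p : ℕ) : ℤ⟦X⟧) = PowerSeries.C (p : ℤ) := by simp
  rw [e1, e2, PowerSeries.coeff_C_mul, PowerSeries.coeff_C_mul] at h1
  simp only [thetaZ, PowerSeries.coeff_mk] at h1
  have hpi := Nat.prime_iff_prime_int.1 hpp
  have h2 : (p : ℤ) ∣ 144 * (k * (k * (hF n s a).coeff k)) := ⟨_, h1⟩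
  have hkk : ¬ (p : ℤ) ∣ k := by
    rw [Int.natCast_dvd_natCast]; exact Nat.not_dvd_of_pos_of_lt h0 hk
  have h144 : ¬ (p : ℤ) ∣ 144 := by
    intro h
    have h : p ∣ 144 := mod_cast h
    have h' : p ∣ 2 ^ 4 * 3 ^ 2 := by simpa using h
    rcases (Nat.Prime.dvd_mul hpp).1 h' with h | h
    · have := Nat.le_of_dvd (by norm_num) (hpp.dvd_of_dvd_pow h); omega
    · have := Nat.le_of_dvd (by norm_num) (hpp.dvd_of_dvd_pow h); omega
  have h3 := (hpi.dvd_or_dvd h2).resolve_left h144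
  have h4 := (hpi.dvd_or_dvd h3).resolve_left hkk
  exact (hpi.dvd_or_dvd h4).resolve_left hkk
end

def JZ (n s : ℕ) : ℤ[X] := ∑ i ∈ range (n + 1), C ((he n s i : ℤ) * (-432) ^ i) * (X - C 1728) ^ (n - i)
def BZ (n s a : ℕ) : ℤ[X] := X ^ (4 * a) * (X - C 1728) ^ (6 * s) * JZ n s ^ 12
def hff (n s a : ℕ) : ℍ → ℂ := fun τ => ∑ i ∈ range (n + 1), he n s i * (f4 τ ^ a * f6 τ ^ (2 * n + s - 2 * i) * (-432 * fD τ) ^ i)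
lemma HasQ.sum0 {ι : Type*} (t : Finset ι) {m : ℕ} (F : ι → ℂ⟦X⟧) (g : ι → ℍ → ℂ) (h : ∀ i ∈ t, HasQ m 0 (F i) (g i)) :
    HasQ m 0 (∑ i ∈ t, F i) (∑ i ∈ t, g i) := by
  classical
  induction t using Finset.induction_on with
  | empty => simpa using! HasQ.const m 0
  | insert a s ha ih =>
    rw [sum_insert ha, sum_insert ha]
    exact (h a (by simp)).add (ih fun i hi => h i (by simp [hi]))
lemma toC_nat (k : ℕ) : toC (k : ℤ⟦X⟧) = PowerSeries.C (k : ℂ) := by simp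
lemma hasQ_hff (n s a : ℕ) : HasQ 1 0 (toC (hF n s a)) (hff n s a) := by
  have hE : HasQ 1 0 (toC FE) (fun τ => -432 * fD τ) := by
    have := (HasQ.const 1 (-432)).mul hasQ_fD
    convert! this using 1
    rw [FE, map_mul]; congr 1
    rw [map_neg, map_neg, map_ofNat, map_ofNat]
  have h := HasQ.sum0 (range (n + 1)) (fun i => toC ((he n s i : ℤ⟦X⟧) * hT a (2 * n + s - 2 * i) i))
    (fun i τ => he n s i * (f4 τ ^ a * f6 τ ^ (2 * n + s - 2 * i) * (-432 * fD τ) ^ i)) (fun i _ => by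
      have h1 := (HasQ.const 1 (he n s i : ℂ)).mul (((hasQ_f4.pow a).mul (hasQ_f6.pow (2 * n + s - 2 * i))).mul (hE.pow i))
      simp only [mul_zero, add_zero] at h1
      rw [hT, map_mul, map_mul, map_mul, map_pow, map_pow, map_pow, toC_nat]
      exact h1)
  convert h using 1
  · rw [hF, map_sum]
  · ext τ; rw [hff, Finset.sum_apply]
lemma hff_eq {p n s a : ℕ} (hp : p = 12 * n + 4 * a + 6 * s + 1) (τ : ℍ) :
    hff n s a τ ^ 12 * (fD τ)⁻¹ ^ (p - 1) = ((BZ n s a).map (castRingHom ℂ)).eval (jf τ) := by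
  have hD := fD_ne τ
  have h4 : f4 τ ^ 3 = fD τ * jf τ := by rw [jf]; field_simp
  have h6 : f6 τ ^ 2 = fD τ * (jf τ - 1728) := by
    have := fD_eq τ
    linear_combination this + h4
  have hJ : hff n s a τ = f4 τ ^ a * f6 τ ^ s * (fD τ ^ n * ((JZ n s).map (castRingHom ℂ)).eval (jf τ)) := by
    rw [hff, JZ, Polynomial.map_sum, eval_finsetSum, mul_sum, mul_sum]
    refine sum_congr rfl fun i hi => ?_
    rw [mem_range] at hi
    have e : 2 * n + s - 2 * i = s + 2 * (n - i) := by omega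
    have e2 : fD τ ^ n = fD τ ^ i * fD τ ^ (n - i) := by rw [← pow_add]; congr 1; omega
    rw [e, pow_add, pow_mul (f6 τ) 2, h6, e2, mul_pow]
    simp
    ring
  rw [BZ, Polynomial.map_mul, Polynomial.map_mul, Polynomial.map_pow, Polynomial.map_pow, Polynomial.map_pow, eval_mul, eval_mul, eval_pow, eval_pow, eval_pow]
  generalize eval (jf τ) ((JZ n s).map (castRingHom ℂ)) = W at *
  rw [hJ]
  have e3 : p - 1 = 12 * n + (4 * a + 6 * s) := by omega
  have e4 : (f4 τ ^ a) ^ 12 = fD τ ^ (4 * a) * jf τ ^ (4 * a) := by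
    rw [← mul_pow, ← h4, ← pow_mul, ← pow_mul]; congr 1; ring
  have e6 : (f6 τ ^ s) ^ 12 = fD τ ^ (6 * s) * (jf τ - 1728) ^ (6 * s) := by
    rw [← mul_pow, ← h6, ← pow_mul, ← pow_mul]; congr 1; ring
  rw [mul_pow, mul_pow, e4, e6, e3, inv_pow, mul_pow, pow_add, pow_add, ← pow_mul, mul_comm n 12]
  simp
  field_simp
lemma hF_split {p n s a : ℕ} (hpp : p.Prime) (h5 : 5 ≤ p) (hs : s ≤ 1) (ha : a ≤ 1) (hp : p = 12 * n + 4 * a + 6 * s + 1) :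
    ∃ H1 H2 : ℤ⟦X⟧, hF n s a = 1 + PowerSeries.C (p : ℤ) * H1 + PowerSeries.X ^ p * H2 := by
  refine ⟨PowerSeries.mk fun k => if k = 0 then 0 else if k < p then (hF n s a).coeff k / p else 0, PowerSeries.mk fun k => (hF n s a).coeff (k + p), ?_⟩
  ext k
  rw [map_add, map_add, PowerSeries.coeff_C_mul, PowerSeries.coeff_X_pow_mul', PowerSeries.coeff_one, PowerSeries.coeff_mk, PowerSeries.coeff_mk]
  have := hpp.pos
  by_cases h0 : k = 0
  · subst h0; rw [hF0]; simp [this.ne']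
  · by_cases hk : k < p
    · have := Int.mul_ediv_cancel' (hF_coeff hpp h5 hs ha hp (by omega) hk)
      simp only [h0, hk, if_true, if_false, not_le.2 hk]; linarith
    · simp only [h0, hk, if_false, if_true, not_lt.1 hk]
      rw [Nat.sub_add_cancel (not_lt.1 hk)]; ring
lemma hF_low {p n s a : ℕ} (hpp : p.Prime) (h5 : 5 ≤ p) (hs : s ≤ 1) (ha : a ≤ 1) (hp : p = 12 * n + 4 * a + 6 * s + 1)
    (L : ℤ⟦X⟧) {k : ℕ} (hk : k < p) : (p : ℤ) ∣ (hF n s a ^ 12 * L - L).coeff k := by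
  obtain ⟨H1, H2, h⟩ := hF_split hpp h5 hs ha hp
  obtain ⟨S, hS⟩ : hF n s a - 1 ∣ hF n s a ^ 12 - 1 := sub_one_dvd_pow_sub_one _ _
  have e : hF n s a ^ 12 * L - L = PowerSeries.C (p : ℤ) * (H1 * S * L) + PowerSeries.X ^ p * (H2 * S * L) := by
    rw [h] at hS ⊢
    linear_combination L * hS
  rw [e, map_add, PowerSeries.coeff_C_mul, PowerSeries.coeff_X_pow_mul', if_neg (not_le.2 hk), add_zero]
  exact dvd_mul_right _ _
namespace PV
variable {p : ℕ} [hp : Fact p.Prime] (v : PV p)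
def piR : AddSubgroup ℂ := v.R.toAddSubgroup.map (AddMonoidHom.mulLeft v.pi)
lemma mem_piR {x : ℂ} : x ∈ v.piR ↔ ∃ c ∈ v.R, x = v.pi * c := by
  simp only [piR, AddSubgroup.mem_map]
  exact ⟨fun ⟨c, h1, h2⟩ => ⟨c, h1, h2.symm⟩, fun ⟨c, h1, h2⟩ => ⟨c, h1, h2.symm⟩⟩
lemma AQ_mq : ∃ h : v.QQ, ∀ τ, (v.aQ : ℍ → ℂ) τ - (fD τ)⁻¹ ^ (p - 1) = v.pi * (h : ℍ → ℂ) τ := by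
  have h1 : v.mq v.aQ = v.mq (v.at1 hasQ_fDi ^ (p - 1)) := by
    have e1 : v.AQ = v.at1 hasQ_fD * v.at' hasQ_fDi none := by
      apply Subtype.ext; funext τ; exact psi_none τ
    have e2 : v.at1 hasQ_fD * v.at1 hasQ_fDi ^ p = v.at1 hasQ_fDi ^ (p - 1) := by
      apply Subtype.ext; funext τ
      change fD τ * (fD τ)⁻¹ ^ p = (fD τ)⁻¹ ^ (p - 1)
      obtain ⟨k, hk⟩ : ∃ k, p = k + 1 := ⟨p - 1, by have := hp.out.pos; omega⟩
      rw [hk, Nat.add_sub_cancel, pow_succ]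
      have := fD_ne τ
      field_simp
    rw [aQ_mq, e1, map_mul, v.at_none hasQ_fDi, ← map_pow, ← map_mul, e2]
  exact v.mk_eq_iff.1 h1
theorem A_eq {n s a : ℕ} (h5 : 5 ≤ p) (hs : s ≤ 1) (ha : a ≤ 1) (hpe : p = 12 * n + 4 * a + 6 * s + 1) :
    v.A = (BZ n s a).map (castRingHom v.kk) := by
  obtain ⟨⟨h, n', H, hH, hhq⟩, hh⟩ := v.AQ_mq
  simp only at hh
  set L := FDi ^ (p - 1)
  have hL : HasQ 1 (p - 1) (toC L) (fun τ => (fD τ)⁻¹ ^ (p - 1)) := by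
    have := hasQ_fDi.pow (p - 1)
    rw [mul_one] at this
    rw [map_pow]; exact this
  have hB : HasQ 1 (p - 1) (toC (hF n s a ^ 12 * L - L)) (fun τ => hff n s a τ ^ 12 * (fD τ)⁻¹ ^ (p - 1) - (fD τ)⁻¹ ^ (p - 1)) := by
    have h1 := ((hasQ_hff n s a).pow 12).mul hL
    rw [mul_zero, zero_add] at h1
    have := h1.sub hL
    rw [map_sub, map_mul, map_pow]; exact this
  have hB' := (hasQ_1 (p := p) hB).shift n'
  have hh' := ((HasQ.const p v.pi).mul hhq).shift (p * (p - 1))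
  rw [zero_add, add_comm n'] at hh'
  have hg := hh'.sub hB'
  have hgv : ∀ τ, (v.aQ : ℍ → ℂ) τ - ((BZ n s a).map (castRingHom ℂ)).eval (jf τ) =
      v.pi * h τ - (hff n s a τ ^ 12 * (fD τ)⁻¹ ^ (p - 1) - (fD τ)⁻¹ ^ (p - 1)) := by
    intro τ; rw [← hh, hff_eq hpe]; ring
  obtain ⟨P, hP, -, -, hPv⟩ := q_principle' v.piR hp.out.pos hg (fun k hk => by
    rw [map_sub]
    refine sub_mem ?_ ?_
    · rw [PowerSeries.coeff_mul_X_pow']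
      split_ifs
      · rw [PowerSeries.coeff_C_mul]; exact v.mem_piR.2 ⟨_, hH _, rfl⟩
      · exact zero_mem _
    · rw [PowerSeries.coeff_mul_X_pow']
      split_ifs with hk'
      · rw [toC_coeff, PowerSeries.coeff_expand]
        split_ifs with hd
        · have hlt : (k - n') / p < p := by
            have hpp := hp.out.pos
            rw [Nat.div_lt_iff_lt_mul hpp]
            have : p * (p - 1) < p * p := Nat.mul_lt_mul_of_pos_left (by omega) hpp
            omega
          obtain ⟨c, hc⟩ := hF_low hp.out h5 hs ha hpe L hlt
          obtain ⟨e, he, hpe⟩ := v.p_eq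
          rw [hc]
          refine v.mem_piR.2 ⟨e * c, mul_mem he (intCast_mem _ _), ?_⟩
          push_cast; rw [hpe]; ring
        · simp
      · exact zero_mem _)
    (by
      intro γ τ
      have e1 := hgv (ofSL γ • τ); have e2 := hgv τ
      simp only [Pi.sub_apply, Pi.mul_apply]
      rw [← e1, ← e2, aQ_inv, jf_smul])
  have hpoly : v.A0.map (algebraMap v.V ℂ) - (BZ n s a).map (castRingHom ℂ) = P := by
    apply Polynomial.funext
    intro c
    obtain ⟨τ, rfl⟩ := jf_surj c
    rw [← hPv, eval_sub, ← A0_spec]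
    simp only [Pi.sub_apply, Pi.mul_apply]
    rw [hgv]
  ext k
  rw [A, coeff_map, coeff_map]
  have h1 := congrArg (fun P => P.coeff k) hpoly
  simp only [coeff_sub, coeff_map] at h1
  obtain ⟨c, hc, hk⟩ := v.mem_piR.1 (hP k)
  have h2 : (v.A0.coeff k : ℂ) = (((BZ n s a).coeff k : ℤ) : ℂ) + v.pi * c := by
    rw [← hk, ← h1]; simp
  have h3 : v.rd (v.A0.coeff k : ℂ) = v.rd (((BZ n s a).coeff k : ℤ) : ℂ) + v.rd (v.pi * c) := by
    rw [h2, v.rd_add (intCast_mem _ _) (mul_mem v.pi_mem hc)]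
  rw [v.rd_coe, v.rd_int, v.rd_pi_mul hc, add_zero] at h3
  simpa using h3
end PV

/-! ### j is injective modulo SL(2,ℤ) -/
lemma inj_near {f : ℂ → ℂ} {z f' : ℂ} (hf : HasStrictDerivAt f f' z) (h : f' ≠ 0) : ∃ U ∈ 𝓝 z, Set.InjOn f U := by
  have hf' := hf.hasStrictFDerivAt_equiv h
  refine ⟨_, hf'.eventually_left_inverse, fun x hx y hy hxy => ?_⟩
  have h1 : _ = x := hx
  have h2 : _ = y := hy
  rw [← h1, ← h2, hxy]
lemma j_an : AnalyticOnNhd ℂ (jf ∘ ofComplex) {z | 0 < z.im} :=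
  (hasQ_j.mdiff one_pos).analyticOnNhd (isOpen_lt continuous_const Complex.continuous_im)
lemma j_cont : Continuous jf := by
  have h : jf = (jf ∘ ofComplex) ∘ UpperHalfPlane.coe := by ext τ; simp
  rw [h]
  exact j_an.continuousOn.comp_continuous UpperHalfPlane.continuous_coe (fun τ => τ.im_pos)
lemma j_open : IsOpenMap jf := by
  intro W hW
  have h : jf '' W = (jf ∘ ofComplex) '' (UpperHalfPlane.coe '' W) := by
    rw [Set.image_image]; exact Set.image_congr fun τ _ => by simp
  rw [h]
  have hpre : IsPreconnected {z : ℂ | 0 < z.im} := (convex_halfSpace_im_gt 0).isPreconnected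
  rcases j_an.is_constant_or_isOpen hpre with ⟨w, hw⟩ | ho
  · exfalso
    obtain ⟨τ, hτ⟩ := jf_surj (w + 1)
    have := hw τ τ.im_pos
    simp [hτ] at this
  · refine ho _ ?_ (isOpenEmbedding_coe.isOpenMap W hW)
    rintro _ ⟨τ, _, rfl⟩; exact τ.im_pos
lemma j_inj_near {τ : ℍ} (h0 : jf τ ≠ 0) (h1 : jf τ ≠ 1728) : ∃ U ∈ 𝓝 τ, Set.InjOn jf U := by
  have hd := (j_an τ τ.im_pos).hasStrictDerivAt
  have h4 : f4 τ ≠ 0 := by intro h; apply h0; simp [jf, h]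
  have h6 : f6 τ ≠ 0 := by
    intro h; apply h1
    have := fD_eq τ
    have hD := fD_ne τ
    rw [jf, div_eq_iff hD, this, h]; ring
  rw [(j_deriv τ).deriv] at hd
  obtain ⟨U, hU, hi⟩ := inj_near hd (by
    have := Complex.two_pi_I_ne_zero
    have := fD_ne τ
    refine mul_ne_zero (neg_ne_zero.2 (by assumption)) (div_ne_zero (mul_ne_zero (pow_ne_zero _ h4) h6) this))
  refine ⟨UpperHalfPlane.coe ⁻¹' U, UpperHalfPlane.continuous_coe.continuousAt hU, fun x hx y hy hxy => ?_⟩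
  apply UpperHalfPlane.ext
  exact hi hx hy (by simpa using hxy)
lemma xq_eq {τ₁ τ₂ : ℍ} (h : xq 1 τ₁ = xq 1 τ₂) : ∃ γ : SL(2, ℤ), τ₁ = γ • τ₂ := by
  simp only [xq, Function.Periodic.qParam] at h
  obtain ⟨n, hn⟩ := Complex.exp_eq_exp_iff_exists_int.1 h
  refine ⟨ModularGroup.T ^ n, ?_⟩
  rw [UpperHalfPlane.modular_T_zpow_smul]
  apply UpperHalfPlane.ext
  have := Complex.two_pi_I_ne_zero
  push_cast at hn
  rw [UpperHalfPlane.coe_vadd]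
  push_cast
  apply mul_left_cancel₀ this
  linear_combination hn
lemma j_inj_inf : ∃ Y : ℝ, ∀ τ₁ τ₂ : ℍ, Y ≤ τ₁.im → Y ≤ τ₂.im → jf τ₁ = jf τ₂ → ∃ γ : SL(2, ℤ), τ₁ = γ • τ₂ := by
  have h0 : HasQ.S (toC Fj) 0 = 1 := by rw [HasQ.S_zero, toC_coeff, Fj0]; simp
  have hS := (hasQ_j.hasFP one_pos).hasFPowerSeriesAt.analyticAt
  have hd : HasStrictDerivAt (fun z => z / HasQ.S (toC Fj) z) 1 0 := by
    have := (hasStrictDerivAt_id (0 : ℂ)).div hS.hasStrictDerivAt (by rw [h0]; exact one_ne_zero)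
    convert! this using 1
    rw [h0]; simp
  obtain ⟨U, hU, hi⟩ := inj_near hd one_ne_zero
  have h1 : ∀ᶠ τ in atImInfty, xq 1 τ ∈ U := (xq_tendsto one_pos) hU
  obtain ⟨Y, hY⟩ := (UpperHalfPlane.atImInfty_mem _).1 h1
  refine ⟨Y, fun τ₁ τ₂ h1 h2 hj => ?_⟩
  have e : ∀ τ, xq 1 τ / HasQ.S (toC Fj) (xq 1 τ) = (jf τ)⁻¹ := by
    intro τ
    rw [← hasQ_j.eq_S τ, pow_one]
    have := xq_ne 1 τ
    rw [div_mul_eq_div_div, div_self this, one_div]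
  exact xq_eq (hi (hY _ h1) (hY _ h2) (by simp only [e, hj]))
lemma j_proper (B : ℝ) : ∃ Y : ℝ, ∀ τ : ℍ, Y ≤ τ.im → B < ‖jf τ‖ := by
  have h1 := (hasQ_j.tendsto one_pos).norm
  rw [toC_coeff, Fj0] at h1
  have h2 := (xq_tendsto one_pos).norm
  rw [norm_zero] at h2
  have e1 := h1.eventually (lt_mem_nhds (show (1/2 : ℝ) < ‖((1 : ℤ) : ℂ)‖ by norm_num))
  have e2 := h2.eventually (gt_mem_nhds (show (0 : ℝ) < 1 / (2 * (|B| + 1)) by positivity))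
  obtain ⟨Y, hY⟩ := (UpperHalfPlane.atImInfty_mem _).1 (e1.and e2)
  refine ⟨Y, fun τ hτ => ?_⟩
  obtain ⟨a, b⟩ := hY τ hτ
  rw [pow_one, norm_mul] at a
  have hp : 0 < |B| + 1 := by positivity
  rw [lt_div_iff₀ (by positivity)] at b
  by_contra hlt
  rw [not_lt] at hlt
  have : ‖xq 1 τ‖ * ‖jf τ‖ ≤ ‖xq 1 τ‖ * (|B| + 1) := by
    gcongr; linarith [le_abs_self B]
  linarith
lemma j_compact (B : ℝ) : ∃ K : Set ℍ, IsCompact K ∧ ∀ τ, ‖jf τ‖ ≤ B → ∃ γ : SL(2, ℤ), γ • τ ∈ K := by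
  obtain ⟨Y, hY⟩ := j_proper B
  refine ⟨_, ModularGroup.isCompact_truncatedFundamentalDomain Y, fun τ hτ => ?_⟩
  obtain ⟨γ, hγ⟩ := ModularGroup.exists_smul_mem_fd τ
  refine ⟨γ, hγ, ?_⟩
  by_contra h
  have := hY (γ • τ) (le_of_not_ge h)
  rw [← ofSL_smul, jf_smul] at this
  linarith
abbrev YY := Quotient (MulAction.orbitRel 𝒮ℒ ℍ)
def yq (τ : ℍ) : YY := Quotient.mk _ τ
lemma yq_eq {τ₁ τ₂ : ℍ} : yq τ₁ = yq τ₂ ↔ ∃ γ : SL(2, ℤ), τ₁ = γ • τ₂ := by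
  unfold yq
  rw [Quotient.eq, MulAction.orbitRel_apply, MulAction.mem_orbit_iff]
  constructor
  · rintro ⟨⟨_, γ, rfl⟩, h⟩
    exact ⟨γ, h.symm⟩
  · rintro ⟨γ, h⟩
    exact ⟨⟨_, γ, rfl⟩, h.symm⟩
theorem j_inj {τ₁ τ₂ : ℍ} (h : jf τ₁ = jf τ₂) : ∃ γ : SL(2, ℤ), τ₁ = γ • τ₂ := by
  set S : Set ℂ := {c | ∃ τ₁ τ₂, jf τ₁ = c ∧ jf τ₂ = c ∧ yq τ₁ ≠ yq τ₂} with hSd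
  have hoq : IsOpenMap yq := MulAction.isOpenQuotientMap_quotientMk.isOpenMap
  have hcq : Continuous yq := continuous_quot_mk
  have hinv : ∀ {τ₁ τ₂}, yq τ₁ = yq τ₂ → jf τ₁ = jf τ₂ := by
    intro τ₁ τ₂ h
    obtain ⟨γ, rfl⟩ := yq_eq.1 h
    rw [← ofSL_smul, jf_smul]
  have hSo : IsOpen S := by
    rw [isOpen_iff_mem_nhds]
    rintro c ⟨a, b, ha, hb, hne⟩
    obtain ⟨U, V, hU, hV, haU, hbV, hd⟩ := t2_separation hne
    have h1 : jf '' (yq ⁻¹' U) ∈ 𝓝 c := (j_open _ (hU.preimage hcq)).mem_nhds ⟨a, haU, ha⟩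
    have h2 : jf '' (yq ⁻¹' V) ∈ 𝓝 c := (j_open _ (hV.preimage hcq)).mem_nhds ⟨b, hbV, hb⟩
    filter_upwards [h1, h2]
    rintro z ⟨x, hx, rfl⟩ ⟨y, hy, hxy⟩
    exact ⟨x, y, rfl, hxy, fun e => hd.ne_of_mem hx hy e⟩
  set T : Set ℂ := {0, 1728}ᶜ with hT
  have hTc : IsConnected T := Set.Countable.isConnected_compl_of_one_lt_rank (by simp) (Set.toFinite _).countable
  have hN : ∀ c ∈ T, c ∉ S → Sᶜ ∈ 𝓝 c := by
    intro c hc hcS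
    obtain ⟨τ, hτ⟩ := jf_surj c
    simp only [hT, Set.mem_compl_iff, Set.mem_insert_iff, Set.mem_singleton_iff, not_or] at hc
    obtain ⟨W, hW, hi⟩ := j_inj_near (τ := τ) (hτ ▸ hc.1) (hτ ▸ hc.2)
    obtain ⟨W', hW', hWo, hτW⟩ := mem_nhds_iff.1 hW
    obtain ⟨K, hK, hKm⟩ := j_compact (‖c‖ + 1)
    have hKc : IsCompact (K \ yq ⁻¹' (yq '' W')) := hK.diff ((hoq _ hWo).preimage hcq)
    have hcl : IsClosed (jf '' (K \ yq ⁻¹' (yq '' W'))) := (hKc.image j_cont).isClosed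
    have hcn : c ∉ jf '' (K \ yq ⁻¹' (yq '' W')) := by
      rintro ⟨x, ⟨_, hx⟩, hxc⟩
      apply hx
      refine ⟨τ, hτW, ?_⟩
      by_contra hne
      exact hcS ⟨τ, x, hτ, hxc, hne⟩
    have hb : Metric.ball c 1 ∈ 𝓝 c := Metric.ball_mem_nhds _ one_pos
    filter_upwards [hcl.isOpen_compl.mem_nhds hcn, hb]
    rintro z hz hzb ⟨a, b, ha, hb', hne⟩
    have hzn : ‖z‖ ≤ ‖c‖ + 1 := by
      rw [Metric.mem_ball, dist_eq_norm] at hzb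
      have := norm_sub_norm_le z c
      linarith
    have key : ∀ a, jf a = z → ∃ w ∈ W', yq w = yq a := by
      intro a ha
      obtain ⟨γ, hγ⟩ := hKm a (ha ▸ hzn)
      by_contra hno
      apply hz
      refine ⟨γ • a, ⟨hγ, ?_⟩, ?_⟩
      · rintro ⟨w, hw, hwe⟩
        exact hno ⟨w, hw, hwe.trans (yq_eq.2 ⟨γ, rfl⟩)⟩
      · rw [← ofSL_smul, jf_smul, ha]
    obtain ⟨w, hw, e1⟩ := key a ha
    obtain ⟨w', hw', e2⟩ := key b hb'
    apply hne
    rw [← e1, ← e2, hi (hW' hw) (hW' hw') (by rw [hinv e1, hinv e2, ha, hb'])]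
  have hST : T ∩ S = ∅ := by
    by_contra hne
    have hsub : T ⊆ S := by
      refine hTc.isPreconnected.subset_left_of_subset_union hSo (v := interior Sᶜ) isOpen_interior ?_ ?_ ?_
      · exact Set.disjoint_left.2 fun x hx hx' => (interior_subset hx') hx
      · intro c hc
        by_cases h : c ∈ S
        · exact Or.inl h
        · exact Or.inr (mem_interior_iff_mem_nhds.2 (hN c hc h))
      · exact Set.nonempty_iff_ne_empty.2 hne
    obtain ⟨Y, hY⟩ := j_inj_inf
    obtain ⟨B, hB⟩ : ∃ B : ℝ, ∀ τ ∈ ModularGroup.truncatedFundamentalDomain Y, ‖jf τ‖ ≤ B := by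
      obtain ⟨B, hB⟩ := ((ModularGroup.isCompact_truncatedFundamentalDomain Y).image j_cont).isBounded.exists_norm_le
      exact ⟨B, fun τ hτ => hB _ ⟨τ, hτ, rfl⟩⟩
    have hbig : ((|B| + 2000 : ℝ) : ℂ) ∈ T := by
      simp only [hT, Set.mem_compl_iff, Set.mem_insert_iff, Set.mem_singleton_iff, not_or]
      have := abs_nonneg B
      constructor
      · intro h; have : |B| + 2000 = 0 := mod_cast h
        linarith
      · intro h; have : |B| + 2000 = 1728 := mod_cast h
        linarith
    obtain ⟨a, b, ha, hb, hne⟩ := hsub hbig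
    have key : ∀ a, jf a = ((|B| + 2000 : ℝ) : ℂ) → ∃ γ : SL(2, ℤ), Y ≤ (γ • a).im := by
      intro a ha
      obtain ⟨γ, hγ⟩ := ModularGroup.exists_smul_mem_fd a
      refine ⟨γ, ?_⟩
      by_contra hlt
      have := hB (γ • a) ⟨hγ, le_of_not_ge hlt⟩
      rw [← ofSL_smul, jf_smul, ha, Complex.norm_real, Real.norm_eq_abs, abs_of_nonneg (by positivity)] at this
      linarith [le_abs_self B]
    obtain ⟨γ, hγ⟩ := key a ha
    obtain ⟨γ', hγ'⟩ := key b hb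
    have := yq_eq.2 (hY _ _ hγ hγ' (by rw [← ofSL_smul, ← ofSL_smul, jf_smul, jf_smul, ha, hb]))
    apply hne
    rw [← yq_eq.2 ⟨γ, rfl⟩, this, yq_eq.2 ⟨γ', rfl⟩]
  rw [← yq_eq]
  by_contra hne
  have hc : jf τ₁ ∈ S := ⟨τ₁, τ₂, rfl, h.symm, hne⟩
  have hdense : Dense T := Set.Countable.dense_compl ℂ (Set.toFinite _).countable
  obtain ⟨x, hx⟩ := hdense.inter_open_nonempty S hSo ⟨_, hc⟩
  have : x ∈ T ∩ S := ⟨hx.2, hx.1⟩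
  rw [hST] at this
  exact this

/-! ### truncated q-expansions -/
/-- power series of a list -/
def PL : List ℤ → ℤ⟦X⟧
  | [] => 0
  | a :: l => PowerSeries.C a + PowerSeries.X * PL l
def ladd : List ℤ → List ℤ → List ℤ
  | [], m => m
  | l, [] => l
  | a :: l, b :: m => (a + b) :: ladd l m
def lsm (c : ℤ) (l : List ℤ) : List ℤ := l.map fun a => c * a
def lmul : List ℤ → List ℤ → List ℤ
  | [], _ => []
  | a :: l, m => ladd (lsm a m) (0 :: lmul l m)
def lsh (k : ℕ) (l : List ℤ) : List ℤ := List.replicate k 0 ++ l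
lemma PL_add (l m : List ℤ) : PL (ladd l m) = PL l + PL m := by
  induction l, m using ladd.induct with
  | case1 m => simp [ladd, PL]
  | case2 l h => cases l <;> simp [ladd, PL]
  | case3 a l b m ih => simp only [ladd, PL, ih, map_add]; ring
lemma PL_sm (c : ℤ) (l : List ℤ) : PL (lsm c l) = PowerSeries.C c * PL l := by
  induction l with
  | nil => simp [lsm, PL]
  | cons a l ih => simp only [lsm, List.map_cons, PL, map_mul] at ih ⊢; rw [ih]; ring
lemma PL_mul (l m : List ℤ) : PL (lmul l m) = PL l * PL m := by
  induction l with
  | nil => simp [lmul, PL]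
  | cons a l ih => simp only [lmul, PL_add, PL_sm, PL, ih, map_zero]; ring
lemma PL_sh (k : ℕ) (l : List ℤ) : PL (lsh k l) = PowerSeries.X ^ k * PL l := by
  induction k with
  | zero => simp [lsh]
  | succ k ih => simp only [lsh, List.replicate_succ, List.cons_append, PL, map_zero] at ih ⊢; rw [ih]; ring
lemma PL_take (n : ℕ) (l : List ℤ) : PowerSeries.X ^ n ∣ PL l - PL (l.take n) := by
  induction n generalizing l with
  | zero => simp
  | succ n ih =>
    cases l with
    | nil => simp
    | cons a l =>
      simp only [List.take_succ_cons, PL]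
      rw [show PowerSeries.C a + PowerSeries.X * PL l - (PowerSeries.C a + PowerSeries.X * PL (l.take n)) = PowerSeries.X * (PL l - PL (l.take n)) by ring, pow_succ']
      exact mul_dvd_mul_left _ (ih l)
lemma PL_coeff (k : ℕ) (l : List ℤ) : (PL l).coeff k = l.getD k 0 := by
  induction l generalizing k with
  | nil => simp [PL]
  | cons a l ih =>
    cases k with
    | zero => simp [PL]
    | succ k =>
      rw [PL, map_add, PowerSeries.coeff_succ_X_mul, ih, PowerSeries.coeff_C, if_neg (Nat.succ_ne_zero k), zero_add, List.getD_cons_succ]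
/-- `l` is the truncation of `F` to order `n` -/
def Tr (n : ℕ) (l : List ℤ) (F : ℤ⟦X⟧) : Prop := PowerSeries.X ^ n ∣ F - PL l
namespace Tr
variable {n : ℕ} {l m : List ℤ} {F G : ℤ⟦X⟧}
lemma add (h : Tr n l F) (h' : Tr n m G) : Tr n (ladd l m) (F + G) := by
  unfold Tr at *; rw [PL_add, show F + G - (PL l + PL m) = (F - PL l) + (G - PL m) by ring]; exact dvd_add h h'
lemma mul (h : Tr n l F) (h' : Tr n m G) : Tr n ((lmul l m).take n) (F * G) := by
  unfold Tr at *
  have := PL_take n (lmul l m)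
  rw [PL_mul] at this
  rw [show F * G - PL ((lmul l m).take n) = (F - PL l) * G + PL l * (G - PL m) + (PL l * PL m - PL ((lmul l m).take n)) by ring]
  exact dvd_add (dvd_add (h.mul_right _) (h'.mul_left _)) this
lemma sm (c : ℤ) (h : Tr n l F) : Tr n (lsm c l) (PowerSeries.C c * F) := by
  unfold Tr at *; rw [PL_sm, ← mul_sub]; exact h.mul_left _
lemma sh (k : ℕ) (h : Tr n l F) : Tr n (lsh k l) (PowerSeries.X ^ k * F) := by
  unfold Tr at *; rw [PL_sh, ← mul_sub]; exact h.mul_left _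
lemma tk (h : Tr n l F) : Tr n (l.take n) F := by
  unfold Tr at *; rw [show F - PL (l.take n) = (F - PL l) + (PL l - PL (l.take n)) by ring]; exact dvd_add h (PL_take n l)
lemma eq (h : Tr n l F) (e : l = m) : Tr n m F := e ▸ h
lemma of_coeff (h : ∀ k < n, F.coeff k = l.getD k 0) : Tr n l F := by
  rw [Tr, PowerSeries.X_pow_dvd_iff]; intro k hk; rw [map_sub, PL_coeff, h k hk, sub_self]
lemma coeff (h : Tr n l F) {k : ℕ} (hk : k < n) : F.coeff k = l.getD k 0 := by
  rw [Tr, PowerSeries.X_pow_dvd_iff] at h; have := h k hk; rw [map_sub, PL_coeff] at this; linarith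
end Tr
def l4 : List ℤ := [1, 240, 2160, 6720, 17520, 30240, 60480, 82560, 140400, 181680, 272160, 319680, 490560, 527520, 743040, 846720, 1123440, 1179360, 1635120, 1646400, 2207520, 2311680, 2877120, 2920320, 3931200, 3780240, 4747680, 4905600, 6026880, 5853600, 7620480, 7150080]
def l6 : List ℤ := [1, -504, -16632, -122976, -532728, -1575504, -4058208, -8471232, -17047800, -29883672, -51991632, -81170208, -129985632, -187132176, -279550656, -384422976, -545530104, -715608432, -986161176, -1247954400, -1665307728, -2066980608, -2678616864, -3243917376, -4159663200, -4923450504, -6175361808, -7261732800, -8954092224, -10337619600, -12685958208, -14429092608]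
def lD : List ℤ := [1, -24, 252, -1472, 4830, -6048, -16744, 84480, -113643, -115920, 534612, -370944, -577738, 401856, 1217160, 987136, -6905934, 2727432, 10661420, -7109760, -4219488, -12830688, 18643272, 21288960, -25499225, 13865712, -73279080, 24647168, 128406630, -29211840, -52843168]
def lj : List ℤ := [1, 744, 196884, 21493760, 864299970, 20245856256, 333202640600, 4252023300096, 44656994071935, 401490886656000, 3176440229784420, 22567393309593600, 146211911499519294, 874313719685775360, 4872010111798142520, 25497827389410525184, 126142916465781843075, 593121772421445058560, 2662842413150775245160, 11459912788444786513920, 47438786801234168813250, 189449976248893390028800, 731811377318137519245696, 2740630712513624654929920, 9971041659937182693533820, 35307453186561427099877376, 121883284330422510433351500, 410789960190307909157638144, 1353563541518646878675077500, 4365689224858876634610401280, 13798375834642999925542288376]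
def lu : List ℤ := [-1, 0, 0, 0, -1, -1488, -196884, -21493760, -864299970, -20245856256, -333202837484, -4252023300096, -44656994071935, -401490886656000, -3176440229784420, -22567393331087360, -146211911499519294, -874313719685775360, -4872010111798142520, -25497827389410525184, -126142916466646143045, -593121772421445058560, -2662842413150775245160, -11459912788444786513920, -47438786801234168813250, -189449976248913635885056, -731811377318137519245696, -2740630712513624654929920, -9971041659937182693533820, -35307453186561427099877376, -121883284330422843635992100]
def lv1 : List ℤ := [1, 744, 196884, 21493760, 864299970, 20245857000, 333203194136, 4252169781792, 44672985429375, 402133925833680, 3191503147035768, 22815296220681696, 149375455598100174, 907542755052738840, 5170889498305500000, 27865085005554733728, 142998659372802729315, 702740594164280958000, 3322124530199569901140, 15163754020407107640000, 67034995796732700559956, 287750626542032569452680, 1201972154121857506188672, 4894883715574375350120000, 19465067909165778760358880, 75690315956862656643449808, 288154934747717532960529464, 1075180130718934717643471872, 3935694744028990425272077530, 14145482531412651359262296160, 49957849095538311489387266496]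
def lv2 : List ℤ := (lmul lv1 lv1).take 31
def lv3 : List ℤ := (lmul lv2 lv1).take 31
def lv4 : List ℤ := (lmul lv3 lv1).take 31
def lv5 : List ℤ := (lmul lv4 lv1).take 31
lemma tr_F4 : Tr 32 l4 F4 := by
  refine Tr.of_coeff fun k hk => ?_
  have : F4.coeff k = (if k = 0 then 1 else 0) + 240 * (σ 3 k : ℤ) := by
    rw [F4, show (240 : ℤ⟦X⟧) = PowerSeries.C 240 by simp, map_add, PowerSeries.coeff_C_mul, sA, PowerSeries.coeff_mk, PowerSeries.coeff_one]
  rw [this]; clear this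
  revert k; decide +kernel
lemma tr_F6 : Tr 32 l6 F6 := by
  refine Tr.of_coeff fun k hk => ?_
  have : F6.coeff k = (if k = 0 then 1 else 0) - 504 * (σ 5 k : ℤ) := by
    rw [F6, show (504 : ℤ⟦X⟧) = PowerSeries.C 504 by simp, map_sub, PowerSeries.coeff_C_mul, sB, PowerSeries.coeff_mk, PowerSeries.coeff_one]
  rw [this]; clear this
  revert k; decide +kernel
lemma tr_D : Tr 31 lD FD' := by
  have h : Tr 32 (lsm 1728 (lsh 1 lD)) (PowerSeries.C 1728 * (PowerSeries.X ^ 1 * FD')) := by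
    have := ((((tr_F4.mul tr_F4).mul tr_F4).add ((tr_F6.mul tr_F6).sm (-1))).tk).eq (m := lsm 1728 (lsh 1 lD)) (by decide +kernel)
    convert! this using 1
    have := FD_mul
    rw [FD_eq, show (1728 : ℤ⟦X⟧) = PowerSeries.C 1728 by simp] at this
    rw [pow_one, this]; simp; ring
  refine Tr.of_coeff fun k hk => ?_
  have := h.coeff (k := k + 1) (by omega)
  rw [← PL_coeff, PL_sm, PL_sh, PowerSeries.coeff_C_mul, PowerSeries.coeff_C_mul, pow_one, PowerSeries.coeff_succ_X_mul, PowerSeries.coeff_succ_X_mul, PL_coeff] at this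
  linarith
lemma tr_j : Tr 31 lj Fj := by
  have h1 := ((tr_F4.mul tr_F4).mul tr_F4)
  have h2 : Tr 31 ((lmul lD lj).take 31) (F4 * F4 * F4) := by
    have : ((lmul lD lj).take 31) = ((List.take 32 (lmul (List.take 32 (lmul l4 l4)) l4)).take 31) := by decide +kernel
    rw [this]
    exact Tr.tk ((pow_dvd_pow _ (by norm_num)).trans h1)
  have h3 : PowerSeries.X ^ 31 ∣ FD' * (Fj - PL lj) := by
    have e : FD' * Fj = F4 * F4 * F4 := by rw [Fj]; linear_combination F4 ^ 3 * FDi_mul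
    have h4 : PowerSeries.X ^ 31 ∣ FD' * PL lj - PL ((lmul lD lj).take 31) := tr_D.mul (m := lj) (G := PL lj) (by simp [Tr])
    have := dvd_sub h2 h4
    rw [← e] at this
    convert! this using 1; ring
  have := h3.mul_left FDi
  rwa [← mul_assoc, mul_comm FDi, FDi_mul, one_mul] at this
def Fx : ℤ⟦X⟧ := PowerSeries.expand 5 (by norm_num) Fj
def Fu : ℤ⟦X⟧ := -(Fx + PowerSeries.X ^ 4 * Fj)
def Fv : ℤ⟦X⟧ := Fx * Fj
lemma tr_x : Tr 31 ((List.range 31).map fun k => if k % 5 = 0 then lj.getD (k / 5) 0 else 0) Fx := by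
  refine Tr.of_coeff fun k hk => ?_
  rw [Fx, PowerSeries.coeff_expand]
  have e : ∀ i < 31, ((List.range 31).map fun k => if k % 5 = 0 then lj.getD (k / 5) 0 else 0).getD i 0 = if i % 5 = 0 then lj.getD (i / 5) 0 else 0 := by decide +kernel
  rw [e k hk]
  simp only [Nat.dvd_iff_mod_eq_zero]
  split_ifs
  · exact tr_j.coeff (by omega)
  · rfl
lemma tr_u : Tr 31 lu Fu := by
  have := ((tr_x.add (tr_j.sh 4)).sm (-1)).tk.eq (m := lu) (by decide +kernel)
  convert! this using 1
  simp [Fu]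
lemma tr_v1 : Tr 31 lv1 Fv := (tr_x.mul tr_j).eq (by decide +kernel)
lemma tr_v2 : Tr 31 lv2 (Fv * Fv) := tr_v1.mul tr_v1
lemma tr_v3 : Tr 31 lv3 (Fv * Fv * Fv) := tr_v2.mul tr_v1
lemma tr_v4 : Tr 31 lv4 (Fv * Fv * Fv * Fv) := tr_v3.mul tr_v1
lemma tr_v5 : Tr 31 lv5 (Fv * Fv * Fv * Fv * Fv) := tr_v4.mul tr_v1
lemma tr_v0 : Tr 31 [1] (1 : ℤ⟦X⟧) := by simp [Tr, PL]
/-- homogenised `Q5` -/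
def Qh {R : Type*} [CommRing R] (u v x : R) : R :=
  (1) * u ^ 6
  + (-1963211489280) * u ^ 5 * x ^ 5
  + (-246683410956) * u ^ 4 * v ^ 1 * x ^ 4 + (1284733132841424456253440) * u ^ 4 * x ^ 10
  + (-2028551200) * u ^ 3 * v ^ 2 * x ^ 3 + (-128541798897012758937600) * u ^ 3 * v ^ 1 * x ^ 9 + (-280244777828439527804321565297868800) * u ^ 3 * x ^ 15
  + (-4550940) * u ^ 2 * v ^ 3 * x ^ 2 + (383083610766544859184) * u ^ 2 * v ^ 2 * x ^ 8 + (-192457939757860831020806056181760) * u ^ 2 * v ^ 1 * x ^ 14 + (6692500042627997708487149415015068467200) * u ^ 2 * x ^ 20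
  + (-3720) * u ^ 1 * v ^ 4 * x ^ 1 + (-107878922099683200) * u ^ 1 * v ^ 3 * x ^ 7 + (-26898103232984020907026022400) * u ^ 1 * v ^ 2 * x ^ 13 + (-35714002250464310712293507636763033600) * u ^ 1 * v ^ 1 * x ^ 19 + (-53274330803424425450420160273356509151232000) * u ^ 1 * x ^ 25
  + (-1) * v ^ 5 + (1666008466480) * v ^ 4 * x ^ 6 + (-441973132732967824498752) * v ^ 3 * x ^ 12 + (5495857649359740948103830574202880) * v ^ 2 * x ^ 18 + (-277458457161876591676690089078008919883776) * v ^ 1 * x ^ 24 + (141359947154721358697753474691071362751004672000) * x ^ 30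
lemma Qh_eq {R : Type*} [CommRing R] (u v x : R) : Qh (x ^ 5 * u) (x ^ 6 * v) x = x ^ 30 * Q5 u v := by
  unfold Qh Q5; ring
lemma map_Qh {R R' : Type*} [CommRing R] [CommRing R'] (f : R →+* R') (u v x : R) : f (Qh u v x) = Qh (f u) (f v) (f x) := by
  simp only [Qh, map_add, map_mul, map_pow, map_neg, map_ofNat, map_one]
lemma map_Q5 {R R' : Type*} [CommRing R] [CommRing R'] (f : R →+* R') (u v : R) : f (Q5 u v) = Q5 (f u) (f v) := by
  simp only [Q5, map_add, map_sub, map_mul, map_pow, map_neg, map_ofNat]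
lemma Qh_zero : ∀ k < 31, (Qh Fu Fv PowerSeries.X).coeff k = 0 := by
  have h := ((((((((((((((((((((((((((((((tr_v0.sm 1).mul tr_u).add ((tr_v0.sh 5).sm (-1963211489280))).tk.mul tr_u).add ((tr_v1.sh 4).sm (-246683410956))).add ((tr_v0.sh 10).sm (1284733132841424456253440))).tk.mul tr_u).add ((tr_v2.sh 3).sm (-2028551200))).add ((tr_v1.sh 9).sm (-128541798897012758937600))).add ((tr_v0.sh 15).sm (-280244777828439527804321565297868800))).tk.mul tr_u).add ((tr_v3.sh 2).sm (-4550940))).add ((tr_v2.sh 8).sm (383083610766544859184))).add ((tr_v1.sh 14).sm (-192457939757860831020806056181760))).add ((tr_v0.sh 20).sm (6692500042627997708487149415015068467200))).tk.mul tr_u).add ((tr_v4.sh 1).sm (-3720))).add ((tr_v3.sh 7).sm (-107878922099683200))).add ((tr_v2.sh 13).sm (-26898103232984020907026022400))).add ((tr_v1.sh 19).sm (-35714002250464310712293507636763033600))).add ((tr_v0.sh 25).sm (-53274330803424425450420160273356509151232000))).tk.mul tr_u).add ((tr_v5.sh 0).sm (-1))).add ((tr_v4.sh 6).sm (1666008466480))).add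 ((tr_v3.sh 12).sm (-441973132732967824498752))).add ((tr_v2.sh 18).sm (5495857649359740948103830574202880))).add ((tr_v1.sh 24).sm (-277458457161876591676690089078008919883776))).add ((tr_v0.sh 30).sm (141359947154721358697753474691071362751004672000))).tk)).eq (m := List.replicate 31 0) (by decide +kernel)
  intro k hk
  have e := h.coeff hk
  have e2 : ∀ i < 31, (List.replicate 31 (0 : ℤ)).getD i 0 = 0 := by decide +kernel
  rw [e2 k hk] at e
  convert! e using 2
  simp only [Qh, map_neg, map_ofNat, map_one]
  ring

/-! ### the modular polynomial of level 5 -/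
def Phi {R : Type*} [CommRing R] (x y : R) : R := Q5 (-(x + y)) (x * y)
lemma Phi_symm {R : Type*} [CommRing R] (x y : R) : Phi x y = Phi y x := by
  unfold Phi; rw [add_comm, mul_comm]
lemma map_Phi {R R' : Type*} [CommRing R] [CommRing R'] (f : R →+* R') (x y : R) : f (Phi x y) = Phi (f x) (f y) := by
  unfold Phi; rw [map_Q5, map_neg, map_add, map_mul]
def cy0 {R : Type*} [CommRing R] (y : R) : R := (141359947154721358697753474691071362751004672000) * y ^ 0 + (53274330803424425450420160273356509151232000) * y ^ 1 + (6692500042627997708487149415015068467200) * y ^ 2 + (280244777828439527804321565297868800) * y ^ 3 + (1284733132841424456253440) * y ^ 4 + (1963211489280) * y ^ 5 + (1) * y ^ 6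
def cy1 {R : Type*} [CommRing R] (y : R) : R := (53274330803424425450420160273356509151232000) * y ^ 0 + (-264073457076620596259715790247978782949376) * y ^ 1 + (36554736583949629295706472332656640000) * y ^ 2 + (-192457934618928299655108231168000) * y ^ 3 + (128541798906828816384000) * y ^ 4 + (-246683410950) * y ^ 5
def cy2 {R : Type*} [CommRing R] (y : R) : R := (6692500042627997708487149415015068467200) * y ^ 0 + (36554736583949629295706472332656640000) * y ^ 1 + (5110941777552418083110765199360000) * y ^ 2 + (26898488858380731577417728000) * y ^ 3 + (383083609779811215375) * y ^ 4 + (2028551200) * y ^ 5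
def cy3 {R : Type*} [CommRing R] (y : R) : R := (280244777828439527804321565297868800) * y ^ 0 + (-192457934618928299655108231168000) * y ^ 1 + (26898488858380731577417728000) * y ^ 2 + (-441206965512914835246100) * y ^ 3 + (107878928185336800) * y ^ 4 + (-4550940) * y ^ 5
def cy4 {R : Type*} [CommRing R] (y : R) : R := (1284733132841424456253440) * y ^ 0 + (128541798906828816384000) * y ^ 1 + (383083609779811215375) * y ^ 2 + (107878928185336800) * y ^ 3 + (1665999364600) * y ^ 4 + (3720) * y ^ 5
def cy5 {R : Type*} [CommRing R] (y : R) : R := (1963211489280) * y ^ 0 + (-246683410950) * y ^ 1 + (2028551200) * y ^ 2 + (-4550940) * y ^ 3 + (3720) * y ^ 4 + (-1) * y ^ 5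
def PhiP {R : Type*} [CommRing R] (y : R) : R[X] := X ^ 6 + (C (cy5 y) * X ^ 5 + C (cy4 y) * X ^ 4 + C (cy3 y) * X ^ 3 + C (cy2 y) * X ^ 2 + C (cy1 y) * X + C (cy0 y))
lemma PhiP_eval {R : Type*} [CommRing R] (x y : R) : (PhiP y).eval x = Phi x y := by
  simp only [PhiP, eval_add, eval_mul, eval_pow, eval_X, eval_C]
  unfold Phi Q5 cy5 cy4 cy3 cy2 cy1 cy0
  ring
lemma PhiP_monic {R : Type*} [CommRing R] [Nontrivial R] (y : R) : (PhiP y).Monic ∧ (PhiP y).natDegree = 6 := by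
  have h : (C (cy5 y) * X ^ 5 + C (cy4 y) * X ^ 4 + C (cy3 y) * X ^ 3 + C (cy2 y) * X ^ 2 + C (cy1 y) * X + C (cy0 y)).natDegree < 6 := by
    refine Nat.lt_of_le_of_lt (m := 5) ?_ (by norm_num)
    compute_degree
  have h' := (degree_le_natDegree (p := (C (cy5 y) * X ^ 5 + C (cy4 y) * X ^ 4 + C (cy3 y) * X ^ 3 + C (cy2 y) * X ^ 2 + C (cy1 y) * X + C (cy0 y)))).trans_lt (by exact_mod_cast h : _ < ((6 : ℕ) : WithBot ℕ))
  refine ⟨monic_X_pow_add h', ?_⟩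
  rw [PhiP, natDegree_add_eq_left_of_natDegree_lt (by rw [natDegree_X_pow]; exact h), natDegree_X_pow]
/-! ### asymptotics at i∞ -/
def Ld (m n : ℕ) (g : ℍ → ℂ) (c : ℂ) : Prop := Tendsto (fun τ => xq m τ ^ n * g τ) atImInfty (𝓝 c)
namespace Ld
variable {m n n' k : ℕ} {f g : ℍ → ℂ} {c d : ℂ}
lemma of_hasQ (hm : 0 < m) {F : ℂ⟦X⟧} (h : HasQ m n F g) : Ld m n g (F.coeff 0) := h.tendsto hm
lemma add (h : Ld m n f c) (h' : Ld m n g d) : Ld m n (fun τ => f τ + g τ) (c + d) := by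
  unfold Ld at *; simpa only [mul_add] using Tendsto.add h h'
lemma sub (h : Ld m n f c) (h' : Ld m n g d) : Ld m n (fun τ => f τ - g τ) (c - d) := by
  unfold Ld at *; simpa only [mul_sub] using Tendsto.sub h h'
lemma mul (h : Ld m n f c) (h' : Ld m n' g d) : Ld m (n + n') (fun τ => f τ * g τ) (c * d) := by
  unfold Ld at *
  refine (Tendsto.mul h h').congr fun τ => ?_
  ring
lemma const (c : ℂ) : Ld m 0 (fun _ => c) c := by unfold Ld; simp
lemma pow (h : Ld m n f c) (k : ℕ) : Ld m (k * n) (fun τ => f τ ^ k) (c ^ k) := by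
  induction k with
  | zero => simpa using const 1
  | succ k ih => simpa only [pow_succ, Nat.succ_mul] using ih.mul h
lemma prod {ι : Type*} (s : Finset ι) {f : ι → ℍ → ℂ} {n : ι → ℕ} {c : ι → ℂ} (h : ∀ i ∈ s, Ld m (n i) (f i) (c i)) :
    Ld m (∑ i ∈ s, n i) (fun τ => ∏ i ∈ s, f i τ) (∏ i ∈ s, c i) := by
  classical
  induction s using Finset.induction_on with
  | empty => simpa using const 1
  | insert a s ha ih =>
    simp only [sum_insert ha, Finset.prod_insert ha]
    exact (h a (Finset.mem_insert_self _ _)).mul (ih fun i hi => h i (Finset.mem_insert_of_mem hi))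
lemma weak (hm : 0 < m) (h : Ld m n f c) (hn : n < k) : Ld m k f 0 := by
  unfold Ld at *
  obtain ⟨e, rfl⟩ := Nat.exists_eq_add_of_lt hn
  have h1 := ((xq_tendsto hm).pow (e + 1)).mul h
  rw [zero_pow (Nat.succ_ne_zero e), zero_mul] at h1
  refine h1.congr fun τ => ?_
  ring
lemma congr (h : Ld m n f c) (hk : n = k) (hfg : ∀ τ, f τ = g τ) (hc : c = d) : Ld m k g d := by
  subst hk hc; rwa [funext hfg] at h
lemma unique (h : Ld m n f c) (h' : Ld m n f d) : c = d := tendsto_nhds_unique h h'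
lemma ne (h : Ld m n f c) (hc : c ≠ 0) : ∀ᶠ τ in atImInfty, f τ ≠ 0 := by
  filter_upwards [Tendsto.eventually_ne h hc] with τ hτ h0
  exact hτ (by rw [h0, mul_zero])
end Ld
lemma ld_j {m : ℕ} (hm : 0 < m) : Ld m m jf 1 := by
  have h : Ld 1 1 jf 1 := by
    have := Ld.of_hasQ one_pos hasQ_j
    rwa [toC_coeff, Fj0, Int.cast_one] at this
  unfold Ld at *
  refine h.congr fun τ => ?_
  rw [pow_one, xq_one_eq hm.ne' τ]
lemma j_inf : Tendsto (fun τ => ‖jf τ‖) atImInfty atTop := by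
  have h : Tendsto (fun τ => ‖xq 1 τ ^ 1 * jf τ‖ * ‖xq 1 τ‖⁻¹) atImInfty atTop := by
    refine Tendsto.pos_mul_atTop (C := ‖(1:ℂ)‖) (by simp) (ld_j one_pos).norm ?_
    refine tendsto_inv_nhdsGT_zero.comp (tendsto_nhdsWithin_iff.2 ⟨?_, .of_forall fun τ => norm_pos_iff.2 (xq_ne 1 τ)⟩)
    simpa using (xq_tendsto one_pos).norm
  refine h.congr fun τ => ?_
  have := norm_ne_zero_iff.2 (xq_ne 1 τ)
  rw [pow_one, norm_mul]; field_simp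
lemma poly_lim {P : ℂ[X]} {L : ℂ} (h : Tendsto (fun τ => P.eval (jf τ)) atImInfty (𝓝 L)) : P = C L := by
  by_cases hd : 0 < P.degree
  · exact absurd (h.norm) (not_tendsto_nhds_of_tendsto_atTop (P.tendsto_norm_atTop hd j_inf) _)
  · rw [not_lt] at hd
    rw [eq_C_of_degree_le_zero hd] at h ⊢
    simp only [eval_C] at h
    rw [tendsto_nhds_unique tendsto_const_nhds h]
section
variable {l : ℕ} [NeZero l]
lemma ld_rep_none : Ld l (l ^ 2) (jX (rep l none)) 1 := by
  have hl := NeZero.ne l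
  have h1 := hasQ_j.subst (m := l) (a := l ^ 2) (pow_ne_zero 2 hl) (fun τ => rep l none • τ) one_ne_zero (fun τ => by
    have := xq_upper (rep l none) (a := l) (d := 1) (by simp [rep]) (by simp [rep]) (by simp [rep]) hl one_ne_zero τ
    rw [this]; simp [rep])
  have := Ld.of_hasQ (Nat.pos_of_ne_zero hl) h1
  refine this.congr (by ring) (fun τ => rfl) ?_
  simp [toC_coeff, ← coeff_zero_eq_constantCoeff_apply, PowerSeries.coeff_expand, Fj0]
lemma ld_rep_some (b : Fin l) : Ld l 1 (jX (rep l (some b))) (Complex.exp (2 * Real.pi * Complex.I * (((b : ℕ) : ℤ) / l : ℂ)))⁻¹ := by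
  have hl := NeZero.ne l
  have h1 := hasQ_j.subst (m := l) (a := 1) one_ne_zero (fun τ => rep l (some b) • τ) (ζ := Complex.exp (2 * Real.pi * Complex.I * (((b : ℕ) : ℤ) / l : ℂ))) (Complex.exp_ne_zero _) (fun τ => by
    have := xq_upper (rep l (some b)) (a := 1) (d := l) (by simp [rep]) (by simp [rep]) (by simp [rep]) one_ne_zero hl τ
    rw [this]; simp [rep])
  have := Ld.of_hasQ (Nat.pos_of_ne_zero hl) h1
  refine this.congr (by ring) (fun τ => rfl) ?_
  simp [toC_coeff, ← coeff_zero_eq_constantCoeff_apply, PowerSeries.coeff_expand, Fj0]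
lemma rep_distinct (h1l : 1 < l) : ∀ᶠ τ in atImInfty, Function.Injective fun i => jX (rep l i) τ := by
  have hl : 0 < l := by omega
  have key : ∀ i j, i ≠ j → ∀ᶠ τ in atImInfty, jX (rep l i) τ - jX (rep l j) τ ≠ 0 := by
    have hn : ∀ b, Ld l (l ^ 2) (jX (rep l (some b))) 0 := fun b => (ld_rep_some b).weak hl (by nlinarith)
    intro i j hij
    rcases i with _ | b <;> rcases j with _ | b'
    · exact absurd rfl hij
    · exact (ld_rep_none.sub (hn b')).ne (by simp)
    · exact ((hn b).sub ld_rep_none).ne (by simp)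
    · refine ((ld_rep_some b).sub (ld_rep_some b')).ne ?_
      rw [sub_ne_zero]
      intro h
      have h := inv_injective h
      have hz := Complex.isPrimitiveRoot_exp l hl.ne'
      have e : ∀ c : Fin l, Complex.exp (2 * Real.pi * Complex.I * (((c : ℕ) : ℤ) / l : ℂ)) = Complex.exp (2 * Real.pi * Complex.I / l) ^ (c : ℕ) := fun c => by
        rw [← Complex.exp_nat_mul]; congr 1; push_cast; ring
      rw [e, e] at h
      exact hij (congrArg some (Fin.ext (hz.pow_inj b.2 b'.2 h)))
  have : ∀ᶠ τ in atImInfty, ∀ i j, i ≠ j → jX (rep l i) τ - jX (rep l j) τ ≠ 0 := by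
    simp only [eventually_all]; exact key
  filter_upwards [this] with τ hτ i j hij
  by_contra hne
  exact hτ i j hne (sub_eq_zero.2 hij)
end
/-! ### vanishing of `Phi` on `5`-isogenous pairs -/
lemma hasQ_x : HasQ 1 5 (toC Fx) (jX (rep 5 none)) := by
  have h1 := hasQ_j.subst (m := 1) (a := 5) (by norm_num) (fun τ => rep 5 none • τ) one_ne_zero (fun τ => by
    have := xq_upper (rep 5 none) (a := 5) (d := 1) (by simp [rep]) (by simp [rep]) (by simp [rep]) (by norm_num) one_ne_zero τ
    rw [this, xq_one_eq (m := 5) (by norm_num)]; simp [rep]; rw [← pow_mul])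
  have e : toC Fx = PowerSeries.expand 5 (by norm_num) (toC Fj) := by
    ext k
    rw [toC_coeff, Fx, PowerSeries.coeff_expand, PowerSeries.coeff_expand]
    split_ifs <;> simp [toC_coeff]
  rw [e]
  simpa using! h1
def HQ : Subring (ℤ⟦X⟧ × (ℍ → ℂ)) where
  carrier := {a | HasQ 1 0 (toC a.1) a.2}
  mul_mem' := fun {a b} ha hb => by
    have := HasQ.mul (show HasQ 1 0 (toC a.1) a.2 from ha) (show HasQ 1 0 (toC b.1) b.2 from hb)
    rw [← map_mul] at this; exact this
  add_mem' := fun {a b} ha hb => by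
    have := HasQ.add (show HasQ 1 0 (toC a.1) a.2 from ha) (show HasQ 1 0 (toC b.1) b.2 from hb)
    rw [← map_add] at this; exact this
  one_mem' := by
    have := HasQ.const 1 1
    simpa using! this
  zero_mem' := by
    have := HasQ.const 1 0
    simpa using! this
  neg_mem' := fun {a} ha => by
    have := HasQ.sub (HasQ.const 1 0) (show HasQ 1 0 (toC a.1) a.2 from ha)
    have h2 : HasQ 1 0 (toC (-a.1)) (-a.2) := by
      convert! this using 1
      · simp
      · ext τ; simp
    exact h2
lemma HQ_Qh {F G : ℤ⟦X⟧} {f g : ℍ → ℂ} (hf : HasQ 1 5 (toC F) f) (hg : HasQ 1 6 (toC G) g) :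
    HasQ 1 30 (toC (Qh F G PowerSeries.X)) (fun τ => Q5 (f τ) (g τ)) := by
  have h1 : (F, fun τ => xq 1 τ ^ 5 * f τ) ∈ HQ := fun τ => by simpa using hf τ
  have h2 : (G, fun τ => xq 1 τ ^ 6 * g τ) ∈ HQ := fun τ => by simpa using hg τ
  have h3 : ((PowerSeries.X : ℤ⟦X⟧), fun τ => xq 1 τ) ∈ HQ := fun τ => by
    have := HasQ.xpow 1 1 τ
    simpa [toC] using this
  have h := (Qh (⟨_, h1⟩ : HQ) ⟨_, h2⟩ ⟨_, h3⟩).2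
  have e1 := map_Qh HQ.subtype (⟨_, h1⟩ : HQ) ⟨_, h2⟩ ⟨_, h3⟩
  simp only [Subring.coe_subtype] at e1
  rw [e1] at h
  have e2 := map_Qh (RingHom.fst ℤ⟦X⟧ (ℍ → ℂ)) (F, fun τ => xq 1 τ ^ 5 * f τ) (G, fun τ => xq 1 τ ^ 6 * g τ) (PowerSeries.X, fun τ => xq 1 τ)
  intro τ
  have e3 := map_Qh ((Pi.evalRingHom _ τ).comp (RingHom.snd ℤ⟦X⟧ (ℍ → ℂ))) (F, fun τ => xq 1 τ ^ 5 * f τ) (G, fun τ => xq 1 τ ^ 6 * g τ) (PowerSeries.X, fun τ => xq 1 τ)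
  simp only [RingHom.coe_fst, RingHom.comp_apply, RingHom.coe_snd, Pi.evalRingHom_apply] at e2 e3
  have := h τ
  rw [e2, e3, Qh_eq] at this
  simpa using this
lemma HasQ.lim0 {m : ℕ} (hm : 0 < m) : ∀ {n : ℕ} {F : ℂ⟦X⟧} {g : ℍ → ℂ}, HasQ m n F g → (∀ k ≤ n, F.coeff k = 0) → Tendsto g atImInfty (𝓝 0) := by
  intro n
  induction n with
  | zero =>
    intro F g h h0
    have := h.tendsto hm
    rw [h0 0 le_rfl] at this
    simpa using this
  | succ n ih =>
    intro F g h h0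
    exact ih (h.shift_down (h0 0 (Nat.zero_le _))) fun k hk => by rw [PowerSeries.coeff_mk]; exact h0 _ (by omega)
lemma Phi_none_lim : Tendsto (fun τ => Phi (jX (rep 5 none) τ) (jf τ)) atImInfty (𝓝 0) := by
  have hy : HasQ 1 5 (toC (PowerSeries.X ^ 4 * Fj)) jf := by
    have := hasQ_j.shift 4
    rwa [show toC Fj * PowerSeries.X ^ 4 = toC (PowerSeries.X ^ 4 * Fj) by simp [toC, mul_comm]] at this
  have hu : HasQ 1 5 (toC Fu) (fun τ => -(jX (rep 5 none) τ + jf τ)) := by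
    intro τ
    have := ((hasQ_x.add hy) τ).neg
    rw [← map_add] at this
    have e : toC Fu = -toC (Fx + PowerSeries.X ^ 4 * Fj) := by rw [Fu, map_neg]
    rw [e]
    have e2 : (fun k => (PowerSeries.coeff k) (-toC (Fx + PowerSeries.X ^ 4 * Fj)) * xq 1 τ ^ k) =
        fun b => -((PowerSeries.coeff b) (toC (Fx + PowerSeries.X ^ 4 * Fj)) * xq 1 τ ^ b) := by
      funext k; rw [map_neg, neg_mul]
    rw [e2]
    show HasSum _ (xq 1 τ ^ 5 * -(jX (rep 5 none) τ + jf τ))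
    rw [mul_neg]; exact this
  have hv : HasQ 1 6 (toC Fv) (fun τ => jX (rep 5 none) τ * jf τ) := by
    have := hasQ_x.mul hasQ_j
    rwa [← map_mul] at this
  exact (HQ_Qh hu hv).lim0 one_pos fun k hk => by rw [toC_coeff, Qh_zero k (by omega), Int.cast_zero]
lemma rep_none_some (b : Fin 5) (τ : ℍ) : jX (rep 5 none) (rep 5 (some b) • τ) = jf τ := by
  let γ : SL(2, ℤ) := ⟨!![1, ((b : ℕ) : ℤ); 0, 1], by simp⟩
  have e : rep 5 none * rep 5 (some b) = ofSL γ * Mp.sc 5 (by norm_num) := by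
    have hγ : ((ofSL γ : Mp) : M2) = !![1, ((b : ℕ) : ℤ); 0, 1] := rfl
    apply Mp.ext' <;> simp [Mp.mul_entries, rep, hγ, Mp.sc, mul_comm]
  rw [jX, ← mul_smul, e, mul_smul, jf_smul, Mp.sc_smul]
lemma rep_some_tendsto (b : Fin 5) : Tendsto (fun τ => rep 5 (some b) • τ) atImInfty atImInfty := by
  have e : ∀ τ : ℍ, (rep 5 (some b) • τ).im = τ.im / 5 := fun τ => by
    rw [← UpperHalfPlane.coe_im, Mp.coe_smul]
    have : jd (rep 5 (some b)) τ = ((5:ℝ) : ℂ) := by simp [jd, rep]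
    rw [this, Complex.div_ofReal_im]
    simp [rep]
  rw [atImInfty, tendsto_comap_iff]
  refine (tendsto_comap.atTop_div_const (by norm_num : (0:ℝ) < 5)).congr fun τ => ?_
  simp [e]
lemma Phi_lim (i) : Tendsto (fun τ => Phi (jX (rep 5 i) τ) (jf τ)) atImInfty (𝓝 0) := by
  cases i with
  | none => exact Phi_none_lim
  | some b =>
    refine (Phi_none_lim.comp (rep_some_tendsto b)).congr fun τ => ?_
    simp only [Function.comp]
    rw [rep_none_some, Phi_symm]; rfl
lemma RU_top : RU ⊤ := fun _ _ _ _ => trivial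
lemma Phi_mem {B : Type*} [CommRing B] (S : Subring B) {x y : B} (hx : x ∈ S) (hy : y ∈ S) : Phi x y ∈ S := by
  have e := map_Phi S.subtype (⟨x, hx⟩ : S) ⟨y, hy⟩
  have e2 : Phi x y = S.subtype (Phi (⟨x, hx⟩ : S) ⟨y, hy⟩) := e.symm
  rw [e2]
  exact Subtype.property _
lemma Phi_pi {ι B : Type*} [CommRing B] (f g : ι → B) (i : ι) : (Phi f g) i = Phi (f i) (g i) :=
  map_Phi (Pi.evalRingHom (fun _ => B) i) f g
lemma QR_Phi {m : ℕ} {f g : ℍ → ℂ} {R : Subring ℂ} (hf : f ∈ QR R m) (hg : g ∈ QR R m) : (fun τ => Phi (f τ) (g τ)) ∈ QR R m := by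
  have h := Phi_mem (QR R m) hf hg
  have e2 : (fun τ => Phi (f τ) (g τ)) = Phi f g := funext fun τ => (Phi_pi f g τ).symm
  rw [e2]; exact h
lemma QR_prod {m : ℕ} {R : Subring ℂ} {ι : Type*} (s : Finset ι) {f : ι → ℍ → ℂ} (h : ∀ i ∈ s, f i ∈ QR R m) : (fun τ => ∏ i ∈ s, f i τ) ∈ QR R m := by
  have := (QR R m).prod_mem h
  convert! this using 1
  ext τ; simp
lemma inv_prod {l : ℕ} [NeZero l] (hl : l.Prime) {u : Mp → ℍ → ℂ} (hu : Fam u) (G : ℂ → ℂ → ℂ) : MInv (fun τ => ∏ i, G (jf τ) (u (rep l i) τ)) := by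
  intro γ τ
  simp only [hu.perm hl γ τ, jf_smul]
  exact Function.Bijective.prod_comp (Fam.sig_bij hl γ) (fun i => G (jf τ) (u (rep l i) τ))
lemma Phi_zero (i) (τ : ℍ) : Phi (jX (rep 5 i) τ) (jf τ) = 0 := by
  set c := Phi (jX (rep 5 i) τ) (jf τ) with hc
  have hq : (fun τ => ∏ i, (c - Phi (jX (rep 5 i) τ) (jf τ))) ∈ QR ⊤ 5 :=
    QR_prod _ fun i _ => (QR ⊤ 5).sub_mem (QR.const trivial) (QR_Phi (QR_j i RU_top) QR_j1)
  obtain ⟨P, -, hP⟩ := QR_principle (by norm_num) hq (inv_prod (l := 5) (by norm_num) fam_j fun a b => c - Phi b a)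
  have hl : Tendsto (fun τ => P.eval (jf τ)) atImInfty (𝓝 (∏ i : Option (Fin 5), (c - 0))) := by
    simp_rw [← hP]
    exact tendsto_finsetProd _ fun i _ => tendsto_const_nhds.sub (Phi_lim i)
  have h := hP τ
  rw [poly_lim hl, eval_C] at h
  rw [prod_eq_zero (mem_univ i) (by rw [← hc, sub_self])] at h
  simpa using h.symm
/-- the modular equation of level 5 -/
theorem Phi_prod (c : ℂ) (τ : ℍ) : ∏ i, (c - jX (rep 5 i) τ) = Phi c (jf τ) := by
  have hev : ∀ᶠ τ in atImInfty, ∏ i, (c - jX (rep 5 i) τ) = Phi c (jf τ) := by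
    filter_upwards [rep_distinct (l := 5) (by norm_num)] with τ hτ
    have hm := PhiP_monic (jf τ)
    have hd : (∏ i, (X - C (jX (rep 5 i) τ))) ∣ PhiP (jf τ) := by
      refine Finset.prod_dvd_of_coprime (fun i _ j _ hij => ?_) fun i _ => ?_
      · exact isCoprime_X_sub_C_of_isUnit_sub (sub_ne_zero.2 fun h => hij (hτ h)).isUnit
      · rw [dvd_iff_isRoot, IsRoot, PhiP_eval, Phi_zero]
    have he : (∏ i, (X - C (jX (rep 5 i) τ))) = PhiP (jf τ) := by
      refine (eq_of_monic_of_dvd_of_natDegree_le (monic_prod_of_monic _ _ fun _ _ => monic_X_sub_C _) hm.1 hd ?_).symm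
      rw [hm.2, natDegree_prod_of_monic _ _ fun _ _ => monic_X_sub_C _]
      simp
    rw [← PhiP_eval, ← he, eval_prod]; simp
  have hq : (fun τ => ∏ i, (c - jX (rep 5 i) τ) - Phi c (jf τ)) ∈ QR ⊤ 5 :=
    (QR ⊤ 5).sub_mem (QR_prod _ fun i _ => (QR ⊤ 5).sub_mem (QR.const trivial) (QR_j i RU_top)) (QR_Phi (QR.const trivial) QR_j1)
  obtain ⟨P, -, hP⟩ := QR_principle (by norm_num) hq (fun γ τ => by
    have := inv_prod (l := 5) (by norm_num) fam_j (fun a b => c - b) γ τ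
    simp only at this ⊢
    rw [this, jf_smul])
  have hl : Tendsto (fun τ => P.eval (jf τ)) atImInfty (𝓝 0) := by
    refine (tendsto_congr' ?_).2 tendsto_const_nhds
    filter_upwards [hev] with τ hτ
    rw [← hP, hτ, sub_self]
  have h := hP τ
  rw [poly_lim hl, eval_C] at h
  exact sub_eq_zero.1 h

/-! ### the Kronecker type polynomial -/
lemma Ld.poly0 {m a b : ℕ} {g : ℍ → ℂ} {d : ℂ} (hm : 0 < m) (hg : Ld m b g d) (P : ℂ[X]) {N : ℕ} (hN : P.natDegree ≤ N) (h : N * b < a) :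
    Ld m a (fun τ => P.eval (g τ)) 0 := by
  simp only [eval_eq_sum_range]
  unfold Ld
  simp only [mul_sum]
  rw [show (0 : ℂ) = ∑ i ∈ range (P.natDegree + 1), 0 by simp]
  refine tendsto_finset_sum _ fun i hi => ?_
  have hi' : i ≤ N := by simp at hi; omega
  have := ((Ld.const (m := m) (P.coeff i)).mul (hg.pow i)).weak hm (k := a) (by
    have := Nat.mul_le_mul_right b hi'; omega)
  exact this
lemma Phi_Ld {m a b : ℕ} {f g : ℍ → ℂ} {c d : ℂ} (hm : 0 < m) (hf : Ld m a f c) (hg : Ld m b g d) (h : 5 * b < a) :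
    Ld m (6 * a) (fun τ => Phi (f τ) (g τ)) (c ^ 6) := by
  have e5 := hg.poly0 hm (cy5 (X : ℂ[X])) (N := 5) (by unfold cy5; compute_degree) h
  have e4 := hg.poly0 hm (cy4 (X : ℂ[X])) (N := 5) (by unfold cy4; compute_degree) h
  have e3 := hg.poly0 hm (cy3 (X : ℂ[X])) (N := 5) (by unfold cy3; compute_degree) h
  have e2 := hg.poly0 hm (cy2 (X : ℂ[X])) (N := 5) (by unfold cy2; compute_degree) h
  have e1 := hg.poly0 hm (cy1 (X : ℂ[X])) (N := 5) (by unfold cy1; compute_degree) h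
  have e0 := hg.poly0 hm (cy0 (X : ℂ[X])) (N := 6) (a := 6 * a) (by unfold cy0; compute_degree) (by omega)
  have k5 := (e5.mul (hf.pow 5)).congr (k := 6 * a) (by ring) (fun _ => rfl) (zero_mul _)
  have k4 := (e4.mul (hf.pow 4)).weak (k := 6 * a) hm (by omega)
  have k3 := (e3.mul (hf.pow 3)).weak (k := 6 * a) hm (by omega)
  have k2 := (e2.mul (hf.pow 2)).weak (k := 6 * a) hm (by omega)
  have k1 := (e1.mul hf).weak (k := 6 * a) hm (by omega)
  refine ((hf.pow 6).add (((((k5.add k4).add k3).add k2).add k1).add e0)).congr rfl (fun τ => ?_) (by simp)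
  rw [← PhiP_eval, PhiP]
  simp [cy0, cy1, cy2, cy3, cy4, cy5]
lemma map_multiset {ι R : Type*} [Fintype ι] [CommRing R] [IsDomain R] (b : ι → R) :
    (∏ i, (X - C (b i))).roots = Finset.univ.val.map b := by
  have := roots_multiset_prod_X_sub_C (Finset.univ.val.map b)
  rw [Multiset.map_map] at this
  exact this
namespace PV
variable {p : ℕ} [hp : Fact p.Prime] (v : PV p) {τ : ℍ}
instance instAC : IsAlgClosed v.kk := by
  refine IsAlgClosed.of_exists_root _ fun f hf hi => ?_
  obtain ⟨q, hq, hd, hm⟩ := lifts_and_natDegree_eq_and_monic (f := IsLocalRing.residue v.V) (p := f)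
    ((mem_lifts _).2 (Polynomial.map_surjective _ IsLocalRing.residue_surjective f)) hf
  have hm' := hm.map (algebraMap v.V ℂ)
  obtain ⟨x, hx⟩ := IsAlgClosed.exists_root (q.map (algebraMap v.V ℂ)) (by
    rw [degree_eq_natDegree hm'.ne_zero, natDegree_map_eq_of_injective Subtype.val_injective, hd]
    exact_mod_cast hi.natDegree_pos.ne')
  have hxV : x ∈ v.V := mem_of_root v.V hm' (fun k => by rw [coeff_map]; exact Subtype.property _) hx
  refine ⟨v.rd x, ?_⟩
  rw [← hq, ← v.rd_eval _ hxV, hx, v.rd_zero]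
def gP (p : ℕ) [Fact p.Prime] (τ : ℍ) : ℂ := ∏ i, Phi (jf τ) (jX (rep p i) τ)
lemma exists_P : ∃ P : v.V[X], ∀ τ, gP p τ = (P.map (algebraMap v.V ℂ)).eval (jf τ) := by
  have hq : gP p ∈ QR v.R p := QR_prod _ fun i _ => QR_Phi QR_j1 (QR_j i v.ru)
  obtain ⟨P, h1, h2⟩ := QR_principle hp.out.pos hq (inv_prod hp.out fam_j Phi)
  obtain ⟨Q, rfl⟩ := v.lift_poly h1
  exact ⟨Q, h2⟩
def P : v.V[X] := v.exists_P.choose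
lemma P_spec (τ) : gP p τ = (v.P.map (algebraMap v.V ℂ)).eval (jf τ) := v.exists_P.choose_spec τ
lemma gP_Ld (h7 : 5 < p) : Ld p (12 * p * p) (gP p) 1 := by
  have hm := hp.out.pos
  have h0 : Ld p (6 * p ^ 2) (fun τ => Phi (jf τ) (jX (rep p none) τ)) 1 :=
    (Phi_Ld hm (ld_rep_none (l := p)) (ld_j hm) (by nlinarith)).congr rfl (fun τ => Phi_symm _ _) (one_pow _)
  have h1 : ∀ b, Ld p (6 * p) (fun τ => Phi (jf τ) (jX (rep p (some b)) τ)) 1 := fun b =>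
    (Phi_Ld hm (ld_j hm) (ld_rep_some (l := p) b) (by omega)).congr rfl (fun τ => rfl) (one_pow _)
  have := h0.mul (Ld.prod univ fun b _ => h1 b)
  refine this.congr ?_ (fun τ => ?_) (by simp)
  · simp; ring
  · rw [gP, Fintype.prod_option]
lemma P_monic (h7 : 5 < p) : v.P.Monic := by
  have hm := hp.out.pos
  set Q := v.P.map (algebraMap v.V ℂ) with hQ
  have hinj : Function.Injective (algebraMap v.V ℂ) := Subtype.val_injective
  have h0 : Q ≠ 0 := by
    intro h
    have := gP_Ld (p := p) h7
    have h2 : Ld p (12 * p * p) (gP p) 0 := by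
      unfold Ld
      simp [v.P_spec, ← hQ, h]
    exact one_ne_zero (this.unique h2)
  have key : ∀ N, Q.natDegree ≤ N → Ld p (N * p) (gP p) (Q.coeff N) := by
    intro N hN
    have : Ld p (N * p) (fun τ => ∑ i ∈ range N, Q.coeff i * jf τ ^ i + Q.coeff N * jf τ ^ N) (0 + Q.coeff N) := by
      refine Ld.add ?_ (((Ld.const (Q.coeff N)).mul ((ld_j hm).pow N)).congr (by ring) (fun _ => rfl) (by simp))
      unfold Ld
      simp only [mul_sum]
      rw [show (0 : ℂ) = ∑ i ∈ range N, 0 by simp]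
      refine tendsto_finset_sum _ fun i hi => ?_
      exact ((Ld.const (Q.coeff i)).mul ((ld_j hm).pow i)).weak hm (k := N * p) (by
        simp at hi ⊢; exact Nat.mul_lt_mul_of_pos_right hi hm)
    refine this.congr rfl (fun τ => ?_) (zero_add _)
    rw [v.P_spec, ← hQ, eval_eq_sum_range' (n := N + 1) (by omega), sum_range_succ]
  have hd : Q.natDegree ≤ 12 * p := by
    by_contra hlt
    push Not at hlt
    have := (key _ le_rfl).unique ((gP_Ld (p := p) h7).weak hm (Nat.mul_lt_mul_of_pos_right hlt hm))
    exact h0 (leadingCoeff_eq_zero.1 this)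
  have hc := (key _ hd).unique (gP_Ld (p := p) h7)
  have : Q.Monic := monic_of_natDegree_le_of_coeff_eq_one _ hd hc
  rw [Monic, leadingCoeff_map_of_injective hinj] at this
  exact hinj (by rw [this, map_one])
def ff : v.kk[X] := Phi (X ^ p) X
lemma ff_eval (α : v.kk) : v.ff.eval α = Phi (α ^ p) α := by
  have := map_Phi (evalRingHom α) (X ^ p) X
  simpa [ff] using this
lemma Phi_memV {x y : ℂ} (hx : x ∈ v.V) (hy : y ∈ v.V) : Phi x y ∈ v.V := Phi_mem v.R hx hy
lemma rd_Phi {x y : ℂ} (hx : x ∈ v.V) (hy : y ∈ v.V) : v.rd (Phi x y) = Phi (v.rd x) (v.rd y) := by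
  have e1 := map_Phi (algebraMap v.V ℂ) ⟨x, hx⟩ ⟨y, hy⟩
  have e2 := map_Phi (IsLocalRing.residue v.V) ⟨x, hx⟩ ⟨y, hy⟩
  rw [← v.rd_eq hx, ← v.rd_eq hy, ← v.rd_coe] at e2
  rw [← e2]; congr 1
lemma rd_prod {ι : Type*} (s : Finset ι) (f : ι → ℂ) (h : ∀ i, f i ∈ v.V) : v.rd (∏ i ∈ s, f i) = ∏ i ∈ s, v.rd (f i) := by
  classical
  induction s using Finset.induction_on with
  | empty => simp [v.rd_one]
  | insert a s ha ih =>
    rw [Finset.prod_insert ha, Finset.prod_insert ha, v.rd_mul (h a) (prod_mem fun i _ => h i), ih]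
lemma Pbar : v.P.map (IsLocalRing.residue v.V) = v.ff ^ 2 := by
  apply Polynomial.funext
  intro α
  obtain ⟨x, hx, rfl⟩ := v.rd_surj α
  obtain ⟨τ, rfl⟩ := jf_surj x
  rw [← v.rd_eval _ hx, ← v.P_spec, gP, v.rd_prod _ _ fun i => v.Phi_memV hx (v.jX_mem _ hx), eval_pow, ff_eval]
  simp only [v.rd_Phi hx (v.jX_mem _ hx)]
  set α := v.rd (jf τ)
  obtain ⟨β, hβ⟩ := IsAlgClosed.exists_pow_nat_eq α hp.out.pos
  have h1 := v.j_prod hx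
  have h2 : (X ^ p - C α) = (X - C β : v.kk[X]) ^ p := by
    rw [sub_pow_char, ← C_pow, hβ]
  have h3 := congrArg roots h1
  rw [map_multiset, h2, roots_mul (mul_ne_zero (pow_ne_zero _ (X_sub_C_ne_zero _)) (X_sub_C_ne_zero _)), roots_pow, roots_X_sub_C, roots_X_sub_C] at h3
  have h4 := congrArg (fun s => (s.map (fun y => Phi α y)).prod) h3
  simp only [Multiset.map_map, Multiset.map_add, Multiset.prod_add, Multiset.map_nsmul, Multiset.prod_nsmul, Multiset.map_singleton, Multiset.prod_singleton, Function.comp_def] at h4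
  have h5 : Phi α β ^ p = Phi (α ^ p) α := by
    have := map_Phi (frobenius v.kk p) α β
    simpa [frobenius_def, hβ] using this
  rw [h5, Phi_symm α (α ^ p)] at h4
  rw [sq]
  exact h4
end PV

/-! ### fixed points -/
lemma fix_coords {X : Mp} {τ : ℍ} (h : X • τ = τ) :
    2 * (X 1 0 : ℝ) * τ.re = X 0 0 - X 1 1 ∧
    (X 0 1 : ℝ) = - X 1 0 * (τ.re ^ 2 + τ.im ^ 2) := by
  have e := fix_eq h
  simp only [jd] at e
  have hy := τ.im_pos
  have him := congrArg Complex.im e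
  have hre := congrArg Complex.re e
  simp at him hre
  have h1 : 2 * (X 1 0 : ℝ) * τ.re = X 0 0 - X 1 1 := by
    have : τ.im * (2 * (X 1 0 : ℝ) * τ.re - (X 0 0 - X 1 1)) = 0 := by linarith
    rcases mul_eq_zero.1 this with h | h
    · exact absurd h hy.ne'
    · linarith
  refine ⟨h1, ?_⟩
  have h2 : (X 0 0 : ℝ) = 2 * (X 1 0 : ℝ) * τ.re + X 1 1 := by linarith
  rw [h2] at hre
  linarith
lemma fix_of_coords {X : Mp} {τ : ℍ} (h1 : 2 * (X 1 0 : ℝ) * τ.re = X 0 0 - X 1 1)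
    (h2 : (X 0 1 : ℝ) = - X 1 0 * (τ.re ^ 2 + τ.im ^ 2)) : X • τ = τ := by
  apply fix_of_eq
  have h3 : (X 0 0 : ℝ) = 2 * (X 1 0 : ℝ) * τ.re + X 1 1 := by linarith
  simp only [jd]
  apply Complex.ext
  · simp
    rw [h2, h3]; ring
  · simp
    rw [h3]; ring
lemma fix_disc {X : Mp} {τ : ℍ} (h : X • τ = τ) :
    ((Mtr X ^ 2 - 4 * Mdet X : ℤ) : ℝ) = - (2 * X 1 0 * τ.im) ^ 2 := by
  obtain ⟨h1, h2⟩ := fix_coords h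
  rw [Mdet_eq, Mtr]
  push_cast
  rw [h2]
  have h3 : (X 0 0 : ℝ) = 2 * (X 1 0 : ℝ) * τ.re + X 1 1 := by linarith
  rw [h3]; ring
lemma fix_disc_neg {X : Mp} {τ : ℍ} (h : X • τ = τ) (hc : X 1 0 ≠ 0) : Mtr X ^ 2 - 4 * Mdet X < 0 := by
  have := fix_disc h
  have hy := τ.im_pos
  have hc' : (X 1 0 : ℝ) ≠ 0 := mod_cast hc
  have : ((Mtr X ^ 2 - 4 * Mdet X : ℤ) : ℝ) < 0 := by
    rw [this]
    have : 0 < (2 * (X 1 0 : ℝ) * τ.im) ^ 2 := by positivity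
    linarith
  exact_mod_cast this
lemma fix_scalar {X : Mp} {τ : ℍ} (h : X • τ = τ) (hc : X 1 0 = 0) : X 0 1 = 0 ∧ X 0 0 = X 1 1 := by
  obtain ⟨h1, h2⟩ := fix_coords h
  rw [hc] at h1 h2
  simp at h1 h2
  refine ⟨h2, ?_⟩
  have : (X 0 0 : ℝ) = X 1 1 := by linarith
  exact_mod_cast this
lemma fix_unique {X Y : Mp} {τ : ℍ} (hX : X • τ = τ) (hY : Y • τ = τ) (tX : Mtr X = 0) (tY : Mtr Y = 0) (hd : Mdet X = Mdet Y) :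
    X = Y ∨ ∀ i j, X i j = - Y i j := by
  have hx := fix_disc hX
  have hy := fix_disc hY
  rw [tX, hd] at hx
  rw [tY, hx] at hy
  have hp := τ.im_pos
  obtain ⟨h1, h2⟩ := fix_coords hX
  obtain ⟨h3, h4⟩ := fix_coords hY
  have tX' : (X 1 1 : ℝ) = - X 0 0 := by
    have : X 1 1 = - X 0 0 := by unfold Mtr at tX; linarith
    exact_mod_cast this
  have tY' : (Y 1 1 : ℝ) = - Y 0 0 := by
    have : Y 1 1 = - Y 0 0 := by unfold Mtr at tY; linarith
    exact_mod_cast this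
  have hc : ((X 1 0 : ℝ) - Y 1 0) * ((X 1 0 : ℝ) + Y 1 0) = 0 := by
    have : (2 * τ.im) ^ 2 * (((X 1 0 : ℝ) - Y 1 0) * ((X 1 0 : ℝ) + Y 1 0)) = 0 := by linarith
    rcases mul_eq_zero.1 this with h | h
    · exact absurd h (by positivity)
    · exact h
  rcases mul_eq_zero.1 hc with h | h
  · left
    have e : (X 1 0 : ℝ) = Y 1 0 := by linarith
    rw [e] at h1 h2
    apply Mp.ext'
    · exact_mod_cast (by linarith : (X 0 0 : ℝ) = Y 0 0)
    · exact_mod_cast (by linarith : (X 0 1 : ℝ) = Y 0 1)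
    · exact_mod_cast e
    · exact_mod_cast (by linarith : (X 1 1 : ℝ) = Y 1 1)
  · right
    have e : (X 1 0 : ℝ) = - Y 1 0 := by linarith
    rw [e] at h1 h2
    have k00 : X 0 0 = - Y 0 0 := mod_cast (by linarith : (X 0 0 : ℝ) = - Y 0 0)
    have k01 : X 0 1 = - Y 0 1 := mod_cast (by linarith : (X 0 1 : ℝ) = - Y 0 1)
    have k10 : X 1 0 = - Y 1 0 := mod_cast e
    have k11 : X 1 1 = - Y 1 1 := mod_cast (by linarith : (X 1 1 : ℝ) = - Y 1 1)
    intro i j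
    fin_cases i <;> fin_cases j <;> assumption
lemma jX_eq_fix {X Y : Mp} {τ : ℍ} (h : jX X τ = jX Y τ) : ∃ γ : SL(2, ℤ), (ofSL γ * X) • τ = Y • τ := by
  obtain ⟨γ, hγ⟩ := j_inj h.symm
  exact ⟨γ, by rw [mul_smul, ofSL_smul, ← hγ]⟩
lemma jX_fix {X : Mp} {τ : ℍ} (h : jf τ = jX X τ) : ∃ γ : SL(2, ℤ), (ofSL γ * X) • τ = τ := by
  obtain ⟨γ, hγ⟩ := j_inj h
  exact ⟨γ, by rw [mul_smul, ofSL_smul, ← hγ]⟩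
lemma jX_left (γ : SL(2, ℤ)) (X : Mp) (τ : ℍ) : jX (ofSL γ * X) τ = jX X τ := by
  rw [jX, mul_smul, jf_smul, jX]
/-- derivative of `j(Xτ)` -/
lemma jX_deriv (X : Mp) (τ : ℍ) : HasDerivAt (fun z => jX X (ofComplex z))
    (-(2 * Real.pi * Complex.I) * (f4 (X • τ) ^ 2 * f6 (X • τ) / fD (X • τ)) * (Mdet X / jd X τ ^ 2)) (τ : ℂ) := by
  have hne := jd_ne X τ
  have hh : HasDerivAt (fun z : ℂ => ((X 0 0 : ℂ) * z + X 0 1) / ((X 1 0 : ℂ) * z + X 1 1)) (Mdet X / jd X τ ^ 2) (τ : ℂ) := by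
    have := (((hasDerivAt_id (τ : ℂ)).const_mul (X 0 0 : ℂ)).add_const (X 0 1 : ℂ)).div
      (((hasDerivAt_id (τ : ℂ)).const_mul (X 1 0 : ℂ)).add_const (X 1 1 : ℂ)) hne
    refine this.congr_deriv ?_
    rw [Mdet_eq]
    simp only [jd, id]
    push_cast
    ring
  have hj := j_deriv (X • τ)
  rw [Mp.coe_smul] at hj
  have := hj.comp (τ : ℂ) hh
  refine this.congr_of_eventuallyEq ?_
  have : ∀ᶠ z : ℂ in 𝓝 (τ : ℂ), 0 < z.im := (isOpen_lt continuous_const Complex.continuous_im).mem_nhds τ.im_pos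
  filter_upwards [this] with z hz
  simp only [Function.comp, jX]
  congr 1
  have e : ofComplex z = ⟨z, hz⟩ := ofComplex_apply_of_im_pos hz
  rw [e]
  have := Mp.coe_smul X ⟨z, hz⟩
  simp only [jd] at this
  rw [← show ((X • (⟨z, hz⟩ : ℍ) : ℍ) : ℂ) = _ from this, ofComplex_apply]
lemma f6_I : f6 I = 0 := by
  have h := f6_smul ModularGroup.S I
  have hS : ((ofSL ModularGroup.S : Mp) : M2) = !![0, -1; 1, 0] := rfl
  have e : ofSL ModularGroup.S • I = I := by
    apply fix_of_coords <;> simp [hS]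
  rw [e] at h
  have hj : jd (ofSL ModularGroup.S) I ^ 6 = -1 := by
    simp [jd, hS]
  rw [hj] at h
  have : (2:ℂ) * f6 I = 0 := by linear_combination h
  simpa using this
lemma jf_of_f6 {τ : ℍ} (h : f6 τ = 0) : jf τ = 1728 := by
  have := fD_eq τ
  rw [h] at this
  have hne := fD_ne τ
  rw [jf]
  field_simp
  linear_combination -this
def CM (N : ℤ) (τ : ℍ) : Prop := ∃ X : Mp, Mdet X = N ∧ Mtr X = 0 ∧ X • τ = τ
lemma CM.smul {N : ℤ} {τ : ℍ} (h : CM N τ) (γ : SL(2, ℤ)) : CM N (γ • τ) := by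
  obtain ⟨X, h1, h2, h3⟩ := h
  refine ⟨ofSL γ * X * ofSL γ⁻¹, ?_, ?_, ?_⟩
  · rw [Mdet_mul, Mdet_mul, ofSL_det, ofSL_det, h1]; ring
  · have : Mtr (ofSL γ * X * ofSL γ⁻¹) = Mtr X := by
      have e : ∀ Y : Mp, Mtr Y = (Y : M2).trace := fun Y => by rw [Matrix.trace_fin_two, Mtr]
      rw [e, e]
      have h1 : ((ofSL γ⁻¹ : Mp) : M2) * (ofSL γ : Mp) = 1 := by
        have : (ofSL γ⁻¹ * ofSL γ : Mp) = 1 := by rw [← map_mul, inv_mul_cancel, map_one]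
        exact congrArg Subtype.val this
      show ((ofSL γ : M2) * (X : M2) * (ofSL γ⁻¹ : M2)).trace = _
      rw [Matrix.trace_mul_comm, ← mul_assoc, h1, one_mul]
    rw [this, h2]
  · rw [mul_smul, mul_smul, ofSL_smul γ⁻¹, inv_smul_smul, h3, ofSL_smul]
lemma CM.f6_ne {N : ℤ} {τ : ℍ} (h : CM N τ) (hN : ¬ IsSquare N) : f6 τ ≠ 0 := by
  intro h6
  obtain ⟨γ, hγ⟩ := j_inj ((jf_of_f6 f6_I).trans (jf_of_f6 h6).symm)
  obtain ⟨X, h1, h2, h3⟩ := h.smul γ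
  rw [← hγ] at h3
  obtain ⟨k1, k2⟩ := fix_coords h3
  simp at k1 k2
  have k1' : X 0 0 = X 1 1 := by
    have : (X 0 0 : ℝ) = X 1 1 := by linarith
    exact_mod_cast this
  have k2' : X 0 1 = -X 1 0 := mod_cast k2
  apply hN
  rw [Mtr] at h2
  rw [Mdet_eq, k2'] at h1
  refine ⟨X 1 0, ?_⟩
  have : X 0 0 = 0 := by omega
  rw [this] at h1
  linarith

namespace PV
variable {p : ℕ} [hp : Fact p.Prime] (v : PV p) {τ : ℍ}
abbrev PC : ℂ[X] := v.P.map (algebraMap v.V ℂ)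
lemma gP_pairs (τ : ℍ) : gP p τ = ∏ x : Option (Fin p) × Option (Fin 5), (jf τ - jX (rep 5 x.2 * rep p x.1) τ) := by
  rw [gP, Fintype.prod_prod_type]
  refine prod_congr rfl fun i _ => ?_
  have := Phi_prod (jf τ) (rep p i • τ)
  rw [show jX (rep p i) τ = jf (rep p i • τ) from rfl, ← this]
  refine prod_congr rfl fun k _ => ?_
  rw [jX, jX, mul_smul]
lemma root_iff (τ : ℍ) : v.PC.eval (jf τ) = 0 ↔ ∃ x : Option (Fin p) × Option (Fin 5), jf τ = jX (rep 5 x.2 * rep p x.1) τ := by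
  rw [← v.P_spec, gP_pairs, Finset.prod_eq_zero_iff]
  simp [sub_eq_zero]
lemma CM_root (h : CM (5 * p) τ) : v.PC.eval (jf τ) = 0 := by
  obtain ⟨X, h1, h2, h3⟩ := h
  obtain ⟨Y, i, rfl⟩ := rep_factor hp.out X (by rw [h1]; exact dvd_mul_left _ _)
  rw [Mdet_mul, rep_det] at h1
  have hY : Mdet Y = 5 := mul_right_cancel₀ (mod_cast hp.out.ne_zero) h1
  obtain ⟨Y', k, rfl⟩ := rep_factor (l := 5) (by norm_num) Y (by rw [hY]; rfl)
  rw [Mdet_mul, rep_det] at hY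
  have hY' : Mdet Y' = 1 := by omega
  obtain ⟨γ, rfl⟩ := exists_ofSL hY'
  rw [v.root_iff]
  refine ⟨(i, k), ?_⟩
  rw [← jX_left γ, ← mul_assoc, jX, h3]
lemma PC_monic (h5 : 5 < p) : v.PC.Monic := (v.P_monic h5).map _
lemma PC_mem (h5 : 5 < p) {r : ℂ} (h : v.PC.eval r = 0) : r ∈ v.V :=
  mem_of_root v.V (v.PC_monic h5) (fun k => by rw [coeff_map]; exact Subtype.property _) h
lemma not_sq (h5 : 5 < p) : ¬ IsSquare (5 * p : ℤ) := by
  rintro ⟨r, hr⟩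
  have hpp : Prime (p : ℤ) := Nat.prime_iff_prime_int.1 hp.out
  have h1 : (p : ℤ) ∣ r := by
    rcases hpp.dvd_or_dvd (hr ▸ dvd_mul_left _ _ : (p : ℤ) ∣ r * r) with h | h <;> exact h
  obtain ⟨s, rfl⟩ := h1
  have h2 : (5 : ℤ) = p * (s * s) := by
    have : (p : ℤ) ≠ 0 := hpp.ne_zero
    apply mul_right_cancel₀ this
    rw [hr]; ring
  have h3 : (p : ℤ) ∣ 5 := ⟨_, h2⟩
  have := Int.le_of_dvd (by norm_num) h3
  omega
lemma CM_of_root (h20 : 20 < p) (x : Option (Fin p) × Option (Fin 5)) (h : jf τ = jX (rep 5 x.2 * rep p x.1) τ) (hV : jf τ ∈ v.V) (hs : v.SS τ) :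
    ∃ γ : SL(2, ℤ), (ofSL γ * (rep 5 x.2 * rep p x.1)) • τ = τ ∧ Mdet (ofSL γ * (rep 5 x.2 * rep p x.1)) = 5 * p ∧
      Mtr (ofSL γ * (rep 5 x.2 * rep p x.1)) = 0 := by
  obtain ⟨γ, hγ⟩ := jX_fix h
  have hd : Mdet (ofSL γ * (rep 5 x.2 * rep p x.1)) = 5 * p := by
    rw [Mdet_mul, Mdet_mul, rep_det, rep_det, ofSL_det]; simp
  refine ⟨γ, hγ, hd, ?_⟩
  set X := ofSL γ * (rep 5 x.2 * rep p x.1)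
  have h1 := v.crit1 hV hs hγ (by rw [hd]; exact dvd_mul_left _ _)
  have hc : X 1 0 ≠ 0 := by
    intro hc
    obtain ⟨h2, h3⟩ := fix_scalar hγ hc
    rw [Mdet_eq, hc, h3] at hd
    exact not_sq (p := p) (by omega) ⟨X 1 1, by linarith⟩
  have h2 := fix_disc_neg hγ hc
  rw [hd] at h2
  obtain ⟨t, ht⟩ := h1
  rw [ht] at h2 ⊢
  have hp20 : (20 : ℤ) < p := mod_cast h20
  have : t = 0 := by
    by_contra h0
    have : 1 ≤ t ^ 2 := by have : 0 < t ^ 2 := by positivity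
                           omega
    have h3 : (p : ℤ) ^ 2 * 1 ≤ p ^ 2 * t ^ 2 := mul_le_mul_of_nonneg_left this (by positivity)
    nlinarith
  rw [this, mul_zero]
lemma CM_iff (h20 : 20 < p) : (v.PC.eval (jf τ) = 0 ∧ v.SS τ) ↔ CM (5 * p) τ := by
  constructor
  · rintro ⟨h1, h2⟩
    obtain ⟨x, hx⟩ := (v.root_iff τ).1 h1
    obtain ⟨γ, k1, k2, k3⟩ := v.CM_of_root h20 x hx (v.PC_mem (by omega) h1) h2
    exact ⟨_, k2, k3, k1⟩
  · intro h
    have h1 := v.CM_root h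
    refine ⟨h1, ?_⟩
    obtain ⟨X, k1, k2, k3⟩ := h
    refine v.crit2 (v.PC_mem (by omega) h1) k3 (by rw [k1]; exact dvd_mul_left _ _) ?_ k2
    rw [k1, sq]
    intro hd
    have := Int.dvd_of_mul_dvd_mul_right (mod_cast hp.out.ne_zero) hd
    have := Int.le_of_dvd (by norm_num) this
    omega
lemma pair_unique (h5 : 5 < p) {x y : Option (Fin p) × Option (Fin 5)} {γ δ : SL(2, ℤ)}
    (h : ofSL γ * (rep 5 x.2 * rep p x.1) = ofSL δ * (rep 5 y.2 * rep p y.1)) : x = y := by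
  rw [← mul_assoc, ← mul_assoc] at h
  have hnd : ¬ (p : ℤ) ∣ 5 := fun hd => by have := Int.le_of_dvd (by norm_num) hd; omega
  have h1 : x.1 = y.1 := by
    refine rep_unique hp.out h fun hD => ?_
    have := Div_det _ hD
    rw [Mdet_mul, rep_det, Mdet_mul, ofSL_det, rep_det] at this
    exact not_sq_dvd hp.out (a := 5) hnd (by simpa using this)
  rw [h1] at h
  have h := Mp.cancel_right h
  have h2 : x.2 = y.2 := by
    refine rep_unique (l := 5) (by norm_num) h fun hD => ?_
    have := Div_det _ hD
    rw [Mdet_mul, rep_det, ofSL_det] at this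
    exact not_sq_dvd (l := 5) (by norm_num) (a := 1) (by norm_num) this
  exact Prod.ext h1 h2
lemma root_ne_zero (h11 : 11 < p) (h : v.PC.eval (jf τ) = 0) : jf τ ≠ 0 := by
  intro h0
  rw [h0] at h
  have h1 := v.rd_eval v.P v.V.zero_mem
  rw [h, v.rd_zero, v.Pbar, eval_pow, v.ff_eval] at h1
  have h2 : Phi ((0 : v.kk) ^ p) 0 = 0 := by simpa using h1.symm
  rw [zero_pow hp.out.ne_zero] at h2
  have h3 : (((2 ^ 90 * 3 ^ 18 * 5 ^ 3 * 11 ^ 9 : ℕ) : ℕ) : v.kk) = 0 := by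
    rw [← h2, Phi, Q5]; push_cast; ring
  rw [CharP.cast_eq_zero_iff v.kk p] at h3
  have hpp := hp.out
  simp only [hpp.dvd_mul] at h3
  rcases h3 with ((h | h) | h) | h <;> have := Nat.le_of_dvd (by norm_num) (hpp.dvd_of_dvd_pow h) <;> omega
lemma simple (h20 : 20 < p) (h : v.PC.eval (jf τ) = 0) (hs : v.SS τ) : v.PC.derivative.eval (jf τ) ≠ 0 := by
  classical
  have hV := v.PC_mem (by omega) h
  have hCM := (v.CM_iff h20).1 ⟨h, hs⟩
  obtain ⟨x, hx⟩ := (v.root_iff τ).1 h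
  obtain ⟨γ, k1, k2, k3⟩ := v.CM_of_root h20 x hx hV hs
  set X := ofSL γ * (rep 5 x.2 * rep p x.1) with hX
  set J := -(2 * Real.pi * Complex.I) * (f4 τ ^ 2 * f6 τ / fD τ) with hJ
  have hJ0 : J ≠ 0 := by
    have h4 : f4 τ ≠ 0 := by
      intro h4
      apply v.root_ne_zero (by omega) h
      rw [jf, h4]; simp
    have h6 := hCM.f6_ne (not_sq (p := p) (by omega))
    have hD := fD_ne τ
    have : (Real.pi : ℂ) ≠ 0 := mod_cast Real.pi_ne_zero
    rw [hJ]
    refine mul_ne_zero (neg_ne_zero.2 (mul_ne_zero (mul_ne_zero two_ne_zero this) Complex.I_ne_zero)) (div_ne_zero (mul_ne_zero (pow_ne_zero _ h4) h6) hD)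
  have d0 := j_deriv τ
  rw [← hJ] at d0
  have hx' : ∀ τ', jX (rep 5 x.2 * rep p x.1) τ' = jX X τ' := fun τ' => (jX_left γ _ τ').symm
  have d1 := jX_deriv X τ
  have hjd : jd X τ ^ 2 = - Mdet X := by
    have := fix_char k1
    rw [k3] at this
    linear_combination this
  have hdet : (Mdet X : ℂ) ≠ 0 := Int.cast_ne_zero.2 (Mp.pos X).ne'
  rw [k1, ← hJ, hjd, div_neg, div_self hdet, mul_neg, mul_one] at d1
  have d2 : HasDerivAt (fun z => jf (ofComplex z) - jX X (ofComplex z)) (J - -J) (τ : ℂ) := HasDerivAt.sub d0 d1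
  -- the rest of the product
  set rest : ℂ → ℂ := fun z => ∏ y ∈ Finset.univ.erase x, (jf (ofComplex z) - jX (rep 5 y.2 * rep p y.1) (ofComplex z)) with hrest
  have dr : DifferentiableAt ℂ rest (τ : ℂ) :=
    DifferentiableAt.fun_finset_prod fun y _ => d0.differentiableAt.sub (jX_deriv _ τ).differentiableAt
  have r0 : rest (τ : ℂ) ≠ 0 := by
    rw [hrest]
    simp only [ofComplex_apply]
    rw [Finset.prod_ne_zero_iff]
    intro y hy h0
    have hy' : y ≠ x := (Finset.mem_erase.1 hy).1
    obtain ⟨δ, l1, l2, l3⟩ := v.CM_of_root h20 y (sub_eq_zero.1 h0) hV hs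
    rcases fix_unique k1 l1 k3 l3 (k2.trans l2.symm) with e | e
    · exact hy' (pair_unique (p := p) (by omega) e).symm
    · refine hy' (pair_unique (p := p) (γ := γ) (δ := -δ) (by omega) ?_).symm
      apply Subtype.ext
      rw [← hX]
      ext i j
      rw [e i j]
      have : ((ofSL (-δ) * (rep 5 y.2 * rep p y.1) : Mp) : M2) = - ((ofSL δ * (rep 5 y.2 * rep p y.1) : Mp) : M2) := by
        show ((ofSL (-δ) : Mp) : M2) * _ = - (((ofSL δ : Mp) : M2) * _)
        rw [← neg_mul]
        congr 1
      rw [this]; rfl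
  have dg := d2.mul dr.hasDerivAt
  have hv0 : jf (ofComplex (τ : ℂ)) - jX X (ofComplex (τ : ℂ)) = 0 := by
    rw [ofComplex_apply, ← hx', ← hx, sub_self]
  rw [hv0, zero_mul, add_zero] at dg
  have dP : HasDerivAt (fun z => v.PC.eval (jf (ofComplex z))) (v.PC.derivative.eval (jf τ) * J) (τ : ℂ) := by
    have := v.PC.hasDerivAt (jf (ofComplex (τ : ℂ)))
    have := this.comp (τ : ℂ) d0
    rw [ofComplex_apply] at this
    exact this
  have e : (fun z => v.PC.eval (jf (ofComplex z))) = (fun z => jf (ofComplex z) - jX X (ofComplex z)) * rest := by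
    funext z
    rw [← v.P_spec, gP_pairs, ← Finset.mul_prod_erase _ _ (mem_univ x), hx']
    rfl
  rw [e] at dP
  have := dP.unique dg
  intro h0
  rw [h0, zero_mul] at this
  have h2 : J - -J ≠ 0 := by
    rw [sub_neg_eq_add, ← two_mul]; exact mul_ne_zero two_ne_zero hJ0
  exact mul_ne_zero h2 r0 this.symm
def Zset (p : ℕ) : Set ℂ := {r | ∃ τ, jf τ = r ∧ CM (5 * p) τ}
theorem card_Z (h20 : 20 < p) [DecidablePred fun a : v.kk => v.A.eval a = 0] : (Zset p).ncard = 2 * Multiset.card (v.ff.roots.filter (fun a => v.A.eval a = 0)) := by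
  classical
  have h5 : 5 < p := by omega
  have hPC := v.PC_monic h5
  have hPb0 : v.P.map (IsLocalRing.residue v.V) ≠ 0 := ((v.P_monic h5).map _).ne_zero
  have hr := v.roots_red hPb0
  rw [v.Pbar, roots_pow, Multiset.filter_eq_self.2 (fun r hr => v.PC_mem h5 ((mem_roots hPC.ne_zero).1 hr))] at hr
  have hf := congrArg (fun s => Multiset.card (s.filter (fun a => v.A.eval a = 0))) hr
  simp only [Multiset.filter_nsmul, Multiset.card_nsmul, Multiset.filter_map, Multiset.card_map, smul_eq_mul] at hf
  rw [hf]
  set S := v.PC.roots.filter ((fun a => v.A.eval a = 0) ∘ v.rd) with hS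
  have hmem : ∀ r, r ∈ S ↔ r ∈ Zset p := by
    intro r
    obtain ⟨τ, rfl⟩ := jf_surj r
    rw [hS, Multiset.mem_filter, mem_roots hPC.ne_zero]
    have := v.CM_iff (τ := τ) h20
    constructor
    · intro h
      exact ⟨τ, rfl, this.1 h⟩
    · rintro ⟨τ', h1, h2⟩
      obtain ⟨γ, rfl⟩ := j_inj h1.symm
      exact this.2 (h2.smul γ)
  have hnd : S.Nodup := by
    rw [Multiset.nodup_iff_count_le_one]
    intro r
    by_cases hr : r ∈ S
    · obtain ⟨τ, rfl⟩ := jf_surj r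
      rw [hS, Multiset.mem_filter, mem_roots hPC.ne_zero] at hr
      have := v.simple h20 hr.1 hr.2
      refine (Multiset.count_le_of_le _ (Multiset.filter_le _ _)).trans ?_
      rw [count_roots]
      by_contra hlt
      push Not at hlt
      exact this ((one_lt_rootMultiplicity_iff_isRoot hPC.ne_zero).1 hlt).2
    · rw [Multiset.count_eq_zero_of_notMem hr]; exact zero_le_one
  rw [← Multiset.toFinset_card_of_nodup hnd, ← Set.ncard_coe_finset]
  congr 1
  ext r
  simp [hmem]
end PV

section Lattice
open NumberField
variable {K : Type} [Field K] [NumberField K] (φ : 𝓞 K →+* ℂ)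
/-- An ideal with an oriented lattice basis. -/
structure OLat (I : Ideal (𝓞 K)) (α β : 𝓞 K) (τ : ℍ) : Prop where
  mem : ∀ x, x ∈ I ↔ ∃ a b : ℤ, x = a * α + b * β
  ne : α ≠ 0
  eq : φ β = τ * φ α
variable {φ} {I I' : Ideal (𝓞 K)} {α β α' β' w : 𝓞 K} {τ τ' : ℍ} {t n : ℤ}
lemma real_indep {τ : ℍ} {a b : ℝ} (h : (a : ℂ) + b * τ = 0) : a = 0 ∧ b = 0 := by
  have h1 := congrArg Complex.im h
  have h2 := congrArg Complex.re h
  simp at h1 h2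
  have hb : b = 0 := h1.resolve_right τ.im_pos.ne'
  subst hb
  exact ⟨by simpa using h2, rfl⟩
lemma int_indep {τ : ℍ} {a b a' b' : ℤ} (h : (a : ℂ) + b * τ = a' + b' * τ) : a = a' ∧ b = b' := by
  have := real_indep (τ := τ) (a := a - a') (b := b - b') (by push_cast; linear_combination h)
  constructor
  · have := this.1; exact_mod_cast sub_eq_zero.1 this
  · have := this.2; exact_mod_cast sub_eq_zero.1 this

lemma OLat.exists (hφ : Function.Injective φ) (hK : Module.finrank ℚ K = 2) (hw : 0 < (φ w).im) (hI : I ≠ ⊥) :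
    ∃ α β τ, OLat φ I α β τ := by
  have hr : Module.finrank ℤ I = 2 := by
    have := Ideal.finrank_eq_finrank (RingOfIntegers.basis K) I hI
    rw [RingOfIntegers.rank, hK] at this
    exact this
  let B := Module.finBasisOfFinrankEq ℤ I hr
  have hmem : ∀ x, x ∈ I ↔ ∃ a b : ℤ, x = a * (B 0 : 𝓞 K) + b * (B 1 : 𝓞 K) := by
    intro x
    constructor
    · intro hx
      have := B.sum_repr ⟨x, hx⟩
      rw [Fin.sum_univ_two] at this
      refine ⟨B.repr ⟨x, hx⟩ 0, B.repr ⟨x, hx⟩ 1, ?_⟩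
      · have := congrArg Subtype.val this
        simpa [zsmul_eq_mul] using this.symm
    · rintro ⟨a, b, rfl⟩
      exact I.add_mem (I.mul_mem_left _ (B 0).2) (I.mul_mem_left _ (B 1).2)
  set α : 𝓞 K := (B 0 : 𝓞 K) with hα
  set β : 𝓞 K := (B 1 : 𝓞 K) with hβ
  have hα0 : α ≠ 0 := by
    intro h
    exact B.ne_zero 0 (Subtype.ext h)
  have hφα : φ α ≠ 0 := fun h => hα0 (hφ (by simpa using h))
  obtain ⟨d, c, hdc⟩ := (hmem (w * α)).1 (I.mul_mem_left _ (B 0).2)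
  have h1 : φ w = d + c * (φ β / φ α) := by
    have := congrArg φ hdc
    simp only [map_mul, map_add, map_intCast] at this
    field_simp
    linear_combination this
  have h2 : (c : ℝ) * (φ β / φ α).im = (φ w).im := by
    rw [h1]; simp
  have h3 : (φ β / φ α).im ≠ 0 := by
    intro h; rw [h] at h2; simp at h2; exact hw.ne h2
  rcases lt_or_gt_of_ne h3 with h | h
  · refine ⟨α, -β, ⟨-(φ β / φ α), by simpa using h⟩, ⟨fun x => ?_, hα0, ?_⟩⟩
    · rw [hmem]
      constructor
      · rintro ⟨a, b, rfl⟩; exact ⟨a, -b, by push_cast; ring⟩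
      · rintro ⟨a, b, rfl⟩; exact ⟨a, -b, by push_cast; ring⟩
    · simp [hφα]
  · exact ⟨α, β, ⟨φ β / φ α, h⟩, ⟨hmem, hα0, by simp [hφα]⟩⟩

lemma OLat.ne' (hφ : Function.Injective φ) (h : OLat φ I α β τ) : φ α ≠ 0 := fun h' => h.ne (hφ (by simpa using h'))

lemma OLat.matrix (hφ : Function.Injective φ) (h : OLat φ I α β τ) (hw : 0 < (φ w).im) (hq : w ^ 2 = t * w - n) (ht : t ^ 2 - 4 * n < 0) :
    ∃ X : Mp, Mtr X = t ∧ Mdet X = n ∧ X • τ = τ := by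
  have hα := h.ne' hφ
  have mα : α ∈ I := (h.mem _).2 ⟨1, 0, by simp⟩
  have mβ : β ∈ I := (h.mem _).2 ⟨0, 1, by simp⟩
  obtain ⟨d, c, h1⟩ := (h.mem (w * α)).1 (I.mul_mem_left _ mα)
  obtain ⟨b, a, h2⟩ := (h.mem (w * β)).1 (I.mul_mem_left _ mβ)
  have e1 : φ w = d + c * τ := by
    have := congrArg φ h1
    simp only [map_mul, map_add, map_intCast, h.eq] at this
    exact mul_right_cancel₀ hα (by linear_combination this)
  have e2 : φ w * τ = b + a * τ := by
    have := congrArg φ h2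
    simp only [map_mul, map_add, map_intCast, h.eq] at this
    exact mul_right_cancel₀ hα (by linear_combination this)
  have e3 : φ w ^ 2 = t * φ w - n := by
    have := congrArg φ hq
    simpa using this
  have e4 : φ w ^ 2 = (a + d) * φ w - (a * d - b * c) := by
    rw [e1] at e2 ⊢
    linear_combination c * e2
  have e5 : ((n - (a * d - b * c) : ℤ) : ℂ) = ((t - (a + d) : ℤ) : ℂ) * φ w := by
    push_cast; linear_combination e3 - e4
  have e6 := congrArg Complex.im e5
  simp only [Complex.intCast_im, Complex.mul_im, Complex.intCast_re, zero_mul, add_zero] at e6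
  have e7 : t - (a + d) = 0 := by
    have := (mul_eq_zero.1 e6.symm).resolve_right hw.ne'
    exact_mod_cast this
  rw [e7] at e5
  have e8 : n - (a * d - b * c) = 0 := by
    have : ((n - (a * d - b * c) : ℤ) : ℂ) = 0 := by simpa using e5
    exact_mod_cast this
  have hpos : 0 < a * d - b * c := by nlinarith [sq_nonneg t]
  refine ⟨mkM a b c d hpos, ?_, ?_, ?_⟩
  · simp [Mtr]; linarith
  · simp [Mdet]; linarith
  · apply UpperHalfPlane.ext
    rw [Mp.coe_smul, jd]
    have hne : φ w ≠ 0 := fun h => by simp [h] at hw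
    simp only [mkM_coe]
    simp
    rw [div_eq_iff (by rw [add_comm, ← e1]; exact hne)]
    rw [add_comm, ← e2, e1]; ring

lemma OLat.inj (hφ : Function.Injective φ) (h : OLat φ I α β τ) (h' : OLat φ I' α' β' τ') (γ : SL(2, ℤ)) (hγ : τ = γ • τ') :
    ∃ x y : 𝓞 K, x ≠ 0 ∧ y ≠ 0 ∧ Ideal.span {x} * I = Ideal.span {y} * I' := by
  have hα := h.ne' hφ
  have hα' := h'.ne' hφ
  have hγ' : (τ : ℂ) = (ofSL γ 0 0 * τ' + ofSL γ 0 1) / jd (ofSL γ) τ' := by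
    rw [← Mp.coe_smul, ofSL_smul, hγ]
  rw [eq_div_iff (jd_ne _ _)] at hγ'
  have hjd := jd_ne (ofSL γ) τ'
  have hdet := γ.2
  rw [Matrix.det_fin_two] at hdet
  rw [jd] at hγ' hjd
  simp only [ofSL_coe] at hγ' hjd
  set a := γ.1 0 0; set b := γ.1 0 1; set c := γ.1 1 0; set d := γ.1 1 1
  have key : β * (c * β' + d * α') = α * (a * β' + b * α') := by
    apply hφ
    simp only [map_mul, map_add, map_intCast, h.eq, h'.eq]
    linear_combination φ α * φ α' * hγ'
  have hμ : c * β' + d * α' ≠ 0 := by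
    intro h0
    have := congrArg φ h0
    simp only [map_mul, map_add, map_intCast, h'.eq, map_zero] at this
    exact hjd (mul_right_cancel₀ hα' (by linear_combination this))
  have hdet' : (a : 𝓞 K) * d - b * c = 1 := mod_cast hdet
  refine ⟨c * β' + d * α', α, hμ, h.ne, ?_⟩
  ext x
  simp only [Ideal.mem_span_singleton_mul]
  constructor
  · rintro ⟨z, hz, rfl⟩
    obtain ⟨r, s, rfl⟩ := (h.mem z).1 hz
    refine ⟨((r * d + s * b : ℤ) : 𝓞 K) * α' + ((r * c + s * a : ℤ) : 𝓞 K) * β', (h'.mem _).2 ⟨_, _, rfl⟩, ?_⟩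
    push_cast
    linear_combination - s * key
  · rintro ⟨z, hz, rfl⟩
    obtain ⟨r, s, rfl⟩ := (h'.mem z).1 hz
    refine ⟨((r * a - s * b : ℤ) : 𝓞 K) * α + ((s * d - r * c : ℤ) : 𝓞 K) * β, (h.mem _).2 ⟨_, _, rfl⟩, ?_⟩
    push_cast
    linear_combination (s * d - r * c) * key + (r * α * α' + s * α * β') * hdet'

lemma OLat.jeq (hφ : Function.Injective φ) (h : OLat φ I α β τ) (h' : OLat φ I' α' β' τ') {x y : 𝓞 K} (hx : x ≠ 0) (hy : y ≠ 0)
    (he : Ideal.span {x} * I = Ideal.span {y} * I') : jf τ = jf τ' := by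
  have hα := h.ne' hφ
  have hα' := h'.ne' hφ
  have hx' : φ x ≠ 0 := fun h' => hx (hφ (by simpa using h'))
  have hy' : φ y ≠ 0 := fun h' => hy (hφ (by simpa using h'))
  have f1 : ∀ z ∈ I, ∃ z' ∈ I', y * z' = x * z := fun z hz => by
    have : x * z ∈ Ideal.span {y} * I' := he ▸ Ideal.mem_span_singleton_mul.2 ⟨z, hz, rfl⟩
    exact Ideal.mem_span_singleton_mul.1 this
  have f2 : ∀ z ∈ I', ∃ z' ∈ I, x * z' = y * z := fun z hz => by
    have : y * z ∈ Ideal.span {x} * I := he ▸ Ideal.mem_span_singleton_mul.2 ⟨z, hz, rfl⟩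
    exact Ideal.mem_span_singleton_mul.1 this
  obtain ⟨z1, m1, e1⟩ := f1 α ((h.mem _).2 ⟨1, 0, by simp⟩)
  obtain ⟨z2, m2, e2⟩ := f1 β ((h.mem _).2 ⟨0, 1, by simp⟩)
  obtain ⟨z3, m3, e3⟩ := f2 α' ((h'.mem _).2 ⟨1, 0, by simp⟩)
  obtain ⟨z4, m4, e4⟩ := f2 β' ((h'.mem _).2 ⟨0, 1, by simp⟩)
  obtain ⟨d, c, rfl⟩ := (h'.mem _).1 m1
  obtain ⟨b, a, rfl⟩ := (h'.mem _).1 m2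
  obtain ⟨d', c', rfl⟩ := (h.mem _).1 m3
  obtain ⟨b', a', rfl⟩ := (h.mem _).1 m4
  have g1 := congrArg φ e1
  have g2 := congrArg φ e2
  have g3 := congrArg φ e3
  have g4 := congrArg φ e4
  simp only [map_mul, map_add, map_intCast, h.eq, h'.eq] at g1 g2 g3 g4
  have k1 : ((d' * d + c' * b : ℤ) : ℂ) + ((d' * c + c' * a : ℤ) : ℂ) * τ' = ((1 : ℤ) : ℂ) + ((0 : ℤ) : ℂ) * τ' := by
    refine mul_left_cancel₀ (mul_ne_zero hy' hα') ?_
    push_cast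
    linear_combination d' * g1 + c' * g2 + g3
  have k2 : ((b' * d + a' * b : ℤ) : ℂ) + ((b' * c + a' * a : ℤ) : ℂ) * τ' = ((0 : ℤ) : ℂ) + ((1 : ℤ) : ℂ) * τ' := by
    refine mul_left_cancel₀ (mul_ne_zero hy' hα') ?_
    push_cast
    linear_combination b' * g1 + a' * g2 + g4
  obtain ⟨i1, i2⟩ := int_indep k1
  obtain ⟨i3, i4⟩ := int_indep k2
  have hdd : (a * d - b * c) * (a' * d' - b' * c') = 1 := by
    have : (a * d - b * c) * (a' * d' - b' * c') = (d' * d + c' * b) * (b' * c + a' * a) - (d' * c + c' * a) * (b' * d + a' * b) := by ring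
    rw [this, i1, i2, i3, i4]; ring
  have hτ : (d + c * (τ' : ℂ)) * τ = b + a * τ' := by
    refine mul_left_cancel₀ (mul_ne_zero hy' hα') ?_
    linear_combination τ * g1 - g2
  have him : (τ.im) * ((d + c * τ'.re) ^ 2 + (c * τ'.im) ^ 2) = (a * d - b * c) * τ'.im := by
    have r1 := congrArg Complex.re hτ
    have r2 := congrArg Complex.im hτ
    simp at r1 r2
    linear_combination (d + c * τ'.re) * r2 - c * τ'.im * r1
  have hd1 : a * d - b * c = 1 := by
    rcases Int.eq_one_or_neg_one_of_mul_eq_one hdd with h | h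
    · exact h
    · exfalso
      have : ((a * d - b * c : ℤ) : ℝ) = -1 := by rw [h]; simp
      push_cast at this
      rw [this] at him
      have := τ.im_pos
      have := τ'.im_pos
      have : 0 ≤ τ.im * ((d + c * τ'.re) ^ 2 + (c * τ'.im) ^ 2) := by positivity
      linarith
  obtain ⟨γ, hγ⟩ := exists_ofSL (X := mkM a b c d (by rw [hd1]; norm_num)) (by simp [Mdet]; linarith)
  have : τ = ofSL γ • τ' := by
    apply UpperHalfPlane.ext
    rw [Mp.coe_smul, eq_div_iff (jd_ne _ _), jd, ← hγ]
    simp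
    linear_combination hτ
  rw [this, jf_smul]
lemma OLat.surj (hw : 0 < (φ w).im) (hq : w ^ 2 = t * w - n) (ht : t ^ 2 - 4 * n < 0)
    (hspan : ∀ x : 𝓞 K, ∃ a b : ℤ, x = a + b * w) {X : Mp} (h1 : Mtr X = t) (h2 : Mdet X = n) (h3 : X • τ = τ) :
    ∃ I : Ideal (𝓞 K), I ≠ ⊥ ∧ ∃ α β, OLat φ I α β τ := by
  obtain ⟨X, h1, h2, h3, hc⟩ : ∃ X : Mp, Mtr X = t ∧ Mdet X = n ∧ X • τ = τ ∧ 0 < X 1 0 := by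
    have hc : X 1 0 ≠ 0 := by
      intro hc
      obtain ⟨h4, h5⟩ := fix_scalar h3 hc
      rw [Mtr, h5] at h1
      rw [Mdet_eq, h4, h5] at h2
      rw [← h1, ← h2] at ht
      linarith
    rcases lt_or_gt_of_ne hc with h | h
    · refine ⟨Mp.adj X, ?_, ?_, ?_, ?_⟩
      · rw [← h1]; simp [Mtr, Mp.adj, Matrix.adjugate_fin_two]; ring
      · rw [← h2, Mdet_eq, Mdet_eq]; simp [Mp.adj]; ring
      · conv_lhs => rw [← h3]
        rw [← mul_smul, Mp.adj_mul, Mp.sc_smul]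
      · simpa [Mp.adj, Matrix.adjugate_fin_two] using h
    · exact ⟨X, h1, h2, h3, h⟩
  rw [Mdet_eq] at h2
  rw [Mtr] at h1
  have e := congrArg UpperHalfPlane.coe h3
  rw [Mp.coe_smul, div_eq_iff (jd_ne _ _), jd] at e
  set a := X 0 0; set b := X 0 1; set c := X 1 0; set d := X 1 1
  have e1 : φ w ^ 2 = t * φ w - n := by simpa using congrArg φ hq
  have hω : φ w = c * τ + d := by
    have : (φ w - (c * τ + d)) * (φ w + (c * τ + d) - t) = 0 := by
      rw [← h1] at e1 ⊢; rw [← h2] at e1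
      push_cast at e1 ⊢
      linear_combination e1 + c * e
    rcases mul_eq_zero.1 this with h | h
    · exact sub_eq_zero.1 h
    · exfalso
      have := congrArg Complex.im h
      simp at this
      have h5 : 0 < (c : ℝ) * τ.im := mul_pos (mod_cast hc) τ.im_pos
      linarith
  refine ⟨Ideal.span {(c : 𝓞 K), w - d}, ?_, c, w - d, ?_, ?_, ?_⟩
  · intro h
    rw [Ideal.span_eq_bot] at h
    have := h c (by simp)
    exact hc.ne' (mod_cast this)
  · intro x
    rw [Ideal.mem_span_pair]
    constructor
    · rintro ⟨u, v, rfl⟩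
      obtain ⟨u0, u1, rfl⟩ := hspan u
      obtain ⟨v0, v1, rfl⟩ := hspan v
      refine ⟨u0 + u1 * d + v1 * b, u1 * c + v0 + v1 * a, ?_⟩
      have h1' : (a : 𝓞 K) + d = t := mod_cast h1
      have h2' : (a : 𝓞 K) * d - b * c = n := mod_cast h2
      push_cast
      linear_combination v1 * hq - v1 * w * h1' + v1 * h2'
    · rintro ⟨u, v, rfl⟩; exact ⟨u, v, rfl⟩
  · exact_mod_cast hc.ne'
  · simp [hω]; ring
open scoped Classical in
theorem class_count (hφ : Function.Injective φ) (hK : Module.finrank ℚ K = 2) (hw : 0 < (φ w).im) (hq : w ^ 2 = t * w - n) (ht : t ^ 2 - 4 * n < 0)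
    (hspan : ∀ x : 𝓞 K, ∃ a b : ℤ, x = a + b * w) :
    {r : ℂ | ∃ τ, jf τ = r ∧ ∃ X : Mp, Mtr X = t ∧ Mdet X = n ∧ X • τ = τ}.ncard = classNumber K := by
  have hI : ∀ C : ClassGroup (𝓞 K), ∃ I : (Ideal (𝓞 K))⁰, ClassGroup.mk0 I = C := ClassGroup.mk0_surjective
  choose I hIC using hI
  have hL : ∀ C, ∃ α β τ, OLat φ (I C : Ideal (𝓞 K)) α β τ := fun C =>
    OLat.exists hφ hK hw (nonZeroDivisors.coe_ne_zero (I C))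
  choose α β τ hL using hL
  have hinj : Function.Injective (fun C => jf (τ C)) := by
    intro C C' h
    obtain ⟨γ, hγ⟩ := j_inj h
    obtain ⟨x, y, hx, hy, hxy⟩ := (hL C).inj hφ (hL C') γ hγ
    rw [← hIC C, ← hIC C']
    exact ClassGroup.mk0_eq_mk0_iff.2 ⟨x, y, hx, hy, hxy⟩
  have hset : {r : ℂ | ∃ τ, jf τ = r ∧ ∃ X : Mp, Mtr X = t ∧ Mdet X = n ∧ X • τ = τ} = (fun C => jf (τ C)) '' Set.univ := by
    ext r
    simp only [Set.mem_ofPred_eq, Set.image_univ, Set.mem_range]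
    constructor
    · rintro ⟨τ', rfl, X, h1, h2, h3⟩
      obtain ⟨J, hJ, α', β', hL'⟩ := OLat.surj hw hq ht hspan h1 h2 h3
      let J0 : (Ideal (𝓞 K))⁰ := ⟨J, mem_nonZeroDivisors_of_ne_zero hJ⟩
      refine ⟨ClassGroup.mk0 J0, ?_⟩
      obtain ⟨x, y, hx, hy, hxy⟩ := ClassGroup.mk0_eq_mk0_iff.1 (hIC (ClassGroup.mk0 J0))
      exact (hL _).jeq hφ hL' hx hy hxy
    · rintro ⟨C, rfl⟩
      exact ⟨τ C, rfl, (hL C).matrix hφ hw hq ht⟩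
  rw [hset, Set.ncard_image_of_injective _ hinj, Set.ncard_univ, Nat.card_eq_fintype_card, classNumber]
end Lattice

section IntRing
open NumberField
variable {K : Type} [Field K] [NumberField K] {θ : K} {p : ℕ}
lemma rat_int {q : ℚ} (h : IsIntegral ℤ (q : ℂ)) : ∃ m : ℤ, q = m := by
  have h' : IsIntegral ℤ q := by
    have : (q : ℂ) = algebraMap ℚ ℂ q := by simp
    rw [this] at h
    exact (isIntegral_algebraMap_iff (algebraMap ℚ ℂ).injective).1 h
  obtain ⟨y, hy⟩ := IsIntegrallyClosed.isIntegral_iff.1 h'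
  exact ⟨y, by simpa using hy.symm⟩
lemma sq_im {z : ℂ} {N : ℝ} (hN : 0 < N) (h : z ^ 2 = -(N : ℂ)) : z.re = 0 ∧ z.im ≠ 0 := by
  have h1 := congrArg Complex.re h
  have h2 := congrArg Complex.im h
  simp [pow_two] at h1 h2
  have hi : z.im ≠ 0 := by intro h0; rw [h0] at h1; nlinarith [mul_self_nonneg z.re]
  refine ⟨?_, hi⟩
  have : z.re * z.im = 0 := by linarith
  exact (mul_eq_zero.1 this).resolve_right hi
lemma exists_emb (hp : 0 < p) (hθ : θ ^ 2 = -((5 * p : ℕ) : K)) :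
    ∃ e : K →+* ℂ, (e θ).re = 0 ∧ 0 < (e θ).im := by
  let e : K →+* ℂ := Classical.arbitrary _
  have h : (e θ) ^ 2 = -(((5 * p : ℕ) : ℝ) : ℂ) := by
    have := congrArg e hθ
    rw [map_pow, map_neg, map_natCast] at this
    simpa using this
  obtain ⟨h1, h2⟩ := sq_im (by positivity) h
  rcases lt_or_gt_of_ne h2 with h3 | h3
  · exact ⟨(starRingEnd ℂ).comp e, by simp [h1], by simpa using h3⟩
  · exact ⟨e, h1, h3⟩
lemma exists_coords (hK : Module.finrank ℚ K = 2) {e : K →+* ℂ} (he : 0 < (e θ).im) (x : K) :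
    ∃ r s : ℚ, x = r + s * θ := by
  have hli : LinearIndependent ℚ ![(1 : K), θ] := by
    rw [LinearIndependent.pair_iff]
    intro s t h
    have h1 := congrArg e h
    rw [Rat.smul_def, Rat.smul_def] at h1
    simp only [map_add, map_mul, map_ratCast, map_one, map_zero] at h1
    have h2 := congrArg Complex.im h1
    simp at h2
    have ht : t = 0 := h2.resolve_right he.ne'
    subst ht
    simp at h1
    exact ⟨h1, rfl⟩
  let B := basisOfLinearIndependentOfCardEqFinrank hli (by simp [hK])
  have := B.sum_repr x
  rw [Fin.sum_univ_two] at this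
  refine ⟨B.repr x 0, B.repr x 1, ?_⟩
  have b0 : B 0 = 1 := by simp [B]
  have b1 : B 1 = θ := by simp [B]
  rw [b0, b1, Rat.smul_def, Rat.smul_def, mul_one] at this
  exact this.symm
lemma int_coords (hp : p.Prime) (h5 : 5 < p) (hθ : θ ^ 2 = -((5 * p : ℕ) : K)) (hK : Module.finrank ℚ K = 2)
    {e : K →+* ℂ} (he : (e θ).re = 0 ∧ 0 < (e θ).im) (x : K) (hx : IsIntegral ℤ x) :
    ∃ m l k : ℤ, 2 * x = m + l * θ ∧ m ^ 2 + 5 * p * l ^ 2 = 4 * k := by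
  obtain ⟨r, s, rfl⟩ := exists_coords hK he.2 x
  have hc : (starRingEnd ℂ) (e θ) = - e θ := by
    apply Complex.ext <;> simp [he.1]
  have h1 : IsIntegral ℤ (e (r + s * θ)) := map_isIntegral_int e hx
  have h2 : IsIntegral ℤ ((starRingEnd ℂ) (e (r + s * θ))) := map_isIntegral_int (starRingEnd ℂ) h1
  have hθ' : e θ ^ 2 = -(5 * p : ℂ) := by
    have := congrArg e hθ
    rw [map_pow, map_neg, map_natCast] at this
    simpa using this
  obtain ⟨m, hm⟩ := rat_int (q := 2 * r) (by
    have := h1.add h2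
    convert! this using 1
    rw [map_add, map_mul, map_ratCast, map_ratCast, map_add, map_mul, hc, map_ratCast, map_ratCast]; push_cast; ring)
  obtain ⟨k, hk⟩ := rat_int (q := r ^ 2 + 5 * p * s ^ 2) (by
    have := h1.mul h2
    convert! this using 1
    rw [map_add, map_mul, map_ratCast, map_ratCast, map_add, map_mul, hc, map_ratCast, map_ratCast]; push_cast; linear_combination (s ^ 2 : ℂ) * hθ')
  have e1 : (5 * p : ℚ) * (2 * s) ^ 2 = 4 * k - m ^ 2 := by rw [← hm, ← hk]; ring
  obtain ⟨y, hy⟩ := rat_int (q := 5 * p * (2 * s)) (by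
    apply IsIntegral.of_pow (n := 2) (by norm_num)
    have : ((5 * p * (2 * s) : ℚ) : ℂ) ^ 2 = ((5 * p * (4 * k - m ^ 2) : ℤ) : ℂ) := by
      have : ((5 * p * (2 * s) : ℚ)) ^ 2 = ((5 * p * (4 * k - m ^ 2) : ℤ) : ℚ) := by
        push_cast; rw [← e1]; ring
      exact_mod_cast congrArg (fun q : ℚ => (q : ℂ)) this
    rw [this]
    exact isIntegral_algebraMap (R := ℤ) (A := ℂ))
  have e2 : y ^ 2 = 5 * p * (4 * k - m ^ 2) := by
    have : (y : ℚ) ^ 2 = 5 * p * (4 * k - m ^ 2) := by rw [← hy, ← e1]; ring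
    exact_mod_cast this
  have d5 : (5 : ℤ) ∣ y := Int.Prime.dvd_pow' (by norm_num : Nat.Prime 5) (n := y) (k := 2) (by rw [e2]; exact ⟨p * (4 * k - m ^ 2), by push_cast; ring⟩)
  have dp : (p : ℤ) ∣ y := Int.Prime.dvd_pow' hp (n := y) (k := 2) (by rw [e2]; exact ⟨5 * (4 * k - m ^ 2), by ring⟩)
  have hcop : IsCoprime (5 : ℤ) p := by
    have : Nat.Coprime 5 p := (Nat.coprime_primes (by norm_num) hp).2 h5.ne
    exact_mod_cast Nat.isCoprime_iff_coprime.2 this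
  obtain ⟨l, hl⟩ := hcop.mul_dvd d5 dp
  have hpQ : (p : ℚ) ≠ 0 := mod_cast hp.ne_zero
  have e3 : 2 * s = l := by
    rw [hl] at hy; push_cast at hy
    have : (5 * p : ℚ) ≠ 0 := by positivity
    exact mul_left_cancel₀ this hy
  refine ⟨m, l, k, ?_, ?_⟩
  · have hm' : (2 : K) * r = m := mod_cast congrArg (fun q : ℚ => (q : K)) hm
    have hl' : (2 : K) * s = l := mod_cast congrArg (fun q : ℚ => (q : K)) e3
    linear_combination hm' + θ * hl'
  · have : (m : ℚ) ^ 2 + 5 * p * l ^ 2 = 4 * k := by rw [← e3, e1]; ring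
    exact_mod_cast this
lemma sq_mod4 (m : ℤ) : (m % 2 = 0 ∧ m ^ 2 % 4 = 0) ∨ (m % 2 = 1 ∧ m ^ 2 % 4 = 1) := by
  rcases Int.even_or_odd' m with ⟨c, rfl | rfl⟩
  · left; refine ⟨by omega, ?_⟩; ring_nf; omega
  · right; refine ⟨by omega, ?_⟩; ring_nf; omega
theorem class_one (hp : p.Prime) (h5 : 5 < p) (h4 : p % 4 = 1) (hθ : θ ^ 2 = -((5 * p : ℕ) : K)) (hK : Module.finrank ℚ K = 2) :
    (PV.Zset p).ncard = classNumber K := by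
  obtain ⟨e, he⟩ := exists_emb hp.pos hθ
  have hi : IsIntegral ℤ θ := by
    apply IsIntegral.of_pow (n := 2) (by norm_num)
    rw [hθ]
    have := (isIntegral_algebraMap (R := ℤ) (A := K) (x := ((5 * p : ℕ) : ℤ))).neg
    simpa using this
  obtain ⟨w, hwc⟩ : ∃ w : 𝓞 K, algebraMap (𝓞 K) K w = θ := ⟨⟨θ, hi⟩, rfl⟩
  let φ : 𝓞 K →+* ℂ := e.comp (algebraMap (𝓞 K) K)
  have := class_count (φ := φ) (w := w) (t := 0) (n := 5 * p) (e.injective.comp RingOfIntegers.coe_injective) hK (by simpa [φ, hwc] using he.2) (by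
    apply RingOfIntegers.coe_injective
    rw [map_pow, map_sub, map_mul, map_intCast, hwc, hθ, map_intCast]
    push_cast; ring) (by have := hp.pos; nlinarith) (by
    intro x
    obtain ⟨m, l, k, h1, h2⟩ := int_coords hp h5 hθ hK he (x : K) x.2
    have hmp : ((p : ℤ) % 4 = 1) := by omega
    have key : m % 2 = 0 ∧ l % 2 = 0 := by
      have hml : (m ^ 2 + 5 * p * l ^ 2) % 4 = 0 := by omega
      have hm1 : (m ^ 2 + 5 * p * l ^ 2) % 4 = (m ^ 2 % 4 + l ^ 2 % 4) % 4 := by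
        rw [Int.add_emod, Int.mul_emod (5 * (p : ℤ)), show (5 * (p : ℤ)) % 4 = 1 by omega, one_mul, Int.emod_emod]
      rcases sq_mod4 m with hm | hm <;> rcases sq_mod4 l with hl | hl <;> omega
    refine ⟨m / 2, l / 2, RingOfIntegers.coe_injective ?_⟩
    have hm : ((2 * (m / 2) : ℤ) : K) = m := by congr 1; omega
    have hl : ((2 * (l / 2) : ℤ) : K) = l := by congr 1; omega
    push_cast at hm hl
    have h2 : (2 : K) ≠ 0 := two_ne_zero
    apply mul_left_cancel₀ h2
    change 2 * (algebraMap (𝓞 K) K x) = _ at h1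
    rw [h1, ← hm, ← hl, map_add, map_mul, map_intCast, map_intCast, hwc]
    ring)
  rw [← this]
  congr 1
  ext r
  simp only [PV.Zset, CM, Set.mem_ofPred_eq]
  constructor
  · rintro ⟨τ, h, X, h1, h2, h3⟩; exact ⟨τ, h, X, h2, by simpa using h1, h3⟩
  · rintro ⟨τ, h, X, h1, h2, h3⟩; exact ⟨τ, h, X, by simpa using h2, h1, h3⟩
theorem class_three (hp : p.Prime) (h5 : 5 < p) (h4 : p % 4 = 3) (hθ : θ ^ 2 = -((5 * p : ℕ) : K)) (hK : Module.finrank ℚ K = 2)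
    {n : ℤ} (hn : 4 * n = 5 * p + 1) :
    {r : ℂ | ∃ τ, jf τ = r ∧ ∃ X : Mp, Mtr X = 1 ∧ Mdet X = n ∧ X • τ = τ}.ncard = classNumber K := by
  obtain ⟨e, he⟩ := exists_emb hp.pos hθ
  have h2 : (2 : K) ≠ 0 := two_ne_zero
  have hnK : (4 : K) * n = 5 * p + 1 := mod_cast congrArg (fun z : ℤ => (z : K)) hn
  have hθ' : θ ^ 2 = 1 - 4 * n := by rw [hθ, hnK]; push_cast; ring
  have hq : ((1 + θ) / 2) ^ 2 = (1 + θ) / 2 - n := by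
    field_simp; linear_combination hθ'
  have hi : IsIntegral ℤ ((1 + θ) / 2) := by
    refine ⟨X ^ 2 - X + C n, ?_, ?_⟩
    · monicity!
    · rw [eval₂_add, eval₂_sub, eval₂_pow, eval₂_X, eval₂_C, hq]; simp
  obtain ⟨w, hwc⟩ : ∃ w : 𝓞 K, algebraMap (𝓞 K) K w = (1 + θ) / 2 := ⟨⟨_, hi⟩, rfl⟩
  let φ : 𝓞 K →+* ℂ := e.comp (algebraMap (𝓞 K) K)
  refine class_count (φ := φ) (w := w) (t := 1) (n := n) (e.injective.comp RingOfIntegers.coe_injective) hK ?_ ?_ ?_ ?_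
  · have : φ w = (1 + e θ) / 2 := by
      change e (algebraMap (𝓞 K) K w) = _
      rw [hwc, map_div₀, map_add, map_one, map_ofNat]
    rw [this]; simpa using he.2
  · apply RingOfIntegers.coe_injective
    rw [map_pow, map_sub, map_mul, map_intCast, hwc, hq, map_intCast]
    push_cast; ring
  · have := hp.pos; omega
  · intro x
    obtain ⟨m, l, k, h1, hk⟩ := int_coords hp h5 hθ hK he (x : K) x.2
    have hmp : ((p : ℤ) % 4 = 3) := by omega
    have key : m % 2 = l % 2 := by
      have hml : (m ^ 2 + 5 * p * l ^ 2) % 4 = 0 := by omega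
      have hm1 : (m ^ 2 + 5 * p * l ^ 2) % 4 = (m ^ 2 % 4 + 3 * (l ^ 2 % 4)) % 4 := by
        rw [Int.add_emod, Int.mul_emod (5 * (p : ℤ)), show (5 * (p : ℤ)) % 4 = 3 by omega, Int.add_emod (m ^ 2 % 4), Int.emod_emod]; omega
      rcases sq_mod4 m with hm | hm <;> rcases sq_mod4 l with hl | hl <;> omega
    refine ⟨(m - l) / 2, l, RingOfIntegers.coe_injective ?_⟩
    have hm : ((2 * ((m - l) / 2) : ℤ) : K) = ((m - l : ℤ) : K) := by congr 1; omega
    push_cast at hm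
    apply mul_left_cancel₀ h2
    change 2 * (algebraMap (𝓞 K) K x) = _ at h1
    rw [h1, map_add, map_mul, map_intCast, map_intCast, hwc, mul_add, hm]; field_simp; ring_nf
end IntRing

section Levels
variable {N n : ℤ} {τ τ' : ℍ}
/-- `τ` is fixed by an integral matrix of trace `t` and determinant `n`. -/
def FixBy (t n : ℤ) (τ : ℍ) : Prop := ∃ X : Mp, Mtr X = t ∧ Mdet X = n ∧ X • τ = τ
lemma FixBy.smul {t : ℤ} (h : FixBy t n τ) (γ : SL(2, ℤ)) : FixBy t n (ofSL γ • τ) := by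
  obtain ⟨X, h1, h2, h3⟩ := h
  have hd : Mdet (Mp.adj (ofSL γ)) = 1 := by
    rw [Mdet_eq, ← ofSL_det γ, Mdet_eq]; simp [Mp.adj]; ring
  refine ⟨ofSL γ * X * Mp.adj (ofSL γ), ?_, ?_, ?_⟩
  · have h4 := ofSL_det γ
    rw [Mdet_eq] at h4
    rw [← h1]
    simp only [Mtr, Mp.mul_entries]
    simp only [ofSL_coe] at h4
    simp [Mp.adj]
    linear_combination (X 0 0 + X 1 1) * h4
  · rw [Mdet_mul, Mdet_mul, ofSL_det, hd, h2]; ring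
  · rw [← mul_smul, mul_assoc, mul_assoc, Mp.adj_mul, mul_smul, mul_smul, Mp.sc_smul, h3]
lemma FixBy.of_j {t : ℤ} (h : FixBy t n τ) (hj : jf τ' = jf τ) : FixBy t n τ' := by
  obtain ⟨γ, rfl⟩ := j_inj hj
  rw [← ofSL_smul]; exact h.smul γ
/-- Parity type of a trace zero matrix fixing `τ`. -/
def OddCM (N : ℤ) (τ : ℍ) : Prop :=
  ∃ X : Mp, Mtr X = 0 ∧ Mdet X = N ∧ X • τ = τ ∧ ¬ (Even (X 0 1) ∧ Even (X 1 0))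
lemma FixBy.double (hN : 4 * n = N + 1) (h0 : 0 < N) {W : Mp} (h1 : Mtr W = 1) (h2 : Mdet W = n) (h3 : W • τ = τ) :
    ∃ X : Mp, Mtr X = 0 ∧ Mdet X = N ∧ X • τ = τ ∧
      (X : M2) = !![2 * W 0 0 - 1, 2 * W 0 1; 2 * W 1 0, 1 - 2 * W 0 0] := by
  rw [Mtr] at h1
  rw [Mdet_eq] at h2
  have hd : (2 * W 0 0 - 1) * (1 - 2 * W 0 0) - 2 * W 0 1 * (2 * W 1 0) = N := by
    linear_combination 4 * h2 - 4 * W 0 0 * h1 + hN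
  refine ⟨mkM (2 * W 0 0 - 1) (2 * W 0 1) (2 * W 1 0) (1 - 2 * W 0 0) (by rw [hd]; exact h0), ?_, ?_, ?_, rfl⟩
  · simp [Mtr]
  · rw [Mdet_eq]; simpa using hd
  · obtain ⟨f1, f2⟩ := fix_coords h3
    have h1' : (W 0 0 : ℝ) + W 1 1 = 1 := mod_cast h1
    apply fix_of_coords
    · simp; linear_combination 2 * f1 - 2 * h1'
    · simp; linear_combination 2 * f2
lemma FixBy.half (hN : 4 * n = N + 1) (h0 : 0 < N) {X : Mp} (h1 : Mtr X = 0) (h2 : Mdet X = N) (h3 : X • τ = τ)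
    (hb : Even (X 0 1)) (hc : Even (X 1 0)) : FixBy 1 n τ := by
  rw [Mtr] at h1
  rw [Mdet_eq] at h2
  obtain ⟨f1, f2⟩ := fix_coords h3
  obtain ⟨b, hb⟩ := hb
  obtain ⟨c, hc⟩ := hc
  have hd : X 1 1 = - X 0 0 := by linarith
  have ha : ¬ Even (X 0 0) := by
    rintro ⟨a, ha⟩
    rw [hd, ha, hb, hc] at h2
    have : 4 * (-(a * a) - b * c) = N := by linear_combination h2
    omega
  obtain ⟨a, ha⟩ := Int.not_even_iff_odd.1 ha
  rw [hd, ha, hc] at f1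
  rw [hb, hc] at f2
  rw [hd, ha, hb, hc] at h2
  have hdet : (a + 1) * (-a) - b * c = n := by linarith
  refine ⟨mkM (a + 1) b c (-a) (by rw [hdet]; linarith), ?_, ?_, ?_⟩
  · simp [Mtr]
  · rw [Mdet_eq]; simpa using hdet
  · push_cast at f1 f2
    apply fix_of_coords
    · simp; linarith
    · simp; linarith
lemma FixBy.not_odd (hN : 4 * n = N + 1) (h0 : 0 < N) (h : FixBy 1 n τ) (h' : OddCM N τ) : False := by
  obtain ⟨W, h1, h2, h3⟩ := h
  obtain ⟨X, g1, g2, g3, g4⟩ := FixBy.double hN h0 h1 h2 h3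
  obtain ⟨Y, k1, k2, k3, k4⟩ := h'
  rcases fix_unique k3 g3 k1 g1 (by rw [k2, g2]) with h | h
  · apply k4; rw [h, g4]; simp
  · apply k4; rw [h, h, g4]; simp
lemma OddCM.smul (hN : 4 * n = N + 1) (h0 : 0 < N) (h : OddCM N τ) (γ : SL(2, ℤ)) : OddCM N (ofSL γ • τ) := by
  by_contra hc
  obtain ⟨X, h1, h2, h3, h4⟩ := h
  obtain ⟨Y, g1, g2, g3⟩ := FixBy.smul (⟨X, h1, h2, h3⟩ : FixBy 0 N τ) γ
  have h5 : FixBy 1 n (ofSL γ • τ) := by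
    by_cases he : Even (Y 0 1) ∧ Even (Y 1 0)
    · exact FixBy.half hN h0 g1 g2 g3 he.1 he.2
    · exact absurd ⟨Y, g1, g2, g3, he⟩ hc
  have h6 := h5.smul γ⁻¹
  rw [← mul_smul, ← map_mul, inv_mul_cancel, map_one, one_smul] at h6
  exact h6.not_odd hN h0 ⟨X, h1, h2, h3, h4⟩
lemma OddCM.of_j (hN : 4 * n = N + 1) (h0 : 0 < N) (h : OddCM N τ) (hj : jf τ' = jf τ) : OddCM N τ' := by
  obtain ⟨γ, rfl⟩ := j_inj hj
  rw [← ofSL_smul]; exact h.smul hN h0 γ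
def al : Option (Fin 2) → ℤ → ℤ → Prop
  | none, _, y => ¬ Even y
  | some 0, x, _ => ¬ Even x
  | some 1, x, y => Even (x + y)
lemma push_aux {X X' R : Mp} (h3 : X • τ = τ) (h : Mp.sc 2 (by norm_num) * X' = R * X * Mp.adj R) :
    X' • (R • τ) = R • τ := by
  rw [← Mp.sc_smul 2 (by norm_num) (X' • (R • τ)), ← mul_smul, h, mul_smul, mul_smul, ← mul_smul (Mp.adj R), Mp.adj_mul, Mp.sc_smul, h3]
lemma push (hN : 4 * n = N + 1) (h0 : 0 < N) {W : Mp} (h1 : Mtr W = 1) (h2 : Mdet W = n) (h3 : W • τ = τ) (i : Option (Fin 2)) :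
    ∃ X : Mp, Mtr X = 0 ∧ Mdet X = N ∧ X • (rep 2 i • τ) = rep 2 i • τ ∧ ¬ Even (X 0 0) ∧ ¬ Even (X 1 1) ∧
      (i = none → Even (X 0 1)) ∧ (i ≠ none → Even (X 1 0)) ∧
      ((Even (X 0 1) ∧ Even (X 1 0)) ↔ ¬ al i (W 0 1) (W 1 0)) := by
  obtain ⟨Y, g1, g2, g3, g4⟩ := FixBy.double hN h0 h1 h2 h3
  rw [Mtr] at h1
  rw [Mdet_eq] at h2
  set w := W 0 0
  set x := W 0 1
  set y := W 1 0
  have hd : (2 * w - 1) * (1 - 2 * w) - 4 * x * y = N := by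
    linear_combination 4 * h2 - 4 * w * h1 + hN
  rcases i with _ | i
  · have hd' : (2 * w - 1) * (1 - 2 * w) - 4 * x * y = N := by linarith
    refine ⟨mkM (2 * w - 1) (4 * x) y (1 - 2 * w) (by rw [hd']; exact h0), ?_, ?_, ?_, ?_⟩
    · simp [Mtr]
    · rw [Mdet_eq]; simpa using hd'
    · apply push_aux g3
      apply Mp.ext' <;> simp [Mp.mul_entries, Mp.sc, Mp.adj, rep, g4] <;> ring
    · simp [al, Int.even_sub, Int.even_mul, parity_simps]
      have e4 : Even (4 : ℤ) := by decide
      tauto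
  · fin_cases i
    · have hd' : (2 * w - 1) * (1 - 2 * w) - x * (4 * y) = N := by linarith
      refine ⟨mkM (2 * w - 1) x (4 * y) (1 - 2 * w) (by rw [hd']; exact h0), ?_, ?_, ?_, ?_⟩
      · simp [Mtr]
      · rw [Mdet_eq]; simpa using hd'
      · apply push_aux g3
        apply Mp.ext' <;> simp [Mp.mul_entries, Mp.sc, Mp.adj, rep, g4] <;> ring
      · simp [al, Int.even_sub, Int.even_mul, parity_simps]
        have e4 : Even (4 : ℤ) := by decide
        tauto
    · have hd' : (2 * w + 2 * y - 1) * (1 - 2 * w - 2 * y) - (x - y + 1 - 2 * w) * (4 * y) = N := by linarith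
      refine ⟨mkM (2 * w + 2 * y - 1) (x - y + 1 - 2 * w) (4 * y) (1 - 2 * w - 2 * y) (by rw [hd']; exact h0), ?_, ?_, ?_, ?_⟩
      · simp [Mtr]; ring
      · rw [Mdet_eq]; simpa using hd'
      · apply push_aux g3
        apply Mp.ext' <;> simp [Mp.mul_entries, Mp.sc, Mp.adj, rep, g4] <;> ring
      · simp [al, Int.even_sub, Int.even_mul, parity_simps]
        have e4 : Even (4 : ℤ) := by decide
        rw [← Int.not_even_iff_odd]
        tauto
lemma push_iff (hN : 4 * n = N + 1) (h0 : 0 < N) {W : Mp} (h1 : Mtr W = 1) (h2 : Mdet W = n) (h3 : W • τ = τ) (i : Option (Fin 2)) :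
    OddCM N (rep 2 i • τ) ↔ al i (W 0 1) (W 1 0) := by
  obtain ⟨X, g1, g2, g3, _, _, _, _, g4⟩ := push hN h0 h1 h2 h3 i
  constructor
  · intro h
    by_contra hc
    rw [← g4] at hc
    exact (FixBy.half hN h0 g1 g2 g3 hc.1 hc.2).not_odd hN h0 h
  · intro h
    refine ⟨X, g1, g2, g3, fun h' => ?_⟩
    rw [g4] at h'; exact h' h
lemma OddCM.down (hN : 4 * n = N + 1) (h : OddCM N τ) : ∃ τ₀ i, FixBy 1 n τ₀ ∧ jf τ = jX (rep 2 i) τ₀ := by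
  obtain ⟨X, h1, h2, h3, h4⟩ := h
  have h0 : 0 < N := h2 ▸ Mp.pos X
  have hadj : ∀ R : Mp, Mp.adj R • R • τ = τ := fun R => by rw [← mul_smul, Mp.adj_mul, Mp.sc_smul]
  rw [Mtr] at h1
  rw [Mdet_eq] at h2
  set a := X 0 0 with ha
  set b := X 0 1 with hb
  set c := X 1 0 with hc
  have hd : X 1 1 = - a := by linarith
  have hX : (X : M2) = !![a, b; c, -a] := by
    rw [← hd]; exact Matrix.eta_fin_two _
  rw [hd] at h2
  have key : ∀ (R Y : Mp), Mp.sc 2 (by norm_num) * Y = R * X * Mp.adj R → Even (Y 0 1) → Even (Y 1 0) →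
      Mtr Y = 0 → Mdet Y = N → FixBy 1 n (R • τ) := fun R Y e e1 e2 e3 e4 =>
    FixBy.half hN h0 e3 e4 (push_aux h3 e) e1 e2
  rcases Int.even_or_odd' a with ⟨a', ha' | ha'⟩
  · -- a even
    have hbc : b * c = 4 * (-(a' * a') - n) + 1 := by rw [ha'] at h2; linear_combination hN - h2
    have hb1 : ¬ Even b := by
      rintro ⟨b', hb'⟩; rw [hb'] at hbc
      have : 2 * (b' * c) = 4 * (-(a' * a') - n) + 1 := by linear_combination hbc
      omega
    have hc1 : ¬ Even c := by
      rintro ⟨b', hb'⟩; rw [hb'] at hbc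
      have : 2 * (b * b') = 4 * (-(a' * a') - n) + 1 := by linear_combination hbc
      omega
    obtain ⟨b', hb'⟩ := Int.not_even_iff_odd.1 hb1
    obtain ⟨c', hc'⟩ := Int.not_even_iff_odd.1 hc1
    have hpar : Even (b' - c') := by
      rw [hb', hc'] at hbc
      have : b' + c' = 2 * (-(a' * a') - n - b' * c') := by linarith
      rw [Int.even_iff]; omega
    obtain ⟨e, he⟩ := hpar
    have hdet : (a + c) * (-a - c) - (-a' + e) * 2 * (2 * c) = N := by
      rw [← h2, ha', hb', hc', show b' = c' + 2 * e by linarith]; ring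
    have hf := key (rep 2 (some 1)) (mkM (a + c) ((-a' + e) * 2) (2 * c) (-a - c) (by rw [hdet]; exact h0)) (by
      apply Mp.ext' <;> simp [Mp.mul_entries, Mp.sc, Mp.adj, rep, hX]
      · ring
      · rw [ha', hb', hc', show b' = c' + 2 * e by linarith]; ring
      · ring
      · ring) (by simp) (by simp) (by simp [Mtr]) (by rw [Mdet_eq]; simpa using hdet)
    refine ⟨_, none, hf, ?_⟩
    let γ : SL(2, ℤ) := ⟨!![1, -1; 0, 1], by simp [Matrix.det_fin_two]⟩
    have hγ : ofSL γ * rep 2 none = Mp.adj (rep 2 (some 1)) := by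
      have hγ : ((ofSL γ : Mp) : M2) = !![1, -1; 0, 1] := rfl
      apply Mp.ext' <;> simp [Mp.mul_entries, Mp.adj, rep, hγ]
    rw [← jX_left γ, hγ, jX, hadj]
  · have hbc : b * c = 4 * (-(a' * a') - a' - n) := by rw [ha'] at h2; linear_combination hN - h2
    by_cases hb1 : Even b
    · have hc1 : Odd c := by
        rw [← Int.not_even_iff_odd]; intro hc1; exact h4 ⟨hb1, hc1⟩
      have h4b : (4 : ℤ) ∣ b := by
        have : IsCoprime (4 : ℤ) c := by
          have := (Int.isCoprime_iff_gcd_eq_one.2 (Int.isCoprime_iff_gcd_eq_one.1 (Int.isCoprime_two_left.2 hc1))).pow_left (m := 2)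
          simpa using this
        exact this.dvd_of_dvd_mul_right ⟨_, hbc⟩
      obtain ⟨b', hb'⟩ := h4b
      have hdet : a * (-a) - 2 * b' * (2 * c) = N := by rw [← h2, hb']; ring
      have hf := key (rep 2 (some 0)) (mkM a (2 * b') (2 * c) (-a) (by rw [hdet]; exact h0)) (by
        apply Mp.ext' <;> simp [Mp.mul_entries, Mp.sc, Mp.adj, rep, hX]
        · ring
        · rw [hb']; ring
        · ring) (by simp) (by simp) (by simp [Mtr]) (by rw [Mdet_eq]; simpa using hdet)
      refine ⟨_, none, hf, ?_⟩
      have hγ : rep 2 none = Mp.adj (rep 2 (some 0)) := by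
        apply Mp.ext' <;> simp [Mp.adj, rep]
      rw [hγ, jX, hadj]
    · have h4c : (4 : ℤ) ∣ c := by
        have : IsCoprime (4 : ℤ) b := by
          have := (Int.isCoprime_two_left.2 (Int.not_even_iff_odd.1 hb1)).pow_left (m := 2)
          simpa using this
        exact this.dvd_of_dvd_mul_left ⟨_, hbc⟩
      obtain ⟨c', hc'⟩ := h4c
      have hdet : a * (-a) - 2 * b * (2 * c') = N := by rw [← h2, hc']; ring
      have hf := key (rep 2 none) (mkM a (2 * b) (2 * c') (-a) (by rw [hdet]; exact h0)) (by
        apply Mp.ext' <;> simp [Mp.mul_entries, Mp.sc, Mp.adj, rep, hX]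
        · ring
        · rw [hc']; ring
        · ring) (by simp) (by simp) (by simp [Mtr]) (by rw [Mdet_eq]; simpa using hdet)
      refine ⟨_, some 0, hf, ?_⟩
      have hγ : rep 2 (some 0) = Mp.adj (rep 2 none) := by
        apply Mp.ext' <;> simp [Mp.adj, rep]
      rw [hγ, jX, hadj]
lemma parB {i i' : Option (Fin 2)} {G : Mp} (h1 : i = none → i' = none → Even (G 0 1))
    (h2 : i = none → i' ≠ none → Even (G 1 1)) (h3 : i ≠ none → i' = none → Even (G 0 0))
    (h4 : i ≠ none → i' ≠ none → Even (G 1 0)) (r s : Fin 2) :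
    Even (((Mp.adj (rep 2 i') * G * rep 2 i : Mp) : M2) r s) := by
  rcases i with _ | i <;> rcases i' with _ | i'
  · have := h1 rfl rfl
    fin_cases r <;> fin_cases s <;>
      simp [Mp.mul_entries, Mp.adj, rep, Int.even_add, Int.even_mul, this]
  · have := h2 rfl (by simp)
    fin_cases i' <;> fin_cases r <;> fin_cases s <;>
      simp [Mp.mul_entries, Mp.adj, rep, Int.even_add, Int.even_mul, this]
  · have := h3 (by simp) rfl
    fin_cases i <;> fin_cases r <;> fin_cases s <;>
      simp [Mp.mul_entries, Mp.adj, rep, Int.even_add, Int.even_mul, this]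
  · have := h4 (by simp) (by simp)
    fin_cases i <;> fin_cases i' <;> fin_cases r <;> fin_cases s <;>
      simp [Mp.mul_entries, Mp.adj, rep, Int.even_add, Int.even_mul, this]
lemma push_inj (hN : 4 * n = N + 1) (h0 : 0 < N) (hτ : FixBy 1 n τ) (hτ' : FixBy 1 n τ') {i i' : Option (Fin 2)}
    (ho : OddCM N (rep 2 i • τ)) (hj : jX (rep 2 i) τ = jX (rep 2 i') τ') :
    ∃ γ δ : SL(2, ℤ), Mp.sc 2 (by norm_num) * ofSL δ = Mp.adj (rep 2 i') * ofSL γ * rep 2 i ∧ ofSL δ • τ = τ' := by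
  have ho' : OddCM N (rep 2 i' • τ') := ho.of_j hN h0 hj.symm
  obtain ⟨W, h1, h2, h3⟩ := hτ
  obtain ⟨W', h1', h2', h3'⟩ := hτ'
  obtain ⟨X, g1, g2, g3, g4, g5, g6, g7, g8⟩ := push hN h0 h1 h2 h3 i
  obtain ⟨Y, k1, k2, k3, k4, k5, k6, k7, k8⟩ := push hN h0 h1' h2' h3' i'
  rw [push_iff hN h0 h1 h2 h3] at ho
  rw [push_iff hN h0 h1' h2' h3'] at ho'
  have g9 : ¬ (Even (X 0 1) ∧ Even (X 1 0)) := by rw [g8]; exact not_not.2 ho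
  have k9 : ¬ (Even (Y 0 1) ∧ Even (Y 1 0)) := by rw [k8]; exact not_not.2 ho'
  obtain ⟨γ, hγ⟩ := j_inj (hj.symm : jf (rep 2 i' • τ') = jf (rep 2 i • τ))
  rw [← ofSL_smul] at hγ
  -- conjugate
  have hZ : ∃ Z : Mp, Z * ofSL γ = ofSL γ * X ∧ Mtr Z = 0 ∧ Mdet Z = N ∧ Z • (rep 2 i' • τ') = rep 2 i' • τ' := by
    refine ⟨ofSL γ * X * ofSL γ⁻¹, ?_, ?_, ?_, ?_⟩
    · rw [mul_assoc, ← map_mul, inv_mul_cancel, map_one, mul_one]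
    · have e : ∀ Y : Mp, Mtr Y = (Y : M2).trace := fun Y => by rw [Matrix.trace_fin_two, Mtr]
      rw [e] at g1 ⊢
      have h1 : ((ofSL γ⁻¹ : Mp) : M2) * (ofSL γ : Mp) = 1 := by
        have : (ofSL γ⁻¹ * ofSL γ : Mp) = 1 := by rw [← map_mul, inv_mul_cancel, map_one]
        exact congrArg Subtype.val this
      show ((ofSL γ : M2) * (X : M2) * (ofSL γ⁻¹ : M2)).trace = _
      rw [Matrix.trace_mul_comm, ← mul_assoc, h1, one_mul, g1]
    · rw [Mdet_mul, Mdet_mul, ofSL_det, ofSL_det, g2]; ring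
    · rw [hγ, ← mul_smul, mul_assoc, ← map_mul, inv_mul_cancel, map_one, mul_one, mul_smul, g3]
  obtain ⟨Z, z1, z2, z3, z4⟩ := hZ
  have hZY : ∀ r s, Even ((Z : M2) r s) ↔ Even ((Y : M2) r s) := by
    intro r s
    rcases fix_unique z4 k3 z2 k1 (by rw [z3, k2]) with h | h
    · rw [h]
    · rw [h]; simp
  have c00 := congrArg (fun Z : Mp => Even (Z 0 0)) z1
  have c01 := congrArg (fun Z : Mp => Even (Z 0 1)) z1
  have c10 := congrArg (fun Z : Mp => Even (Z 1 0)) z1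
  have c11 := congrArg (fun Z : Mp => Even (Z 1 1)) z1
  simp only [Mp.mul_entries, Int.even_add, Int.even_mul, hZY, k4, k5, g4, g5, eq_iff_iff, false_or, or_false] at c00 c01 c10 c11
  have hB : ∀ r s, Even (((Mp.adj (rep 2 i') * ofSL γ * rep 2 i : Mp) : M2) r s) := by
    apply parB
    · rintro rfl rfl
      have ga := g6 rfl
      have kb := k6 rfl
      have gc : ¬ Even (X 1 0) := fun h => g9 ⟨ga, h⟩
      have kc : ¬ Even (Y 1 0) := fun h => k9 ⟨kb, h⟩
      simp only [ga, kb, gc, kc, true_or, or_true, false_or, or_false, iff_true, true_iff] at c00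
      revert c00; clear * -; tauto
    · rintro rfl hi
      have ga := g6 rfl
      have kb := k7 hi
      have gc : ¬ Even (X 1 0) := fun h => g9 ⟨ga, h⟩
      have kc : ¬ Even (Y 0 1) := fun h => k9 ⟨h, kb⟩
      simp only [ga, kb, gc, kc, true_or, or_true, false_or, or_false, iff_true, true_iff] at c10
      revert c10; clear * -; tauto
    · rintro hi rfl
      have ga := g7 hi
      have kb := k6 rfl
      have gc : ¬ Even (X 0 1) := fun h => g9 ⟨h, ga⟩
      have kc : ¬ Even (Y 1 0) := fun h => k9 ⟨kb, h⟩
      simp only [ga, kb, gc, kc, true_or, or_true, false_or, or_false, iff_true, true_iff] at c01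
      revert c01; clear * -; tauto
    · rintro hi hi'
      have ga := g7 hi
      have kb := k7 hi'
      have gc : ¬ Even (X 0 1) := fun h => g9 ⟨h, ga⟩
      have kc : ¬ Even (Y 0 1) := fun h => k9 ⟨h, kb⟩
      simp only [ga, kb, gc, kc, true_or, or_true, false_or, or_false, iff_true, true_iff] at c00
      revert c00; clear * -; tauto
  set B := Mp.adj (rep 2 i') * ofSL γ * rep 2 i with hBdef
  have hBτ : B • τ = τ' := by
    rw [hBdef, mul_smul, mul_smul, ← hγ, ← mul_smul, Mp.adj_mul, Mp.sc_smul]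
  have hBd : Mdet B = 4 := by
    have hd : Mdet (Mp.adj (rep 2 i')) = 2 := by
      have e := rep_det (l := 2) i'
      rw [Mdet_eq] at e ⊢
      simp [Mp.adj]
      push_cast at e
      linarith
    rw [hBdef, Mdet_mul, Mdet_mul, ofSL_det, hd, rep_det]; norm_num
  obtain ⟨a, ha⟩ := hB 0 0
  obtain ⟨b, hb⟩ := hB 0 1
  obtain ⟨c, hc⟩ := hB 1 0
  obtain ⟨d, hd⟩ := hB 1 1
  have hdet : a * d - b * c = 1 := by
    rw [Mdet_eq, ha, hb, hc, hd] at hBd; linarith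
  obtain ⟨δ, hδ⟩ := exists_ofSL (X := mkM a b c d (by rw [hdet]; norm_num)) (by rw [Mdet_eq]; simpa using hdet)
  have hB2 : Mp.sc 2 (by norm_num) * ofSL δ = B := by
    rw [← hδ]
    apply Mp.ext' <;> simp [Mp.mul_entries, Mp.sc, ha, hb, hc, hd, two_mul]
  refine ⟨γ, δ, hB2, ?_⟩
  rw [← hBτ, ← hB2, mul_smul, Mp.sc_smul]
end Levels

lemma isSquare_of_mul {m y z : ℤ} (hy : y ≠ 0) (h : m * y ^ 2 = z ^ 2) : IsSquare m := by
  have hd : y ^ 2 ∣ z ^ 2 := ⟨m, by rw [← h]; ring⟩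
  obtain ⟨w, rfl⟩ := (Int.pow_dvd_pow_iff (by norm_num)).1 hd
  refine ⟨w, ?_⟩
  have : y ^ 2 ≠ 0 := pow_ne_zero _ hy
  apply mul_right_cancel₀ this
  rw [h]; ring
lemma not_sq_mul {p : ℕ} (hp : p.Prime) {k : ℤ} (hk : ¬ (p : ℤ) ∣ k) : ¬ IsSquare (k * p) := by
  rintro ⟨w, hw⟩
  have hpz : Prime (p : ℤ) := Nat.prime_iff_prime_int.1 hp
  have h1 : (p : ℤ) ∣ w := by
    have : (p : ℤ) ∣ w * w := ⟨k, by rw [← hw]; ring⟩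
    exact (hpz.dvd_or_dvd this).elim id id
  obtain ⟨u, rfl⟩ := h1
  apply hk
  refine ⟨u * u, ?_⟩
  apply mul_right_cancel₀ hpz.ne_zero
  rw [hw]; ring
section
variable {p : ℕ} {n : ℤ} {τ : ℍ}
lemma stab_one (hp : p.Prime) (h5 : 5 < p) (hn : 4 * n = 5 * p + 1) (hτ : FixBy 1 n τ) {δ : SL(2, ℤ)}
    (h : ofSL δ • τ = τ) : (ofSL δ : Mp) 1 0 = 0 := by
  obtain ⟨W, h1, h2, h3⟩ := hτ
  have e1 := fix_disc h3
  have e2 := fix_disc h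
  rw [h1, h2] at e1
  rw [ofSL_det] at e2
  by_contra hc
  set c := (ofSL δ : Mp) 1 0
  set w := W 1 0
  set t := Mtr (ofSL δ)
  have hnr : (4 * n : ℝ) = 5 * p + 1 := mod_cast hn
  have him := τ.im_pos
  push_cast at e1 e2
  have key : (4 - t ^ 2) * w ^ 2 = (5 * p) * c ^ 2 := by
    have : ((4 - t ^ 2) * w ^ 2 : ℝ) * (2 * τ.im) ^ 2 = ((5 * p) * c ^ 2) * (2 * τ.im) ^ 2 := by
      linear_combination (-(2 * w * τ.im) ^ 2) * e2 + (2 * c * τ.im) ^ 2 * e1 + (2 * c * τ.im) ^ 2 * hnr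
    have := mul_right_cancel₀ (by positivity) this
    exact_mod_cast this
  have hp0 : (0 : ℤ) < p := mod_cast hp.pos
  have hc2 : 0 < c ^ 2 := by positivity
  have hw : 0 < (4 - t ^ 2) := by
    by_contra hle
    push Not at hle
    have : (4 - t ^ 2) * w ^ 2 ≤ 0 := mul_nonpos_of_nonpos_of_nonneg hle (sq_nonneg _)
    have : 0 < (5 * (p : ℤ)) * c ^ 2 := by positivity
    linarith
  have ht1 : t < 2 := by nlinarith
  have ht2 : -2 < t := by nlinarith
  have hpn : ∀ k : ℤ, 0 < k → k < p → ¬ (p : ℤ) ∣ k := fun k h1 h2 h3 => by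
    have := Int.le_of_dvd h1 h3; linarith
  have hpz : Prime (p : ℤ) := Nat.prime_iff_prime_int.1 hp
  have h5p : (5 : ℤ) < p := mod_cast h5
  have h15 : ¬ (p : ℤ) ∣ 15 := fun h => by
    rw [show (15 : ℤ) = 3 * 5 by norm_num] at h
    rcases hpz.dvd_or_dvd h with h | h
    · exact hpn 3 (by norm_num) (by linarith) h
    · exact hpn 5 (by norm_num) (by linarith) h
  have : t = -1 ∨ t = 0 ∨ t = 1 := by omega
  rcases this with ht | ht | ht
  · exact not_sq_mul hp h15 (isSquare_of_mul (y := c) (z := 3 * w) hc (by rw [ht] at key; linear_combination -3 * key))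
  · exact not_sq_mul hp (hpn 5 (by norm_num) (by linarith)) (isSquare_of_mul (y := c) (z := 2 * w) hc (by rw [ht] at key; linear_combination -key))
  · exact not_sq_mul hp h15 (isSquare_of_mul (y := c) (z := 3 * w) hc (by rw [ht] at key; linear_combination -3 * key))
lemma push_inj' (hp : p.Prime) (h5 : 5 < p) (hn : 4 * n = 5 * p + 1) {τ' : ℍ} (hτ : FixBy 1 n τ) (hτ' : FixBy 1 n τ')
    (hr : jf τ = jf τ' → τ = τ') {i i' : Option (Fin 2)}
    (ho : OddCM (5 * p) (rep 2 i • τ)) (hj : jX (rep 2 i) τ = jX (rep 2 i') τ') : τ = τ' ∧ i = i' := by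
  have hp0 : (0 : ℤ) < 5 * p := by have := hp.pos; positivity
  obtain ⟨γ, δ, h1, h2⟩ := push_inj hn hp0 hτ hτ' ho hj
  have hττ : τ = τ' := hr (by rw [← h2, jf_smul])
  subst hττ
  refine ⟨rfl, ?_⟩
  have hc := stab_one hp h5 hn hτ h2
  obtain ⟨hb, had⟩ := fix_scalar h2 hc
  have h3 : ofSL δ * rep 2 i' = ofSL γ * rep 2 i := by
    have hcm : ofSL δ * rep 2 i' = rep 2 i' * ofSL δ := by
      apply Mp.ext' <;> simp only [Mp.mul_entries, hb, hc, had] <;> ring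
    apply Mp.cancel_left (X := Mp.sc 2 (by norm_num))
    have h4 : rep 2 i' * (Mp.sc 2 (by norm_num) * ofSL δ) = rep 2 i' * (Mp.adj (rep 2 i') * ofSL γ * rep 2 i) := by rw [h1]
    have h6 : Mp.sc (Mdet (rep 2 i')) (Mp.pos _).ne' = Mp.sc 2 (by norm_num) := by
      congr 1; exact rep_det i'
    simp only [← mul_assoc] at h4
    rw [Mp.sc_comm, Mp.mul_adj, h6] at h4
    rw [hcm, ← mul_assoc, ← mul_assoc, h4]
  refine (rep_unique Nat.prime_two h3 ?_).symm
  intro hD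
  have := Div_det _ hD
  rw [Mdet_mul, ofSL_det, rep_det] at this
  norm_num at this
lemma al_count (hn : 4 * n = 5 * p + 1) {W : Mp} (h1 : Mtr W = 1) (h2 : Mdet W = n) [DecidablePred fun i => al i (W 0 1) (W 1 0)] :
    (Finset.univ.filter fun i => al i (W 0 1) (W 1 0)).card = if p % 8 = 3 then 1 else 3 := by
  classical
  rw [Mdet_eq] at h2
  rw [Mtr] at h1
  have h11 : W 1 1 = 1 - W 0 0 := by linarith
  rw [h11] at h2
  generalize W 0 1 = x at *
  generalize W 1 0 = y at *
  generalize W 0 0 = w at *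
  have hw : Even (w * (1 - w)) := by
    rcases Int.even_or_odd w with h | h
    · exact h.mul_right _
    · exact (Int.even_sub.2 (by simp [Int.not_even_iff_odd.2 h])).mul_left _
  have hxy : Even (x * y) ↔ Even n := by
    rw [← h2, Int.even_sub]; simp [hw]
  have hn8 : Even n ↔ p % 8 = 3 := by rw [Int.even_iff]; omega
  rw [hn8, Int.even_mul] at hxy
  rw [Finset.card_filter, Fintype.sum_option, Fin.sum_univ_two]
  simp only [al, Int.even_add]
  by_cases hx : Even x <;> by_cases hy : Even y <;> simp_all [Int.not_even_iff_odd.2]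
lemma count_three (hp : p.Prime) (h5 : 5 < p) (hn : 4 * n = 5 * p + 1) (hfin : {r : ℂ | ∃ τ, jf τ = r ∧ FixBy 1 n τ}.Finite) :
    (PV.Zset p).ncard = (if p % 8 = 3 then 2 else 4) * {r : ℂ | ∃ τ, jf τ = r ∧ FixBy 1 n τ}.ncard := by
  classical
  have hp0 : (0 : ℤ) < 5 * p := by have := hp.pos; positivity
  set ZW := {r : ℂ | ∃ τ, jf τ = r ∧ FixBy 1 n τ} with hZW
  set Z1 := {r : ℂ | ∃ τ, jf τ = r ∧ OddCM (5 * p) τ} with hZ1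
  have hZ : PV.Zset p = ZW ∪ Z1 := by
    ext r
    constructor
    · rintro ⟨τ, hr, X, h1, h2, h3⟩
      by_cases he : Even (X 0 1) ∧ Even (X 1 0)
      · exact Or.inl ⟨τ, hr, FixBy.half hn hp0 h2 h1 h3 he.1 he.2⟩
      · exact Or.inr ⟨τ, hr, X, h2, h1, h3, he⟩
    · rintro (⟨τ, hr, W, h1, h2, h3⟩ | ⟨τ, hr, X, h1, h2, h3, -⟩)
      · obtain ⟨X, g1, g2, g3, -⟩ := FixBy.double hn hp0 h1 h2 h3
        exact ⟨τ, hr, X, g2, g1, g3⟩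
      · exact ⟨τ, hr, X, h2, h1, h3⟩
  have hdis : Disjoint ZW Z1 := by
    rw [Set.disjoint_left]
    rintro r ⟨τ, hr, h⟩ ⟨τ', hr', h'⟩
    exact FixBy.not_odd hn hp0 h (h'.of_j hn hp0 (hr.trans hr'.symm))
  choose! t ht1 ht2 using (fun r (hr : r ∈ ZW) => hr)
  let S : Finset (Σ _ : ℂ, Option (Fin 2)) := hfin.toFinset.sigma fun r => Finset.univ.filter fun i => OddCM (5 * p) (rep 2 i • t r)
  have hS : Z1 = (S.image fun x => jX (rep 2 x.2) (t x.1) : Finset ℂ) := by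
    ext r
    simp only [Finset.coe_image, Set.mem_image, S, Finset.mem_coe, Finset.mem_sigma, mem_filter, mem_univ, true_and, Set.Finite.mem_toFinset]
    constructor
    · rintro ⟨τ, hr, ho⟩
      obtain ⟨τ₀, i, h1, h2⟩ := OddCM.down hn ho
      have hm : jf τ₀ ∈ ZW := ⟨τ₀, rfl, h1⟩
      obtain ⟨γ, hγ⟩ := j_inj (ht1 _ hm).symm
      have hγ' : τ₀ = ofSL γ • t (jf τ₀) := by rw [ofSL_smul]; exact hγ
      have h3 : jX (rep 2 i) τ₀ = jX (rep 2 (sig Nat.prime_two (ofSL γ) i)) (t (jf τ₀)) := by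
        conv_lhs => rw [hγ']
        exact fam_j.perm Nat.prime_two γ _ i
      refine ⟨⟨jf τ₀, sig Nat.prime_two (ofSL γ) i⟩, ⟨hm, ?_⟩, ?_⟩
      · refine ho.of_j hn hp0 ?_
        rw [h2, h3]; rfl
      · rw [← h3, ← h2, hr]
    · rintro ⟨⟨r', i⟩, ⟨hm, ho⟩, rfl⟩
      exact ⟨_, rfl, ho⟩
  have hinj : Set.InjOn (fun x : (Σ _ : ℂ, Option (Fin 2)) => jX (rep 2 x.2) (t x.1)) S := by
    rintro ⟨r, i⟩ hx ⟨r', i'⟩ hx' he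
    simp only [S, Finset.mem_coe, Finset.mem_sigma, mem_filter, mem_univ, true_and, Set.Finite.mem_toFinset] at hx hx' he
    obtain ⟨g1, g2⟩ := push_inj' hp h5 hn (ht2 r hx.1) (ht2 r' hx'.1) (fun h => by
      rw [ht1 r hx.1, ht1 r' hx'.1] at h; rw [h]) hx.2 he
    have : r = r' := by rw [← ht1 r hx.1, ← ht1 r' hx'.1, g1]
    subst this; subst g2; rfl
  have hcard : S.card = hfin.toFinset.card * (if p % 8 = 3 then 1 else 3) := by
    rw [Finset.card_sigma, Finset.sum_const_nat]
    intro r hr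
    obtain ⟨W, h1, h2, h3⟩ := ht2 r (hfin.mem_toFinset.1 hr)
    rw [← al_count hn h1 h2]
    congr 1
    ext i
    simp only [mem_filter, mem_univ, true_and]
    exact push_iff hn hp0 h1 h2 h3 i
  rw [hZ, Set.ncard_union_eq hdis hfin (by rw [hS]; exact Finset.finite_toSet _), hS, Set.ncard_coe_finset,
    Finset.card_image_of_injOn hinj, hcard, Set.ncard_eq_toFinset_card _ hfin]
  split_ifs <;> ring
end
lemma Z_card {p : ℕ} (hp : p.Prime) (h5 : 5 < p) {K : Type} [Field K] [NumberField K] {θ : K}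
    (hθ : θ ^ 2 = -((5 * p : ℕ) : K)) (hK : Module.finrank ℚ K = 2) :
    ((PV.Zset p).ncard : ℚ) = ap p * (NumberField.classNumber K : ℚ) := by
  have h2 : p % 2 = 1 := Nat.Prime.eq_two_or_odd hp |>.resolve_left (by omega)
  have ho : Odd p := Nat.odd_iff.2 h2
  rw [ap, jacobiSym.at_neg_one ho, jacobiSym.at_two ho]
  have h4 : p % 4 = 1 ∨ p % 4 = 3 := by omega
  rcases h4 with h4 | h4
  · rw [class_one hp h5 h4 hθ hK, ZMod.χ₄_nat_one_mod_four h4]; norm_num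
  · obtain ⟨n, hn⟩ : ∃ n : ℤ, 4 * n = 5 * p + 1 := ⟨(5 * p + 1) / 4, by omega⟩
    have h3 := class_three hp h5 h4 hθ hK hn
    have hpos : 0 < NumberField.classNumber K := Fintype.card_pos
    have hfin : {r : ℂ | ∃ τ, jf τ = r ∧ FixBy 1 n τ}.Finite := by
      apply Set.finite_of_ncard_pos
      unfold FixBy
      rw [h3]; exact hpos
    have h5' := count_three hp h5 hn hfin
    unfold FixBy at h5'
    rw [h5', h3, ZMod.χ₄_nat_three_mod_four h4, ZMod.χ₈_nat_eq_if_mod_eight]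
    have h8 : p % 8 = 3 ∨ p % 8 = 7 := by omega
    rcases h8 with h8 | h8 <;> simp [h8, h2] <;> norm_num

/-! ### Places above `p` -/
lemma PV.exists_pv (p : ℕ) [hp : Fact p.Prime] (h2 : p ≠ 2) : Nonempty (PV p) := by
  let A : Subring ℂ := (castRingHom ℂ).range
  let I : Ideal A := Ideal.span {(p : A)}
  have hI : I ≠ ⊤ := by
    rw [Ne, Ideal.eq_top_iff_one, Ideal.mem_span_singleton]
    rintro ⟨⟨a, m, rfl⟩, h⟩
    have h1 : (1 : ℂ) = p * (m : ℂ) := by simpa using congrArg Subtype.val h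
    have h3 : (1 : ℤ) = p * m := mod_cast h1
    have h4 : (p : ℤ) ∣ 1 := ⟨m, h3⟩
    exact hp.out.one_lt.ne' (mod_cast Int.eq_one_of_dvd_one (by positivity) h4)
  obtain ⟨B, -, hB⟩ := Ideal.image_subset_nonunits_valuationSubring I hI
  refine ⟨⟨B, _, Complex.isPrimitiveRoot_exp p hp.out.ne_zero, ?_, h2⟩⟩
  rw [← ValuationSubring.mem_nonunits_iff]
  exact hB ⟨(p : A), Ideal.mem_span_singleton_self _, by simp⟩
/-! ### Good primes -/
def badP : List ℕ := [2, 3, 5, 7, 11, 13, 17, 19, 23, 29, 31, 37, 41, 43, 47, 53, 59, 61, 67, 71, 73, 79, 83, 89, 97, 109,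
  113, 127, 131, 137, 139, 149, 151, 157, 163, 181, 197, 211, 229, 233, 241, 257, 277, 281, 283, 307, 313, 317, 331, 349,
  353, 373, 379]
def badN : ℕ := badP.prod
def Smooth (n : ℤ) : Prop := n.natAbs ∣ badN ^ 300
instance (n : ℤ) : Decidable (Smooth n) := inferInstanceAs (Decidable (_ ∣ _))
lemma good_not_dvd {p : ℕ} (hp : p.Prime) (hr : 379 < p ∨ p ∈ Sset) : ¬ p ∣ badN := by
  intro h
  obtain ⟨a, ha, hpa⟩ := (Prime.dvd_prod_iff hp.prime).1 h
  have h1 : ∀ a ∈ badP, a ≤ 379 ∧ 0 < a ∧ ∀ q ∈ Sset, ¬ q ∣ a := by decide +kernel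
  obtain ⟨h2, h3, h4⟩ := h1 a ha
  rcases hr with hr | hr
  · have := Nat.le_of_dvd h3 hpa; omega
  · exact h4 p hr hpa
lemma good_ne {p : ℕ} (hp : p.Prime) (hr : 379 < p ∨ p ∈ Sset) (R : Type*) [Ring R] [CharP R p] {n : ℤ} (hn : Smooth n) :
    (n : R) ≠ 0 := by
  rw [Ne, CharP.intCast_eq_zero_iff R p]
  intro h
  have h1 : p ∣ n.natAbs := Int.natCast_dvd.1 h
  exact good_not_dvd hp hr (hp.dvd_of_dvd_pow (h1.trans hn))
lemma good_gt {p : ℕ} (hr : 379 < p ∨ p ∈ Sset) : 100 < p := by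
  rcases hr with h | h
  · omega
  · revert h; revert p; decide
/-! ### Integer polynomials as lists -/
def lev {R : Type*} [CommRing R] (x : R) : List ℤ → R
  | [] => 0
  | c :: l => c + x * lev x l
def mulx (v : ℤ) : ℤ → List ℤ → List ℤ
  | c, [] => [c]
  | c, a :: l => (c - v * a) :: mulx v a l
def prodL (vs : List ℤ) : List ℤ := vs.foldr (fun v l => mulx v 0 l) [1]
section
variable {R : Type*} [CommRing R] (x : R)
lemma lev_mulx (v : ℤ) (l : List ℤ) (c : ℤ) : lev x (mulx v c l) = c + (x - v) * lev x l := by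
  induction l generalizing c with
  | nil => simp [mulx, lev]
  | cons a l ih => rw [mulx, lev, ih, lev]; push_cast; ring
lemma lev_prodL (vs : List ℤ) : lev x (prodL vs) = (vs.map fun v : ℤ => x - (v : R)).prod := by
  induction vs with
  | nil => simp [prodL, lev]
  | cons v vs ih =>
    rw [List.map_cons, List.prod_cons, ← ih]
    change lev x (mulx v 0 (prodL vs)) = _
    rw [lev_mulx]; push_cast; ring
lemma lev_mod (l : ℕ) [CharP R l] (c : List ℤ) : lev x (c.map (· % (l : ℤ))) = lev x c := by
  induction c with
  | nil => rfl
  | cons a c ih =>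
    rw [List.map_cons, lev, lev, ih]
    congr 1
    rw [← sub_eq_zero, ← Int.cast_sub, CharP.intCast_eq_zero_iff R l]
    exact (Int.mod_modEq a l).symm.dvd
lemma lev_int (l : List ℤ) (y : ℤ) : lev (y : R) l = ((lev y l : ℤ) : R) := by
  induction l with
  | nil => simp [lev]
  | cons c l ih => rw [lev, ih, lev]; push_cast; rfl
def toP : List ℤ → ℤ[X]
  | [] => 0
  | c :: l => C c + X * toP l
lemma toP_eval {S : Type*} [CommRing S] (x : S) (l : List ℤ) : ((toP l).map (castRingHom S)).eval x = lev x l := by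
  induction l with
  | nil => simp [toP, lev]
  | cons c l ih => simp [toP, lev, ih]
end
/-- The class polynomials as coefficient lists. -/
def hl : ℕ → List ℤ
  | 4 => [-1728, 1]
  | 11 => [32768, 1]
  | 16 => [-287496, 1]
  | 19 => [884736, 1]
  | 20 => [-681472000, -1264000, 1]
  | 24 => [14670139392, -4834944, 1]
  | 36 => [-1790957481984, -153542016, 1]
  | 51 => [6262062317568, 5541101568, 1]
  | 64 => [-7367066619912, -82226316240, 1]
  | 91 => [-3845689020776448, 10359073013760, 1]
  | 99 => [-56171326053810176, 37616060956672, 1]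
  | 84 => [-5133201653210986057826304, 88821246589810089394176, -5663679223085309952, -3196800946944, 1]
  | 96 => [-984163224549635621646336, 447805364111967209472, 670421055192156288, -23340144296736, 1]
  | _ => []
lemma toP_hl {d : ℕ} (hd : d ∈ Tfrak ∪ {20}) : classPoly d = toP (hl d) := by
  simp only [Tfrak, Finset.mem_union, mem_insert, mem_singleton] at hd
  rcases hd with (h | h | h | h | h | h | h | h | h | h | h | h) | h <;> subst h <;>
    simp only [classPoly, hl, toP] <;> simp only [map_neg, map_ofNat, map_one] <;> ring
lemma hl_monic {d : ℕ} (hd : d ∈ Tfrak ∪ {20}) : (classPoly d).Monic ∧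
    (classPoly d).natDegree = if d ≤ 19 then 1 else if d = 84 ∨ d = 96 then 4 else 2 := by
  simp only [Tfrak, Finset.mem_union, mem_insert, mem_singleton] at hd
  have key : ∀ f : ℤ[X], ∀ n, f.natDegree ≤ n → f.coeff n = 1 → f.Monic ∧ f.natDegree = n := fun f n h1 h2 =>
    ⟨monic_of_natDegree_le_of_coeff_eq_one n h1 h2, natDegree_eq_of_le_of_coeff_ne_zero h1 (by rw [h2]; norm_num)⟩
  rcases hd with (h | h | h | h | h | h | h | h | h | h | h | h) | h <;> subst h <;> refine key _ _ ?_ ?_ <;>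
    simp only [classPoly] <;> norm_num <;> first | compute_degree | (compute_degree; done) | skip

/-! ### Supersingular values at small primes -/
def ssv : ℕ → List ℤ
  | 7 => [1728]
  | 11 => [0, 1728]
  | 13 => [2592]
  | 17 => [0, 2592]
  | 19 => [1728, 4320]
  | 23 => [0, 1728, 4320]
  | _ => []
lemma ssv_iff {l : ℕ} [Fact l.Prime] (hl : l ∈ [7, 11, 13, 17, 19, 23]) (v : PV l) (α : v.kk) :
    v.A.eval α = 0 ↔ ∃ w ∈ ssv l, α = (w : ℤ) := by
  simp only [List.mem_cons, List.not_mem_nil, or_false] at hl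
  have key : ∀ a b : v.kk, a - b = 0 ↔ a = b := fun a b => sub_eq_zero
  rcases hl with h | h | h | h | h | h <;> subst h
  · rw [v.A_eq (n := 0) (s := 1) (a := 0) (by norm_num) (by norm_num) (by norm_num) (by norm_num)]
    simp [BZ, JZ, he, ssv, key]
  · rw [v.A_eq (n := 0) (s := 1) (a := 1) (by norm_num) (by norm_num) (by norm_num) (by norm_num)]
    simp [BZ, JZ, he, ssv, key]
  · rw [v.A_eq (n := 1) (s := 0) (a := 0) (by norm_num) (by norm_num) (by norm_num) (by norm_num)]
    simp [BZ, JZ, he, ssv, sum_range_succ, Nat.choose]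
    rw [← key α 2592]; ring_nf
  · rw [v.A_eq (n := 1) (s := 0) (a := 1) (by norm_num) (by norm_num) (by norm_num) (by norm_num)]
    simp [BZ, JZ, he, ssv, sum_range_succ, Nat.choose]
    rw [← key α 2592]; ring_nf
  · rw [v.A_eq (n := 1) (s := 1) (a := 0) (by norm_num) (by norm_num) (by norm_num) (by norm_num)]
    simp [BZ, JZ, he, ssv, sum_range_succ, Nat.choose]
    rw [← key α 4320, ← key α 1728]; ring_nf
  · rw [v.A_eq (n := 1) (s := 1) (a := 1) (by norm_num) (by norm_num) (by norm_num) (by norm_num)]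
    simp [BZ, JZ, he, ssv, sum_range_succ, Nat.choose]
    rw [← key α 4320, ← key α 1728, or_assoc]; ring_nf
lemma PV.rd_lev {p : ℕ} [Fact p.Prime] (v : PV p) {x : ℂ} (hx : x ∈ v.V) (l : List ℤ) :
    lev x l ∈ v.V ∧ v.rd (lev x l) = lev (v.rd x) l := by
  induction l with
  | nil => exact ⟨zero_mem _, v.rd_zero⟩
  | cons c l ih =>
    refine ⟨add_mem (intCast_mem _ c) (mul_mem hx ih.1), ?_⟩
    rw [lev, v.rd_add (intCast_mem _ c) (mul_mem hx ih.1), v.rd_mul hx ih.1, ih.2, v.rd_int, lev]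
lemma PV.root_mem {p d : ℕ} [Fact p.Prime] (v : PV p) (hd : d ∈ Tfrak ∪ {20}) {x : ℂ} (hx : lev x (hl d) = 0) : x ∈ v.V := by
  have hm := (hl_monic hd).1
  rw [toP_hl hd] at hm
  have h1 : IsIntegral ℤ x := ⟨toP (hl d), hm, by rw [← hx, ← toP_eval, eval_map]; rfl⟩
  have h2 : IsIntegral v.V x := h1.tower_top
  obtain ⟨y, rfl⟩ := IsIntegrallyClosed.isIntegral_iff.1 h2
  exact y.2
/-- Behaviour of the class polynomials at auxiliary primes. -/
def tab : ℕ → List (ℕ × Option (List ℤ))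
  | 4 => [(13, none)]
  | 11 => [(7, some [1728]), (13, some [2592])]
  | 16 => [(13, none)]
  | 19 => [(7, none), (11, none)]
  | 20 => [(7, none), (11, some [0, 1728])]
  | 24 => [(11, none), (23, some [1728, 4320])]
  | 36 => [(7, some [1728, 1728]), (23, some [0, 4320])]
  | 51 => [(11, none), (13, none)]
  | 64 => [(7, some [1728, 1728]), (23, some [0, 4320])]
  | 91 => [(7, some [1728, 1728]), (11, some [1728, 1728]), (19, none)]
  | 99 => [(7, some [1728, 1728]), (13, some [2592, 2592]), (19, some [1728, 1728])]
  | 84 => [(7, some [1728, 1728, 1728, 1728]), (13, some [2592, 2592, 2592, 2592]), (17, none)]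
  | 96 => [(11, none), (23, some [0, 1728, 4320, 4320])]
  | _ => []
lemma tab_prime {d : ℕ} (hd : d ∈ Tfrak ∪ {20}) : ∀ e ∈ tab d, e.1 ∈ [7, 11, 13, 17, 19, 23] := by
  revert d; decide +kernel
lemma tab_some {d : ℕ} (hd : d ∈ Tfrak ∪ {20}) : ∀ e ∈ tab d, ∀ vs ∈ e.2, (∀ w ∈ vs, w ∈ ssv e.1) ∧
    (hl d).map (· % (e.1 : ℤ)) = (prodL vs).map (· % (e.1 : ℤ)) := by
  revert d; decide +kernel
lemma tab_none {d : ℕ} (hd : d ∈ Tfrak ∪ {20}) : ∀ e ∈ tab d, e.2 = none → ∀ w ∈ ssv e.1, ¬ (e.1 : ℤ) ∣ lev w (hl d) := by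
  revert d; decide +kernel
lemma tab_ss {d : ℕ} (hd : d ∈ Tfrak ∪ {20}) {l : ℕ} {o : Option (List ℤ)} (he : (l, o) ∈ tab d) [Fact l.Prime] (v : PV l)
    {τ : ℍ} (hx : lev (jf τ) (hl d) = 0) : v.SS τ ↔ o.isSome := by
  have hm := v.root_mem hd hx
  have h1 : lev (v.rd (jf τ)) (hl d) = 0 := by rw [← (v.rd_lev hm _).2, hx, v.rd_zero]
  rw [PV.SS, ssv_iff (tab_prime hd _ he) v]
  cases o with
  | none =>
    simp only [Option.isSome_none, Bool.false_eq_true, iff_false]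
    rintro ⟨w, hw, h⟩
    rw [h, lev_int, CharP.intCast_eq_zero_iff v.kk l] at h1
    exact tab_none hd _ he rfl w hw h1
  | some vs =>
    simp only [Option.isSome_some, iff_true]
    obtain ⟨g1, g2⟩ := tab_some hd _ he vs rfl
    rw [← lev_mod _ l, g2, lev_mod, lev_prodL, List.prod_eq_zero_iff, List.mem_map] at h1
    obtain ⟨w, hw, h⟩ := h1
    exact ⟨w, g1 w hw, sub_eq_zero.1 h⟩
def dm (d : ℕ) : ℤ := if d ≤ 20 then 5 else 25
def Elim (d : ℕ) (D : ℤ) : Prop := ∃ e ∈ tab d, ¬ (e.1 : ℤ) ∣ D ∧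
  ((e.2.isSome = true) ↔ ∃ y ∈ range e.1, (e.1 : ℤ) ∣ D - (y : ℤ) ^ 2)
instance (d D) : Decidable (Elim d D) := inferInstanceAs (Decidable (∃ e ∈ tab d, _))
lemma elim_table {d : ℕ} (hd : d ∈ Tfrak ∪ {20}) : ∀ k ∈ range 10, (k : ℤ) ^ 2 - 4 * dm d < 0 →
    Elim d ((k : ℤ) ^ 2 - 4 * dm d) ∨ ∃ c ∈ range 101, ((k : ℤ) ^ 2 - 4 * dm d) * (-(d : ℤ)) = (c : ℤ) ^ 2 := by
  revert d; decide +kernel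
lemma cm_class {d : ℕ} (hd : d ∈ Tfrak ∪ {20}) {τ : ℍ} (hx : lev (jf τ) (hl d) = 0) {X : Mp} (hX : X • τ = τ)
    (hm : Mdet X = dm d) (hD : Mtr X ^ 2 - 4 * Mdet X < 0) :
    ∃ c ∈ range 101, (Mtr X ^ 2 - 4 * Mdet X) * (-(d : ℤ)) = (c : ℤ) ^ 2 := by
  have hk : Mtr X ^ 2 = ((Mtr X).natAbs : ℤ) ^ 2 := by simp
  have hk10 : (Mtr X).natAbs ∈ range 10 := by
    have : dm d ≤ 25 := by unfold dm; split_ifs <;> norm_num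
    rw [hm] at hD
    rw [mem_range]
    have h2 : |Mtr X| < 10 := abs_lt_of_sq_lt_sq (by linarith) (by norm_num)
    have h3 := Int.natCast_natAbs (Mtr X)
    omega
  have key := elim_table hd _ hk10
  rw [← hk, ← hm] at key
  refine (key hD).resolve_left ?_
  rintro ⟨⟨l, o⟩, he, h1, h2⟩
  dsimp only at h1 h2
  have hpr : l.Prime ∧ l ≠ 2 ∧ ¬ (l : ℤ) ∣ dm d := by
    have h3 := tab_prime hd _ he
    have h4 : ∀ l : ℕ, l ∈ [7, 11, 13, 17, 19, 23] → l.Prime ∧ l ≠ 2 ∧ ¬ (l : ℤ) ∣ 5 ∧ ¬ (l : ℤ) ∣ 25 := by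
      simp only [List.mem_cons, List.not_mem_nil, or_false, forall_eq_or_imp, forall_eq]; norm_num
    obtain ⟨g1, g2, g3, g4⟩ := h4 l h3
    refine ⟨g1, g2, ?_⟩
    unfold dm; split_ifs <;> assumption
  haveI : Fact l.Prime := ⟨hpr.1⟩
  obtain ⟨v⟩ := PV.exists_pv l hpr.2.1
  have h5 := v.ss_iff (v.root_mem hd hx) hX (by rw [hm]; exact hpr.2.2) hD h1
  rw [tab_ss hd he v hx, h2] at h5
  have h6 : (∃ y ∈ range l, (l : ℤ) ∣ Mtr X ^ 2 - 4 * Mdet X - (y : ℤ) ^ 2) ↔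
      ∃ y : ℤ, (l : ℤ) ∣ Mtr X ^ 2 - 4 * Mdet X - y ^ 2 := by
    constructor
    · rintro ⟨y, -, h⟩; exact ⟨y, h⟩
    · rintro ⟨y, h⟩
      have hl0 : (0 : ℤ) < l := mod_cast hpr.1.pos
      refine ⟨(y % l).toNat, ?_, ?_⟩
      · rw [mem_range, Int.toNat_lt (Int.emod_nonneg _ hl0.ne')]; exact Int.emod_lt_of_pos _ hl0
      · rw [Int.toNat_of_nonneg (Int.emod_nonneg _ hl0.ne')]
        have h7 : (l : ℤ) ∣ y ^ 2 - (y % l) ^ 2 := ((Int.mod_modEq y l).pow 2).dvd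
        have := dvd_add h h7
        rwa [sub_add_sub_cancel] at this
  rw [h6] at h5
  exact iff_not_self h5

/-! ### Partial derivatives of `Q5` and `Phi` -/
def Q5u {R : Type*} [CommRing R] (u v : R) : R :=
    6 * u ^ 5 - 9816057446400 * u ^ 4 - 986733643824 * u ^ 3 * v + 5138932531365697825013760 * u ^ 3
    - 6085653600 * u ^ 2 * v ^ 2 - 385625396691038276812800 * u ^ 2 * v - 840734333485318583412964695893606400 * u ^ 2
    - 9101880 * u * v ^ 3 + 766167221533089718368 * u * v ^ 2 - 384915879515721662041612112363520 * u * v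
    + 13385000085255995416974298830030136934400 * u - 3720 * v ^ 4 - 107878922099683200 * v ^ 3
    - 26898103232984020907026022400 * v ^ 2 - 35714002250464310712293507636763033600 * v
    - 53274330803424425450420160273356509151232000
def Q5v {R : Type*} [CommRing R] (u v : R) : R :=
    -246683410956 * u ^ 4 - 4057102400 * u ^ 3 * v - 128541798897012758937600 * u ^ 3 - 13652820 * u ^ 2 * v ^ 2
    + 766167221533089718368 * u ^ 2 * v - 192457939757860831020806056181760 * u ^ 2 - 14880 * u * v ^ 3
    - 323636766299049600 * u * v ^ 2 - 53796206465968041814052044800 * u * v - 35714002250464310712293507636763033600 * u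
    - 5 * v ^ 4 + 6664033865920 * v ^ 3 - 1325919398198903473496256 * v ^ 2 + 10991715298719481896207661148405760 * v
    - 277458457161876591676690089078008919883776
def Q5uu {R : Type*} [CommRing R] (u v : R) : R :=
    30 * u ^ 4 - 39264229785600 * u ^ 3 - 2960200931472 * u ^ 2 * v + 15416797594097093475041280 * u ^ 2
    - 12171307200 * u * v ^ 2 - 771250793382076553625600 * u * v - 1681468666970637166825929391787212800 * u - 9101880 * v ^ 3
    + 766167221533089718368 * v ^ 2 - 384915879515721662041612112363520 * v + 13385000085255995416974298830030136934400
def Q5uv {R : Type*} [CommRing R] (u v : R) : R :=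
    -986733643824 * u ^ 3 - 12171307200 * u ^ 2 * v - 385625396691038276812800 * u ^ 2 - 27305640 * u * v ^ 2
    + 1532334443066179436736 * u * v - 384915879515721662041612112363520 * u - 14880 * v ^ 3 - 323636766299049600 * v ^ 2
    - 53796206465968041814052044800 * v - 35714002250464310712293507636763033600
def Q5vv {R : Type*} [CommRing R] (u v : R) : R :=
    -4057102400 * u ^ 3 - 27305640 * u ^ 2 * v + 766167221533089718368 * u ^ 2 - 44640 * u * v ^ 2
    - 647273532598099200 * u * v - 53796206465968041814052044800 * u - 20 * v ^ 3 + 19992101597760 * v ^ 2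
    - 2651838796397806946992512 * v + 10991715298719481896207661148405760
def dPhi {R : Type*} [CommRing R] (x y : R) : R := -Q5u (-(x + y)) (x * y) + x * Q5v (-(x + y)) (x * y)
def ddPhi {R : Type*} [CommRing R] (x y : R) : R :=
  Q5uu (-(x + y)) (x * y) - 2 * x * Q5uv (-(x + y)) (x * y) + x ^ 2 * Q5vv (-(x + y)) (x * y)
section
variable {R S : Type*} [CommRing R] [CommRing S] (f : R →+* S) (u v : R)
lemma map_Q5u : f (Q5u u v) = Q5u (f u) (f v) := by
  simp only [Q5u, map_add, map_sub, map_mul, map_pow, map_neg, map_ofNat]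
lemma map_Q5v : f (Q5v u v) = Q5v (f u) (f v) := by
  simp only [Q5v, map_add, map_sub, map_mul, map_pow, map_neg, map_ofNat]
lemma map_Q5uu : f (Q5uu u v) = Q5uu (f u) (f v) := by
  simp only [Q5uu, map_add, map_sub, map_mul, map_pow, map_neg, map_ofNat]
lemma map_Q5uv : f (Q5uv u v) = Q5uv (f u) (f v) := by
  simp only [Q5uv, map_add, map_sub, map_mul, map_pow, map_neg, map_ofNat]
lemma map_Q5vv : f (Q5vv u v) = Q5vv (f u) (f v) := by
  simp only [Q5vv, map_add, map_sub, map_mul, map_pow, map_neg, map_ofNat]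
lemma map_dPhi (x y : R) : f (dPhi x y) = dPhi (f x) (f y) := by simp [dPhi, map_Q5u, map_Q5v]
lemma map_ddPhi (x y : R) : f (ddPhi x y) = ddPhi (f x) (f y) := by
  have h2 : f 2 = 2 := map_ofNat f 2
  simp [ddPhi, map_Q5uu, map_Q5uv, map_Q5vv, h2]
lemma der_Q5 (a b : R[X]) : derivative (Q5 a b) = Q5u a b * derivative a + Q5v a b * derivative b := by
  unfold Q5 Q5u Q5v
  simp only [derivative_add, derivative_sub, derivative_mul, derivative_pow, derivative_neg, derivative_ofNat, zero_mul, mul_zero, map_natCast]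
  push_cast
  ring
lemma der_Q5u (a b : R[X]) : derivative (Q5u a b) = Q5uu a b * derivative a + Q5uv a b * derivative b := by
  unfold Q5u Q5uu Q5uv
  simp only [derivative_add, derivative_sub, derivative_mul, derivative_pow, derivative_neg, derivative_ofNat, zero_mul, mul_zero, map_natCast]
  push_cast
  ring
lemma der_Q5v (a b : R[X]) : derivative (Q5v a b) = Q5uv a b * derivative a + Q5vv a b * derivative b := by
  unfold Q5v Q5uv Q5vv
  simp only [derivative_add, derivative_sub, derivative_mul, derivative_pow, derivative_neg, derivative_ofNat, zero_mul, mul_zero, map_natCast]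
  push_cast
  ring
lemma der_Phi (a : R[X]) (ha : derivative a = 0) : derivative (Phi a X) = dPhi a X := by
  rw [Phi, der_Q5, dPhi]; simp [ha]; ring
lemma der_dPhi (a : R[X]) (ha : derivative a = 0) : derivative (dPhi a X) = ddPhi a X := by
  rw [dPhi, derivative_add, derivative_neg, derivative_mul, der_Q5u, der_Q5v, ddPhi]; simp [ha]; ring
lemma Phi_diag (x : R) : Phi x x = -(lev x (hl 4) * lev x (hl 11) * lev x (hl 16) * lev x (hl 19)) ^ 2 * lev x (hl 20) := by
  simp only [Phi, Q5, lev, hl]; push_cast; ring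
end

/-! ### The singular points of `Q5 = 0` -/
def T2 : Finset ℕ := {24, 36, 51, 64, 84, 91, 96, 99}
def pD (d : ℕ) : ℤ := if d = 84 then 21 else if d = 96 then 6 else 1
def pa0 (d : ℕ) : ℤ := if d = 84 then -1598400473472 else if d = 96 then -11670072148368 else (hl d).getD 1 0
def pa1 (d : ℕ) : ℤ := if d = 84 then 348799965696 else if d = 96 then -4764286992816 else 0
def pb0 (d : ℕ) : ℤ := if d = 84 then 92704725504000 else if d = 96 then 10900447400376000 else (hl d).getD 0 0
def pb1 (d : ℕ) : ℤ := if d = 84 then -20235870240768 else if d = 96 then 4450089034924416 else 0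
def pu {R : Type*} [CommRing R] (d : ℕ) (r : R) : R := pa0 d + pa1 d * r
def pv {R : Type*} [CommRing R] (d : ℕ) (r : R) : R := pb0 d + pb1 d * r
def zu (d : ℕ) : ℤ√(pD d) := ⟨pa0 d, pa1 d⟩
def zv (d : ℕ) : ℤ√(pD d) := ⟨pb0 d, pb1 d⟩
def hesN {R : Type*} [CommRing R] (u v : R) : R :=
  Q5uu u v ^ 2 + 2 * Q5uu u v * Q5uv u v * u + Q5uu u v * Q5vv u v * (u ^ 2 - 2 * v) + 4 * Q5uv u v ^ 2 * v
    + 2 * Q5uv u v * Q5vv u v * u * v + Q5vv u v ^ 2 * v ^ 2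
lemma T2_sub {d : ℕ} (hd : d ∈ T2) : d ∈ Tfrak ∪ {20} := by
  revert d; decide
lemma zpt_sing : ∀ d ∈ T2, Q5 (zu d) (zv d) = 0 ∧ Q5u (zu d) (zv d) = 0 ∧ Q5v (zu d) (zv d) = 0 := by
  decide +kernel
lemma zpt_hess : ∀ d ∈ T2, Smooth (hesN (zu d) (zv d)).norm := by
  decide +kernel
section
variable {R S : Type*} [CommRing R] [CommRing S]
lemma map_hesN (f : R →+* S) (u v : R) : f (hesN u v) = hesN (f u) (f v) := by
  simp only [hesN, map_add, map_sub, map_mul, map_pow, map_ofNat, map_Q5uu, map_Q5uv, map_Q5vv]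
lemma ddPhi_mul (x y : R) : ddPhi x y * ddPhi y x = hesN (-(x + y)) (x * y) := by
  have e1 : -(y + x) = -(x + y) := by ring
  have e2 : y * x = x * y := by ring
  unfold ddPhi hesN
  rw [e1, e2]
  generalize Q5uu (-(x + y)) (x * y) = A
  generalize Q5uv (-(x + y)) (x * y) = B
  generalize Q5vv (-(x + y)) (x * y) = D
  ring
def zl (d : ℕ) (r : R) (hr : r ^ 2 = (pD d : R)) : ℤ√(pD d) →+* R := Zsqrtd.lift ⟨r, by rw [← hr]; ring⟩
lemma zl_u {d : ℕ} {r : R} (hr : r ^ 2 = (pD d : R)) : zl d r hr (zu d) = pu d r := by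
  simp [zl, zu, pu, Zsqrtd.lift]
lemma zl_v {d : ℕ} {r : R} (hr : r ^ 2 = (pD d : R)) : zl d r hr (zv d) = pv d r := by
  simp [zl, zv, pv, Zsqrtd.lift]
lemma pt_sing {d : ℕ} (hd : d ∈ T2) {r : R} (hr : r ^ 2 = (pD d : R)) :
    Q5 (pu d r) (pv d r) = 0 ∧ Q5u (pu d r) (pv d r) = 0 ∧ Q5v (pu d r) (pv d r) = 0 := by
  obtain ⟨h1, h2, h3⟩ := zpt_sing d hd
  rw [← zl_u hr, ← zl_v hr, ← map_Q5, ← map_Q5u, ← map_Q5v, h1, h2, h3]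
  simp
lemma pt_norm {p : ℕ} (hp : p.Prime) (hr : 379 < p ∨ p ∈ Sset) [CharP R p] {d : ℕ} {r : R} (h : r ^ 2 = (pD d : R))
    {z : ℤ√(pD d)} (hz : Smooth z.norm) : zl d r h z ≠ 0 := by
  intro h0
  have h1 : zl d r h (z * star z) = 0 := by rw [map_mul, h0, zero_mul]
  rw [← Zsqrtd.norm_eq_mul_conj, map_intCast] at h1
  exact good_ne hp hr R hz h1
lemma pt_hess {p : ℕ} (hp : p.Prime) (hr : 379 < p ∨ p ∈ Sset) [CharP R p] {d : ℕ} (hd : d ∈ T2) {r : R} (h : r ^ 2 = (pD d : R)) :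
    hesN (pu d r) (pv d r) ≠ 0 := by
  rw [← zl_u h, ← zl_v h, ← map_hesN]
  exact pt_norm hp hr h (zpt_hess d hd)
lemma lev_split [IsDomain R] {d : ℕ} (hd : d ∈ T2) {r : R} (h : r ^ 2 = (pD d : R)) (x : R) :
    lev x (hl d) = 0 ↔ x ^ 2 + pu d r * x + pv d r = 0 ∨ x ^ 2 + pu d (-r) * x + pv d (-r) = 0 := by
  simp only [T2, mem_insert, mem_singleton] at hd
  rcases hd with rfl | rfl | rfl | rfl | rfl | rfl | rfl | rfl
  case inr.inr.inr.inr.inl =>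
    rw [← mul_eq_zero]
    have : lev x (hl 84) = (x ^ 2 + pu 84 r * x + pv 84 r) * (x ^ 2 + pu 84 (-r) * x + pv 84 (-r)) := by
      simp [pu, pv, pa0, pa1, pb0, pb1, hl, lev, pD] at h ⊢
      linear_combination (348799965696 * x - 20235870240768) ^ 2 * h
    rw [this]
  case inr.inr.inr.inr.inr.inr.inl =>
    rw [← mul_eq_zero]
    have : lev x (hl 96) = (x ^ 2 + pu 96 r * x + pv 96 r) * (x ^ 2 + pu 96 (-r) * x + pv 96 (-r)) := by
      simp [pu, pv, pa0, pa1, pb0, pb1, hl, lev, pD] at h ⊢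
      linear_combination (-4764286992816 * x + 4450089034924416) ^ 2 * h
    rw [this]
  all_goals
    simp [pu, pv, pa0, pa1, pb0, pb1, hl, lev]
    ring_nf
end

/-! ### Class polynomial roots: reduction criterion -/
lemma Phi_poly (τ : ℍ) : ∏ i, (X - C (jX (rep 5 i) τ)) = Phi (C (jf τ)) (X : ℂ[X]) := by
  apply Polynomial.funext
  intro c
  have h1 : eval c (Phi (C (jf τ)) (X : ℂ[X])) = Phi (jf τ) c := by
    have := map_Phi (evalRingHom c) (C (jf τ)) (X : ℂ[X])
    simpa using this
  rw [h1, Phi_symm, ← Phi_prod, eval_prod]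
  simp
lemma adj_det (X : Mp) : Mdet (Mp.adj X) = Mdet X := by
  rw [Mdet_eq, Mdet_eq]; simp [Mp.adj, mkM_coe]; ring
lemma sc_congr {m n : ℤ} (h : m = n) (hm : m ≠ 0) (hn : n ≠ 0) : Mp.sc m hm = Mp.sc n hn := by subst h; rfl
lemma cm_fix25 {τ : ℍ} {i i' : Option (Fin 5)} (hi : i ≠ i') (h : jX (rep 5 i) τ = jX (rep 5 i') τ) :
    ∃ X : Mp, X • τ = τ ∧ Mdet X = 25 ∧ Mtr X ^ 2 - 4 * Mdet X < 0 := by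
  obtain ⟨γ, hγ⟩ := jX_eq_fix h
  have h1 : (Mp.adj (rep 5 i') * (ofSL γ * rep 5 i)) • τ = τ := by
    rw [mul_smul, hγ, ← mul_smul, Mp.adj_mul, Mp.sc_smul]
  have hd' : Mdet (Mp.adj (rep 5 i')) = 5 := by
    rw [adj_det, rep_det]; norm_num
  have hd : Mdet (Mp.adj (rep 5 i') * (ofSL γ * rep 5 i)) = 25 := by
    rw [Mdet_mul, Mdet_mul, hd', ofSL_det, rep_det]; norm_num
  refine ⟨_, h1, hd, fix_disc_neg h1 fun hc => hi ?_⟩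
  obtain ⟨h2, h3⟩ := fix_scalar h1 hc
  have e := hd
  rw [Mdet_eq] at e
  set Z := Mp.adj (rep 5 i') * (ofSL γ * rep 5 i) with hZ
  obtain ⟨n, hn, hn0, h4⟩ : ∃ n : ℤ, Z 0 0 = 5 * n ∧ n ≠ 0 ∧ Z 0 0 ≠ 0 := by
    rw [hc, ← h3, mul_zero, sub_zero] at e
    have : (Z 0 0 - 5) * (Z 0 0 + 5) = 0 := by linear_combination e
    rcases mul_eq_zero.1 this with h | h
    · exact ⟨1, by omega, by omega, by omega⟩
    · exact ⟨-1, by omega, by omega, by omega⟩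
  have hZs : Z = Mp.sc 5 (by norm_num) * Mp.sc n hn0 := by
    apply Mp.ext' <;> simp [Mp.mul_entries, Mp.sc, mkM_coe, hn, h2, hc, ← h3]
  have h5 : Mp.sc 5 (by norm_num) * (ofSL γ * rep 5 i) = Mp.sc 5 (by norm_num) * (Mp.sc n hn0 * rep 5 i') := by
    have h6 : rep 5 i' * Z = Mp.sc 5 (by norm_num) * (ofSL γ * rep 5 i) := by
      rw [hZ, ← mul_assoc, Mp.mul_adj, sc_congr (rep_det i')]; rfl
    rw [← h6, hZs, ← mul_assoc, Mp.sc_comm, Mp.sc_comm 5 _ (rep 5 i'), ← mul_assoc, Mp.sc_comm, mul_assoc]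
  refine rep_unique (by norm_num) (Mp.cancel_left h5) fun hdv => ?_
  have := Div_det _ hdv
  rw [Mdet_mul, ofSL_det, rep_det] at this
  norm_num at this
lemma cm_fix {d : ℕ} (hd : d ∈ Tfrak ∪ {20}) {τ : ℍ} (hx : lev (jf τ) (hl d) = 0) :
    ∃ X : Mp, X • τ = τ ∧ Mdet X = dm d ∧ Mtr X ^ 2 - 4 * Mdet X < 0 := by
  by_cases h2 : d ∈ T2
  · have hdm : dm d = 25 := by revert h2; clear * -; revert d; decide
    rw [hdm]
    obtain ⟨r, hr⟩ := IsAlgClosed.exists_pow_nat_eq ((pD d : ℤ) : ℂ) (n := 2) (by norm_num)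
    obtain ⟨r', hr', hq⟩ : ∃ r' : ℂ, r' ^ 2 = (pD d : ℂ) ∧ jf τ ^ 2 + pu d r' * jf τ + pv d r' = 0 := by
      rcases (lev_split h2 hr (jf τ)).1 hx with h | h
      · exact ⟨r, hr, h⟩
      · exact ⟨-r, by rw [neg_sq, hr], h⟩
    obtain ⟨e1, e2, e3⟩ := pt_sing h2 hr'
    set x := jf τ with hxx
    set y := -pu d r' - x with hy
    have hu : -(x + y) = pu d r' := by rw [hy]; ring
    have hv : x * y = pv d r' := by rw [hy]; linear_combination -hq
    have g1 : Phi x y = 0 := by rw [Phi, hu, hv, e1]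
    have g2 : dPhi x y = 0 := by rw [dPhi, hu, hv, e2, e3]; simp
    by_contra hcon
    have hinj : Function.Injective fun i => jX (rep 5 i) τ := by
      intro i i' h
      by_contra hne
      exact hcon (cm_fix25 hne h)
    have hsep := (separable_prod_X_sub_C_iff (F := ℂ)).2 hinj
    have hr1 : aeval y (∏ i, (X - C (jX (rep 5 i) τ))) = 0 := by
      have := map_Phi (evalRingHom y) (C (jf τ)) (X : ℂ[X])
      rw [Phi_poly, coe_aeval_eq_eval]
      simp only [coe_evalRingHom, eval_C, eval_X] at this
      rw [this, ← hxx, g1]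
    refine hsep.aeval_derivative_ne_zero hr1 ?_
    rw [Phi_poly, der_Phi _ derivative_C, coe_aeval_eq_eval]
    have := map_dPhi (evalRingHom y) (C (jf τ)) (X : ℂ[X])
    simp only [coe_evalRingHom, eval_C, eval_X] at this
    rw [this, ← hxx, g2]
  · have h3 : d ∈ ({4, 11, 16, 19, 20} : Finset ℕ) := by revert hd h2; clear * -; revert d; decide
    have hdm : dm d = 5 := by revert h3; clear * -; revert d; decide
    rw [hdm]
    have h0 : Phi (jf τ) (jf τ) = 0 := by
      rw [Phi_diag]
      simp only [mem_insert, mem_singleton] at h3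
      rcases h3 with rfl | rfl | rfl | rfl | rfl <;> rw [hx] <;> ring
    rw [← Phi_prod, Finset.prod_eq_zero_iff] at h0
    obtain ⟨i, -, hi⟩ := h0
    obtain ⟨γ, hγ⟩ := jX_fix (sub_eq_zero.1 hi)
    have hdet : Mdet (ofSL γ * rep 5 i) = 5 := by rw [Mdet_mul, ofSL_det, rep_det]; norm_num
    refine ⟨_, hγ, hdet, fix_disc_neg hγ fun hc => ?_⟩
    obtain ⟨h4, h5⟩ := fix_scalar hγ hc
    rw [Mdet_eq, hc, ← h5, mul_zero, sub_zero] at hdet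
    generalize (ofSL γ * rep 5 i : Mp) 0 0 = z at hdet
    have hz : z.natAbs * z.natAbs = 5 := by
      have := congrArg Int.natAbs hdet
      rwa [Int.natAbs_mul] at this
    have : z.natAbs < 3 := by nlinarith
    interval_cases z.natAbs <;> omega
lemma PV.cm_ss {p : ℕ} [hp : Fact p.Prime] (hp1 : 100 < p) (v : PV p) {d : ℕ} (hd : d ∈ Tfrak ∪ {20}) {τ : ℍ}
    (hx : lev (jf τ) (hl d) = 0) : v.SS τ ↔ ¬ IsSquare ((-(d : ℤ) : ℤ) : ZMod p) := by
  obtain ⟨Y, hY, hm, hD⟩ := cm_fix hd hx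
  obtain ⟨c, hc, hcd⟩ := cm_class hd hx hY hm hD
  rw [mem_range] at hc
  have hd0 : 0 < d := by clear * - hd; revert d; decide
  have hpz := Nat.prime_iff_prime_int.1 hp.1
  have hc0 : c ≠ 0 := by
    rintro rfl
    have : (Mtr Y ^ 2 - 4 * Mdet Y) * (-(d : ℤ)) > 0 := mul_pos_of_neg_of_neg hD (by omega)
    simp at hcd; omega
  have hpc : ¬ (p : ℤ) ∣ (c : ℤ) := by
    intro h
    have := Nat.le_of_dvd (Nat.pos_of_ne_zero hc0) (Int.natCast_dvd_natCast.1 h)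
    omega
  have hpcc : ¬ (p : ℤ) ∣ (Mtr Y ^ 2 - 4 * Mdet Y) * (-(d : ℤ)) := by
    rw [hcd]; exact fun h => hpc (hpz.dvd_of_dvd_pow h)
  have hpD : ¬ (p : ℤ) ∣ Mtr Y ^ 2 - 4 * Mdet Y := fun h => hpcc (h.mul_right _)
  have hpd : ¬ (p : ℤ) ∣ (-(d : ℤ)) := fun h => hpcc (h.mul_left _)
  have hpm : ¬ (p : ℤ) ∣ Mdet Y := by
    rw [hm]
    intro h
    have h25 : (p : ℤ) ∣ 25 := by
      refine h.trans ?_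
      unfold dm; split_ifs <;> norm_num
    have := Int.le_of_dvd (by norm_num) h25
    omega
  rw [v.ss_iff (v.root_mem hd hx) hY hpm hD hpD, not_iff_not]
  set D := Mtr Y ^ 2 - 4 * Mdet Y with hDD
  have h1 : (∃ y : ℤ, (p : ℤ) ∣ D - y ^ 2) ↔ IsSquare ((D : ℤ) : ZMod p) := by
    constructor
    · rintro ⟨y, hy⟩
      refine ⟨(y : ZMod p), ?_⟩
      rw [← ZMod.intCast_zmod_eq_zero_iff_dvd] at hy
      push_cast at hy
      linear_combination hy
    · rintro ⟨y, hy⟩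
      obtain ⟨z, rfl⟩ := ZMod.intCast_surjective y
      refine ⟨z, ?_⟩
      rw [← ZMod.intCast_zmod_eq_zero_iff_dvd]
      push_cast
      linear_combination hy
  rw [h1]
  have hD0 : ((D : ℤ) : ZMod p) ≠ 0 := by rwa [Ne, ZMod.intCast_zmod_eq_zero_iff_dvd]
  have hd0 : ((-(d : ℤ) : ℤ) : ZMod p) ≠ 0 := by rwa [Ne, ZMod.intCast_zmod_eq_zero_iff_dvd]
  have hcd' : ((D : ℤ) : ZMod p) * ((-(d : ℤ) : ℤ) : ZMod p) = (c : ZMod p) ^ 2 := by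
    rw [← Int.cast_mul, hcd]; push_cast; rfl
  constructor
  · rintro ⟨y, hy⟩
    have hy0 : y ≠ 0 := by rintro rfl; simp at hy; exact hD0 (by simpa using hy)
    refine ⟨c / y, ?_⟩
    rw [hy] at hcd'
    field_simp
    linear_combination hcd'
  · rintro ⟨y, hy⟩
    have hy0 : y ≠ 0 := by rintro rfl; simp at hy; exact hd0 (by simpa using hy)
    refine ⟨c / y, ?_⟩
    rw [hy] at hcd'
    field_simp
    linear_combination hcd'
lemma PV.red_ss {p : ℕ} [hp : Fact p.Prime] (hp1 : 100 < p) (v : PV p) {d : ℕ} (hd : d ∈ Tfrak ∪ {20}) {α : v.kk}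
    (hα : lev α (hl d) = 0) : v.A.eval α = 0 ↔ ¬ IsSquare ((-(d : ℤ) : ℤ) : ZMod p) := by
  have h0 : (((toP (hl d)).map (castRingHom v.V)).map (IsLocalRing.residue v.V)) = (toP (hl d)).map (castRingHom v.kk) := by
    rw [Polynomial.map_map]; congr 1
  have h1 : (((toP (hl d)).map (castRingHom v.V)).map (algebraMap v.V ℂ)) = (toP (hl d)).map (castRingHom ℂ) := by
    rw [Polynomial.map_map]; congr 1
  have hmon := (hl_monic hd).1
  rw [toP_hl hd] at hmon
  obtain ⟨x, hx, rfl, hx0⟩ := v.root_lift (f := (toP (hl d)).map (castRingHom v.V)) (by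
    rw [h0]; exact (hmon.map _).ne_zero) (α := α) (by rw [h0, toP_eval, hα])
  rw [h1, toP_eval] at hx0
  obtain ⟨τ, rfl⟩ := jf_surj x
  exact v.cm_ss hp1 hd hx0

/-! ### Every singular point of `Q5 = 0` is listed -/
section
variable {F : Type*} [Field F]
def Uy (y : F) : F := 28105850880 - 1152216576 * y + 18820800 * y ^ 2 - 153090 * y ^ 3 + 620 * y ^ 4 - y ^ 5
def Vy (y : F) : F := (y ^ 2 - 11520) ^ 3
def Dl (y : F) : F := (y ^ 2 - 204 * y + 10512) * (y ^ 2 - 276 * y + 20496) * (y ^ 2 - 192 * y + 16128) * (y ^ 2 + 7938) * (y ^ 2 + 145152) * (y ^ 2 - 1088 * y + 388864) *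
  ((y ^ 2 + 18 * y + 32760) ^ 2 - 21 * (54 * y + 4248) ^ 2) * ((y ^ 2 - 378 * y + 142740) ^ 2 - 6 * (66 * y - 53496) ^ 2)
lemma Q5u_par (y : F) : Q5u (Uy y) (Vy y) = -(6 * (y ^ 2 - 11520) ^ 2 * y * Dl y) := by
  unfold Q5u Uy Vy Dl; ring
lemma Q5v_par (y : F) : Q5v (Uy y) (Vy y) =
    (-1152216576 + 37641600 * y - 459270 * y ^ 2 + 2480 * y ^ 3 - 5 * y ^ 4) * Dl y := by
  unfold Q5v Uy Vy Dl; ring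
def cA (u v : F) : F := (u ^ 2 - 654403829760 * u + (5209253090426880) + (-125915652) * v)
def cB (u v : F) : F := (-(66211200) * u + (-82577379557376) + (20620) * v)
def cC (u v : F) : F := (-(1240) * u + (229282790400) + (-1) * v)
lemma Q5_norm (u v : F) : Q5 u v = cA u v ^ 3 + v * cB u v ^ 3 + v ^ 2 * cC u v ^ 3 - 3 * v * (cA u v * cB u v * cC u v) := by
  unfold Q5 cA cB cC; ring
lemma q_par (u y : F) (z : F) (hz : y ^ 2 = z + 11520) : cA u (z ^ 3) + cB u (z ^ 3) * z + cC u (z ^ 3) * z ^ 2 =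
    (Uy y - u) * (Uy (-y) - u) := by
  obtain rfl : z = y ^ 2 - 11520 := by rw [hz]; ring
  unfold cA cB cC Uy; ring
lemma exists_par [IsAlgClosed F] {u v : F} (h : Q5 u v = 0) : ∃ y, u = Uy y ∧ v = Vy y := by
  obtain ⟨z, rfl⟩ := IsAlgClosed.exists_pow_nat_eq v (n := 3) (by norm_num)
  obtain ⟨w, hw⟩ : ∃ w : F, w ^ 2 + w + 1 = 0 := by
    obtain ⟨w, hw⟩ := IsAlgClosed.exists_root (X ^ 2 + X + 1 : F[X]) (by
      have : (X ^ 2 + X + 1 : F[X]).degree = 2 := by compute_degree!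
      rw [this]; norm_num)
    exact ⟨w, by simpa using hw⟩
  obtain ⟨z', hz', hq⟩ : ∃ z', z' ^ 3 = z ^ 3 ∧ cA u (z ^ 3) + cB u (z ^ 3) * z' + cC u (z ^ 3) * z' ^ 2 = 0 := by
    rw [Q5_norm] at h
    generalize cA u (z ^ 3) = A at *
    generalize cB u (z ^ 3) = B at *
    generalize cC u (z ^ 3) = D at *
    have h1 : (A + B * z + D * z ^ 2) * ((A + B * (w * z) + D * (w * z) ^ 2) * (A + B * (w ^ 2 * z) + D * (w ^ 2 * z) ^ 2)) = 0 := by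
      have hw3 : w ^ 3 = 1 := by linear_combination (w - 1) * hw
      have e4 : (w ^ 2 * z) ^ 2 = w * z ^ 2 := by linear_combination w * z ^ 2 * hw3
      have e2 : w ^ 2 = -1 - w := by linear_combination hw
      rw [e4, mul_pow w z, e2]
      linear_combination h + (A + B * z + D * z ^ 2) * (-B ^ 2 * z ^ 2 - D ^ 2 * z ^ 4 + 2 * B * D * z ^ 3) * hw
    have hw3 : w ^ 3 = 1 := by linear_combination (w - 1) * hw
    rcases mul_eq_zero.1 h1 with h2 | h2
    · exact ⟨z, rfl, h2⟩
    rcases mul_eq_zero.1 h2 with h2 | h2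
    · exact ⟨w * z, by rw [mul_pow, hw3, one_mul], h2⟩
    · exact ⟨w ^ 2 * z, by linear_combination z ^ 3 * (w ^ 3 + 1) * hw3, h2⟩
  rw [← hz'] at hq ⊢
  obtain ⟨y, hy⟩ := IsAlgClosed.exists_pow_nat_eq (z' + 11520) (n := 2) (by norm_num)
  rw [q_par u y z' hy] at hq
  have hV : z' ^ 3 = Vy y := by rw [Vy, hy]; ring
  rcases mul_eq_zero.1 hq with h2 | h2
  · exact ⟨y, (sub_eq_zero.1 h2).symm, hV⟩
  · exact ⟨-y, (sub_eq_zero.1 h2).symm, by rw [hV, Vy, Vy, neg_sq]⟩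
lemma listed [IsAlgClosed F] {p : ℕ} (hp : p.Prime) (hr : 379 < p ∨ p ∈ Sset) [CharP F p] {u v : F} (hv : v ≠ 0)
    (h : Q5 u v = 0) (hu' : Q5u u v = 0) (hv' : Q5v u v = 0) :
    ∃ d ∈ T2, ∃ r : F, r ^ 2 = (pD d : F) ∧ u = pu d r ∧ v = pv d r := by
  obtain ⟨y, rfl, rfl⟩ := exists_par h
  rw [Q5u_par, neg_eq_zero] at hu'
  rw [Q5v_par] at hv'
  have hD : Dl y = 0 := by
    by_contra hD
    have h1 := (mul_eq_zero.1 hv').resolve_right hD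
    have h2 := (mul_eq_zero.1 hu').resolve_right hD
    have hw : y ^ 2 - 11520 ≠ 0 := fun h => hv (by rw [Vy, h]; ring)
    have h6 : (6 : F) ≠ 0 := by
      have := good_ne hp hr F (n := 6) (by decide +kernel); simpa using this
    have hy : y = 0 := by
      rcases mul_eq_zero.1 h2 with h | h
      · exact absurd h (mul_ne_zero h6 (pow_ne_zero _ hw))
      · exact h
    rw [hy] at h1
    refine good_ne hp hr F (n := -1152216576) (by decide +kernel) ?_
    push_cast
    linear_combination h1
  unfold Dl at hD
  simp only [mul_eq_zero, or_assoc] at hD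
  obtain ⟨r21, hr21⟩ := IsAlgClosed.exists_pow_nat_eq (21 : F) (n := 2) (by norm_num)
  obtain ⟨r6, hr6⟩ := IsAlgClosed.exists_pow_nat_eq (6 : F) (n := 2) (by norm_num)
  have e84 : (y ^ 2 + 18 * y + 32760) ^ 2 - 21 * (54 * y + 4248) ^ 2 =
      (y ^ 2 + 18 * y + 32760 - r21 * (54 * y + 4248)) * (y ^ 2 + 18 * y + 32760 - -r21 * (54 * y + 4248)) := by
    linear_combination (54 * y + 4248) ^ 2 * hr21
  have e96 : (y ^ 2 - 378 * y + 142740) ^ 2 - 6 * (66 * y - 53496) ^ 2 =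
      (y ^ 2 - 378 * y + 142740 - r6 * (66 * y - 53496)) * (y ^ 2 - 378 * y + 142740 - -r6 * (66 * y - 53496)) := by
    linear_combination (66 * y - 53496) ^ 2 * hr6
  have f84 : ∀ r : F, r ^ 2 = 21 → y ^ 2 + 18 * y + 32760 - r * (54 * y + 4248) = 0 →
      ∃ d ∈ T2, ∃ r : F, r ^ 2 = (pD d : F) ∧ Uy y = pu d r ∧ Vy y = pv d r := by
    intro r hr h
    refine ⟨84, by decide, r, by simp [pD, hr], ?_, ?_⟩
    · simp [Uy, pu, pa0, pa1]
      linear_combination ((31931172) + (-193050) * y + (638) * y ^ 2 + (-1) * y ^ 3 + r * ((-6506604) + (31176) * y + (-54) * y ^ 2)) * h - ((27640053792) + (218920968) * y + (-1454112) * y ^ 2 + (2916) * y ^ 3) * hr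
    · simp [Vy, pv, pb0, pb1]
      linear_combination ((-1846406016) + (8123328) * y + (-5760) * y ^ 2 + (-18) * y ^ 3 + (1) * y ^ 4 + r * ((378276480) + (-2198016) * y + (2304) * y ^ 2 + (54) * y ^ 3)) * h - ((-1606918487040) + (-11089757952) * y + (108905472) * y ^ 2 + (-353808) * y ^ 3 + (-2916) * y ^ 4) * hr
  have f96 : ∀ r : F, r ^ 2 = 6 → y ^ 2 - 378 * y + 142740 - r * (66 * y - 53496) = 0 →
      ∃ d ∈ T2, ∃ r : F, r ^ 2 = (pD d : F) ∧ Uy y = pu d r ∧ Vy y = pv d r := by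
    intro r hr h
    refine ⟨96, by decide, r, by simp [pD, hr], ?_, ?_⟩
    · simp [Uy, pu, pa0, pa1]
      linear_combination ((43878276) + (54990) * y + (242) * y ^ 2 + (-1) * y ^ 3 + r * ((16932708) + (44520) * y + (-66) * y ^ 2)) * h - ((905832147168) + (1264083192) * y + (-6469056) * y ^ 2 + (4356) * y ^ 3) * hr
    · simp [Vy, pv, pb0, pb1]
      linear_combination ((-39883040496) + (-79695576) * y + (-8280) * y ^ 2 + (378) * y ^ 3 + (1) * y ^ 4 + r * ((-16228848960) + (-31549608) * y + (-3600) * y ^ 2 + (66) * y ^ 3)) * h - ((-868178503964160) + (-616673798208) * y + (1889688528) * y ^ 2 + (3768336) * y ^ 3 + (-4356) * y ^ 4) * hr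
  rcases hD with h | h | h | h | h | h | h | h
  · refine ⟨24, by decide, 1, by simp [pD], ?_, ?_⟩
    · simp [Uy, pu, pa0, pa1, hl]
      linear_combination ((2674152) + (-57714) * y + (416) * y ^ 2 + (-1) * y ^ 3) * h
    · simp [Vy, pv, pb0, pb1, hl]
      linear_combination ((-146831616) + (-2849472) * y + (-3456) * y ^ 2 + (204) * y ^ 3 + (1) * y ^ 4) * h
  · refine ⟨36, by decide, 1, by simp [pD], ?_, ?_⟩
    · simp [Uy, pu, pa0, pa1, hl]
      linear_combination ((1378776) + (-37650) * y + (344) * y ^ 2 + (-1) * y ^ 3) * h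
    · simp [Vy, pv, pb0, pb1, hl]
      linear_combination ((12789504) + (172224) * y + (21120) * y ^ 2 + (276) * y ^ 3 + (1) * y ^ 4) * h
  · refine ⟨51, by decide, 1, by simp [pD], ?_, ?_⟩
    · simp [Uy, pu, pa0, pa1, hl]
      linear_combination ((1399104) + (-54786) * y + (428) * y ^ 2 + (-1) * y ^ 3) * h
    · simp [Vy, pv, pb0, pb1, hl]
      linear_combination ((-483065856) + (-5750784) * y + (-13824) * y ^ 2 + (192) * y ^ 3 + (1) * y ^ 4) * h
  · refine ⟨64, by decide, 1, by simp [pD], ?_, ?_⟩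
    · simp [Uy, pu, pa0, pa1, hl]
      linear_combination ((13899240) + (-145152) * y + (620) * y ^ 2 + (-1) * y ^ 3) * h
    · simp [Vy, pv, pb0, pb1, hl]
      linear_combination ((735480324) + (-42498) * y ^ 2 + (1) * y ^ 4) * h
  · refine ⟨91, by decide, 1, by simp [pD], ?_, ?_⟩
    · simp [Uy, pu, pa0, pa1, hl]
      linear_combination ((-71173440) + (-7938) * y + (620) * y ^ 2 + (-1) * y ^ 3) * h
    · simp [Vy, pv, pb0, pb1, hl]
      linear_combination ((26483687424) + (-179712) * y ^ 2 + (1) * y ^ 4) * h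
  · refine ⟨99, by decide, 1, by simp [pD], ?_, ?_⟩
    · simp [Uy, pu, pa0, pa1, hl]
      linear_combination ((-96660928) + (-273410) * y + (-468) * y ^ 2 + (-1) * y ^ 3) * h
    · simp [Vy, pv, pb0, pb1, hl]
      linear_combination ((144445865984) + (404144128) * y + (760320) * y ^ 2 + (1088) * y ^ 3 + (1) * y ^ 4) * h
  · rw [e84] at h
    rcases mul_eq_zero.1 h with h | h
    · exact f84 r21 hr21 h
    · exact f84 (-r21) (by rw [neg_sq, hr21]) h
  · rw [e96] at h
    rcases mul_eq_zero.1 h with h | h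
    · exact f96 r6 hr6 h
    · exact f96 (-r6) (by rw [neg_sq, hr6]) h
end

/-! ### Local multiplicities of `Phi (X^p) X` -/
def fP (p : ℕ) (k : Type*) [Field k] : k[X] := Phi (X ^ p) X
def Lp {R : Type*} [CommRing R] (d : ℕ) (a b : R) : Prop := ∃ r : R, r ^ 2 = (pD d : R) ∧ a = pu d r ∧ b = pv d r
def qs (d : ℕ) : ℤ := if d = 84 then -85051 else if d = 96 then -163459 else 0
def qt (d : ℕ) : ℤ := if d = 84 then -1466 else if d = 96 then -175 else 0
lemma qst_smooth : ∀ d ∈ T2, pD d ≠ 1 → Smooth (qs d * pa1 d + qt d * pb1 d) := by decide +kernel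
lemma pab_zero : ∀ d ∈ T2, pD d = 1 → pa1 d = 0 ∧ pb1 d = 0 := by decide
section
variable {p : ℕ} [hp : Fact p.Prime] {k : Type*} [Field k] [CharP k p]
lemma fP_eval (α : k) : (fP p k).eval α = Phi (α ^ p) α := by
  have := map_Phi (evalRingHom α) (X ^ p) (X : k[X]); simpa [fP] using this
lemma dXp : derivative (X ^ p : k[X]) = 0 := by
  rw [derivative_X_pow, CharP.cast_eq_zero, C_0, zero_mul]
lemma fP_d (α : k) : (derivative (fP p k)).eval α = dPhi (α ^ p) α := by
  rw [fP, der_Phi _ dXp]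
  have := map_dPhi (evalRingHom α) (X ^ p) (X : k[X]); simpa using this
lemma fP_dd (α : k) : (derivative (derivative (fP p k))).eval α = ddPhi (α ^ p) α := by
  rw [fP, der_Phi _ dXp, der_dPhi _ dXp]
  have := map_ddPhi (evalRingHom α) (X ^ p) (X : k[X]); simpa using this
lemma mult_one (hf : fP p k ≠ 0) {α : k} (h0 : Phi (α ^ p) α = 0) (h1 : dPhi (α ^ p) α ≠ 0) : (fP p k).rootMultiplicity α = 1 := by
  have a1 : 0 < (fP p k).rootMultiplicity α := (rootMultiplicity_pos hf).2 (by rw [IsRoot, fP_eval, h0])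
  have a2 : ¬ 1 < (fP p k).rootMultiplicity α := by
    rw [one_lt_rootMultiplicity_iff_isRoot hf, IsRoot, IsRoot, fP_d]; exact fun h => h1 h.2
  omega
lemma mult_two (hf : fP p k ≠ 0) {α : k} (h0 : Phi (α ^ p) α = 0) (h1 : dPhi (α ^ p) α = 0) (h2 : ddPhi (α ^ p) α ≠ 0) :
    (fP p k).rootMultiplicity α = 2 := by
  have a1 : 1 < (fP p k).rootMultiplicity α := by
    rw [one_lt_rootMultiplicity_iff_isRoot hf, IsRoot, IsRoot, fP_d, fP_eval]; exact ⟨h0, h1⟩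
  have a2 : ¬ 2 < (fP p k).rootMultiplicity α := by
    intro h
    have := isRoot_iterate_derivative_of_lt_rootMultiplicity h
    simp only [Function.iterate_succ, Function.iterate_zero, Function.comp, id, IsRoot] at this
    rw [fP_dd] at this
    exact h2 this
  omega
variable (ι : ZMod p →+* k)
lemma io_pow (a : ZMod p) : ι a ^ p = ι a := by rw [← map_pow, ZMod.pow_card]
lemma io_range {α : k} (h : α ^ p = α) : ∃ a, ι a = α := by
  have h1 : (⊥ : Subfield k) ≤ ι.fieldRange := bot_le
  exact h1 ((Subfield.mem_bot_iff_pow_eq_self k p).2 h)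
lemma frob_add (x y : k) : (x + y) ^ p = x ^ p + y ^ p := add_pow_char x y p
/-- coordinates of a non rational point of degree two -/
lemma coords {α : k} (hne : α ^ p ≠ α) (h2 : (α ^ p) ^ p = α) :
    ∃ a b : ZMod p, ι a = -(α ^ p + α) ∧ ι b = α ^ p * α ∧ b ≠ 0 := by
  obtain ⟨a, ha⟩ := io_range ι (α := α ^ p + α) (by rw [frob_add, h2, add_comm])
  obtain ⟨b, hb⟩ := io_range ι (α := α ^ p * α) (by rw [mul_pow, h2, mul_comm])
  refine ⟨-a, b, by rw [map_neg, ha], hb, ?_⟩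
  rintro rfl
  rw [map_zero, eq_comm, mul_eq_zero] at hb
  rcases hb with h | h
  · exact hne (by rw [h]; exact (pow_eq_zero_iff hp.1.ne_zero).1 h |>.symm)
  · exact hne (by rw [h, zero_pow hp.1.ne_zero])
lemma Lst_iff [IsAlgClosed k] (ι : ZMod p →+* k) (hr : 379 < p ∨ p ∈ Sset) {a b : ZMod p} (hb : b ≠ 0) (h : Q5 a b = 0) :
    (Q5u a b = 0 ∧ Q5v a b = 0) ↔ ∃ d ∈ T2, Lp d a b := by
  constructor
  · rintro ⟨h1, h2⟩
    obtain ⟨d, hd, r, hr2, hu, hv⟩ := listed (F := k) hp.1 hr (u := ι a) (v := ι b) (by simpa using hb)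
      (by rw [← map_Q5, h, map_zero]) (by rw [← map_Q5u, h1, map_zero]) (by rw [← map_Q5v, h2, map_zero])
    refine ⟨d, hd, ?_⟩
    by_cases h1 : pD d = 1
    · obtain ⟨e1, e2⟩ := pab_zero d hd h1
      refine ⟨1, by simp [h1], ι.injective ?_, ι.injective ?_⟩
      · rw [hu]; simp [pu, e1]
      · rw [hv]; simp [pv, e2]
    · have hs := good_ne hp.1 hr (ZMod p) (qst_smooth d hd h1)
      have hs' := good_ne hp.1 hr k (qst_smooth d hd h1)
      obtain ⟨s, hs0⟩ : ∃ s : ZMod p, ι s = r := by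
        refine ⟨(qs d * (a - pa0 d) + qt d * (b - pb0 d)) / ((qs d * pa1 d + qt d * pb1 d : ℤ) : ZMod p), ?_⟩
        rw [map_div₀, map_intCast, div_eq_iff hs']
        simp only [map_add, map_mul, map_sub, map_intCast, hu, hv, pu, pv]
        push_cast
        ring
      refine ⟨s, ι.injective ?_, ι.injective ?_, ι.injective ?_⟩
      · rw [map_pow, hs0, hr2, map_intCast]
      · rw [hu]; simp [pu, hs0]
      · rw [hv]; simp [pv, hs0]
  · rintro ⟨d, hd, r, hr2, rfl, rfl⟩
    exact (pt_sing hd hr2).2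
lemma mult_deg2 [IsAlgClosed k] (hr : 379 < p ∨ p ∈ Sset) (hf : fP p k ≠ 0) {α : k} (hne : α ^ p ≠ α) (h2 : (α ^ p) ^ p = α)
    {a b : ZMod p} (ha : ι a = -(α ^ p + α)) (hb : ι b = α ^ p * α) (hb0 : b ≠ 0) (hQ : Q5 a b = 0)
    [Decidable (∃ d ∈ T2, Lp d a b)] :
    (fP p k).rootMultiplicity α = if ∃ d ∈ T2, Lp d a b then 2 else 1 := by
  have h0 : Phi (α ^ p) α = 0 := by rw [Phi, ← ha, ← hb, ← map_Q5, hQ, map_zero]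
  have hd : dPhi (α ^ p) α = -ι (Q5u a b) + α ^ p * ι (Q5v a b) := by
    rw [dPhi, ← ha, ← hb, map_Q5u, map_Q5v]
  have hL := Lst_iff ι hr hb0 hQ
  split_ifs with h
  · obtain ⟨g1, g2⟩ := hL.2 h
    refine mult_two hf h0 (by rw [hd, g1, g2]; simp) fun h3 => ?_
    obtain ⟨d, hdT, r, hr2, rfl, rfl⟩ := h
    have h4 := ddPhi_mul (α ^ p) α
    rw [h3, zero_mul, ← ha, ← hb, ← map_hesN, eq_comm, map_eq_zero] at h4
    exact pt_hess hp.1 hr hdT hr2 h4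
  · refine mult_one hf h0 fun h3 => h (hL.1 ?_)
    rw [hd] at h3
    have h4 : -ι (Q5u a b) + α * ι (Q5v a b) = 0 := by
      have h5 := congrArg (· ^ p) h3
      rw [frob_add, ← map_neg, io_pow, mul_pow, h2, io_pow, zero_pow hp.1.ne_zero, map_neg] at h5
      exact h5
    have h6 : ι (Q5v a b) = 0 := by
      have : (α ^ p - α) * ι (Q5v a b) = 0 := by linear_combination h3 - h4
      exact (mul_eq_zero.1 this).resolve_left (sub_ne_zero.2 hne)
    have h7 : ι (Q5u a b) = 0 := by rw [h6] at h3; simpa using h3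
    exact ⟨by simpa using h7, by simpa using h6⟩
end

/-! ### Roots of degree two -/
section
variable {p : ℕ} [hp : Fact p.Prime] {k : Type*} [Field k] [CharP k p] (ι : ZMod p →+* k)
def Irr (a b : ZMod p) : Prop := ∀ x, x ^ 2 + a * x + b ≠ 0
lemma irr_iff {F : Type*} [Field F] (a b : F) : Irreducible (X ^ 2 + C a * X + C b) ↔ ∀ x, x ^ 2 + a * x + b ≠ 0 := by
  have hm : (X ^ 2 + C a * X + C b).Monic := by monicity!
  have hd : (X ^ 2 + C a * X + C b).natDegree = 2 := by compute_degree!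
  rw [hm.irreducible_iff_roots_eq_zero_of_degree_le_three (by rw [hd]) (by rw [hd]; norm_num), Multiset.eq_zero_iff_forall_notMem]
  simp only [mem_roots hm.ne_zero, IsRoot, eval_add, eval_pow, eval_X, eval_mul, eval_C]
lemma quad_frob {a b : ZMod p} {α : k} (h : α ^ 2 + ι a * α + ι b = 0) : (α ^ p) ^ 2 + ι a * α ^ p + ι b = 0 := by
  have h1 := congrArg (· ^ p) h
  rw [frob_add, frob_add, mul_pow, io_pow, io_pow, zero_pow hp.1.ne_zero] at h1
  rw [← h1]; ring
lemma irr_ne {a b : ZMod p} (hi : Irr a b) {α : k} (h : α ^ 2 + ι a * α + ι b = 0) : α ^ p ≠ α := by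
  intro h1
  obtain ⟨x, rfl⟩ := io_range ι h1
  exact hi x (ι.injective (by simpa using h))
lemma vieta {a b : ZMod p} (hi : Irr a b) {α : k} (h : α ^ 2 + ι a * α + ι b = 0) :
    α ^ p ≠ α ∧ (α ^ p) ^ p = α ∧ ι a = -(α ^ p + α) ∧ ι b = α ^ p * α ∧ b ≠ 0 := by
  have h1 := irr_ne ι hi h
  have h2 := quad_frob ι h
  have ha : ι a = -(α ^ p + α) := by
    have : (α ^ p - α) * (ι a + (α ^ p + α)) = 0 := by linear_combination h2 - h
    have := (mul_eq_zero.1 this).resolve_left (sub_ne_zero.2 h1)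
    linear_combination this
  have hb : ι b = α ^ p * α := by linear_combination h - α * ha
  refine ⟨h1, ?_, ha, hb, ?_⟩
  · have h3 := quad_frob ι h2
    have h4 := irr_ne ι hi h2
    have : ((α ^ p) ^ p - α ^ p) * ((α ^ p) ^ p - α) = 0 := by
      rw [ha, hb] at h3; linear_combination h3
    exact sub_eq_zero.1 ((mul_eq_zero.1 this).resolve_left (sub_ne_zero.2 h4))
  · rintro rfl; exact hi 0 (by ring)
def Rw (w : ZMod p × ZMod p) : Finset k := by
  classical exact (X ^ 2 + C (ι w.1) * X + C (ι w.2)).roots.toFinset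
lemma mem_Rw {w : ZMod p × ZMod p} {α : k} : α ∈ Rw ι w ↔ α ^ 2 + ι w.1 * α + ι w.2 = 0 := by
  have hm : (X ^ 2 + C (ι w.1) * X + C (ι w.2)).Monic := by monicity!
  simp [Rw, mem_roots hm.ne_zero]
lemma Rw_eq [DecidableEq k] {w : ZMod p × ZMod p} (hi : Irr w.1 w.2) {α : k} (h : α ∈ Rw ι w) : Rw ι w = {α, α ^ p} := by
  obtain ⟨-, -, ha, hb, -⟩ := vieta ι hi ((mem_Rw ι).1 h)
  ext x
  rw [mem_Rw, ha, hb, mem_insert, mem_singleton, ← sub_eq_zero (a := x) (b := α),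
    ← sub_eq_zero (a := x) (b := α ^ p), ← mul_eq_zero]
  constructor <;> intro h <;> linear_combination h
open Classical in
def WW (A : k[X]) : Finset (ZMod p × ZMod p) :=
  Finset.univ.filter fun w => Irr w.1 w.2 ∧ (∃ α ∈ Rw ι w, A.eval α = 0) ∧ Q5 w.1 w.2 = 0
open Classical in
lemma sum_R2 [IsAlgClosed k] (hr : 379 < p ∨ p ∈ Sset) (hf : fP p k ≠ 0) {A : k[X]} (hF : ∀ α, A.eval α = 0 → A.eval (α ^ p) = 0)
    (hsq : ∀ α, A.eval α = 0 → (α ^ p) ^ p = α) :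
    ∑ α ∈ (fP p k).roots.toFinset.filter (fun α => A.eval α = 0 ∧ α ^ p ≠ α), (fP p k).rootMultiplicity α =
      ∑ w ∈ WW ι A, 2 * (if ∃ d ∈ T2, Lp d w.1 w.2 then 2 else 1) := by
  have hWm : ∀ w ∈ WW ι A, Irr w.1 w.2 ∧ (∃ α ∈ Rw ι w, A.eval α = 0) ∧ Q5 w.1 w.2 = 0 := fun w hw => (Finset.mem_filter.1 hw).2
  have hA : ∀ w ∈ WW ι A, ∀ α ∈ Rw ι w, A.eval α = 0 := by
    intro w hw α hα
    obtain ⟨h1, ⟨β, hβ, h2⟩, -⟩ := hWm w hw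
    rw [Rw_eq ι h1 hβ, mem_insert, mem_singleton] at hα
    rcases hα with rfl | rfl
    · exact h2
    · exact hF _ h2
  have e : (fP p k).roots.toFinset.filter (fun α => A.eval α = 0 ∧ α ^ p ≠ α) = (WW ι A).biUnion (Rw ι) := by
    ext α
    rw [mem_filter, Multiset.mem_toFinset, mem_roots hf, IsRoot, fP_eval, Finset.mem_biUnion]
    constructor
    · rintro ⟨h1, h2, h3⟩
      have h4 := hsq α h2
      obtain ⟨a, b, ha, hb, hb0⟩ := coords ι h3 h4
      have hR : α ∈ Rw ι (a, b) := by rw [mem_Rw]; simp only [ha, hb]; ring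
      refine ⟨(a, b), Finset.mem_filter.2 ⟨mem_univ _, ?_, ⟨α, hR, h2⟩, ?_⟩, hR⟩
      · intro x hx
        have hx' := congrArg ι hx
        rw [map_add, map_add, map_mul, map_pow, map_zero, ha, hb] at hx'
        have : (ι x - α) * (ι x - α ^ p) = 0 := by linear_combination hx'
        rcases mul_eq_zero.1 this with h | h
        · exact h3 (by rw [← sub_eq_zero.1 h, io_pow])
        · have := io_pow ι x
          rw [sub_eq_zero.1 h, h4] at this
          exact h3 this.symm
      · rw [Phi, ← ha, ← hb, ← map_Q5, map_eq_zero] at h1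
        exact h1
    · rintro ⟨w, hw, hα⟩
      obtain ⟨g1, -, g3⟩ := hWm w hw
      obtain ⟨h1, h2, ha, hb, -⟩ := vieta ι g1 ((mem_Rw ι).1 hα)
      exact ⟨by rw [Phi, ← ha, ← hb, ← map_Q5, g3, map_zero], hA w hw α hα, h1⟩
  rw [e, Finset.sum_biUnion]
  · refine sum_congr rfl fun w hw => ?_
    obtain ⟨g1, ⟨α, hα, -⟩, g3⟩ := hWm w hw
    have : ∀ β ∈ Rw ι w, (fP p k).rootMultiplicity β = if ∃ d ∈ T2, Lp d w.1 w.2 then 2 else 1 := by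
      intro β hβ
      obtain ⟨h1, h2, ha, hb, hb0⟩ := vieta ι g1 ((mem_Rw ι).1 hβ)
      exact mult_deg2 ι hr hf h1 h2 ha hb hb0 g3
    rw [sum_congr rfl this, sum_const, Rw_eq ι g1 hα, Finset.card_pair (irr_ne ι g1 ((mem_Rw ι).1 hα)).symm, smul_eq_mul]
  · intro w hw w' hw' hne
    rw [Function.onFun, Finset.disjoint_left]
    intro α h1 h2
    obtain ⟨-, -, ha, hb, -⟩ := vieta ι (hWm w hw).1 ((mem_Rw ι).1 h1)
    obtain ⟨-, -, ha', hb', -⟩ := vieta ι (hWm w' hw').1 ((mem_Rw ι).1 h2)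
    exact hne (Prod.ext (ι.injective (by rw [ha, ha'])) (ι.injective (by rw [hb, hb'])))
end

/-! ### Legendre symbols and the listed points -/
def pe (d : ℕ) : ℤ :=
  if d = 36 ∨ d = 84 then 3 else if d = 51 then 17 else if d = 91 then 13 else if d = 99 then 33 else 2
def pc (d : ℕ) : ℤ√(pD d) :=
  if d = 24 then ⟨3414528, 0⟩ else if d = 36 then ⟨88660992, 0⟩ else if d = 51 then ⟨1343913984, 0⟩
  else if d = 64 then ⟨58142785932, 0⟩ else if d = 91 then ⟨2873089916928, 0⟩ else if d = 99 then ⟨6548115718144, 0⟩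
  else if d = 84 then ⟨922836934656, -201379756032⟩ else ⟨8251987131648, 3368859648336⟩
lemma pc_eq : ∀ d ∈ T2, zu d ^ 2 - 4 * zv d = (pe d : ℤ√(pD d)) * pc d ^ 2 ∧ Smooth (pc d).norm ∧ Smooth (pe d) ∧
    Smooth (pD d) ∧ Smooth (-(d : ℤ)) := by
  decide +kernel
def disR (D x y D' x' y' : ℤ) : ℤ :=
  4 * (x - x') ^ 2 * (D * y ^ 2) - (D' * y' ^ 2 - D * y ^ 2 - (x - x') ^ 2) ^ 2
lemma disR_smooth : ∀ d ∈ T2, ∀ e ∈ T2, d ≠ e → Smooth (Int.gcd (disR (pD d) (pa0 d) (pa1 d) (pD e) (pa0 e) (pa1 e))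
    (disR (pD d) (pb0 d) (pb1 d) (pD e) (pb0 e) (pb1 e)) : ℤ) := by
  decide +kernel
lemma disR_zero {R : Type*} [CommRing R] {D x y D' x' y' : ℤ} {r s : R} (hr : r ^ 2 = D) (hs : s ^ 2 = D')
    (h : (x : R) + y * r = x' + y' * s) : (disR D x y D' x' y' : R) = 0 := by
  have hm : ((y : R) * r) ^ 2 = D * y ^ 2 := by rw [mul_pow, hr]; ring
  have hm' : ((y' : R) * s) ^ 2 = D' * y' ^ 2 := by rw [mul_pow, hs]; ring
  have h' : (y' : R) * s = y * r + (x - x') := by linear_combination -h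
  unfold disR
  push_cast
  rw [← hm, ← hm', h']
  ring
section
variable {p : ℕ} [hp : Fact p.Prime]
lemma jac_eq {a : ℤ} (h : (a : ZMod p) ≠ 0) [Decidable (IsSquare (a : ZMod p))] :
    jacobiSym a p = if IsSquare (a : ZMod p) then 1 else -1 := by
  rw [← jacobiSym.legendreSym.to_jacobiSym]
  split_ifs with h1
  · exact (legendreSym.eq_one_iff p h).2 h1
  · exact (legendreSym.eq_neg_one_iff p).2 h1
lemma Lp_disj (hr : 379 < p ∨ p ∈ Sset) {d e : ℕ} (hd : d ∈ T2) (he : e ∈ T2) (hde : d ≠ e) {a b : ZMod p}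
    (h1 : Lp d a b) (h2 : Lp e a b) : False := by
  obtain ⟨r, hr1, rfl, rfl⟩ := h1
  obtain ⟨s, hs1, h3, h4⟩ := h2
  refine good_ne hp.1 hr (ZMod p) (disR_smooth d hd e he hde) ?_
  rw [Int.gcd_eq_gcd_ab]
  push_cast
  rw [disR_zero hr1 hs1 h3, disR_zero hr1 hs1 h4]
  ring
lemma irr_disc (h2 : (2 : ZMod p) ≠ 0) (a b : ZMod p) : Irr a b ↔ ¬ IsSquare (a ^ 2 - 4 * b) := by
  constructor
  · rintro h ⟨r, hr⟩
    refine h ((-a + r) / 2) ?_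
    field_simp
    linear_combination -hr
  · intro h x hx
    exact h ⟨2 * x + a, by linear_combination -4 * hx⟩
lemma Lp_irr (hr : 379 < p ∨ p ∈ Sset) {d : ℕ} (hd : d ∈ T2) {a b : ZMod p} (h : Lp d a b) :
    Irr a b ↔ ¬ IsSquare (pe d : ZMod p) := by
  have h2 : (2 : ZMod p) ≠ 0 := mod_cast good_ne hp.1 hr (ZMod p) (n := 2) (by decide +kernel)
  obtain ⟨r, hr1, rfl, rfl⟩ := h
  rw [irr_disc h2, not_iff_not]
  have h3 := congrArg (zl d r hr1) (pc_eq d hd).1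
  have h4 := pt_norm hp.1 hr hr1 (pc_eq d hd).2.1
  rw [map_sub, map_mul, map_mul, map_pow, map_pow, map_ofNat, map_intCast, zl_u, zl_v] at h3
  rw [h3]
  constructor
  · rintro ⟨y, hy⟩
    exact ⟨y / zl d r hr1 (pc d), by field_simp; linear_combination hy⟩
  · rintro ⟨y, hy⟩
    exact ⟨y * zl d r hr1 (pc d), by rw [hy]; ring⟩
lemma disc_pe : ∀ d ∈ T2, d ≠ 84 → d ≠ 96 → discH d = pe d * (pc d).re ^ 2 ∧ Smooth (pc d).re ∧ pD d = 1 := by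
  decide +kernel
lemma jac_val {a : ℤ} (h : (a : ZMod p) ≠ 0) : jacobiSym a p = 1 ∨ jacobiSym a p = -1 := by
  classical rw [jac_eq h]; split_ifs <;> simp
lemma jac_sq {a : ℤ} (h : (a : ZMod p) ≠ 0) : IsSquare (a : ZMod p) ↔ jacobiSym a p = 1 := by
  classical rw [jac_eq h]; split_ifs with h1 <;> simp [h1]
open Classical in
lemma eps_T2 (hr : 379 < p ∨ p ∈ Sset) {d : ℕ} (hd : d ∈ T2) : epsd p d =
    if ¬ IsSquare ((-(d : ℤ) : ℤ) : ZMod p) ∧ ¬ IsSquare (pe d : ZMod p) ∧ IsSquare (pD d : ZMod p) then 1 else 0 := by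
  have G := fun {n : ℤ} (hn : Smooth n) => good_ne hp.1 hr (ZMod p) hn
  have J3 := jac_val (G (show Smooth 3 by decide +kernel))
  have J7 := jac_val (G (show Smooth 7 by decide +kernel))
  have J2 := jac_val (G (show Smooth 2 by decide +kernel))
  have V1 := jac_val (G (pc_eq d hd).2.2.2.2)
  have V2 := jac_val (G (pc_eq d hd).2.2.1)
  simp only [jac_sq (G (pc_eq d hd).2.2.2.2), jac_sq (G (pc_eq d hd).2.2.1), jac_sq (G (pc_eq d hd).2.2.2.1)]
  by_cases h84 : d = 84
  · subst h84
    have e : jacobiSym (pD 84) p = jacobiSym 3 p * jacobiSym 7 p := by rw [← jacobiSym.mul_left]; rfl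
    have e2 : pe 84 = 3 := rfl
    rw [e, e2]
    unfold epsd
    push_cast at V1 ⊢
    rcases V1 with h | h <;> rcases J3 with h3 | h3 <;> rcases J7 with h7 | h7 <;> norm_num [h, h3, h7]
  by_cases h96 : d = 96
  · subst h96
    have e : jacobiSym (pD 96) p = jacobiSym 2 p * jacobiSym 3 p := by rw [← jacobiSym.mul_left]; rfl
    have e2 : pe 96 = 2 := rfl
    rw [e, e2]
    unfold epsd
    push_cast at V1 ⊢
    rcases V1 with h | h <;> rcases J3 with h3 | h3 <;> rcases J2 with h7 | h7 <;> norm_num [h, h3, h7]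
  obtain ⟨e1, e2, e3⟩ := disc_pe d hd h84 h96
  have e4 : jacobiSym (discH d) p = jacobiSym (pe d) p := by
    rw [e1, jacobiSym.mul_left, jacobiSym.pow_left]
    rcases jac_val (G e2) with h | h <;> rw [h] <;> ring
  have e5 : d ≠ 20 ∧ ¬ (d = 4 ∨ d = 11 ∨ d = 16 ∨ d = 19) := by clear * - hd; revert d; decide
  rw [epsd, if_neg e5.1, if_neg e5.2, if_neg h84, if_neg h96, e4, e3, jacobiSym.one_left]
  rcases V1 with h | h <;> rcases V2 with h3 | h3 <;> norm_num [h, h3]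
open Classical in
lemma eps_T1 (hr : 379 < p ∨ p ∈ Sset) {d : ℕ} (hd : d ∈ ({4, 11, 16, 19} : Finset ℕ)) : epsd p d =
    if ¬ IsSquare ((-(d : ℤ) : ℤ) : ZMod p) then 1 else 0 := by
  have h1 : ∀ d ∈ ({4, 11, 16, 19} : Finset ℕ), Smooth (-(d : ℤ)) ∧ d ≠ 20 ∧ (d = 4 ∨ d = 11 ∨ d = 16 ∨ d = 19) := by
    decide +kernel
  obtain ⟨h1, h2, h3⟩ := h1 d hd
  have h4 := good_ne hp.1 hr (ZMod p) h1
  rw [epsd, if_neg h2, if_pos h3]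
  simp only [jac_sq h4]
  rcases jac_val h4 with h | h <;> norm_num [h]
open Classical in
lemma eps_20 (hr : 379 < p ∨ p ∈ Sset) : epsd p 20 =
    if ¬ IsSquare ((-((20 : ℕ) : ℤ) : ℤ) : ZMod p) ∧ IsSquare ((5 : ℤ) : ZMod p) then 1 else 0 := by
  have h4 := good_ne hp.1 hr (ZMod p) (show Smooth (-((20 : ℕ) : ℤ)) by decide +kernel)
  have h5 := good_ne hp.1 hr (ZMod p) (show Smooth 5 by decide +kernel)
  rw [epsd, if_pos rfl]
  simp only [jac_sq h4, jac_sq h5]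
  have := jac_val h4
  push_cast at this ⊢
  rcases this with h | h <;> rcases jac_val h5 with h' | h' <;> norm_num [h, h']
/-! ### Counting the listed points -/
variable {k : Type*} [Field k] [CharP k p] (ι : ZMod p →+* k)
lemma io_lev (a : ZMod p) (l : List ℤ) : ι (lev a l) = lev (ι a) l := by
  induction l with
  | nil => simp [lev]
  | cons c l ih => simp [lev, ih]
lemma io_pu (d : ℕ) (r : ZMod p) : ι (pu d r) = pu d (ι r) := by simp [pu]
lemma io_pv (d : ℕ) (r : ZMod p) : ι (pv d r) = pv d (ι r) := by simp [pv]
lemma Lp_lev {d : ℕ} (hd : d ∈ T2) {w : ZMod p × ZMod p} (h : Lp d w.1 w.2) {α : k} (hα : α ∈ Rw ι w) : lev α (hl d) = 0 := by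
  obtain ⟨r, hr1, h1, h2⟩ := h
  rw [mem_Rw, h1, h2, io_pu, io_pv] at hα
  exact (lev_split hd (r := ι r) (by rw [← map_pow, hr1, map_intCast]) α).2 (Or.inl hα)
lemma Rw_ne [IsAlgClosed k] (w : ZMod p × ZMod p) : ∃ α, α ∈ Rw ι w := by
  have hd : (X ^ 2 + C (ι w.1) * X + C (ι w.2)).natDegree = 2 := by compute_degree!
  obtain ⟨α, h⟩ := IsAlgClosed.exists_root (X ^ 2 + C (ι w.1) * X + C (ι w.2))
    (by rw [degree_eq_natDegree (fun h => by simp [h] at hd), hd]; norm_num)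
  exact ⟨α, (mem_Rw ι).2 (by simpa [IsRoot] using h)⟩
lemma mem_WW_Lp [IsAlgClosed k] (hr : 379 < p ∨ p ∈ Sset) {A : k[X]}
    (hss : ∀ d ∈ Tfrak ∪ {20}, ∀ α : k, lev α (hl d) = 0 → (A.eval α = 0 ↔ ¬ IsSquare ((-(d : ℤ) : ℤ) : ZMod p)))
    {d : ℕ} (hd : d ∈ T2) {w : ZMod p × ZMod p} (h : Lp d w.1 w.2) :
    w ∈ WW ι A ↔ ¬ IsSquare ((-(d : ℤ) : ℤ) : ZMod p) ∧ ¬ IsSquare (pe d : ZMod p) := by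
  classical
  rw [WW, mem_filter, Lp_irr hr hd h]
  have hq : Q5 w.1 w.2 = 0 := by
    obtain ⟨r, hr1, h1, h2⟩ := h
    rw [h1, h2]; exact (pt_sing hd hr1).1
  obtain ⟨α, hα⟩ := Rw_ne ι w
  constructor
  · rintro ⟨-, h1, ⟨β, hβ, h2⟩, -⟩
    exact ⟨(hss d (T2_sub hd) β (Lp_lev ι hd h hβ)).1 h2, h1⟩
  · rintro ⟨h1, h2⟩
    exact ⟨mem_univ _, h2, ⟨α, hα, (hss d (T2_sub hd) α (Lp_lev ι hd h hα)).2 h1⟩, hq⟩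
open Classical in
lemma Lp_card (hr : 379 < p ∨ p ∈ Sset) {d : ℕ} (hd : d ∈ T2) (hs : IsSquare (pD d : ZMod p)) :
    2 * (Finset.univ.filter fun w : ZMod p × ZMod p => Lp d w.1 w.2).card = (classPoly d).natDegree := by
  obtain ⟨r, hr1⟩ := hs
  have hr2 : r ^ 2 = pD d := by rw [hr1]; ring
  have h0 : (Finset.univ.filter fun w : ZMod p × ZMod p => Lp d w.1 w.2) = {(pu d r, pv d r), (pu d (-r), pv d (-r))} := by
    ext ⟨a, b⟩
    simp only [mem_filter, mem_univ, true_and, mem_insert, mem_singleton, Prod.mk.injEq]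
    constructor
    · rintro ⟨s, hs, rfl, rfl⟩
      rcases sq_eq_sq_iff_eq_or_eq_neg.1 (hs.trans hr2.symm) with rfl | rfl <;> simp
    · rintro (⟨rfl, rfl⟩ | ⟨rfl, rfl⟩)
      · exact ⟨r, hr2, rfl, rfl⟩
      · exact ⟨-r, by rw [neg_sq, hr2], rfl, rfl⟩
  rw [h0, (hl_monic (T2_sub hd)).2]
  by_cases h1 : pD d = 1
  · obtain ⟨ha, hb⟩ := pab_zero d hd h1
    have h2 : ¬ d ≤ 19 ∧ ¬ (d = 84 ∨ d = 96) := by clear * - hd h1; revert d; decide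
    rw [if_neg h2.1, if_neg h2.2]
    simp [pu, pv, ha, hb]
  · have h2 : ¬ d ≤ 19 ∧ (d = 84 ∨ d = 96) := by clear * - hd h1; revert d; decide
    rw [if_neg h2.1, if_pos h2.2, Finset.card_pair]
    intro h
    have G := fun {n : ℤ} (hn : Smooth n) => good_ne hp.1 hr (ZMod p) hn
    have e1 := G (qst_smooth d hd h1)
    have e2 := G (show Smooth 2 by decide +kernel)
    have e3 : r ≠ 0 := by
      rintro rfl
      exact G (pc_eq d hd).2.2.2.1 (by rw [← hr2]; ring)
    obtain ⟨ha, hb⟩ := Prod.mk.inj h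
    refine mul_ne_zero (mul_ne_zero e2 e3) e1 ?_
    simp only [pu, pv] at ha hb
    push_cast
    linear_combination (qs d : ZMod p) * ha + (qt d : ZMod p) * hb
open Classical in
lemma WW_Lp_card [IsAlgClosed k] (hr : 379 < p ∨ p ∈ Sset) {A : k[X]}
    (hss : ∀ d ∈ Tfrak ∪ {20}, ∀ α : k, lev α (hl d) = 0 → (A.eval α = 0 ↔ ¬ IsSquare ((-(d : ℤ) : ℤ) : ZMod p)))
    {d : ℕ} (hd : d ∈ T2) : 2 * (((WW ι A).filter fun w => Lp d w.1 w.2).card : ℚ) = epsd p d * (classPoly d).natDegree := by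
  rw [eps_T2 hr hd]
  by_cases h : ¬ IsSquare ((-(d : ℤ) : ℤ) : ZMod p) ∧ ¬ IsSquare (pe d : ZMod p) ∧ IsSquare (pD d : ZMod p)
  · rw [if_pos h, one_mul, ← Lp_card hr hd h.2.2]
    have : ((WW ι A).filter fun w => Lp d w.1 w.2) = Finset.univ.filter fun w : ZMod p × ZMod p => Lp d w.1 w.2 := by
      ext w
      simp only [mem_filter, mem_univ, true_and, and_iff_right_iff_imp]
      exact fun hw => (mem_WW_Lp ι hr hss hd hw).2 ⟨h.1, h.2.1⟩
    rw [this]; push_cast; rfl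
  · rw [if_neg h, zero_mul, Finset.card_eq_zero.2, Nat.cast_zero, mul_zero]
    rw [Finset.filter_eq_empty_iff]
    intro w hw hL
    obtain ⟨h1, h2⟩ := (mem_WW_Lp ι hr hss hd hL).1 hw
    obtain ⟨r, hr1, -⟩ := hL
    exact h ⟨h1, h2, r, by rw [← hr1]; ring⟩
open Classical in
lemma sum_WW [IsAlgClosed k] (hr : 379 < p ∨ p ∈ Sset) {A : k[X]}
    (hss : ∀ d ∈ Tfrak ∪ {20}, ∀ α : k, lev α (hl d) = 0 → (A.eval α = 0 ↔ ¬ IsSquare ((-(d : ℤ) : ℤ) : ZMod p))) :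
    ((∑ w ∈ WW ι A, 2 * (if ∃ d ∈ T2, Lp d w.1 w.2 then 2 else 1) : ℕ) : ℚ) =
      2 * (((WW ι A).filter fun w => ¬ ∃ d ∈ T2, Lp d w.1 w.2).card : ℚ) + ∑ d ∈ T2, 2 * epsd p d * (classPoly d).natDegree := by
  have h1 : (WW ι A).filter (fun w => ∃ d ∈ T2, Lp d w.1 w.2) = T2.biUnion fun d => (WW ι A).filter fun w => Lp d w.1 w.2 := by
    ext w; simp only [mem_filter, Finset.mem_biUnion]; tauto
  have h2 : (((WW ι A).filter (fun w => ∃ d ∈ T2, Lp d w.1 w.2)).card : ℚ) =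
      ∑ d ∈ T2, (((WW ι A).filter fun w => Lp d w.1 w.2).card : ℚ) := by
    rw [h1, Finset.card_biUnion, Nat.cast_sum]
    intro d hd e he hde
    exact Finset.disjoint_left.2 fun w hw hw' => Lp_disj hr hd he hde (Finset.mem_filter.1 hw).2 (Finset.mem_filter.1 hw').2
  rw [← Finset.sum_filter_add_sum_filter_not _ (fun w : ZMod p × ZMod p => ∃ d ∈ T2, Lp d w.1 w.2),
    sum_congr rfl (g := fun _ => 4) (fun w hw => by rw [if_pos (Finset.mem_filter.1 hw).2]),
    sum_congr (s₁ := (WW ι A).filter fun w => ¬ ∃ d ∈ T2, Lp d w.1 w.2) rfl (g := fun _ => 2)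
      (fun w hw => by rw [if_neg (Finset.mem_filter.1 hw).2]), sum_const, sum_const]
  push_cast [smul_eq_mul]
  rw [h2, Finset.sum_mul, add_comm]
  congr 1
  · ring
  · exact sum_congr rfl fun d hd => by rw [mul_assoc 2, ← WW_Lp_card ι hr hss hd]; ring
end

/-! ### Roots of degree one -/
def T1 : Finset ℕ := {4, 11, 16, 19}
def jT (d : ℕ) : ℤ := -(hl d).getD 0 0
def z20 : ℤ√5 := ⟨632000, 282880⟩
lemma jT_prop : ∀ d ∈ T1, dPhi (jT d) (jT d) = 0 ∧ Smooth (ddPhi (jT d) (jT d)) ∧ Smooth (lev (jT d) (hl 20)) ∧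
    ∀ e ∈ T1, d ≠ e → Smooth (jT d - jT e) := by decide +kernel
lemma z20_prop : Smooth (dPhi z20 z20).norm := by decide +kernel
section
variable {p : ℕ} [hp : Fact p.Prime] {k : Type*} [Field k] [CharP k p] (ι : ZMod p →+* k)
lemma lev_T1 {R : Type*} [CommRing R] {d : ℕ} (hd : d ∈ T1) (x : R) : lev x (hl d) = x - jT d := by
  simp only [T1, mem_insert, mem_singleton] at hd
  rcases hd with rfl | rfl | rfl | rfl <;> simp [hl, lev, jT] <;> ring
lemma lev_20 {R : Type*} [CommRing R] (x : R) : lev x (hl 20) = (x - 632000) ^ 2 - 5 * 282880 ^ 2 := by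
  simp only [hl, lev]; push_cast; ring
lemma d20 (hr : 379 < p ∨ p ∈ Sset) {α : k} (h : lev α (hl 20) = 0) : dPhi α α ≠ 0 := by
  have h0 : ((282880 : ℤ) : k) ≠ 0 := good_ne hp.1 hr k (by decide +kernel)
  push_cast at h0
  rw [lev_20] at h
  have hs : (α - 632000) / 282880 * ((α - 632000) / 282880) = ((5 : ℤ) : k) := by
    field_simp; push_cast; linear_combination h
  set f : ℤ√5 →+* k := Zsqrtd.lift ⟨_, hs⟩ with hf
  have h1 : f z20 = α := by simp [hf, z20, Zsqrtd.lift]; field_simp; ring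
  intro h2
  rw [← h1, ← map_dPhi] at h2
  have h3 : f (dPhi z20 z20 * star (dPhi z20 z20)) = 0 := by rw [map_mul, h2, zero_mul]
  rw [← Zsqrtd.norm_eq_mul_conj, map_intCast] at h3
  exact good_ne hp.1 hr k z20_prop h3
open Classical in
lemma card_20 (ι : ZMod p →+* k) (hr : 379 < p ∨ p ∈ Sset) {A : k[X]} {E : Finset k}
    (hss : ∀ d ∈ Tfrak ∪ {20}, ∀ α : k, lev α (hl d) = 0 → (A.eval α = 0 ↔ ¬ IsSquare ((-(d : ℤ) : ℤ) : ZMod p)))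
    (hE : ∀ α, α ∈ E ↔ lev α (hl 20) = 0 ∧ A.eval α = 0 ∧ α ^ p = α) : (E.card : ℚ) = 2 * epsd p 20 := by
  have G := fun {n : ℤ} (hn : Smooth n) => good_ne hp.1 hr (ZMod p) hn
  have g5 := G (show Smooth 5 by decide +kernel)
  have g2 := G (show Smooth 2 by decide +kernel)
  have gc := G (show Smooth 282880 by decide +kernel)
  push_cast at g5 g2 gc
  rw [eps_20 hr]
  split_ifs with h
  · obtain ⟨h1, s, hs⟩ := h
    push_cast at hs
    have hL : ∀ t : ZMod p, t * t = 5 → ι (632000 + 282880 * t) ∈ E := fun t ht => by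
      have : lev (ι (632000 + 282880 * t)) (hl 20) = 0 := by
        rw [← io_lev, lev_20, ← map_zero ι]; congr 1; linear_combination 282880 ^ 2 * ht
      exact (hE _).2 ⟨this, (hss 20 (by decide) _ this).2 h1, io_pow ι _⟩
    have : E = {ι (632000 + 282880 * s), ι (632000 + 282880 * (-s))} := by
      ext α
      simp only [mem_insert, mem_singleton]
      constructor
      · intro hα
        obtain ⟨h3, -, h4⟩ := (hE α).1 hα
        obtain ⟨a, rfl⟩ := io_range ι h4
        rw [← io_lev, map_eq_zero, lev_20, hs] at h3
        have : (a - (632000 + 282880 * s)) * (a - (632000 + 282880 * (-s))) = 0 := by linear_combination h3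
        rcases mul_eq_zero.1 this with h5 | h5 <;> rw [sub_eq_zero.1 h5] <;> simp
      · rintro (rfl | rfl)
        · exact hL s hs.symm
        · exact hL (-s) (by linear_combination -hs)
    rw [this, Finset.card_pair]
    · norm_num
    · intro h5
      have h6 := ι.injective h5
      have h7 : 2 * 282880 * s = 0 := by linear_combination h6
      rcases mul_eq_zero.1 h7 with h8 | rfl
      · exact mul_ne_zero g2 gc h8
      · exact g5 (by rw [hs]; ring)
  · rw [mul_zero, Nat.cast_eq_zero, Finset.card_eq_zero, Finset.eq_empty_iff_forall_notMem]
    intro α hα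
    obtain ⟨h3, h5, h4⟩ := (hE α).1 hα
    refine h ⟨(hss 20 (by decide) α h3).1 h5, ?_⟩
    obtain ⟨a, rfl⟩ := io_range ι h4
    rw [← io_lev, map_eq_zero, lev_20] at h3
    exact ⟨(a - 632000) / 282880, by field_simp; push_cast; linear_combination -h3⟩
open Classical in
lemma sum_R1 (ι : ZMod p →+* k) (hr : 379 < p ∨ p ∈ Sset) (hf : fP p k ≠ 0) {A : k[X]}
    (hss : ∀ d ∈ Tfrak ∪ {20}, ∀ α : k, lev α (hl d) = 0 → (A.eval α = 0 ↔ ¬ IsSquare ((-(d : ℤ) : ℤ) : ZMod p))) :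
    ((∑ α ∈ (fP p k).roots.toFinset.filter (fun α => A.eval α = 0 ∧ α ^ p = α), (fP p k).rootMultiplicity α : ℕ) : ℚ) =
      2 * epsd p 20 + ∑ d ∈ T1, 2 * epsd p d * (classPoly d).natDegree := by
  have hT : ∀ d ∈ T1, d ∈ Tfrak ∪ {20} ∧ d ≤ 19 := by decide
  have lT := fun d (hd : d ∈ T1) => lev_T1 (R := k) hd
  have jp : ∀ d : ℕ, (jT d : k) ^ p = jT d := fun d => by simpa using io_pow ι (jT d : ZMod p)
  set D := (fP p k).roots.toFinset.filter (fun α => A.eval α = 0 ∧ α ^ p = α) with hD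
  have mD : ∀ α, α ∈ D ↔ Phi α α = 0 ∧ A.eval α = 0 ∧ α ^ p = α := fun α => by
    rw [hD, mem_filter, Multiset.mem_toFinset, mem_roots hf, IsRoot, fP_eval]
    constructor <;> rintro ⟨h1, h2, h3⟩
    · rw [h3] at h1; exact ⟨h1, h2, h3⟩
    · exact ⟨by rw [h3]; exact h1, h2, h3⟩
  have hE := card_20 ι hr (E := D.filter fun α => lev α (hl 20) = 0) hss fun α => by
    rw [mem_filter, mD, Phi_diag]
    constructor
    · rintro ⟨⟨-, h1⟩, h2⟩; exact ⟨h2, h1⟩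
    · rintro ⟨h1, h2⟩; exact ⟨⟨by rw [h1, mul_zero], h2⟩, h1⟩
  have hI : (D.filter fun α => ¬ lev α (hl 20) = 0) =
      (T1.filter fun d : ℕ => ¬ IsSquare ((-(d : ℤ) : ℤ) : ZMod p)).image fun d => (jT d : k) := by
    ext α
    simp only [mem_filter, Finset.mem_image, mD]
    constructor
    · rintro ⟨⟨h1, h2, -⟩, h3⟩
      rw [Phi_diag, mul_eq_zero, or_iff_left h3, neg_eq_zero, sq_eq_zero_iff] at h1
      obtain ⟨d, hd, h4⟩ : ∃ d ∈ T1, lev α (hl d) = 0 := by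
        simp only [mul_eq_zero, or_assoc] at h1
        rcases h1 with h | h | h | h
        exacts [⟨4, by decide, h⟩, ⟨11, by decide, h⟩, ⟨16, by decide, h⟩, ⟨19, by decide, h⟩]
      exact ⟨d, ⟨hd, (hss d (hT d hd).1 α h4).1 h2⟩, (sub_eq_zero.1 ((lT d hd α).symm.trans h4)).symm⟩
    · rintro ⟨d, ⟨hd, h1⟩, rfl⟩
      have h4 : lev (jT d : k) (hl d) = 0 := by rw [lT d hd, sub_self]
      refine ⟨⟨?_, (hss d (hT d hd).1 _ h4).2 h1, jp d⟩, ?_⟩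
      · rw [Phi_diag]
        have hd' := hd
        simp only [T1, mem_insert, mem_singleton] at hd'
        rcases hd' with rfl | rfl | rfl | rfl <;> rw [h4] <;> ring
      · rw [lev_int]; exact good_ne hp.1 hr k (jT_prop d hd).2.2.1
  rw [← Finset.sum_filter_add_sum_filter_not D (fun α => lev α (hl 20) = 0), Nat.cast_add]
  congr 1
  · rw [sum_congr rfl (g := fun _ => 1), sum_const, smul_eq_mul, mul_one, hE]
    intro α hα
    obtain ⟨h1, h2⟩ := Finset.mem_filter.1 hα
    obtain ⟨h3, -, h4⟩ := (mD α).1 h1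
    exact mult_one hf (by rw [h4, h3]) (by rw [h4]; exact d20 hr h2)
  · rw [hI, Finset.sum_image, sum_congr rfl (g := fun _ => 2), sum_const, Finset.card_filter, smul_eq_mul,
      Finset.sum_mul, Nat.cast_sum]
    · refine sum_congr rfl fun d hd => ?_
      rw [eps_T1 hr hd, (hl_monic (hT d hd).1).2, if_pos (hT d hd).2]
      split_ifs <;> norm_num
    · intro d hd
      have hd1 := (Finset.mem_filter.1 hd).1
      obtain ⟨h1, h2, -⟩ := jT_prop d hd1
      have h3 : ((jT d : ℤ) : k) ∈ D := (Finset.mem_filter.1 (hI ▸ Finset.mem_image_of_mem _ hd)).1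
      refine mult_two hf (by rw [jp, ((mD _).1 h3).1]) ?_ ?_
      · rw [jp]
        have := map_dPhi (castRingHom k) (jT d) (jT d)
        rw [h1, map_zero] at this; exact this.symm
      · rw [jp]
        have := map_ddPhi (castRingHom k) (jT d) (jT d)
        intro h0
        exact good_ne hp.1 hr k h2 (this.trans h0)
    · intro d hd e he hde
      by_contra hne
      refine good_ne hp.1 hr k ((jT_prop d (Finset.mem_filter.1 hd).1).2.2.2 e (Finset.mem_filter.1 he).1 hne) ?_
      push_cast
      exact sub_eq_zero.2 hde
/-! ### Divisibility -/
lemma quad_dvd {w : ZMod p × ZMod p} (hi : Irr w.1 w.2) {α : k} (hα : α ∈ Rw ι w) (P : (ZMod p)[X]) :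
    (X ^ 2 + C w.1 * X + C w.2) ∣ P ↔ (P.map ι).eval α = 0 := by
  have h0 : ((X ^ 2 + C w.1 * X + C w.2).map ι).eval α = 0 := by simpa using (mem_Rw ι).1 hα
  constructor
  · rintro ⟨Q, rfl⟩
    rw [Polynomial.map_mul, eval_mul, h0, zero_mul]
  · intro h
    by_contra hn
    obtain ⟨u, v, huv⟩ := (((irr_iff _ _).2 hi).coprime_iff_not_dvd).2 hn
    generalize (X ^ 2 + C w.1 * X + C w.2 : (ZMod p)[X]) = q at huv h0
    have := congrArg (fun R => (R.map ι).eval α) huv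
    simp only [Polynomial.map_add, Polynomial.map_mul, eval_add, eval_mul, h, h0] at this
    simp at this
lemma ite_one {c : Prop} [Decidable c] (h : (if c then (1 : ℚ) else 0) = 1) : c := by
  by_contra hc; simp [hc] at h
lemma listed_iff [IsAlgClosed k] (hr : 379 < p ∨ p ∈ Sset) {A : k[X]}
    (hss : ∀ d ∈ Tfrak ∪ {20}, ∀ α : k, lev α (hl d) = 0 → (A.eval α = 0 ↔ ¬ IsSquare ((-(d : ℤ) : ℤ) : ZMod p)))
    {w : ZMod p × ZMod p} (hw : w ∈ WW ι A) {α : k} (hα : α ∈ Rw ι w) :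
    (∃ d ∈ T2, Lp d w.1 w.2) ↔ ∃ d ∈ Tfrak ∪ {20}, epsd p d = 1 ∧ lev α (hl d) = 0 := by
  classical
  have hi : Irr w.1 w.2 := (Finset.mem_filter.1 hw).2.1
  have hα' := (mem_Rw ι).1 hα
  have hne : ∀ a, ι a ≠ α := fun a h => irr_ne ι hi hα' (by rw [← h, io_pow])
  constructor
  · rintro ⟨d, hd, hL⟩
    refine ⟨d, T2_sub hd, ?_, Lp_lev ι hd hL hα⟩
    obtain ⟨h1, h2⟩ := (mem_WW_Lp ι hr hss hd hL).1 hw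
    obtain ⟨r, hr1, -⟩ := hL
    rw [eps_T2 hr hd, if_pos ⟨h1, h2, r, by rw [← hr1]; ring⟩]
  · rintro ⟨d, hd, he, hl0⟩
    have hc : d ∈ T1 ∨ d = 20 ∨ d ∈ T2 := by clear * - hd; revert d; decide
    rcases hc with h1 | rfl | h1
    · rw [lev_T1 h1] at hl0
      exact absurd (by rw [map_intCast]; exact (sub_eq_zero.1 hl0).symm) (hne (jT d))
    · rw [eps_20 hr] at he
      obtain ⟨-, s, hs⟩ := ite_one he
      have hs' := congrArg ι hs
      push_cast [map_ofNat] at hs'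
      rw [map_mul] at hs'
      rw [lev_20, hs'] at hl0
      have : (α - ι (632000 + 282880 * s)) * (α - ι (632000 - 282880 * s)) = 0 := by
        simp only [map_add, map_sub, map_mul, map_ofNat]; linear_combination hl0
      rcases mul_eq_zero.1 this with h | h
      · exact absurd (sub_eq_zero.1 h).symm (hne _)
      · exact absurd (sub_eq_zero.1 h).symm (hne _)
    · rw [eps_T2 hr h1] at he
      obtain ⟨-, -, r, hr1⟩ := ite_one he
      have hu : ∀ a b : ZMod p, α ^ 2 + ι a * α + ι b = 0 → w.1 = a ∧ w.2 = b := fun a b hab => by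
        have h3 : ι (w.1 - a) * α = ι (b - w.2) := by rw [map_sub, map_sub]; linear_combination hα' - hab
        have h4 : w.1 - a = 0 := by
          by_contra h5
          refine hne ((b - w.2) / (w.1 - a)) ?_
          rw [map_div₀, ← h3, mul_div_cancel_left₀ _ ((map_ne_zero ι).2 h5)]
        rw [h4, map_zero, zero_mul, eq_comm, map_eq_zero] at h3
        exact ⟨sub_eq_zero.1 h4, (sub_eq_zero.1 h3).symm⟩
      have hr2 : r ^ 2 = pD d := by rw [hr1]; ring
      refine ⟨d, h1, ?_⟩
      rcases (lev_split h1 (r := ι r) (by rw [← map_pow, hr2, map_intCast]) α).1 hl0 with h | h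
      · rw [← io_pu, ← io_pv] at h
        exact ⟨r, hr2, hu _ _ h⟩
      · rw [← map_neg, ← io_pu, ← io_pv] at h
        exact ⟨-r, by rw [neg_sq, hr2], hu _ _ h⟩
lemma Jpoly_eq (p : ℕ) : Jpoly p = (JZ (p / 12) (if p % 4 = 3 then 1 else 0)).map (castRingHom (ZMod p)) := by
  rw [Jpoly, JZ, Polynomial.map_sum, ← Finset.sum_range_reflect]
  refine sum_congr rfl fun i hi => ?_
  generalize p / 12 = n at *
  generalize (if p % 4 = 3 then 1 else 0) = s
  obtain ⟨m, rfl⟩ : ∃ m, n = i + m := ⟨n - i, by have := Finset.mem_range.1 hi; omega⟩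
  have e1 : i + m + 1 - 1 - i = m := by omega
  have e2 : 2 * (i + m) - 2 * m = 2 * i := by omega
  have e3 : i + m - m = i := by omega
  have e4 : i + m - i = m := by omega
  rw [e1, e2, e3, e4, he, ← Nat.choose_symm (n := 2 * (i + m) + s) (k := 2 * i) (by omega)]
  have e5 : 2 * (i + m) + s - 2 * i = 2 * m + s := by omega
  rw [e5]
  simp
end
open Classical in
lemma PV.final {p : ℕ} [hp : Fact p.Prime] (hr : 379 < p ∨ p ∈ Sset) (v : PV p) : ((PV.Zset p).ncard : ℚ) =
    4 * epsd p 20 + (∑ d ∈ Tfrak, 4 * epsd p d * ((classPoly d).natDegree : ℚ)) + 4 * (({ab : ZMod p × ZMod p |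
        Irreducible (X ^ 2 + C ab.1 * X + C ab.2) ∧
        (X ^ 2 + C ab.1 * X + C ab.2) ∣ Jpoly p ∧
        (∀ d ∈ Tfrak ∪ {20}, epsd p d = 1 →
          ¬ (X ^ 2 + C ab.1 * X + C ab.2) ∣
              (classPoly d).map (castRingHom (ZMod p))) ∧
        Q5 ab.1 ab.2 = 0}.ncard : ℕ) : ℚ) := by
  have h100 := good_gt hr
  set ι : ZMod p →+* v.kk := ZMod.castHom dvd_rfl v.kk
  have ic : ∀ P : ℤ[X], (P.map (castRingHom (ZMod p))).map ι = P.map (castRingHom v.kk) := fun P => by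
    rw [Polynomial.map_map]; congr 1; exact RingHom.ext_int _ _
  obtain ⟨n, s, a, hs, ha, hn, hss1, hpe⟩ : ∃ n s a : ℕ, s ≤ 1 ∧ a ≤ 1 ∧ p / 12 = n ∧ (if p % 4 = 3 then 1 else 0) = s ∧
      p = 12 * n + 4 * a + 6 * s + 1 := by
    have h2 : ¬ 2 ∣ p := fun h => by have := (Nat.prime_dvd_prime_iff_eq Nat.prime_two hp.1).1 h; omega
    have h3 : ¬ 3 ∣ p := fun h => by have := (Nat.prime_dvd_prime_iff_eq Nat.prime_three hp.1).1 h; omega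
    refine ⟨p / 12, _, if p % 3 = 2 then 1 else 0, ?_, ?_, rfl, rfl, ?_⟩ <;> split_ifs <;> omega
  have hA := v.A_eq (n := n) (s := s) (a := a) (by omega) hs ha hpe
  have hJ := Jpoly_eq p
  rw [hn, hss1] at hJ
  have hAJ : ∀ α : v.kk, α ^ p ≠ α → (v.A.eval α = 0 ↔ ((Jpoly p).map ι).eval α = 0) := by
    intro α hα
    have i1 : α ≠ 0 := by rintro rfl; exact hα (zero_pow hp.1.ne_zero)
    have i2 : α - 1728 ≠ 0 := fun h => hα (by
      have h1 := io_pow ι ((1728 : ℤ) : ZMod p)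
      rw [map_intCast] at h1
      rw [sub_eq_zero.1 h]; exact_mod_cast h1)
    rw [hA, hJ, ic, BZ, Polynomial.map_mul, Polynomial.map_mul, eval_mul, eval_mul, Polynomial.map_pow, Polynomial.map_pow,
      Polynomial.map_pow, eval_pow, eval_pow, eval_pow, mul_eq_zero, mul_eq_zero]
    simp [i1, i2]
  have hA0 : v.A ≠ 0 := by
    rw [hA, BZ, Polynomial.map_mul, Polynomial.map_mul, Polynomial.map_pow, Polynomial.map_pow, Polynomial.map_pow,
      Polynomial.map_sub, Polynomial.map_X, Polynomial.map_C]
    refine mul_ne_zero (mul_ne_zero (pow_ne_zero _ X_ne_zero) (pow_ne_zero _ (X_sub_C_ne_zero _))) (pow_ne_zero _ fun h => ?_)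
    have h1 := congrArg (fun P => (P.comp (X + C 1728)).coeff n) h
    have e1 : ∀ (c : ℤ) (m : ℕ), ((C c * (X - C 1728) ^ m).map (castRingHom v.kk)).comp (X + C 1728) = C (c : v.kk) * X ^ m :=
      fun c m => by
        rw [Polynomial.map_mul, map_C, Polynomial.map_pow, Polynomial.map_sub, map_X, map_C, map_ofNat, mul_comp, C_comp,
          pow_comp, sub_comp, X_comp, C_comp, add_sub_cancel_right]; rfl
    simp only [JZ, Polynomial.map_sum, Polynomial.sum_comp, finset_sum_coeff, zero_comp, coeff_zero, e1, coeff_C_mul_X_pow] at h1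
    rw [Finset.sum_eq_single 0] at h1
    · simp [he] at h1
    · intro i hi h0
      exact if_neg (by have := Finset.mem_range.1 hi; omega)
    · simp
  have hF : ∀ α, v.A.eval α = 0 → v.A.eval (α ^ p) = 0 := by
    intro α h
    rw [hA, eval_map] at h ⊢
    have h1 := hom_eval₂ (BZ n s a) (castRingHom v.kk) (frobenius v.kk p) α
    rw [h, map_zero, RingHom.ext_int ((frobenius v.kk p).comp (castRingHom v.kk)) (castRingHom v.kk)] at h1
    exact h1.symm
  have hsq : ∀ α, v.A.eval α = 0 → (α ^ p) ^ p = α := fun α h => by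
    rw [← pow_mul, ← sq]; exact v.ss_sq hA0 h
  have hss := fun d (hd : d ∈ Tfrak ∪ {20}) α (h : lev α (hl d) = 0) => v.red_ss h100 hd h
  have hf : fP p v.kk ≠ 0 := fun h => by
    refine ((v.P_monic (by omega)).map (IsLocalRing.residue v.V)).ne_zero ?_
    rw [v.Pbar]
    change fP p v.kk ^ 2 = 0
    rw [h]; ring
  have hM : Multiset.card (v.ff.roots.filter (fun a => v.A.eval a = 0)) =
      (∑ α ∈ (fP p v.kk).roots.toFinset.filter (fun α => v.A.eval α = 0 ∧ α ^ p = α), (fP p v.kk).rootMultiplicity α) +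
      ∑ α ∈ (fP p v.kk).roots.toFinset.filter (fun α => v.A.eval α = 0 ∧ α ^ p ≠ α), (fP p v.kk).rootMultiplicity α := by
    change Multiset.card ((fP p v.kk).roots.filter _) = _
    rw [← Finset.filter_filter, ← Finset.filter_filter, Finset.sum_filter_add_sum_filter_not, ← Multiset.toFinset_sum_count_eq,
      Multiset.toFinset_filter]
    refine sum_congr rfl fun α hα => ?_
    rw [Multiset.count_filter_of_pos (p := fun a => v.A.eval a = 0) (Finset.mem_filter.1 hα).2, count_roots]
  have hW : {ab : ZMod p × ZMod p | Irreducible (X ^ 2 + C ab.1 * X + C ab.2) ∧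
        (X ^ 2 + C ab.1 * X + C ab.2) ∣ Jpoly p ∧
        (∀ d ∈ Tfrak ∪ {20}, epsd p d = 1 →
          ¬ (X ^ 2 + C ab.1 * X + C ab.2) ∣
              (classPoly d).map (castRingHom (ZMod p))) ∧
        Q5 ab.1 ab.2 = 0} = ((WW ι v.A).filter fun w => ¬ ∃ d ∈ T2, Lp d w.1 w.2 : Finset (ZMod p × ZMod p)) := by
    ext w
    rw [Set.mem_ofPred_eq, Finset.mem_coe, mem_filter, irr_iff]
    change Irr w.1 w.2 ∧ _ ↔ _
    have hc : ∀ d ∈ Tfrak ∪ {20}, ∀ α : v.kk, (((classPoly d).map (castRingHom (ZMod p))).map ι).eval α = lev α (hl d) :=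
      fun d hd α => by rw [ic, toP_hl hd, toP_eval]
    obtain ⟨α, hα⟩ := Rw_ne ι w
    have key : w ∈ WW ι v.A ↔ Irr w.1 w.2 ∧ (X ^ 2 + C w.1 * X + C w.2) ∣ Jpoly p ∧ Q5 w.1 w.2 = 0 := by
      rw [WW, mem_filter]
      constructor
      · rintro ⟨-, h1, ⟨β, hβ, h2⟩, h3⟩
        exact ⟨h1, (quad_dvd ι h1 hβ _).2 ((hAJ β (irr_ne ι h1 ((mem_Rw ι).1 hβ))).1 h2), h3⟩
      · rintro ⟨h1, h2, h3⟩
        exact ⟨mem_univ _, h1, ⟨α, hα, (hAJ α (irr_ne ι h1 ((mem_Rw ι).1 hα))).2 ((quad_dvd ι h1 hα _).1 h2)⟩, h3⟩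
    constructor
    · rintro ⟨h1, h2, h3, h4⟩
      have hw := key.2 ⟨h1, h2, h4⟩
      refine ⟨hw, fun h => ?_⟩
      obtain ⟨d, hd, h5, h6⟩ := (listed_iff ι hr hss hw hα).1 h
      exact h3 d hd h5 ((quad_dvd ι h1 hα _).2 ((hc d hd α).trans h6))
    · rintro ⟨hw, h⟩
      obtain ⟨h1, h2, h3⟩ := key.1 hw
      refine ⟨h1, h2, fun d hd h5 h6 => h ((listed_iff ι hr hss hw hα).2 ⟨d, hd, h5, ?_⟩), h3⟩
      rw [← hc d hd α]; exact (quad_dvd ι h1 hα _).1 h6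
  rw [hW, Set.ncard_coe_finset, v.card_Z (by omega), hM, Nat.cast_mul, Nat.cast_add, sum_R1 ι hr hf hss,
    sum_R2 ι hr hf hF hsq, sum_WW ι hr hss]
  have hT : Tfrak = T1 ∪ T2 := by decide
  have hg : ∀ S : Finset ℕ, ∑ d ∈ S, 4 * epsd p d * ((classPoly d).natDegree : ℚ) =
      2 * ∑ d ∈ S, 2 * epsd p d * ((classPoly d).natDegree : ℚ) := fun S => by
    rw [mul_sum]; exact sum_congr rfl fun d _ => by ring
  rw [hg, hT, Finset.sum_union (by decide)]
  push_cast
  ring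

end

/-- Theorem 2.3 of Morton's paper: the class number formula
`a_p·h(−5p) = 4ε₂₀ + Σ_{d∈𝔗} 4ε_d·deg(H_{−d}) + 4N_p` for `p ∈ 𝒮` or `p > 379`. -/
theorem class_number_formula_from_factorization
    (p : ℕ) (hp : Nat.Prime p)
    (hrange : 379 < p ∨ p ∈ Sset)
    (K : Type) [Field K] [NumberField K] (θ : K)
    (hθ : θ ^ 2 = -((5 * p : ℕ) : K))
    (hK : Module.finrank ℚ K = 2)
    (Np : ℕ)
    (hNp : Np = {ab : ZMod p × ZMod p |
        Irreducible (X ^ 2 + C ab.1 * X + C ab.2) ∧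
        (X ^ 2 + C ab.1 * X + C ab.2) ∣ Jpoly p ∧
        (∀ d ∈ Tfrak ∪ {20}, epsd p d = 1 →
          ¬ (X ^ 2 + C ab.1 * X + C ab.2) ∣
              (classPoly d).map (Int.castRingHom (ZMod p))) ∧
        Q5 ab.1 ab.2 = 0}.ncard) :
    ap p * (NumberField.classNumber K : ℚ) =
      4 * epsd p 20 +
        (∑ d ∈ Tfrak, 4 * epsd p d * ((classPoly d).natDegree : ℚ)) + 4 * (Np : ℚ) := by
  haveI : Fact p.Prime := ⟨hp⟩
  have h100 := good_gt hrange
  obtain ⟨v⟩ := PV.exists_pv p (by omega)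
  rw [← Z_card hp (by omega) hθ hK, hNp]
  exact PV.final hrange v
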